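/- For every η ∈ ℝ and every integer k ≥ 0 there exist real numbers Σ_k(η) and Σ(η) such that lim_{N→∞} (1/N) log E[ Crt_{N,k}(η) ] = Σ_k(η) and lim_{N→∞} (1/N) log E[ Crt_N(η) ] = Σ(η). -/

import Mathlib

open MeasureTheory ProbabilityTheory Filter
open scoped ENNReal NNReal

noncomputable section

/-- Euclidean dot product on `ℝ^N`. -/
def dotp {N : ℕ} (σ τ : Fin N → ℝ) : ℝ := ∑ i, σ i * τ i

/-- The sphere `S_N = {σ : ‖σ‖₂² = N}`. -/
def sphereSet (N : ℕ) : Set (Fin N → ℝ) := {σ | ∑ i, (σ i) ^ 2 = (N : ℝ)}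

/-- The mixture `ξ(x) = Σ_{k=2}^P c_k² x^k`. -/
def xiFun (P : ℕ) (c : ℕ → ℝ) (x : ℝ) : ℝ := ∑ k ∈ Finset.Icc 2 P, (c k) ^ 2 * x ^ k

/-- `ξ'`. -/
def xiD1 (P : ℕ) (c : ℕ → ℝ) (x : ℝ) : ℝ :=
  ∑ k ∈ Finset.Icc 2 P, (k : ℝ) * (c k) ^ 2 * x ^ (k - 1)

/-- `ξ''`. -/
def xiD2 (P : ℕ) (c : ℕ → ℝ) (x : ℝ) : ℝ :=
  ∑ k ∈ Finset.Icc 2 P, (k : ℝ) * ((k : ℝ) - 1) * (c k) ^ 2 * x ^ (k - 2)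

/-- The mixed p-spin Hamiltonian built from couplings `g`. -/
def hamiltonian (N P : ℕ) (c : ℕ → ℝ) (g : (k : ℕ) → (Fin k → Fin N) → ℝ)
    (σ : Fin N → ℝ) : ℝ :=
  ∑ k ∈ Finset.Icc 2 P, c k * (N : ℝ) ^ (-(((k : ℝ) - 1) / 2)) *
    ∑ j : Fin k → Fin N, g k j * ∏ i, σ (j i)

/-- Index set for the entries of all the coupling tensors. -/
abbrev GIdx (N P : ℕ) : Type := Σ k : {k : ℕ // k ∈ Finset.Icc 2 P}, (Fin (k : ℕ) → Fin N)

/-- Flatten the couplings into a single Gaussian vector. -/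
def flatten (N P : ℕ) (g : (k : ℕ) → (Fin k → Fin N) → ℝ) : GIdx N P → ℝ :=
  fun i => g i.1 i.2

/-- The couplings `(G^{(k)})_{2 ≤ k ≤ P}` are i.i.d. standard Gaussians. -/
def StdGaussianCouplings {Ω : Type*} [MeasureSpace Ω] (N P : ℕ)
    (G : Ω → (k : ℕ) → (Fin k → Fin N) → ℝ) : Prop :=
  Measure.map (fun ω => flatten N P (G ω)) ℙ = Measure.pi fun _ : GIdx N P => gaussianReal 0 1

/-- The maximum of the Hamiltonian over the sphere. -/
def maxH (N P : ℕ) (c : ℕ → ℝ) (g : (k : ℕ) → (Fin k → Fin N) → ℝ) : ℝ :=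
  ⨆ σ : sphereSet N, hamiltonian N P c g σ.1


/-- Euclidean gradient of the Hamiltonian. -/
def gradH (N P : ℕ) (c : ℕ → ℝ) (g : (k : ℕ) → (Fin k → Fin N) → ℝ)
    (σ : Fin N → ℝ) : Fin N → ℝ :=
  fun i => fderiv ℝ (hamiltonian N P c g) σ (Pi.single i 1)

/-- Euclidean Hessian of the Hamiltonian, as a bilinear form. -/
def hessH (N P : ℕ) (c : ℕ → ℝ) (g : (k : ℕ) → (Fin k → Fin N) → ℝ)
    (σ v w : Fin N → ℝ) : ℝ :=
  fderiv ℝ (fun τ => fderiv ℝ (hamiltonian N P c g) τ w) σ v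

/-- `σ` is a spherical critical point: `∇H(σ) = (⟨∇H(σ),σ⟩/N) σ`. -/
def IsCritPt (N P : ℕ) (c : ℕ → ℝ) (g : (k : ℕ) → (Fin k → Fin N) → ℝ)
    (σ : Fin N → ℝ) : Prop :=
  σ ∈ sphereSet N ∧ gradH N P c g σ = (dotp (gradH N P c g σ) σ / N) • σ

/-- Cardinality of a set, valued in `ℝ≥0∞`. -/
def ecount {α : Type*} (s : Set α) : ℝ≥0∞ := ∑' _ : s, 1

/-- Spherical critical points with energy at least `Nη`. -/
def crtSet (N P : ℕ) (c : ℕ → ℝ) (g : (k : ℕ) → (Fin k → Fin N) → ℝ)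
    (η : ℝ) : Set (Fin N → ℝ) :=
  {σ | IsCritPt N P c g σ ∧ (N : ℝ) * η ≤ hamiltonian N P c g σ}

/-- Index (number of negative eigenvalues) of the spherical Hessian quadratic form at `σ`:
maximal dimension of a subspace of the tangent space on which the form is negative definite. -/
def critIndex (N P : ℕ) (c : ℕ → ℝ) (g : (k : ℕ) → (Fin k → Fin N) → ℝ)
    (σ : Fin N → ℝ) : ℕ :=
  sSup {d : ℕ | ∃ W : Submodule ℝ (Fin N → ℝ), Module.finrank ℝ W = d ∧
    (∀ v ∈ W, dotp v σ = 0) ∧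
    ∀ v ∈ W, v ≠ 0 →
      hessH N P c g σ v v - (dotp (gradH N P c g σ) σ / N) * ∑ i, (v i) ^ 2 < 0}

/-- Critical points of index `N-1-k` in the superlevel set. -/
def crtSetIdx (N P : ℕ) (c : ℕ → ℝ) (g : (k : ℕ) → (Fin k → Fin N) → ℝ)
    (η : ℝ) (k : ℕ) : Set (Fin N → ℝ) :=
  {σ | σ ∈ crtSet N P c g η ∧ critIndex N P c g σ = N - 1 - k}

/-- Coefficients of the pure p-spin model. -/
def pureC (p : ℕ) : ℕ → ℝ := fun k => if k = p then 1 else 0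

/-- The uniform probability measure on the sphere `S_N`. -/
def sphereUniform (N : ℕ) : Measure (Fin N → ℝ) :=
  Measure.map (fun g i => Real.sqrt N * g i / Real.sqrt (∑ j, (g j) ^ 2))
    (Measure.pi fun _ : Fin N => gaussianReal 0 1)

/-- The band around `m`. -/
def band (N : ℕ) (m : Fin N → ℝ) (δ : ℝ) : Set (Fin N → ℝ) :=
  {σ | σ ∈ sphereSet N ∧ |dotp (σ - m) m| < N * δ}

/-- `k`-tuples from the band with pairwise overlaps close to `⟨m,m⟩`. -/
def bandK (N k : ℕ) (m : Fin N → ℝ) (δ ε : ℝ) : Set (Fin k → Fin N → ℝ) :=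
  {σs | (∀ i, σs i ∈ band N m δ) ∧
    ∀ i j, i ≠ j → |dotp (σs i) (σs j) - dotp m m| < N * ε}

/-- `∫₀ᵗ γ(s) ds`, valued in `ℝ≥0∞`. -/
def gammaLInt (γ : ℝ → ℝ) (t : ℝ) : ℝ≥0∞ := ∫⁻ s in Set.Ioo 0 t, ENNReal.ofReal (γ s)

/-- The zero-temperature spherical Parisi functional (Crisanti–Sommers form), with the
convention `1/0 = +∞`. -/
def PFunE (P : ℕ) (c : ℕ → ℝ) (γ : ℝ → ℝ) : ℝ≥0∞ :=
  ⨅ L ∈ {L : ℝ | gammaLInt γ 1 ≤ ENNReal.ofReal L},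
    (∫⁻ t in Set.Ioo (0 : ℝ) 1,
      (ENNReal.ofReal (xiD2 P c t * (L - (gammaLInt γ t).toReal))
        + (ENNReal.ofReal (L - (gammaLInt γ t).toReal))⁻¹)) / 2

/-- The space `𝒰` of order parameters: non-decreasing, non-negative, integrable on `[0,1)`. -/
def calU : Set (ℝ → ℝ) :=
  {γ | (∀ t ∈ Set.Ico (0 : ℝ) 1, 0 ≤ γ t) ∧ MonotoneOn γ (Set.Ico 0 1) ∧
    IntegrableOn γ (Set.Ioo 0 1)}

/-- The support of `γ`: points of `[0,1]` near which `γ` is not constant. -/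
def suppGamma (γ : ℝ → ℝ) : Set ℝ :=
  {q | q ∈ Set.Icc (0 : ℝ) 1 ∧ ∀ ε > 0, ∃ s ∈ Set.Ico (0 : ℝ) 1, ∃ t ∈ Set.Ico (0 : ℝ) 1,
    |s - q| < ε ∧ |t - q| < ε ∧ γ s ≠ γ t}

/-- The superlevel set `L_N(η)`. -/
def levelSet (N P : ℕ) (c : ℕ → ℝ) (g : (k : ℕ) → (Fin k → Fin N) → ℝ)
    (η : ℝ) : Set (Fin N → ℝ) :=
  {σ | σ ∈ sphereSet N ∧ (N : ℝ) * η ≤ hamiltonian N P c g σ}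

/-- Threshold energy of the pure p-spin model. -/
def THRp (p : ℕ) : ℝ := 2 * Real.sqrt (((p : ℝ) - 1) / p)

/-- The function `J` of the pure p-spin complexity. -/
def Jp (p : ℕ) (η : ℝ) : ℝ :=
  η / (THRp p) ^ 2 * Real.sqrt (η ^ 2 - (THRp p) ^ 2)
    - Real.log (η + Real.sqrt (η ^ 2 - (THRp p) ^ 2)) + Real.log (THRp p)

/-- The annealed complexity of the pure p-spin spherical model. -/
def SigmaPure (p : ℕ) (η : ℝ) : ℝ :=
  if η ≤ 0 then Real.log ((p : ℝ) - 1) / 2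
  else if η ≤ THRp p then
    Real.log ((p : ℝ) - 1) / 2 - ((p : ℝ) - 2) / (4 * ((p : ℝ) - 1)) * η ^ 2
  else Real.log ((p : ℝ) - 1) / 2 - ((p : ℝ) - 2) / (4 * ((p : ℝ) - 1)) * η ^ 2 - Jp p η

/-- Couplings, unflattened from a vector indexed by `GIdx N P`. -/
def unflatten (N P : ℕ) (g : GIdx N P → ℝ) : (k : ℕ) → (Fin k → Fin N) → ℝ :=
  fun k j => if h : k ∈ Finset.Icc 2 P then g ⟨⟨k, h⟩, j⟩ else 0

/-- `ξ'''`. -/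
def xiD3 (P : ℕ) (c : ℕ → ℝ) (x : ℝ) : ℝ :=
  ∑ k ∈ Finset.Icc 2 P, (k : ℝ) * ((k : ℝ) - 1) * ((k : ℝ) - 2) * (c k) ^ 2 * x ^ (k - 3)

theorem ecount_iUnion {α : Type*} {t : ℕ → Set α} (h : Pairwise (Function.onFun Disjoint t)) :
    ecount (⋃ i, t i) = ∑' i, ecount (t i) := by
  unfold ecount
  exact ENNReal.tsum_biUnion (f := fun _ => 1) (fun i _ j _ hij => h hij)

theorem ecount_of_subsingleton {α : Type*} {s : Set α} (h : s.Subsingleton) (hn : s.Nonempty) :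
    ecount s = 1 := by
  obtain ⟨a, ha⟩ := hn
  have : s = {a} := h.eq_singleton_of_mem ha
  subst this
  simp [ecount]

theorem ecount_empty {α : Type*} : ecount (∅ : Set α) = 0 := by simp [ecount]

theorem ecount_congr {α β : Type*} {s : Set α} {t : Set β} (e : s ≃ t) : ecount s = ecount t := by
  unfold ecount
  exact e.tsum_eq (fun _ => (1 : ℝ≥0∞))

theorem ecount_eq_encard {α : Type*} (s : Set α) : ecount s = (s.encard : ℝ≥0∞) :=
  ENNReal.tsum_set_one s

/-- Countable partition of the set of regular points into pieces of injectivity. -/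
theorem exists_partition_injOn {E : Type*} [NormedAddCommGroup E] [NormedSpace ℝ E]
    [FiniteDimensional ℝ E] [MeasurableSpace E] [BorelSpace E] {f : E → E} {f' : E → E →L[ℝ] E}
    (hf : ∀ x, HasFDerivAt f (f' x) x) (s : Set E) (hs : ∀ x ∈ s, (f' x).det ≠ 0) :
    ∃ t : ℕ → Set E, Pairwise (Function.onFun Disjoint t) ∧ (∀ n, MeasurableSet (t n)) ∧
      s ⊆ ⋃ n, t n ∧ ∀ n, Set.InjOn f (s ∩ t n) := by
  classical
  rcases s.eq_empty_or_nonempty with rfl | hne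
  · exact ⟨fun _ => ∅, fun _ _ _ => by simp [Function.onFun], by simp, by simp, by simp⟩
  let r : (E →L[ℝ] E) → ℝ≥0 := fun A =>
    if h : A.det ≠ 0 then
      if Subsingleton E then 1 else ‖((A.toContinuousLinearEquivOfDetNeZero h).symm : E →L[ℝ] E)‖₊⁻¹ / 2
    else 1
  have hrpos : ∀ A, r A ≠ 0 := by
    intro A
    simp only [r]
    split_ifs with h1 h2
    · exact one_ne_zero
    · have : Nontrivial E := not_subsingleton_iff_nontrivial.1 h2
      have := (A.toContinuousLinearEquivOfDetNeZero h1).nnnorm_symm_pos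
      positivity
    · exact one_ne_zero
  obtain ⟨t, A, hd, hm, hc, ha, hA⟩ := exists_partition_approximatesLinearOn_of_hasFDerivWithinAt
    f s f' (fun x _ => (hf x).hasFDerivWithinAt) r hrpos
  refine ⟨t, hd, hm, hc, fun n => ?_⟩
  obtain ⟨y, hy, hAy⟩ := hA hne n
  have hdet : (A n).det ≠ 0 := by rw [hAy]; exact hs y hy
  have h := ha n
  rw [← ContinuousLinearMap.coe_toContinuousLinearEquivOfDetNeZero (A n) hdet] at h
  refine h.injOn ?_
  by_cases h2 : Subsingleton E
  · exact Or.inl h2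
  · right
    have : Nontrivial E := not_subsingleton_iff_nontrivial.1 h2
    have h3 := (ContinuousLinearMap.toContinuousLinearEquivOfDetNeZero (A n) hdet).nnnorm_symm_pos
    simp only [r, ContinuousLinearMap.coe_toContinuousLinearEquivOfDetNeZero, hdet, h2, ne_eq,
      not_false_eq_true, dif_pos, if_false]
    exact NNReal.half_lt_self (by positivity)

/-- Area formula with multiplicity. -/
theorem area_formula {E : Type*} [NormedAddCommGroup E] [NormedSpace ℝ E]
    [FiniteDimensional ℝ E] [MeasurableSpace E] [BorelSpace E] (μ : Measure E) [μ.IsAddHaarMeasure]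
    {f : E → E} {f' : E → E →L[ℝ] E} (hf : ∀ x, HasFDerivAt f (f' x) x)
    (hdet : Measurable fun x => (f' x).det) {s : Set E} (hs : MeasurableSet s) :
    AEMeasurable (fun y => ecount (s ∩ f ⁻¹' {y})) μ ∧
    ∀ φ : E → ℝ≥0∞, Measurable φ → ∫⁻ y, ecount (s ∩ f ⁻¹' {y}) * φ y ∂μ =
      ∫⁻ x in s, ENNReal.ofReal |(f' x).det| * φ (f x) ∂μ := by
  set s0 := s ∩ {x | (f' x).det = 0} with hs0
  set s1 := s ∩ {x | (f' x).det ≠ 0} with hs1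
  have hs0m : MeasurableSet s0 := hs.inter (hdet (measurableSet_singleton 0))
  have hs1m : MeasurableSet s1 := hs.inter (hdet (measurableSet_singleton 0)).compl
  have hnull : μ (f '' s0) = 0 :=
    addHaar_image_eq_zero_of_det_fderivWithin_eq_zero μ
      (fun x _ => (hf x).hasFDerivWithinAt) (fun x hx => hx.2)
  obtain ⟨t, hd, hm, hc, hinj⟩ := exists_partition_injOn hf s1 (fun x hx => hx.2)
  have hpm : ∀ n, MeasurableSet (s1 ∩ t n) := fun n => hs1m.inter (hm n)
  have him : ∀ n, MeasurableSet (f '' (s1 ∩ t n)) := fun n =>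
    measurable_image_of_fderivWithin (hpm n) (fun x _ => (hf x).hasFDerivWithinAt) (hinj n)
  have hae : (fun y => ecount (s ∩ f ⁻¹' {y})) =ᵐ[μ]
      fun y => ∑' n, (f '' (s1 ∩ t n)).indicator 1 y := by
    have h0 : ∀ᵐ y ∂μ, y ∉ f '' s0 := measure_eq_zero_iff_ae_notMem.1 hnull
    filter_upwards [h0] with y hy
    have e1 : s ∩ f ⁻¹' {y} = ⋃ n, (s1 ∩ t n) ∩ f ⁻¹' {y} := by
      ext x
      simp only [Set.mem_inter_iff, Set.mem_preimage, Set.mem_singleton_iff, Set.mem_iUnion]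
      constructor
      · rintro ⟨hx, hxy⟩
        have hx1 : x ∈ s1 := ⟨hx, fun h => hy ⟨x, ⟨hx, h⟩, hxy⟩⟩
        obtain ⟨n, hn⟩ := Set.mem_iUnion.1 (hc hx1)
        exact ⟨n, ⟨hx1, hn⟩, hxy⟩
      · rintro ⟨n, ⟨hx, _⟩, hxy⟩
        exact ⟨hx.1, hxy⟩
    rw [e1, ecount_iUnion]
    · refine tsum_congr fun n => ?_
      by_cases hyn : y ∈ f '' (s1 ∩ t n)
      · rw [Set.indicator_of_mem hyn]
        obtain ⟨x, hx, hxy⟩ := hyn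
        refine ecount_of_subsingleton ?_ ⟨x, hx, hxy⟩
        intro a ha b hb
        exact hinj n ha.1 hb.1 (ha.2.trans hb.2.symm)
      · rw [Set.indicator_of_notMem hyn]
        convert ecount_empty
        ext x
        simp only [Set.mem_inter_iff, Set.mem_preimage, Set.mem_singleton_iff,
          Set.mem_empty_iff_false, iff_false]
        rintro ⟨hx, hxy⟩
        exact hyn ⟨x, hx, hxy⟩
    · intro i j hij
      exact (hd hij).mono (fun x hx => hx.1.2) (fun x hx => hx.1.2)
  refine ⟨⟨_, Measurable.tsum fun n => measurable_one.indicator (him n), hae⟩,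
    fun φ hφ => ?_⟩
  have e2 : ∫⁻ x in s, ENNReal.ofReal |(f' x).det| * φ (f x) ∂μ =
      ∫⁻ x in s1, ENNReal.ofReal |(f' x).det| * φ (f x) ∂μ := by
    have hu : s = s1 ∪ s0 := by
      ext x; simp only [hs1, hs0, Set.mem_union, Set.mem_inter_iff, Set.mem_ofPred_eq]; tauto
    rw [hu, lintegral_union hs0m]
    · rw [show ∫⁻ x in s0, ENNReal.ofReal |(f' x).det| * φ (f x) ∂μ = 0 from ?_, add_zero]
      rw [setLIntegral_congr_fun hs0m (g := fun _ => 0)]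
      · simp
      · intro x hx
        have h : (f' x).det = 0 := hx.2
        simp [h]
    · rw [Set.disjoint_left]
      rintro x ⟨_, h1⟩ ⟨_, h2⟩
      exact h1 h2
  have e3 : s1 = ⋃ n, s1 ∩ t n := by
    rw [← Set.inter_iUnion, Set.inter_eq_left.2 hc]
  calc ∫⁻ y, ecount (s ∩ f ⁻¹' {y}) * φ y ∂μ
      = ∫⁻ y, ∑' n, (f '' (s1 ∩ t n)).indicator φ y ∂μ := by
        refine lintegral_congr_ae ?_
        filter_upwards [hae] with y hy
        rw [hy, ← ENNReal.tsum_mul_right]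
        refine tsum_congr fun n => ?_
        by_cases hyn : y ∈ f '' (s1 ∩ t n)
        · simp only [Set.indicator_of_mem hyn, Pi.one_apply, one_mul]
        · simp only [Set.indicator_of_notMem hyn, zero_mul]
    _ = ∑' n, ∫⁻ x in s1 ∩ t n, ENNReal.ofReal |(f' x).det| * φ (f x) ∂μ := by
        rw [lintegral_tsum fun n => (hφ.indicator (him n)).aemeasurable]
        refine tsum_congr fun n => ?_
        rw [lintegral_indicator (him n), lintegral_image_eq_lintegral_abs_det_fderiv_mul μ (hpm n)
          (fun x _ => (hf x).hasFDerivWithinAt) (hinj n)]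
    _ = ∫⁻ x in s1, ENNReal.ofReal |(f' x).det| * φ (f x) ∂μ := by
        conv_rhs => rw [e3]
        rw [lintegral_iUnion hpm]
        intro i j hij
        exact (hd hij).mono (fun x hx => hx.2) (fun x hx => hx.2)
    _ = _ := e2.symm

/-- Standard Gaussian measure on `ι → ℝ`. -/
def stdG (ι : Type*) [Fintype ι] : Measure (ι → ℝ) := Measure.pi fun _ : ι => gaussianReal 0 1

instance stdG_isProbabilityMeasure (ι : Type*) [Fintype ι] : IsProbabilityMeasure (stdG ι) := by
  unfold stdG; infer_instance

theorem charFunDual_stdG {ι : Type*} [Fintype ι] [DecidableEq ι] (L : StrongDual ℝ (ι → ℝ)) :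
    charFunDual (stdG ι) L = Complex.exp (-((∑ i, (L (Pi.single i 1)) ^ 2 : ℝ) : ℂ) / 2) := by
  unfold stdG
  rw [charFunDual_pi]
  have h : ∀ i, charFunDual (gaussianReal 0 1) (L.comp (.single ℝ (fun _ : ι => ℝ) i)) =
      Complex.exp (-((L (Pi.single i 1) ^ 2 : ℝ) : ℂ) / 2) := by
    intro i
    have e : (L.comp (.single ℝ (fun _ : ι => ℝ) i)) =
        (L (Pi.single i 1)) • (ContinuousLinearMap.id ℝ ℝ) := by
      ext; simp
    rw [e, charFunDual_eq_charFun_map_one]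
    have := gaussianReal_map_const_mul (μ := 0) (v := 1) (L (Pi.single i 1))
    have e2 : (⇑((L (Pi.single i 1)) • (ContinuousLinearMap.id ℝ ℝ)) : ℝ → ℝ) =
      fun x => L (Pi.single i 1) * x := by ext; simp
    rw [e2, this, charFun_gaussianReal]
    simp [neg_div]
  rw [Finset.prod_congr rfl (fun i _ => h i), ← Complex.exp_sum]
  congr 1
  push_cast
  rw [← Finset.sum_div, Finset.sum_neg_distrib]

/-- The linear map `x ↦ (⟨x, m k⟩)_k`. -/
def dotMap {ι κ : Type*} [Fintype ι] [Fintype κ] (m : κ → ι → ℝ) : (ι → ℝ) →L[ℝ] (κ → ℝ) :=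
  ContinuousLinearMap.pi fun k => ∑ a, (m k a) • ContinuousLinearMap.proj a

theorem dotMap_apply {ι κ : Type*} [Fintype ι] [Fintype κ] (m : κ → ι → ℝ) (x : ι → ℝ) (k : κ) :
    dotMap m x k = ∑ a, x a * m k a := by
  simp [dotMap, mul_comm]

theorem charFunDual_map_dotMap {ι κ : Type*} [Fintype ι] [Fintype κ] [DecidableEq κ]
    (m : κ → ι → ℝ) (L : StrongDual ℝ (κ → ℝ)) :
    charFunDual ((stdG ι).map (dotMap m)) L = Complex.exp (-((∑ i, ∑ j, L (Pi.single i 1) *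
        L (Pi.single j 1) * ∑ a, m i a * m j a : ℝ) : ℂ) / 2) := by
  classical
  rw [charFunDual_map, charFunDual_stdG]
  congr 4
  have : ∀ a, (L.comp (dotMap m)) (Pi.single a 1) = ∑ i, L (Pi.single i 1) * m i a := by
    intro a
    rw [ContinuousLinearMap.comp_apply, ← L.sum_comp_single]
    refine Finset.sum_congr rfl fun i _ => ?_
    have : (Pi.single i (dotMap m (Pi.single a 1) i) : κ → ℝ) = (m i a) • Pi.single i 1 := by
      rw [dotMap_apply, ← Pi.single_smul]
      simp [Pi.single_apply]
    rw [ContinuousLinearMap.comp_apply,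
      show (ContinuousLinearMap.single ℝ (fun _ : κ => ℝ) i) (dotMap m (Pi.single a 1) i) =
      Pi.single i (dotMap m (Pi.single a 1) i) from rfl, this, map_smul, smul_eq_mul, mul_comm]
  simp_rw [this, sq, Finset.sum_mul_sum, Finset.mul_sum]
  rw [Finset.sum_comm]
  refine Finset.sum_congr rfl fun i _ => ?_
  rw [Finset.sum_comm]
  refine Finset.sum_congr rfl fun j _ => Finset.sum_congr rfl fun a _ => by ring

/-- A linear image of a standard Gaussian vector is determined in law by its Gram matrix. -/
theorem map_dotMap_stdG_eq {ι ι' κ : Type*} [Fintype ι] [Fintype ι'] [Fintype κ]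
    (m : κ → ι → ℝ) (m' : κ → ι' → ℝ)
    (h : ∀ i j, ∑ a, m i a * m j a = ∑ a, m' i a * m' j a) :
    (stdG ι).map (dotMap m) = (stdG ι').map (dotMap m') := by
  classical
  have : IsProbabilityMeasure ((stdG ι).map (dotMap m)) :=
    Measure.isProbabilityMeasure_map (dotMap m).continuous.measurable.aemeasurable
  have : IsProbabilityMeasure ((stdG ι').map (dotMap m')) :=
    Measure.isProbabilityMeasure_map (dotMap m').continuous.measurable.aemeasurable
  refine Measure.ext_of_charFunDual (funext fun L => ?_)
  rw [charFunDual_map_dotMap, charFunDual_map_dotMap]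
  simp_rw [h]

/-- Density of the standard Gaussian. -/
def stdGPDF (ι : Type*) [Fintype ι] (x : ι → ℝ) : ℝ :=
  (Real.sqrt (2 * Real.pi))⁻¹ ^ Fintype.card ι * Real.exp (-(∑ i, x i ^ 2) / 2)

theorem stdGPDF_eq_prod {ι : Type*} [Fintype ι] (x : ι → ℝ) :
    stdGPDF ι x = ∏ i, gaussianPDFReal 0 1 (x i) := by
  simp only [stdGPDF, gaussianPDFReal, NNReal.coe_one, mul_one, sub_zero]
  rw [Finset.prod_mul_distrib, Finset.prod_const, ← Real.exp_sum, Finset.card_univ,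
    ← Finset.sum_div, Finset.sum_neg_distrib]

theorem stdGPDF_pos {ι : Type*} [Fintype ι] (x : ι → ℝ) : 0 < stdGPDF ι x := by
  unfold stdGPDF; positivity

theorem continuous_stdGPDF {ι : Type*} [Fintype ι] : Continuous (stdGPDF ι) := by
  unfold stdGPDF; fun_prop

theorem stdG_eq_withDensity (ι : Type*) [Fintype ι] :
    stdG ι = (volume : Measure (ι → ℝ)).withDensity fun x => ENNReal.ofReal (stdGPDF ι x) := by
  unfold stdG
  refine Measure.pi_eq fun s hs => ?_
  rw [withDensity_apply _ (MeasurableSet.univ_pi hs)]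
  have hInt : ∀ i, Integrable ((s i).indicator (gaussianPDFReal 0 1)) := fun i =>
    (integrable_gaussianPDFReal 0 1).indicator (hs i)
  have h1 : ∀ x : ι → ℝ, (Set.univ.pi s).indicator (fun x => ENNReal.ofReal (stdGPDF ι x)) x =
      ENNReal.ofReal (∏ i, (s i).indicator (gaussianPDFReal 0 1) (x i)) := by
    intro x
    by_cases hx : x ∈ Set.univ.pi s
    · rw [Set.indicator_of_mem hx, stdGPDF_eq_prod]
      congr 1
      refine Finset.prod_congr rfl fun i _ => ?_
      rw [Set.indicator_of_mem (hx i (Set.mem_univ i))]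
    · rw [Set.indicator_of_notMem hx]
      simp only [Set.mem_pi, Set.mem_univ, true_implies, not_forall] at hx
      obtain ⟨i, hi⟩ := hx
      rw [Finset.prod_eq_zero (Finset.mem_univ i) (Set.indicator_of_notMem hi _)]
      simp
  rw [← lintegral_indicator (MeasurableSet.univ_pi hs)]
  simp_rw [h1]
  have hnn : ∀ i y, 0 ≤ (s i).indicator (gaussianPDFReal 0 1) y := fun i y =>
    Set.indicator_nonneg (fun _ _ => gaussianPDFReal_nonneg _ _ _) y
  rw [← ofReal_integral_eq_lintegral_ofReal]
  · rw [integral_fintype_prod_volume_eq_prod, ENNReal.ofReal_prod_of_nonneg]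
    · refine Finset.prod_congr rfl fun i _ => ?_
      rw [integral_indicator (hs i), gaussianReal_apply_eq_integral _ one_ne_zero]
    · intro i _
      exact integral_nonneg (hnn i)
  · exact Integrable.fintype_prod (f := fun i => (s i).indicator (gaussianPDFReal 0 1)) hInt
  · exact ae_of_all _ fun x => Finset.prod_nonneg fun i _ => hnn i _

theorem lintegral_stdG {ι : Type*} [Fintype ι] {f : (ι → ℝ) → ℝ≥0∞} :
    ∫⁻ x, f x ∂(stdG ι) = ∫⁻ x, ENNReal.ofReal (stdGPDF ι x) * f x := by
  rw [stdG_eq_withDensity, lintegral_withDensity_eq_lintegral_mul_non_measurable₀]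
  · rfl
  · exact (continuous_stdGPDF.measurable.ennreal_ofReal).aemeasurable
  · exact ae_of_all _ fun x => ENNReal.ofReal_lt_top

theorem stdG_absolutelyContinuous (ι : Type*) [Fintype ι] : stdG ι ≪ volume := by
  rw [stdG_eq_withDensity]; exact withDensity_absolutelyContinuous _ _

/-- Splitting a standard Gaussian vector indexed by a disjoint union. -/
theorem lintegral_stdG_sum {ι κ : Type*} [Fintype ι] [Fintype κ] {f : (ι ⊕ κ → ℝ) → ℝ≥0∞}
    (hf : Measurable f) :
    ∫⁻ x, f x ∂(stdG (ι ⊕ κ)) = ∫⁻ x, ∫⁻ y, f (Sum.elim x y) ∂(stdG κ) ∂(stdG ι) := by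
  have h := measurePreserving_sumPiEquivProdPi_symm (fun _ : ι ⊕ κ => gaussianReal 0 1)
  unfold stdG
  rw [← h.lintegral_comp hf, lintegral_prod _ (by exact (hf.comp h.measurable).aemeasurable)]
  rfl

/-- Gram-matrix comparison in integrated form. -/
theorem lintegral_dotMap_eq {ι ι' κ : Type*} [Fintype ι] [Fintype ι'] [Fintype κ]
    (m : κ → ι → ℝ) (m' : κ → ι' → ℝ)
    (h : ∀ i j, ∑ a, m i a * m j a = ∑ a, m' i a * m' j a)
    {f : (κ → ℝ) → ℝ≥0∞} (hf : Measurable f) :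
    ∫⁻ x, f (dotMap m x) ∂(stdG ι) = ∫⁻ x, f (dotMap m' x) ∂(stdG ι') := by
  rw [← lintegral_map hf (dotMap m).continuous.measurable, map_dotMap_stdG_eq m m' h,
    lintegral_map hf (dotMap m').continuous.measurable]

section

/-- The feature vector of `σ`, so that `H_g(σ) = ⟨g, feat σ⟩`. -/
def feat (N P : ℕ) (c : ℕ → ℝ) (σ : Fin N → ℝ) (J : GIdx N P) : ℝ :=
  c J.1 * (N : ℝ) ^ (-((((J.1 : ℕ) : ℝ) - 1) / 2)) * ∏ i, σ (J.2 i)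

/-- First directional derivative of the feature vector. -/
def feat1 (N P : ℕ) (c : ℕ → ℝ) (σ v : Fin N → ℝ) (J : GIdx N P) : ℝ :=
  fderiv ℝ (fun τ => feat N P c τ J) σ v

/-- Second directional derivative of the feature vector. -/
def feat2 (N P : ℕ) (c : ℕ → ℝ) (σ v w : Fin N → ℝ) (J : GIdx N P) : ℝ :=
  fderiv ℝ (fun τ => feat1 N P c τ w J) σ v

theorem hamiltonian_eq (N P : ℕ) (c : ℕ → ℝ) (g : (k : ℕ) → (Fin k → Fin N) → ℝ)
    (σ : Fin N → ℝ) :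
    hamiltonian N P c g σ = ∑ J, flatten N P g J * feat N P c σ J := by
  unfold hamiltonian flatten feat
  rw [Fintype.sum_sigma, ← Finset.sum_coe_sort]
  refine Finset.sum_congr rfl fun k _ => ?_
  rw [Finset.mul_sum]
  refine Finset.sum_congr rfl fun j _ => by ring

variable {N P : ℕ} {c : ℕ → ℝ}

theorem contDiff_feat (J : GIdx N P) : ContDiff ℝ ⊤ fun σ => feat N P c σ J := by
  unfold feat
  refine contDiff_const.mul ?_
  exact contDiff_prod fun i _ => contDiff_apply ℝ ℝ (J.2 i)

theorem contDiff_feat1' (J : GIdx N P) :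
    ContDiff ℝ ⊤ fun q : (Fin N → ℝ) × (Fin N → ℝ) => feat1 N P c q.1 q.2 J := by
  unfold feat1
  exact ((contDiff_feat J).fderiv_right (m := ⊤) le_top).comp contDiff_fst |>.clm_apply contDiff_snd

theorem contDiff_feat1 (J : GIdx N P) (v : Fin N → ℝ) :
    ContDiff ℝ ⊤ fun σ => feat1 N P c σ v J :=
  (contDiff_feat1' J).comp (contDiff_id.prodMk contDiff_const)

theorem hasFDerivAt_feat_line (J : GIdx N P) (σ v : Fin N → ℝ) :
    HasDerivAt (fun s : ℝ => feat N P c (σ + s • v) J) (feat1 N P c σ v J) 0 := by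
  have h1 : HasFDerivAt (fun τ => feat N P c τ J) (fderiv ℝ (fun τ => feat N P c τ J) σ)
      (σ + (0 : ℝ) • v) := by
    simpa using ((contDiff_feat J).differentiable (by simp) σ).hasFDerivAt
  have h2 : HasDerivAt (fun s : ℝ => σ + s • v) v 0 := by
    simpa using ((hasDerivAt_id (0 : ℝ)).smul_const v).const_add σ
  exact h1.comp_hasDerivAt 0 h2

theorem hasFDerivAt_feat1_line (J : GIdx N P) (σ v w : Fin N → ℝ) :
    HasDerivAt (fun s : ℝ => feat1 N P c (σ + s • v) w J) (feat2 N P c σ v w J) 0 := by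
  have h1 : HasFDerivAt (fun τ => feat1 N P c τ w J) (fderiv ℝ (fun τ => feat1 N P c τ w J) σ)
      (σ + (0 : ℝ) • v) := by
    simpa using ((contDiff_feat1 J w).differentiable (by simp) σ).hasFDerivAt
  have h2 : HasDerivAt (fun s : ℝ => σ + s • v) v 0 := by
    simpa using ((hasDerivAt_id (0 : ℝ)).smul_const v).const_add σ
  exact h1.comp_hasDerivAt 0 h2

theorem fderiv_hamiltonian (g : (k : ℕ) → (Fin k → Fin N) → ℝ) (σ v : Fin N → ℝ) :
    fderiv ℝ (hamiltonian N P c g) σ v = ∑ J, flatten N P g J * feat1 N P c σ v J := by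
  rw [show hamiltonian N P c g = fun σ => ∑ J, flatten N P g J * feat N P c σ J from
    funext (hamiltonian_eq N P c g)]
  rw [fderiv_fun_sum fun J _ => ((contDiff_feat J).differentiable (by simp) σ).const_mul _]
  rw [sum_apply]
  refine Finset.sum_congr rfl fun J _ => ?_
  rw [fderiv_const_mul ((contDiff_feat J).differentiable (by simp) σ)]
  rfl

theorem hessH_eq (g : (k : ℕ) → (Fin k → Fin N) → ℝ) (σ v w : Fin N → ℝ) :
    hessH N P c g σ v w = ∑ J, flatten N P g J * feat2 N P c σ v w J := by
  unfold hessH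
  rw [show (fun τ => fderiv ℝ (hamiltonian N P c g) τ w) =
    fun τ => ∑ J, flatten N P g J * feat1 N P c τ w J from funext fun τ => fderiv_hamiltonian g τ w]
  rw [fderiv_fun_sum fun J _ => ((contDiff_feat1 J w).differentiable (by simp) σ).const_mul _]
  rw [sum_apply]
  refine Finset.sum_congr rfl fun J _ => ?_
  rw [fderiv_const_mul ((contDiff_feat1 J w).differentiable (by simp) σ)]
  rfl

theorem gradH_eq (g : (k : ℕ) → (Fin k → Fin N) → ℝ) (σ : Fin N → ℝ) (i : Fin N) :
    gradH N P c g σ i = ∑ J, flatten N P g J * feat1 N P c σ (Pi.single i 1) J :=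
  fderiv_hamiltonian g σ _

theorem feat1_linear (σ : Fin N → ℝ) (J : GIdx N P) (v : Fin N → ℝ) :
    feat1 N P c σ v J = ∑ i, v i * feat1 N P c σ (Pi.single i 1) J := by
  unfold feat1
  conv_lhs => rw [← Finset.univ_sum_single v, map_sum]
  refine Finset.sum_congr rfl fun i _ => ?_
  rw [← smul_eq_mul, ← map_smul, ← Pi.single_smul]
  simp

/-- The covariance kernel as a function of the overlap. -/
def kern (N P : ℕ) (c : ℕ → ℝ) (d : ℕ) (s : ℝ) : ℝ :=
  ∑ k ∈ Finset.Icc 2 P, (c k) ^ 2 * (N : ℝ) ^ (-((k : ℝ) - 1)) *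
    ((k.descFactorial d : ℝ) * s ^ (k - d))

theorem hasDerivAt_kern (d : ℕ) (s : ℝ) :
    HasDerivAt (kern N P c d) (kern N P c (d + 1) s) s := by
  unfold kern
  refine HasDerivAt.fun_sum fun k _ => ?_
  have h := ((hasDerivAt_pow (k - d) s).const_mul (k.descFactorial d : ℝ)).const_mul
    ((c k) ^ 2 * (N : ℝ) ^ (-((k : ℝ) - 1)))
  refine h.congr_deriv ?_
  rcases le_or_gt d k with hd | hd
  · rw [Nat.descFactorial_succ, Nat.sub_sub]
    push_cast [Nat.cast_sub hd]
    ring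
  · simp [Nat.descFactorial_eq_zero_iff_lt.2 hd]

theorem sum_feat_mul_feat (σ τ : Fin N → ℝ) :
    ∑ J, feat N P c σ J * feat N P c τ J = kern N P c 0 (dotp σ τ) := by
  unfold feat kern dotp
  rw [Fintype.sum_sigma]
  refine Eq.trans ?_ (Finset.sum_coe_sort (Finset.Icc 2 P) fun k => (c k) ^ 2 *
    (N : ℝ) ^ (-((k : ℝ) - 1)) * ((k.descFactorial 0 : ℝ) * (∑ i, σ i * τ i) ^ (k - 0)))
  refine Finset.sum_congr rfl fun k _ => ?_
  have hN : (N : ℝ) ^ (-(((k : ℕ) : ℝ) - 1)) = (N : ℝ) ^ (-((((k : ℕ) : ℝ) - 1) / 2)) *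
      (N : ℝ) ^ (-((((k : ℕ) : ℝ) - 1) / 2)) := by
    have hk : (2 : ℝ) ≤ ((k : ℕ) : ℝ) := by exact_mod_cast (Finset.mem_Icc.1 k.2).1
    rcases Nat.eq_zero_or_pos N with h0 | h0
    · subst h0
      simp only [Nat.cast_zero]
      rw [Real.zero_rpow (by linarith), Real.zero_rpow (by linarith)]; simp
    · rw [← Real.rpow_add (by exact_mod_cast h0)]
      congr 1; ring
  rw [hN]
  simp only [Nat.descFactorial_zero, Nat.cast_one, one_mul, Nat.sub_zero]
  rw [Finset.sum_pow', Finset.mul_sum]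
  refine Finset.sum_congr (by ext; simp) fun j _ => ?_
  rw [Finset.prod_mul_distrib]
  ring

theorem dotp_line_right (σ τ v : Fin N → ℝ) (s : ℝ) :
    dotp σ (τ + s • v) = dotp σ τ + s * dotp σ v := by
  simp only [dotp, Pi.add_apply, Pi.smul_apply, smul_eq_mul, Finset.mul_sum, ← Finset.sum_add_distrib]
  exact Finset.sum_congr rfl fun i _ => by ring

theorem dotp_line_left (σ τ v : Fin N → ℝ) (s : ℝ) :
    dotp (σ + s • v) τ = dotp σ τ + s * dotp v τ := by
  simp only [dotp, Pi.add_apply, Pi.smul_apply, smul_eq_mul, Finset.mul_sum, ← Finset.sum_add_distrib]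
  exact Finset.sum_congr rfl fun i _ => by ring

theorem hasDerivAt_affine (a b : ℝ) : HasDerivAt (fun s : ℝ => a + s * b) b 0 := by
  simpa using ((hasDerivAt_id (0 : ℝ)).mul_const b).const_add a

theorem hasDerivAt_kern_affine (d : ℕ) (a b : ℝ) :
    HasDerivAt (fun s : ℝ => kern N P c d (a + s * b)) (kern N P c (d + 1) a * b) 0 := by
  have := (hasDerivAt_kern (N := N) (P := P) (c := c) d (a + 0 * b)).comp 0 (hasDerivAt_affine a b)
  simpa [Function.comp_def] using this

theorem sum_feat_mul_feat1 (σ τ w : Fin N → ℝ) :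
    ∑ J, feat N P c σ J * feat1 N P c τ w J = kern N P c 1 (dotp σ τ) * dotp σ w := by
  have h1 : HasDerivAt (fun s : ℝ => ∑ J, feat N P c σ J * feat N P c (τ + s • w) J)
      (∑ J, feat N P c σ J * feat1 N P c τ w J) 0 :=
    HasDerivAt.fun_sum fun J _ => (hasFDerivAt_feat_line J τ w).const_mul _
  refine h1.unique ?_
  simp_rw [sum_feat_mul_feat, dotp_line_right]
  exact hasDerivAt_kern_affine 0 _ _

theorem sum_feat_mul_feat2 (σ τ v w : Fin N → ℝ) :
    ∑ J, feat N P c σ J * feat2 N P c τ v w J =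
      kern N P c 2 (dotp σ τ) * dotp σ v * dotp σ w := by
  have h1 : HasDerivAt (fun s : ℝ => ∑ J, feat N P c σ J * feat1 N P c (τ + s • v) w J)
      (∑ J, feat N P c σ J * feat2 N P c τ v w J) 0 :=
    HasDerivAt.fun_sum fun J _ => (hasFDerivAt_feat1_line J τ v w).const_mul _
  refine h1.unique ?_
  simp_rw [sum_feat_mul_feat1, dotp_line_right]
  exact (hasDerivAt_kern_affine 1 _ _).mul_const _

theorem sum_feat1_mul_feat1 (σ τ v w : Fin N → ℝ) :
    ∑ J, feat1 N P c σ v J * feat1 N P c τ w J =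
      kern N P c 2 (dotp σ τ) * dotp v τ * dotp σ w + kern N P c 1 (dotp σ τ) * dotp v w := by
  have h1 : HasDerivAt (fun s : ℝ => ∑ J, feat N P c (σ + s • v) J * feat1 N P c τ w J)
      (∑ J, feat1 N P c σ v J * feat1 N P c τ w J) 0 :=
    HasDerivAt.fun_sum fun J _ => (hasFDerivAt_feat_line J σ v).mul_const _
  refine h1.unique ?_
  simp_rw [sum_feat_mul_feat1, dotp_line_left]
  have := (hasDerivAt_kern_affine (N := N) (P := P) (c := c) 1 (dotp σ τ) (dotp v τ)).fun_mul
    (hasDerivAt_affine (dotp σ w) (dotp v w))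
  exact this.congr_deriv (by simp)

theorem sum_feat1_mul_feat2 (σ τ u v w : Fin N → ℝ) (hv : dotp σ v = 0) (hw : dotp σ w = 0) :
    ∑ J, feat1 N P c σ u J * feat2 N P c τ v w J = 0 := by
  have h1 : HasDerivAt (fun s : ℝ => ∑ J, feat N P c (σ + s • u) J * feat2 N P c τ v w J)
      (∑ J, feat1 N P c σ u J * feat2 N P c τ v w J) 0 :=
    HasDerivAt.fun_sum fun J _ => (hasFDerivAt_feat_line J σ u).mul_const _
  refine h1.unique ?_
  simp_rw [sum_feat_mul_feat2, dotp_line_left]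
  have := ((hasDerivAt_kern_affine (N := N) (P := P) (c := c) 2 (dotp σ τ) (dotp u τ)).fun_mul
    (hasDerivAt_affine (dotp σ v) (dotp u v))).fun_mul (hasDerivAt_affine (dotp σ w) (dotp u w))
  exact this.congr_deriv (by simp [hv, hw])

theorem sum_feat1_mul_feat2_tangent (σ τ b v w : Fin N → ℝ) (hb : dotp b τ = 0) :
    ∑ J, feat1 N P c σ b J * feat2 N P c τ v w J =
      kern N P c 2 (dotp σ τ) * (dotp b v * dotp σ w + dotp σ v * dotp b w) := by
  have h1 : HasDerivAt (fun s : ℝ => ∑ J, feat N P c (σ + s • b) J * feat2 N P c τ v w J)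
      (∑ J, feat1 N P c σ b J * feat2 N P c τ v w J) 0 :=
    HasDerivAt.fun_sum fun J _ => (hasFDerivAt_feat_line J σ b).mul_const _
  refine h1.unique ?_
  simp_rw [sum_feat_mul_feat2, dotp_line_left]
  have := ((hasDerivAt_kern_affine (N := N) (P := P) (c := c) 2 (dotp σ τ) (dotp b τ)).fun_mul
    (hasDerivAt_affine (dotp σ v) (dotp b v))).fun_mul (hasDerivAt_affine (dotp σ w) (dotp b w))
  exact this.congr_deriv (by simp [hb]; ring)

theorem sum_feat2_mul_feat2 (σ a b v w : Fin N → ℝ) (ha : dotp a σ = 0) (hb : dotp b σ = 0)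
    (hv : dotp σ v = 0) (hw : dotp σ w = 0) :
    ∑ J, feat2 N P c σ a b J * feat2 N P c σ v w J =
      kern N P c 2 (dotp σ σ) * (dotp a v * dotp b w + dotp a w * dotp b v) := by
  have h1 : HasDerivAt (fun s : ℝ => ∑ J, feat1 N P c (σ + s • a) b J * feat2 N P c σ v w J)
      (∑ J, feat2 N P c σ a b J * feat2 N P c σ v w J) 0 :=
    HasDerivAt.fun_sum fun J _ => (hasFDerivAt_feat1_line J σ a b).mul_const _
  refine h1.unique ?_
  simp_rw [sum_feat1_mul_feat2_tangent _ _ _ _ _ hb, dotp_line_left]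
  have := (hasDerivAt_kern_affine (N := N) (P := P) (c := c) 2 (dotp σ σ) (dotp a σ)).fun_mul
    (((hasDerivAt_affine (dotp σ w) (dotp a w)).const_mul (dotp b v)).fun_add
    ((hasDerivAt_affine (dotp σ v) (dotp a v)).mul_const (dotp b w)))
  exact this.congr_deriv (by simp only [ha, hv, hw]; ring_nf)

end

/-- The action of a matrix on coupling tensors. -/
def rho {N P : ℕ} (O : Matrix (Fin N) (Fin N) ℝ) (x : GIdx N P → ℝ) : GIdx N P → ℝ :=
  fun J => ∑ I : Fin (J.1 : ℕ) → Fin N, (∏ a, O (J.2 a) (I a)) * x ⟨J.1, I⟩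

section rho
variable {N P : ℕ} {c : ℕ → ℝ}

theorem rho_add (O : Matrix (Fin N) (Fin N) ℝ) (x y : GIdx N P → ℝ) :
    rho O (x + y) = rho O x + rho O y := by
  ext J; simp [rho, mul_add, Finset.sum_add_distrib]

theorem rho_smul (O : Matrix (Fin N) (Fin N) ℝ) (r : ℝ) (x : GIdx N P → ℝ) :
    rho O (r • x) = r • rho O x := by
  ext J
  simp only [rho, Pi.smul_apply, smul_eq_mul, Finset.mul_sum]
  exact Finset.sum_congr rfl fun I _ => by ring

theorem rho_one (x : GIdx N P → ℝ) : rho (1 : Matrix (Fin N) (Fin N) ℝ) x = x := by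
  ext J
  simp only [rho, Matrix.one_apply]
  rw [Finset.sum_eq_single J.2]
  · simp
  · intro I _ hI
    obtain ⟨a, ha⟩ := Function.ne_iff.1 hI
    rw [Finset.prod_eq_zero (Finset.mem_univ a), zero_mul]
    rw [if_neg (Ne.symm ha)]
  · simp

theorem rho_mul (O O' : Matrix (Fin N) (Fin N) ℝ) (x : GIdx N P → ℝ) :
    rho (O * O') x = rho O (rho O' x) := by
  ext J
  simp only [rho, Matrix.mul_apply, Finset.prod_univ_sum, Finset.sum_mul, Finset.mul_sum,
    Fintype.piFinset_univ]
  rw [Finset.sum_comm]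
  refine Finset.sum_congr rfl fun I _ => Finset.sum_congr rfl fun K _ => ?_
  rw [Finset.prod_mul_distrib]; ring

theorem sum_rho_mul (O : Matrix (Fin N) (Fin N) ℝ) (x y : GIdx N P → ℝ) :
    ∑ J, rho O x J * y J = ∑ J, x J * rho O.transpose y J := by
  rw [Fintype.sum_sigma, Fintype.sum_sigma]
  refine Finset.sum_congr rfl fun k _ => ?_
  have h : ∀ A B : Fin (k : ℕ) → Fin N, (∏ a, O (A a) (B a)) * x ⟨k, B⟩ * y ⟨k, A⟩ =
      x ⟨k, B⟩ * ((∏ a, O.transpose (B a) (A a)) * y ⟨k, A⟩) := by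
    intro A B; simp only [Matrix.transpose_apply]; ring
  calc ∑ A, rho O x ⟨k, A⟩ * y ⟨k, A⟩
      = ∑ A : Fin (k : ℕ) → Fin N, ∑ B : Fin (k : ℕ) → Fin N,
        (∏ a, O (A a) (B a)) * x ⟨k, B⟩ * y ⟨k, A⟩ :=
      Finset.sum_congr rfl fun A _ => Finset.sum_mul _ _ _
    _ = ∑ B : Fin (k : ℕ) → Fin N, ∑ A : Fin (k : ℕ) → Fin N,
        (∏ a, O (A a) (B a)) * x ⟨k, B⟩ * y ⟨k, A⟩ := Finset.sum_comm
    _ = ∑ B, x ⟨k, B⟩ * rho O.transpose y ⟨k, B⟩ :=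
      Finset.sum_congr rfl fun B _ => by
        unfold rho; rw [Finset.mul_sum]; exact Finset.sum_congr rfl fun A _ => h A B

theorem rho_feat (O : Matrix (Fin N) (Fin N) ℝ) (σ : Fin N → ℝ) :
    rho O (feat N P c σ) = feat N P c (O.mulVec σ) := by
  ext J
  simp only [rho, feat, Matrix.mulVec, dotProduct, Finset.prod_univ_sum, Finset.mul_sum,
    Fintype.piFinset_univ, Finset.prod_mul_distrib]
  exact Finset.sum_congr rfl fun I _ => by ring

theorem hasDerivAt_rho (O : Matrix (Fin N) (Fin N) ℝ) {x : ℝ → GIdx N P → ℝ}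
    {x' : GIdx N P → ℝ} {s : ℝ} (h : ∀ J, HasDerivAt (fun s => x s J) (x' J) s) (J : GIdx N P) :
    HasDerivAt (fun s => rho O (x s) J) (rho O x' J) s :=
  HasDerivAt.fun_sum fun _ _ => (h _).const_mul _

theorem rho_feat1 (O : Matrix (Fin N) (Fin N) ℝ) (σ v : Fin N → ℝ) :
    rho O (feat1 N P c σ v) = feat1 N P c (O.mulVec σ) (O.mulVec v) := by
  ext J
  refine (hasDerivAt_rho O (fun J => hasFDerivAt_feat_line (c := c) J σ v) J).unique ?_
  simp_rw [rho_feat, Matrix.mulVec_add, Matrix.mulVec_smul]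
  exact hasFDerivAt_feat_line J _ _

theorem rho_feat2 (O : Matrix (Fin N) (Fin N) ℝ) (σ v w : Fin N → ℝ) :
    rho O (feat2 N P c σ v w) = feat2 N P c (O.mulVec σ) (O.mulVec v) (O.mulVec w) := by
  ext J
  refine (hasDerivAt_rho O (fun J => hasFDerivAt_feat1_line (c := c) J σ v w) J).unique ?_
  simp_rw [rho_feat1, Matrix.mulVec_add, Matrix.mulVec_smul]
  exact hasFDerivAt_feat1_line J _ _ _

theorem sum_rho_sq (O : Matrix (Fin N) (Fin N) ℝ) (hO : O.transpose * O = 1)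
    (x : GIdx N P → ℝ) : ∑ J, rho O x J ^ 2 = ∑ J, x J ^ 2 := by
  simp_rw [sq]
  rw [sum_rho_mul, ← rho_mul, hO, rho_one]

end rho

/-- Derivative of the feature vector along a curve of points and directions. -/
theorem hasDerivAt_feat1_curve {N P : ℕ} {c : ℕ → ℝ} (J : GIdx N P) {σ v : ℝ → Fin N → ℝ}
    {σ' v' : Fin N → ℝ} (hσ : HasDerivAt σ σ' 0) (hv : HasDerivAt v v' 0) :
    HasDerivAt (fun s => feat1 N P c (σ s) (v s) J)
      (feat2 N P c (σ 0) σ' (v 0) J + feat1 N P c (σ 0) v' J) 0 := by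
  have h1 : HasFDerivAt (fun τ => fderiv ℝ (fun τ => feat N P c τ J) τ)
      (fderiv ℝ (fun τ => fderiv ℝ (fun τ => feat N P c τ J) τ) (σ 0)) (σ 0) :=
    (((contDiff_feat J).fderiv_right (m := ⊤) le_top).differentiable (by simp) _).hasFDerivAt
  have h2 := (h1.comp_hasDerivAt 0 hσ).clm_apply hv
  refine h2.congr_deriv ?_
  simp only [feat2, feat1]
  congr 1
  rw [(h1.clm_apply (hasFDerivAt_const (v 0) (σ 0))).fderiv]
  simp

section pole
variable (n : ℕ)

/-- The pole of the sphere. -/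
def pole (n : ℕ) : Fin (n + 1) → ℝ := Fin.cons (Real.sqrt ((n : ℝ) + 1)) 0

/-- The normal of the reflection with parameter `u`. -/
def rvec {n : ℕ} (u : Fin n → ℝ) : Fin (n + 1) → ℝ := Fin.cons 1 u

/-- Its squared length. -/
def rq {n : ℕ} (u : Fin n → ℝ) : ℝ := 1 + ∑ i, u i ^ 2

/-- The reflection in the hyperplane orthogonal to `rvec u`. -/
def hrefl {n : ℕ} (u : Fin n → ℝ) : Matrix (Fin (n + 1)) (Fin (n + 1)) ℝ :=
  1 - (2 / rq u) • Matrix.vecMulVec (rvec u) (rvec u)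

variable {n}

theorem rq_pos (u : Fin n → ℝ) : 0 < rq u := by unfold rq; positivity

theorem dotp_eq {N : ℕ} (x y : Fin N → ℝ) : dotp x y = x ⬝ᵥ y := rfl

theorem dotp_rvec (u : Fin n → ℝ) : dotp (rvec u) (rvec u) = rq u := by
  simp [dotp, rvec, rq, Fin.sum_univ_succ, sq]

theorem hrefl_mulVec (u : Fin n → ℝ) (x : Fin (n + 1) → ℝ) :
    (hrefl u).mulVec x = x - (2 / rq u * dotp (rvec u) x) • rvec u := by
  simp only [hrefl, Matrix.sub_mulVec, Matrix.one_mulVec, Matrix.smul_mulVec, Matrix.vecMulVec_mulVec,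
    dotp_eq]
  ext i; simp; ring

theorem hrefl_transpose (u : Fin n → ℝ) : (hrefl u).transpose = hrefl u := by
  simp [hrefl, Matrix.transpose_sub, Matrix.transpose_smul, Matrix.transpose_vecMulVec]

theorem hrefl_mul_self (u : Fin n → ℝ) : hrefl u * hrefl u = 1 := by
  refine Matrix.ext_of_mulVec_single fun i => ?_
  rw [← Matrix.mulVec_mulVec, Matrix.one_mulVec, hrefl_mulVec, hrefl_mulVec]
  generalize (Pi.single i 1 : Fin (n + 1) → ℝ) = x
  have h1 : dotp (rvec u) (x - (2 / rq u * dotp (rvec u) x) • rvec u) = - dotp (rvec u) x := by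
    rw [dotp_eq, dotProduct_sub, dotProduct_smul, ← dotp_eq, ← dotp_eq, dotp_rvec, smul_eq_mul]
    have := (rq_pos u).ne'
    field_simp; ring
  rw [h1]; ext j; simp

theorem dotp_mulVec {N : ℕ} (O : Matrix (Fin N) (Fin N) ℝ) (hO : O.transpose * O = 1)
    (x y : Fin N → ℝ) : dotp (O.mulVec x) (O.mulVec y) = dotp x y := by
  rw [dotp_eq, dotp_eq, Matrix.dotProduct_mulVec, Matrix.vecMul_mulVec, hO, Matrix.vecMul_one]

theorem dotp_hrefl (u : Fin n → ℝ) (x y : Fin (n + 1) → ℝ) :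
    dotp ((hrefl u).mulVec x) ((hrefl u).mulVec y) = dotp x y :=
  dotp_mulVec _ (by rw [hrefl_transpose, hrefl_mul_self]) x y

theorem dotp_pole : dotp (pole n) (pole n) = ((n + 1 : ℕ) : ℝ) := by
  simp [dotp, pole, Fin.sum_univ_succ]
  exact Real.mul_self_sqrt (by positivity)

theorem hasDerivAt_hrefl (u w : Fin n → ℝ) (x : Fin (n + 1) → ℝ) :
    HasDerivAt (fun s : ℝ => (hrefl (u + s • w)).mulVec ((hrefl u).mulVec x))
      ((2 / rq u) • (dotp (rvec u) x • (Fin.cons 0 w : Fin (n + 1) → ℝ) -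
        dotp (Fin.cons 0 w) x • rvec u)) 0 := by
  set y := (hrefl u).mulVec x with hy
  have hr : ∀ s : ℝ, rvec (u + s • w) = rvec u + s • (Fin.cons 0 w : Fin (n + 1) → ℝ) := by
    intro s; ext i; refine Fin.cases ?_ (fun i => ?_) i <;> simp [rvec]
  have hq : ∀ s : ℝ, rq (u + s • w) = dotp (rvec u + s • (Fin.cons 0 w : Fin (n + 1) → ℝ))
      (rvec u + s • (Fin.cons 0 w : Fin (n + 1) → ℝ)) := by
    intro s; rw [← hr, dotp_rvec]
  have hv : HasDerivAt (fun s : ℝ => rvec u + s • (Fin.cons 0 w : Fin (n + 1) → ℝ))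
      (Fin.cons 0 w) 0 := by
    simpa using ((hasDerivAt_id (0 : ℝ)).smul_const (Fin.cons 0 w : Fin (n + 1) → ℝ)).const_add
      (rvec u)
  have hdy : HasDerivAt (fun s : ℝ => dotp (rvec u + s • (Fin.cons 0 w : Fin (n + 1) → ℝ)) y)
      (dotp (Fin.cons 0 w) y) 0 := by
    simp_rw [dotp_line_left]; exact hasDerivAt_affine _ _
  have hdq : HasDerivAt (fun s : ℝ => rq (u + s • w)) (2 * dotp (Fin.cons 0 w) (rvec u)) 0 := by
    simp_rw [hq, dotp_line_left, dotp_line_right]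
    have := (hasDerivAt_affine (dotp (rvec u) (rvec u)) (dotp (rvec u) (Fin.cons 0 w))).fun_add
      ((hasDerivAt_id' (0 : ℝ)).fun_mul (hasDerivAt_affine (dotp (Fin.cons 0 w) (rvec u))
        (dotp (Fin.cons 0 w : Fin (n + 1) → ℝ) (Fin.cons 0 w))))
    refine this.congr_deriv ?_
    rw [show dotp (rvec u) (Fin.cons 0 w) = dotp (Fin.cons 0 w) (rvec u) from dotProduct_comm _ _]
    ring
  have hq0 : rq (u + (0 : ℝ) • w) = rq u := by simp
  have hqne := (rq_pos u).ne'
  have hcoef := ((hasDerivAt_const (0 : ℝ) (2 : ℝ)).fun_div hdq (by rw [hq0]; exact hqne)).fun_mul hdy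
  have h := (hcoef.fun_smul hv).const_sub y
  simp_rw [hrefl_mulVec (u + _ • w), hr]
  refine h.congr_deriv ?_
  have h1 : dotp (rvec u) y = - dotp (rvec u) x := by
    rw [hy, hrefl_mulVec, dotp_eq, dotProduct_sub, dotProduct_smul, ← dotp_eq, ← dotp_eq, dotp_rvec,
      smul_eq_mul]
    field_simp; ring
  have h2 : dotp (Fin.cons 0 w) y = dotp (Fin.cons 0 w) x -
      2 / rq u * dotp (rvec u) x * dotp (Fin.cons 0 w) (rvec u) := by
    rw [hy, hrefl_mulVec, dotp_eq, dotProduct_sub, dotProduct_smul, ← dotp_eq, ← dotp_eq, smul_eq_mul]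
  ext i
  simp only [zero_smul, add_zero, h1, h2, Pi.neg_apply, Pi.add_apply, Pi.smul_apply, smul_eq_mul,
    Pi.sub_apply, zero_mul]
  field_simp
  ring

end pole

section KacRice
variable {n P : ℕ} {c : ℕ → ℝ}

/-- Tangent basis vectors at the pole. -/
def tb {n : ℕ} (i : Fin n) : Fin (n + 1) → ℝ := Pi.single i.succ 1

/-- Feature vector of the `i`-th tangential derivative at the pole. -/
def lvec (n P : ℕ) (c : ℕ → ℝ) (i : Fin n) : GIdx (n + 1) P → ℝ :=
  feat1 (n + 1) P c (pole n) (tb i)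

/-- Tangential gradient at the pole. -/
def Lm (n P : ℕ) (c : ℕ → ℝ) : (GIdx (n + 1) P → ℝ) →L[ℝ] (Fin n → ℝ) := dotMap (lvec n P c)

/-- Its adjoint. -/
def Ltr (n P : ℕ) (c : ℕ → ℝ) : (Fin n → ℝ) →L[ℝ] (GIdx (n + 1) P → ℝ) :=
  dotMap fun J i => lvec n P c i J

/-- `ξ'(1)`. -/
def kap (P : ℕ) (c : ℕ → ℝ) : ℝ := ∑ k ∈ Finset.Icc 2 P, (k : ℝ) * c k ^ 2

/-- `ξ''(1)`. -/
def nuu (P : ℕ) (c : ℕ → ℝ) : ℝ := ∑ k ∈ Finset.Icc 2 P, (k : ℝ) * ((k : ℝ) - 1) * c k ^ 2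

/-- `ξ(1)`. -/
def xi1 (P : ℕ) (c : ℕ → ℝ) : ℝ := ∑ k ∈ Finset.Icc 2 P, c k ^ 2

theorem kern_zero_pole (N : ℕ) (hN : 0 < N) : kern N P c 0 N = N * xi1 P c := by
  unfold kern xi1
  rw [Finset.mul_sum]
  refine Finset.sum_congr rfl fun k hk => ?_
  have hN' : (0 : ℝ) < N := by exact_mod_cast hN
  rw [← Real.rpow_natCast (N : ℝ), Nat.descFactorial_zero, Nat.cast_one, one_mul, mul_assoc,
    ← Real.rpow_add hN', mul_comm]
  congr 1
  rw [Nat.sub_zero, show -((k : ℝ) - 1) + k = 1 by ring, Real.rpow_one]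

theorem kern_one_pole (N : ℕ) (hN : 0 < N) : kern N P c 1 N = kap P c := by
  unfold kern kap
  refine Finset.sum_congr rfl fun k hk => ?_
  have hN' : (0 : ℝ) < N := by exact_mod_cast hN
  have hk2 := (Finset.mem_Icc.1 hk).1
  rw [← Real.rpow_natCast (N : ℝ), Nat.descFactorial_one]
  push_cast [Nat.cast_sub (show 1 ≤ k by omega)]
  rw [show c k ^ 2 * (N : ℝ) ^ (-((k : ℝ) - 1)) * (k * (N : ℝ) ^ ((k : ℝ) - 1)) =
    (k * c k ^ 2) * ((N : ℝ) ^ (-((k : ℝ) - 1)) * (N : ℝ) ^ ((k : ℝ) - 1)) by ring,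
    ← Real.rpow_add hN']
  simp

theorem kern_two_pole (N : ℕ) (hN : 0 < N) : kern N P c 2 N = nuu P c / N := by
  unfold kern nuu
  rw [Finset.sum_div]
  refine Finset.sum_congr rfl fun k hk => ?_
  have hN' : (0 : ℝ) < N := by exact_mod_cast hN
  have hk2 := (Finset.mem_Icc.1 hk).1
  rw [← Real.rpow_natCast (N : ℝ), Nat.descFactorial_succ, Nat.descFactorial_one]
  push_cast [Nat.cast_sub (show 1 ≤ k by omega), Nat.cast_sub hk2]
  rw [show c k ^ 2 * (N : ℝ) ^ (-((k : ℝ) - 1)) * (((k : ℝ) - 1) * k * (N : ℝ) ^ ((k : ℝ) - 2)) =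
    (k * ((k : ℝ) - 1) * c k ^ 2) * ((N : ℝ) ^ (-((k : ℝ) - 1)) * (N : ℝ) ^ ((k : ℝ) - 2)) by ring,
    ← Real.rpow_add hN', show -((k : ℝ) - 1) + (k - 2) = -1 by ring, Real.rpow_neg_one]
  rfl

theorem pole_zero : pole n 0 = Real.sqrt ((n : ℝ) + 1) := rfl

theorem dotp_pole_tb (i : Fin n) : dotp (pole n) (tb i) = 0 := by
  simp [dotp_eq, tb, pole]

theorem dotp_tb_pole (i : Fin n) : dotp (tb i) (pole n) = 0 := by
  simp [dotp_eq, tb, pole]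

theorem dotp_tb_tb (i j : Fin n) : dotp (tb i) (tb j) = if i = j then 1 else 0 := by
  simp [dotp_eq, tb, Pi.single_apply]
  simp [eq_comm]

theorem sum_lvec_mul_lvec (i j : Fin n) :
    ∑ J, lvec n P c i J * lvec n P c j J = if i = j then kap P c else 0 := by
  unfold lvec
  rw [sum_feat1_mul_feat1, dotp_pole_tb, dotp_tb_tb, dotp_pole, kern_one_pole _ (Nat.succ_pos n)]
  simp

theorem Lm_apply (g : GIdx (n + 1) P → ℝ) (i : Fin n) :
    Lm n P c g i = ∑ J, g J * lvec n P c i J := dotMap_apply _ _ _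

theorem Ltr_apply (w : Fin n → ℝ) (J : GIdx (n + 1) P) :
    Ltr n P c w J = ∑ i, w i * lvec n P c i J := dotMap_apply _ _ _

theorem Lm_Ltr (w : Fin n → ℝ) : Lm n P c (Ltr n P c w) = kap P c • w := by
  ext i
  rw [Lm_apply]
  simp_rw [Ltr_apply, Finset.sum_mul]
  rw [Finset.sum_comm]
  simp_rw [mul_assoc, ← Finset.mul_sum, sum_lvec_mul_lvec]
  simp [mul_comm]

/-- The orthogonal projection onto couplings with critical pole. -/
def prj (n P : ℕ) (c : ℕ → ℝ) : (GIdx (n + 1) P → ℝ) →L[ℝ] (GIdx (n + 1) P → ℝ) :=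
  ContinuousLinearMap.id ℝ _ - (kap P c)⁻¹ • (Ltr n P c).comp (Lm n P c)

theorem prj_apply (g : GIdx (n + 1) P → ℝ) :
    prj n P c g = g - (kap P c)⁻¹ • Ltr n P c (Lm n P c g) := rfl

theorem Lm_prj (hk : kap P c ≠ 0) (g : GIdx (n + 1) P → ℝ) : Lm n P c (prj n P c g) = 0 := by
  rw [prj_apply, map_sub, map_smul, Lm_Ltr, smul_smul, inv_mul_cancel₀ hk, one_smul, sub_self]

theorem sum_Ltr_mul (w : Fin n → ℝ) (g : GIdx (n + 1) P → ℝ) :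
    ∑ J, Ltr n P c w J * g J = ∑ i, w i * Lm n P c g i := by
  simp_rw [Ltr_apply, Lm_apply, Finset.sum_mul, Finset.mul_sum]
  rw [Finset.sum_comm]
  exact Finset.sum_congr rfl fun i _ => Finset.sum_congr rfl fun J _ => by ring

theorem sum_prj_sq (hk : kap P c ≠ 0) (g : GIdx (n + 1) P → ℝ) :
    ∑ J, prj n P c g J ^ 2 = ∑ J, g J ^ 2 - (∑ i, Lm n P c g i ^ 2) / kap P c := by
  have h1 : ∑ J, prj n P c g J ^ 2 = ∑ J, g J * prj n P c g J := by
    have : ∑ J, Ltr n P c (Lm n P c g) J * prj n P c g J = 0 := by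
      rw [sum_Ltr_mul, Lm_prj hk]; simp
    have h2 : ∑ J, prj n P c g J ^ 2 = ∑ J, g J * prj n P c g J -
        (kap P c)⁻¹ * ∑ J, Ltr n P c (Lm n P c g) J * prj n P c g J := by
      rw [Finset.mul_sum, ← Finset.sum_sub_distrib]
      refine Finset.sum_congr rfl fun J _ => ?_
      have : prj n P c g J = g J - (kap P c)⁻¹ * Ltr n P c (Lm n P c g) J := by
        rw [prj_apply]; simp
      rw [sq]; nth_rewrite 1 [this]; ring
    rw [h2, this]; ring
  rw [h1, prj_apply]
  simp only [Pi.sub_apply, Pi.smul_apply, smul_eq_mul, mul_sub, Finset.sum_sub_distrib]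
  congr 1
  · exact Finset.sum_congr rfl fun J _ => by ring
  · rw [show ∑ J, g J * ((kap P c)⁻¹ * Ltr n P c (Lm n P c g) J) =
      (kap P c)⁻¹ * ∑ J, Ltr n P c (Lm n P c g) J * g J by
        rw [Finset.mul_sum]; exact Finset.sum_congr rfl fun J _ => by ring, sum_Ltr_mul]
    rw [div_eq_inv_mul]; congr 1; exact Finset.sum_congr rfl fun J _ => by ring

/-- The map whose fibers are the critical points. -/
def krMap (n P : ℕ) (c : ℕ → ℝ) (g : GIdx (n + 1) P → ℝ) : GIdx (n + 1) P → ℝ :=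
  rho (hrefl (Lm n P c g)) (prj n P c g)

theorem contDiff_hrefl (i j : Fin (n + 1)) :
    ContDiff ℝ ⊤ fun u : Fin n → ℝ => hrefl u i j := by
  have h1 : ContDiff ℝ ⊤ fun u : Fin n → ℝ => rq u := by unfold rq; fun_prop
  have h2 : ∀ i, ContDiff ℝ ⊤ fun u : Fin n → ℝ => rvec u i := by
    intro i
    refine Fin.cases ?_ (fun i => ?_) i
    · simp only [rvec, Fin.cons_zero]; exact contDiff_const
    · simp only [rvec, Fin.cons_succ]; exact contDiff_apply ℝ ℝ i
  have : (fun u : Fin n → ℝ => hrefl u i j) = fun u => (1 : Matrix (Fin (n+1)) (Fin (n+1)) ℝ) i j -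
      2 / rq u * (rvec u i * rvec u j) := by
    ext u; simp [hrefl, Matrix.vecMulVec_apply]
  rw [this]
  exact contDiff_const.sub ((contDiff_const.div h1 fun u => (rq_pos u).ne').mul ((h2 i).mul (h2 j)))

theorem contDiff_rho_hrefl :
    ContDiff ℝ ⊤ fun q : (Fin n → ℝ) × (GIdx (n + 1) P → ℝ) => rho (hrefl q.1) q.2 := by
  rw [contDiff_pi]
  intro J
  refine ContDiff.sum fun I _ => ContDiff.mul ?_ ?_
  · exact contDiff_prod fun a _ => (contDiff_hrefl _ _).comp contDiff_fst
  · exact (contDiff_apply ℝ ℝ _).comp contDiff_snd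

theorem contDiff_krMap : ContDiff ℝ ⊤ (krMap n P c) := by
  have h : ContDiff ℝ ⊤ fun g => (Lm n P c g, prj n P c g) :=
    (Lm n P c).contDiff.prodMk (prj n P c).contDiff
  have e : krMap n P c = (fun q : (Fin n → ℝ) × (GIdx (n + 1) P → ℝ) => rho (hrefl q.1) q.2) ∘
      fun g => (Lm n P c g, prj n P c g) := by
    funext g; simp only [krMap, Function.comp_apply]
  rw [e]
  exact ContDiff.comp contDiff_rho_hrefl h

/-- `rho` as a linear map. -/
def rhoL {N P : ℕ} (O : Matrix (Fin N) (Fin N) ℝ) : (GIdx N P → ℝ) →ₗ[ℝ] (GIdx N P → ℝ) where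
  toFun := rho O
  map_add' := rho_add O
  map_smul' := rho_smul O

/-- Tangential Hessian at the pole. -/
def hessP (n P : ℕ) (c : ℕ → ℝ) (h : GIdx (n + 1) P → ℝ) : Matrix (Fin n) (Fin n) ℝ :=
  fun i j => ∑ J, h J * feat2 (n + 1) P c (pole n) (tb j) (tb i) J

/-- Radial derivative at the pole. -/
def radP (n P : ℕ) (c : ℕ → ℝ) (h : GIdx (n + 1) P → ℝ) : ℝ :=
  (∑ J, h J * feat1 (n + 1) P c (pole n) (pole n) J) / ((n + 1 : ℕ) : ℝ)

/-- Derivative of the rotated couplings. -/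
def krM (h : GIdx (n + 1) P → ℝ) (u : Fin n → ℝ) : (Fin n → ℝ) →ₗ[ℝ] (GIdx (n + 1) P → ℝ) :=
  rhoL (hrefl u) ∘ₗ (fderiv ℝ (fun u => rho (hrefl u) h) u : (Fin n → ℝ) →ₗ[ℝ] _)

theorem rho_fderiv_krMap (g y : GIdx (n + 1) P → ℝ) :
    rho (hrefl (Lm n P c g)) (fderiv ℝ (krMap n P c) g y) =
      prj n P c y + krM (prj n P c g) (Lm n P c g) (Lm n P c y) := by
  set u := Lm n P c g
  set h := prj n P c g
  let Φ : (Fin n → ℝ) × (GIdx (n + 1) P → ℝ) → (GIdx (n + 1) P → ℝ) := fun q => rho (hrefl q.1) q.2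
  have hΦ : HasFDerivAt Φ (fderiv ℝ Φ (u, h)) (u, h) :=
    (contDiff_rho_hrefl.differentiable (by simp) _).hasFDerivAt
  have h1 : HasFDerivAt (krMap n P c) ((fderiv ℝ Φ (u, h)).comp ((Lm n P c).prod (prj n P c))) g :=
    HasFDerivAt.comp (f := fun g => (Lm n P c g, prj n P c g)) (g := Φ) g hΦ
      ((Lm n P c).hasFDerivAt.prodMk (prj n P c).hasFDerivAt)
  have h2 : HasFDerivAt (fun u => rho (hrefl u) h)
      ((fderiv ℝ Φ (u, h)).comp ((ContinuousLinearMap.id ℝ _).prod 0)) u :=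
    HasFDerivAt.comp (f := fun u => (u, h)) u hΦ ((hasFDerivAt_id u).prodMk (hasFDerivAt_const h u))
  have h3 : ∀ y, fderiv ℝ Φ (u, h) (0, y) = rho (hrefl u) y := by
    intro y
    have h4 : HasFDerivAt (fun h => rho (hrefl u) h)
      ((fderiv ℝ Φ (u, h)).comp ((0 : _ →L[ℝ] _).prod (ContinuousLinearMap.id ℝ _))) h :=
      HasFDerivAt.comp (f := fun h => (u, h)) h hΦ ((hasFDerivAt_const u h).prodMk (hasFDerivAt_id h))
    have h5 : HasFDerivAt (fun h : GIdx (n + 1) P → ℝ => rho (hrefl u) h)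
        (LinearMap.toContinuousLinearMap (rhoL (hrefl u))) h :=
      (LinearMap.toContinuousLinearMap (rhoL (P := P) (hrefl u))).hasFDerivAt
    have := congrArg (fun T => T y) (h4.unique h5)
    simpa [rhoL] using this
  rw [h1.fderiv]
  simp only [krM, LinearMap.comp_apply, rhoL, LinearMap.coe_mk, AddHom.coe_mk,
    ContinuousLinearMap.coe_coe, h2.fderiv, ContinuousLinearMap.comp_apply,
    ContinuousLinearMap.prod_apply, ContinuousLinearMap.id_apply, zero_apply]
  rw [show (Lm n P c y, prj n P c y) = (Lm n P c y, 0) + (0, prj n P c y) by simp, map_add, h3,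
    rho_add, ← rho_mul, hrefl_mul_self, rho_one]
  exact add_comm _ _

theorem feat1_cons (σ v : Fin (n + 1) → ℝ) (J : GIdx (n + 1) P) :
    feat1 (n + 1) P c σ v J = v 0 * feat1 (n + 1) P c σ (Pi.single 0 1) J +
      ∑ j : Fin n, v j.succ * feat1 (n + 1) P c σ (tb j) J := by
  rw [feat1_linear, Fin.sum_univ_succ]; rfl

theorem feat2_linear {N : ℕ} (σ w : Fin N → ℝ) (J : GIdx N P) (v : Fin N → ℝ) :
    feat2 N P c σ v w J = ∑ i, v i * feat2 N P c σ (Pi.single i 1) w J := by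
  unfold feat2
  conv_lhs => rw [← Finset.univ_sum_single v, map_sum]
  refine Finset.sum_congr rfl fun i _ => ?_
  rw [← smul_eq_mul, ← map_smul, ← Pi.single_smul]
  simp

theorem pole_eq : pole n = Real.sqrt ((n : ℝ) + 1) • (Pi.single 0 1 : Fin (n + 1) → ℝ) := by
  ext i; refine Fin.cases ?_ (fun i => ?_) i <;> simp [pole]

theorem radP_eq (h : GIdx (n + 1) P → ℝ) : radP n P c h * Real.sqrt ((n : ℝ) + 1) =
    ∑ J, h J * feat1 (n + 1) P c (pole n) (Pi.single 0 1) J := by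
  unfold radP
  have : ∀ J, feat1 (n + 1) P c (pole n) (pole n) J =
      Real.sqrt ((n : ℝ) + 1) * feat1 (n + 1) P c (pole n) (Pi.single 0 1) J := by
    intro J
    rw [feat1_cons]
    simp [pole]
  simp_rw [this]
  rw [show ∑ J, h J * (Real.sqrt ((n : ℝ) + 1) * feat1 (n + 1) P c (pole n) (Pi.single 0 1) J) =
    Real.sqrt ((n : ℝ) + 1) * ∑ J, h J * feat1 (n + 1) P c (pole n) (Pi.single 0 1) J by
      rw [Finset.mul_sum]; exact Finset.sum_congr rfl fun J _ => by ring]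
  have h0 : (0 : ℝ) < (n : ℝ) + 1 := by positivity
  have h1 := Real.mul_self_sqrt h0.le
  push_cast
  field_simp
  rw [sq, h1]

theorem Lm_krM (h : GIdx (n + 1) P → ℝ) (hL : Lm n P c h = 0) (u w : Fin n → ℝ) (i : Fin n) :
    Lm n P c (krM h u w) i = 2 * Real.sqrt ((n : ℝ) + 1) / rq u *
      ((hessP n P c h).mulVec w i - radP n P c h * w i) := by
  have h1 : HasDerivAt (fun s : ℝ => rho (hrefl (u + s • w)) h)
      (fderiv ℝ (fun u => rho (hrefl u) h) u w) 0 := by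
    have h2 : HasFDerivAt (fun u => rho (hrefl u) h) (fderiv ℝ (fun u => rho (hrefl u) h) u)
        (u + (0 : ℝ) • w) := by
      simp only [zero_smul, add_zero]
      exact ((contDiff_rho_hrefl.comp (contDiff_id.prodMk contDiff_const)).differentiable
        (by simp) u).hasFDerivAt
    have h3 : HasDerivAt (fun s : ℝ => u + s • w) w 0 := by
      simpa using ((hasDerivAt_id (0 : ℝ)).smul_const w).const_add u
    exact h2.comp_hasDerivAt 0 h3
  have h4 : HasDerivAt (fun s : ℝ => ∑ J, rho (hrefl (u + s • w)) h J * rho (hrefl u) (lvec n P c i) J)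
      (Lm n P c (krM h u w) i) 0 := by
    have : Lm n P c (krM h u w) i =
        ∑ J, (fderiv ℝ (fun u => rho (hrefl u) h) u w) J * rho (hrefl u) (lvec n P c i) J := by
      rw [Lm_apply]
      simp only [krM, LinearMap.comp_apply, rhoL, LinearMap.coe_mk, AddHom.coe_mk,
        ContinuousLinearMap.coe_coe]
      rw [sum_rho_mul, hrefl_transpose]
    rw [this]
    exact HasDerivAt.fun_sum fun J _ => ((hasDerivAt_pi.1 h1) J).mul_const _
  refine h4.unique ?_
  have h5 : ∀ s : ℝ, ∑ J, rho (hrefl (u + s • w)) h J * rho (hrefl u) (lvec n P c i) J =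
      ∑ J, h J * feat1 (n + 1) P c ((hrefl (u + s • w)).mulVec ((hrefl u).mulVec (pole n)))
        ((hrefl (u + s • w)).mulVec ((hrefl u).mulVec (tb i))) J := by
    intro s
    rw [sum_rho_mul, hrefl_transpose, lvec, rho_feat1, rho_feat1]
  simp_rw [h5]
  have h6 := HasDerivAt.fun_sum (u := Finset.univ) fun J _ =>
    (hasDerivAt_feat1_curve (c := c) (P := P) J (hasDerivAt_hrefl u w (pole n))
    (hasDerivAt_hrefl u w (tb i))).const_mul (h J)
  refine h6.congr_deriv ?_
  have hz : ∀ x, (hrefl (u + (0 : ℝ) • w)).mulVec ((hrefl u).mulVec x) = x := by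
    intro x; rw [zero_smul, add_zero, Matrix.mulVec_mulVec, hrefl_mul_self, Matrix.one_mulVec]
  simp only [hz]
  have e1 : dotp (rvec u) (pole n) = Real.sqrt ((n : ℝ) + 1) := by
    simp [pole_eq, dotp_eq, rvec]
  have e2 : dotp (Fin.cons 0 w) (pole n) = 0 := by simp [pole_eq, dotp_eq]
  have e3 : dotp (rvec u) (tb i) = u i := by simp [tb, dotp_eq, rvec]
  have e4 : dotp (Fin.cons 0 w) (tb i) = w i := by simp [tb, dotp_eq]
  rw [e1, e2, e3, e4]
  have hl : ∀ j, ∑ J, h J * feat1 (n + 1) P c (pole n) (tb j) J = 0 := by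
    intro j; have := congrFun hL j; rwa [Lm_apply] at this
  have e5 : ∀ J, feat2 (n + 1) P c (pole n) ((2 / rq u) • (Real.sqrt ((n : ℝ) + 1) •
      (Fin.cons 0 w : Fin (n + 1) → ℝ) - (0 : ℝ) • rvec u)) (tb i) J =
      2 * Real.sqrt ((n : ℝ) + 1) / rq u * ∑ j : Fin n, w j * feat2 (n + 1) P c (pole n) (tb j) (tb i) J := by
    intro J
    rw [feat2_linear, Fin.sum_univ_succ, Finset.mul_sum]
    simp only [zero_smul, sub_zero, Pi.smul_apply, Fin.cons_zero, Fin.cons_succ, smul_eq_mul, mul_zero,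
      zero_mul, zero_add]
    exact Finset.sum_congr rfl fun j _ => by simp only [tb]; ring
  simp_rw [e5, feat1_cons (pole n) ((2 / rq u) • _), mul_add, Finset.sum_add_distrib]
  have e6 : ∑ J, h J * ∑ j : Fin n, ((2 / rq u) • (u i • (Fin.cons 0 w : Fin (n + 1) → ℝ) - w i • rvec u)) j.succ *
      feat1 (n + 1) P c (pole n) (tb j) J = 0 := by
    simp_rw [Finset.mul_sum]
    rw [Finset.sum_comm]
    refine Finset.sum_eq_zero fun j _ => ?_
    simp_rw [mul_left_comm (h _), ← Finset.mul_sum, hl, mul_zero]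
  rw [e6, add_zero]
  have e7 : (hessP n P c h).mulVec w i = ∑ J, h J * ∑ j : Fin n, w j * feat2 (n + 1) P c (pole n) (tb j) (tb i) J := by
    simp only [Matrix.mulVec, dotProduct, hessP, Finset.sum_mul, Finset.mul_sum]
    rw [Finset.sum_comm]
    exact Finset.sum_congr rfl fun J _ => Finset.sum_congr rfl fun j _ => by ring
  have e8 := radP_eq (c := c) h
  simp_rw [mul_left_comm (h _), ← Finset.mul_sum, ← e8, e7]
  simp only [Pi.smul_apply, Pi.sub_apply, Fin.cons_zero, rvec, smul_eq_mul]
  have h0 : (0 : ℝ) < (n : ℝ) + 1 := by positivity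
  ring

theorem abs_det_rhoL (u : Fin n → ℝ) : |LinearMap.det (rhoL (P := P) (hrefl u))| = 1 := by
  have h : rhoL (P := P) (hrefl u) ∘ₗ rhoL (hrefl u) = LinearMap.id := by
    refine LinearMap.ext fun x => ?_
    simp [rhoL, ← rho_mul, hrefl_mul_self, rho_one]
  have h2 := congrArg LinearMap.det h
  rw [LinearMap.det_comp, LinearMap.det_id] at h2
  rw [← abs_one, abs_eq_abs]
  exact mul_self_eq_one_iff.1 h2

theorem det_id_add_comp {ι κ : Type*} [Fintype ι] [Fintype κ] [DecidableEq ι] [DecidableEq κ]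
    (B : (κ → ℝ) →ₗ[ℝ] (ι → ℝ)) (L : (ι → ℝ) →ₗ[ℝ] (κ → ℝ)) :
    LinearMap.det (LinearMap.id + B ∘ₗ L) = LinearMap.det (LinearMap.id + L ∘ₗ B) := by
  rw [← LinearMap.det_toMatrix', ← LinearMap.det_toMatrix', map_add, map_add,
    LinearMap.toMatrix'_comp, LinearMap.toMatrix'_comp, LinearMap.toMatrix'_id,
    LinearMap.toMatrix'_id, Matrix.det_one_add_mul_comm]

theorem abs_det_krMap (hk : kap P c ≠ 0) (g : GIdx (n + 1) P → ℝ) :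
    |(fderiv ℝ (krMap n P c) g).det| = (2 * Real.sqrt ((n : ℝ) + 1) / rq (Lm n P c g)) ^ n *
      |(hessP n P c (prj n P c g) - radP n P c (prj n P c g) • 1).det| := by
  set u := Lm n P c g
  set h := prj n P c g
  have h1 : rhoL (hrefl u) ∘ₗ (fderiv ℝ (krMap n P c) g : _ →ₗ[ℝ] _) =
      LinearMap.id + (krM h u - (kap P c)⁻¹ • (Ltr n P c : _ →ₗ[ℝ] _)) ∘ₗ (Lm n P c : _ →ₗ[ℝ] _) := by
    refine LinearMap.ext fun y => ?_
    have := rho_fderiv_krMap (c := c) g y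
    simp only [LinearMap.comp_apply, rhoL, LinearMap.coe_mk, AddHom.coe_mk,
      ContinuousLinearMap.coe_coe]
    rw [this, prj_apply]
    simp only [LinearMap.add_apply, LinearMap.id_apply, LinearMap.comp_apply, LinearMap.sub_apply,
      LinearMap.smul_apply, ContinuousLinearMap.coe_coe]
    abel
  have h2 : LinearMap.id + (Lm n P c : _ →ₗ[ℝ] _) ∘ₗ (krM h u - (kap P c)⁻¹ • (Ltr n P c : _ →ₗ[ℝ] _)) =
      Matrix.toLin' ((2 * Real.sqrt ((n : ℝ) + 1) / rq u) • (hessP n P c h - radP n P c h • 1)) := by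
    refine LinearMap.ext fun w => ?_
    ext i
    simp only [LinearMap.add_apply, LinearMap.id_apply, LinearMap.comp_apply, LinearMap.sub_apply,
      LinearMap.smul_apply, ContinuousLinearMap.coe_coe, map_sub, map_smul, Lm_Ltr, Pi.add_apply,
      Pi.sub_apply, Pi.smul_apply, smul_eq_mul, Matrix.toLin'_apply,
      Matrix.one_mulVec]
    rw [Lm_krM h (Lm_prj hk g)]
    field_simp
    ring
  have h3 := congrArg LinearMap.det h1
  rw [LinearMap.det_comp, det_id_add_comp, h2, LinearMap.det_toLin', Matrix.det_smul,
    Fintype.card_fin] at h3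
  have h4 := congrArg abs h3
  rw [abs_mul, abs_det_rhoL, one_mul, abs_mul, abs_pow] at h4
  have hpos : 0 ≤ 2 * Real.sqrt ((n : ℝ) + 1) / rq u := by have := rq_pos u; positivity
  rw [abs_of_nonneg hpos] at h4
  exact h4

end KacRice

/-- Critical points in terms of flattened couplings. -/
def IsCrit (N P : ℕ) (c : ℕ → ℝ) (g : GIdx N P → ℝ) (σ : Fin N → ℝ) : Prop :=
  dotp σ σ = N ∧ ∀ v, dotp σ v = 0 → ∑ J, g J * feat1 N P c σ v J = 0

theorem dotp_comm {N : ℕ} (x y : Fin N → ℝ) : dotp x y = dotp y x := dotProduct_comm _ _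

theorem dotp_self_eq_zero {N : ℕ} {x : Fin N → ℝ} (h : dotp x x = 0) : x = 0 :=
  dotProduct_self_eq_zero.1 h

theorem dotp_gradH {N P : ℕ} {c : ℕ → ℝ} (g : (k : ℕ) → (Fin k → Fin N) → ℝ) (σ v : Fin N → ℝ) :
    dotp (gradH N P c g σ) v = ∑ J, flatten N P g J * feat1 N P c σ v J := by
  simp_rw [feat1_linear σ _ v, Finset.mul_sum, dotp, gradH_eq, Finset.sum_mul]
  rw [Finset.sum_comm]
  exact Finset.sum_congr rfl fun i _ => Finset.sum_congr rfl fun J _ => by ring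

theorem isCritPt_iff {N P : ℕ} {c : ℕ → ℝ} (hN : 0 < N) (g : (k : ℕ) → (Fin k → Fin N) → ℝ)
    (σ : Fin N → ℝ) : IsCritPt N P c g σ ↔ IsCrit N P c (flatten N P g) σ := by
  have h1 : σ ∈ sphereSet N ↔ dotp σ σ = N := by simp [sphereSet, dotp, sq]
  unfold IsCritPt IsCrit
  rw [h1]
  refine and_congr_right fun hσ => ⟨fun h v hv => ?_, fun h => ?_⟩
  · rw [← dotp_gradH, h, dotp_eq, smul_dotProduct, ← dotp_eq, hv, smul_zero]
  · set r := dotp (gradH N P c g σ) σ / N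
    have hN' : (N : ℝ) ≠ 0 := by positivity
    have h2 : dotp σ (gradH N P c g σ - r • σ) = 0 := by
      rw [dotp_eq, dotProduct_sub, dotProduct_smul, ← dotp_eq, ← dotp_eq, hσ, dotp_comm, smul_eq_mul,
        div_mul_cancel₀ _ hN', sub_self]
    have h3 := h _ h2
    rw [← dotp_gradH] at h3
    have h4 : dotp (gradH N P c g σ - r • σ) (gradH N P c g σ - r • σ) = 0 := by
      nth_rewrite 1 [dotp_eq]
      rw [sub_dotProduct, smul_dotProduct, ← dotp_eq, ← dotp_eq, h3, h2]; simp
    exact sub_eq_zero.1 (dotp_self_eq_zero h4)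

section KacRice
variable {n P : ℕ} {c : ℕ → ℝ}

theorem hrefl_pole (u : Fin n → ℝ) : (hrefl u).mulVec (pole n) =
    pole n - (2 / rq u * Real.sqrt ((n : ℝ) + 1)) • rvec u := by
  rw [hrefl_mulVec]
  congr 3
  simp [pole_eq, dotp_eq, rvec]

theorem hrefl_pole_ne (u : Fin n → ℝ) : (hrefl u).mulVec (pole n) ≠ pole n := by
  intro h
  rw [hrefl_pole] at h
  have := congrFun h 0
  have h1 := rq_pos u
  have h2 : 0 < Real.sqrt ((n : ℝ) + 1) := by positivity
  simp [rvec] at this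
  rcases this with h | h
  · exact h1.ne' h
  · exact h2.ne' h

theorem hrefl_pole_injective : Function.Injective fun u : Fin n → ℝ => (hrefl u).mulVec (pole n) := by
  intro u w h
  simp only [hrefl_pole] at h
  have hs : 0 < Real.sqrt ((n : ℝ) + 1) := by positivity
  have h0 := congrFun h 0
  simp only [Pi.sub_apply, Pi.smul_apply, rvec, Fin.cons_zero, smul_eq_mul, mul_one,
    sub_right_inj] at h0
  funext i
  have h1 := congrFun h i.succ
  simp only [Pi.sub_apply, Pi.smul_apply, rvec, Fin.cons_succ, smul_eq_mul,
    sub_right_inj, h0] at h1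
  have : 2 / rq w * Real.sqrt ((n : ℝ) + 1) ≠ 0 := by have := rq_pos w; positivity
  exact mul_left_cancel₀ this h1

theorem exists_hrefl_pole {σ : Fin (n + 1) → ℝ} (h : dotp σ σ = ((n + 1 : ℕ) : ℝ)) (hσ : σ ≠ pole n) :
    ∃ u : Fin n → ℝ, (hrefl u).mulVec (pole n) = σ := by
  set N := Real.sqrt ((n : ℝ) + 1) with hNdef
  have hN : 0 < N := by positivity
  have hNN : N * N = n + 1 := Real.mul_self_sqrt (by positivity)
  have hs : σ 0 * σ 0 + ∑ i : Fin n, σ i.succ ^ 2 = N * N := by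
    rw [hNN, dotp, Fin.sum_univ_succ] at *
    push_cast at h
    rw [← h]; simp [sq]
  have h0 : σ 0 ≠ N := by
    intro h0
    apply hσ
    rw [h0] at hs
    have h2 : ∑ i : Fin n, σ i.succ ^ 2 = 0 := by linarith
    rw [Finset.sum_eq_zero_iff_of_nonneg fun i _ => sq_nonneg _] at h2
    ext i; refine Fin.cases ?_ (fun i => ?_) i
    · exact h0
    · simpa [pole] using h2 i (Finset.mem_univ _)
  have hne : N - σ 0 ≠ 0 := sub_ne_zero.2 (Ne.symm h0)
  refine ⟨fun i => - σ i.succ / (N - σ 0), ?_⟩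
  have hq : rq (fun i : Fin n => - σ i.succ / (N - σ 0)) = 2 * N / (N - σ 0) := by
    unfold rq
    simp_rw [div_pow, neg_sq]
    rw [← Finset.sum_div, show ∑ i : Fin n, σ i.succ ^ 2 = (N - σ 0) * (N + σ 0) by linarith]
    field_simp; ring
  rw [hrefl_pole, hq]
  ext i; refine Fin.cases ?_ (fun i => ?_) i
  · simp only [Pi.sub_apply, pole_zero, Pi.smul_apply, rvec, Fin.cons_zero, smul_eq_mul]
    rw [← hNdef]; field_simp; ring
  · simp only [Pi.sub_apply, pole, Pi.smul_apply, rvec, Fin.cons_succ, smul_eq_mul, Pi.zero_apply]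
    rw [← hNdef]; field_simp; ring

theorem Lm_rho_eq_zero {g : GIdx (n + 1) P → ℝ} {u : Fin n → ℝ}
    (h : IsCrit (n + 1) P c g ((hrefl u).mulVec (pole n))) : Lm n P c (rho (hrefl u) g) = 0 := by
  ext i
  rw [Lm_apply, sum_rho_mul, hrefl_transpose, lvec, rho_feat1]
  refine h.2 _ ?_
  rw [dotp_hrefl, dotp_pole_tb]

theorem isCrit_of_Lm {h : GIdx (n + 1) P → ℝ} (u : Fin n → ℝ) (hL : Lm n P c h = 0) :
    IsCrit (n + 1) P c (rho (hrefl u) h) ((hrefl u).mulVec (pole n)) := by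
  refine ⟨by rw [dotp_hrefl, dotp_pole], fun v hv => ?_⟩
  rw [sum_rho_mul, hrefl_transpose, rho_feat1, Matrix.mulVec_mulVec, hrefl_mul_self, Matrix.one_mulVec]
  set w := (hrefl u).mulVec v
  have hw : w 0 = 0 := by
    have h1 : dotp (pole n) w = 0 := by
      have := dotp_hrefl u ((hrefl u).mulVec (pole n)) v
      rw [hv, Matrix.mulVec_mulVec, hrefl_mul_self, Matrix.one_mulVec] at this
      exact this
    rw [pole_eq, dotp_eq, smul_dotProduct, smul_eq_mul] at h1
    have hs : 0 < Real.sqrt ((n : ℝ) + 1) := by positivity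
    simpa [hs.ne'] using h1
  simp_rw [feat1_cons (pole n) w, hw, zero_mul, zero_add, Finset.mul_sum]
  rw [Finset.sum_comm]
  refine Finset.sum_eq_zero fun j _ => ?_
  have := congrFun hL j
  rw [Lm_apply] at this
  simp_rw [mul_left_comm (h _), ← Finset.mul_sum]
  rw [show ∑ J, h J * feat1 (n + 1) P c (pole n) (tb j) J = 0 from this, mul_zero]

theorem ecount_krMap_fiber (hk : kap P c ≠ 0) {T : (GIdx (n + 1) P → ℝ) → Prop}
    {Q : (GIdx (n + 1) P → ℝ) → (Fin (n + 1) → ℝ) → Prop}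
    (hQ : ∀ u h, Q (rho (hrefl u) h) ((hrefl u).mulVec (pole n)) ↔ T h)
    (g' : GIdx (n + 1) P → ℝ) :
    ecount ({g | T (prj n P c g)} ∩ krMap n P c ⁻¹' {g'}) =
      ecount {σ | IsCrit (n + 1) P c g' σ ∧ σ ≠ pole n ∧ Q g' σ} := by
  have hmem : ∀ g ∈ ({g | T (prj n P c g)} ∩ krMap n P c ⁻¹' {g'}),
      (hrefl (Lm n P c g)).mulVec (pole n) ∈
        {σ | IsCrit (n + 1) P c g' σ ∧ σ ≠ pole n ∧ Q g' σ} := by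
    rintro g ⟨hT, hg⟩
    have hg : krMap n P c g = g' := hg
    rw [← hg]
    exact ⟨isCrit_of_Lm _ (Lm_prj hk g), hrefl_pole_ne _, (hQ _ _).2 hT⟩
  refine ecount_congr (Equiv.ofBijective (fun g => ⟨_, hmem g.1 g.2⟩) ⟨?_, ?_⟩)
  · rintro ⟨g, hg⟩ ⟨k, hk'⟩ h
    have h1 : Lm n P c g = Lm n P c k := hrefl_pole_injective (Subtype.ext_iff.1 h)
    have h2 : prj n P c g = prj n P c k := by
      have e1 : krMap n P c g = g' := hg.2
      have e2 : krMap n P c k = g' := hk'.2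
      have e3 := congrArg (rho (hrefl (Lm n P c g))) (e1.trans e2.symm)
      unfold krMap at e3
      rwa [← h1, ← rho_mul, ← rho_mul, hrefl_mul_self, rho_one, rho_one] at e3
    rw [prj_apply, prj_apply, h1] at h2
    exact Subtype.ext (sub_left_injective h2)
  · rintro ⟨σ, h1, h2, h3⟩
    obtain ⟨u, rfl⟩ := exists_hrefl_pole h1.1 h2
    have hL := Lm_rho_eq_zero h1
    set g := rho (hrefl u) g' + (kap P c)⁻¹ • Ltr n P c u with hg
    have hLg : Lm n P c g = u := by
      rw [hg, map_add, hL, map_smul, Lm_Ltr, smul_smul, inv_mul_cancel₀ hk, one_smul, zero_add]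
    have hpg : prj n P c g = rho (hrefl u) g' := by
      rw [prj_apply, hLg, hg, add_sub_cancel_right]
    have hkr : krMap n P c g = g' := by
      unfold krMap
      rw [hpg, hLg, ← rho_mul, hrefl_mul_self, rho_one]
    refine ⟨⟨g, ?_, hkr⟩, ?_⟩
    · show T (prj n P c g)
      rw [← hQ u, hpg, ← rho_mul, hrefl_mul_self, rho_one]
      exact h3
    · exact Subtype.ext (by simp only [hLg])

/-- Energy at the pole. -/
def hamP (n P : ℕ) (c : ℕ → ℝ) (h : GIdx (n + 1) P → ℝ) : ℝ :=
  ∑ J, h J * feat (n + 1) P c (pole n) J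

theorem sum_prj_mul (g y : GIdx (n + 1) P → ℝ) (hy : Lm n P c y = 0) :
    ∑ J, prj n P c g J * y J = ∑ J, g J * y J := by
  have : ∑ J, Ltr n P c (Lm n P c g) J * y J = 0 := by rw [sum_Ltr_mul, hy]; simp
  rw [prj_apply]
  simp only [Pi.sub_apply, Pi.smul_apply, smul_eq_mul, sub_mul, Finset.sum_sub_distrib, mul_assoc,
    ← Finset.mul_sum]
  rw [this]; ring

theorem hessP_prj (g : GIdx (n + 1) P → ℝ) : hessP n P c (prj n P c g) = hessP n P c g := by
  ext i j
  refine sum_prj_mul g _ ?_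
  ext l
  rw [Lm_apply]
  simp_rw [lvec, mul_comm (feat2 _ _ _ _ _ _ _)]
  exact sum_feat1_mul_feat2 _ _ _ _ _ (dotp_pole_tb _) (dotp_pole_tb _)

theorem radP_prj (g : GIdx (n + 1) P → ℝ) : radP n P c (prj n P c g) = radP n P c g := by
  unfold radP
  rw [sum_prj_mul]
  ext l
  rw [Lm_apply]
  simp_rw [lvec]
  rw [sum_feat1_mul_feat1, dotp_pole_tb]; simp

theorem hamP_prj (g : GIdx (n + 1) P → ℝ) : hamP n P c (prj n P c g) = hamP n P c g := by
  unfold hamP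
  rw [sum_prj_mul]
  ext l
  rw [Lm_apply]
  simp_rw [lvec]
  rw [sum_feat_mul_feat1, dotp_pole_tb]; simp

end KacRice

/-- The Gaussian orthogonal ensemble, off-diagonal variance one. -/
def goe (n : ℕ) (x : Fin n × Fin n → ℝ) : Matrix (Fin n) (Fin n) ℝ :=
  fun i j => (x (i, j) + x (j, i)) / Real.sqrt 2

/-- The normalizing constant in the Kac–Rice formula. -/
def aN (n : ℕ) : ℝ≥0∞ :=
  ∫⁻ u : Fin n → ℝ, ENNReal.ofReal ((Real.sqrt (2 * Real.pi))⁻¹ ^ n * (2 / rq u) ^ n)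

section KacRice
variable {n P : ℕ} {c : ℕ → ℝ}

theorem measurable_hessP : Measurable fun h : GIdx (n + 1) P → ℝ => (fun i j => hessP n P c h i j) := by
  refine measurable_pi_lambda _ fun i => measurable_pi_lambda _ fun j => ?_
  unfold hessP; fun_prop

theorem measurable_radP : Measurable (radP n P c) := by unfold radP; fun_prop

theorem measurable_hamP : Measurable (hamP n P c) := by unfold hamP; fun_prop

theorem measurable_det {ι α : Type*} [Fintype ι] [DecidableEq ι] [MeasurableSpace α]
    {f : α → Matrix ι ι ℝ} (hf : ∀ i j, Measurable fun a => f a i j) :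
    Measurable fun a => (f a).det := by
  simp_rw [Matrix.det_apply]
  refine Finset.measurable_sum _ fun σ _ => ?_
  refine Measurable.const_smul ?_ _
  exact Finset.measurable_prod _ fun i _ => hf _ _

theorem continuous_rq : Continuous (rq (n := n)) := by unfold rq; fun_prop

/-- Matrix of the projection. -/
def prjM (n P : ℕ) (c : ℕ → ℝ) (J a : GIdx (n + 1) P) : ℝ :=
  (if a = J then 1 else 0) - (kap P c)⁻¹ * ∑ i, lvec n P c i J * lvec n P c i a

theorem prj_eq_sum (g : GIdx (n + 1) P → ℝ) (J : GIdx (n + 1) P) :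
    prj n P c g J = ∑ a, g a * prjM n P c J a := by
  rw [prj_apply]
  simp only [Pi.sub_apply, Pi.smul_apply, smul_eq_mul, prjM, mul_sub, Finset.sum_sub_distrib,
    Ltr_apply, Lm_apply]
  congr 1
  · simp
  · simp only [Finset.mul_sum, Finset.sum_mul]
    rw [Finset.sum_comm]
    exact Finset.sum_congr rfl fun i _ => Finset.sum_congr rfl fun J _ => by ring

theorem prj_lvec (hk : kap P c ≠ 0) (i : Fin n) : prj n P c (lvec n P c i) = 0 := by
  have h1 : lvec n P c i = Ltr n P c (Pi.single i 1) := by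
    ext J; rw [Ltr_apply]; simp [Pi.single_apply]
  rw [prj_apply, h1, Lm_Ltr, map_smul, smul_smul, inv_mul_cancel₀ hk, one_smul, sub_self]

theorem lintegral_prj_Lm (hk : 0 < kap P c) {F : (GIdx (n + 1) P → ℝ) → ℝ≥0∞} (hF : Measurable F)
    {K : (Fin n → ℝ) → ℝ≥0∞} (hK : Measurable K) :
    ∫⁻ g, F (prj n P c g) * K (Lm n P c g) ∂(stdG (GIdx (n + 1) P)) =
      (∫⁻ g, F (prj n P c g) ∂(stdG (GIdx (n + 1) P))) *
        ∫⁻ y, K (Real.sqrt (kap P c) • y) ∂(stdG (Fin n)) := by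
  classical
  let m : GIdx (n + 1) P ⊕ Fin n → GIdx (n + 1) P → ℝ := Sum.elim (prjM n P c) (lvec n P c)
  let m' : GIdx (n + 1) P ⊕ Fin n → GIdx (n + 1) P ⊕ Fin n → ℝ :=
    Sum.elim (fun J => Sum.elim (prjM n P c J) 0)
      fun i => Sum.elim 0 (Pi.single i (Real.sqrt (kap P c)))
  have hcross : ∀ J i, ∑ a, prjM n P c J a * lvec n P c i a = 0 := by
    intro J i
    have := congrFun (prj_lvec hk.ne' i) J
    rw [prj_eq_sum, Pi.zero_apply] at this
    rw [← this]; exact Finset.sum_congr rfl fun a _ => by ring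
  have hG : ∀ i j, ∑ a, m i a * m j a = ∑ a, m' i a * m' j a := by
    rintro (J | i) (J' | j)
    · simp [m, m']
    · simp [m, m', hcross]
    · simp only [m, m', Sum.elim_inr, Sum.elim_inl, Fintype.sum_sum_type]
      simp_rw [mul_comm (lvec _ _ _ _ _)]
      simp [hcross]
    · simp only [m, m', Sum.elim_inr, sum_lvec_mul_lvec, Fintype.sum_sum_type, Sum.elim_inl]
      by_cases h : i = j
      · subst h; simp [Pi.single_apply, Real.mul_self_sqrt hk.le]
      · simp [Pi.single_apply, h, Ne.symm h]
  have hf : Measurable fun z : GIdx (n + 1) P ⊕ Fin n → ℝ =>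
      F (fun J => z (Sum.inl J)) * K (fun i => z (Sum.inr i)) := by
    refine (hF.comp ?_).mul (hK.comp ?_) <;> fun_prop
  have h1 := lintegral_dotMap_eq m m' hG hf
  have e1 : ∀ x, (fun J => dotMap m x (Sum.inl J)) = prj n P c x := by
    intro x; ext J; rw [dotMap_apply, prj_eq_sum]; rfl
  have e2 : ∀ x, (fun i => dotMap m x (Sum.inr i)) = Lm n P c x := by
    intro x; ext i; rw [dotMap_apply, Lm_apply]; rfl
  have e3 : ∀ x y, (fun J => dotMap m' (Sum.elim x y) (Sum.inl J)) = prj n P c x := by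
    intro x y; ext J; rw [dotMap_apply, prj_eq_sum]; simp [m']
  have e4 : ∀ x y, (fun i => dotMap m' (Sum.elim x y) (Sum.inr i)) = Real.sqrt (kap P c) • y := by
    intro x y; ext i; rw [dotMap_apply]; simp [m', mul_comm, Pi.single_apply]
  simp only [e1, e2] at h1
  have hf2 : Measurable fun x => F (fun J => dotMap m' x (Sum.inl J)) *
      K (fun i => dotMap m' x (Sum.inr i)) := hf.comp (dotMap m').continuous.measurable
  rw [h1, lintegral_stdG_sum hf2]
  simp only [e3, e4]
  have hF2 : Measurable fun g => F (prj n P c g) := hF.comp (prj n P c).continuous.measurable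
  rw [← lintegral_mul_const _ hF2]
  refine lintegral_congr fun x => ?_
  rw [lintegral_const_mul]
  exact hK.comp (by fun_prop)

theorem lintegral_weight (hk : 0 < kap P c) :
    ∫⁻ y, ENNReal.ofReal ((2 * Real.sqrt ((n : ℝ) + 1) / rq (Real.sqrt (kap P c) • y)) ^ n *
      Real.exp ((∑ i, (Real.sqrt (kap P c) • y) i ^ 2) / (2 * kap P c))) ∂(stdG (Fin n)) =
    ENNReal.ofReal (Real.sqrt (((n : ℝ) + 1) / kap P c) ^ n) * aN n := by
  have hsk : 0 < Real.sqrt (kap P c) := Real.sqrt_pos.2 hk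
  rw [lintegral_stdG]
  have h1 : ∀ y : Fin n → ℝ, ENNReal.ofReal (stdGPDF (Fin n) y) *
      ENNReal.ofReal ((2 * Real.sqrt ((n : ℝ) + 1) / rq (Real.sqrt (kap P c) • y)) ^ n *
      Real.exp ((∑ i, (Real.sqrt (kap P c) • y) i ^ 2) / (2 * kap P c))) =
      (fun u => ENNReal.ofReal (Real.sqrt ((n : ℝ) + 1) ^ n) *
        ENNReal.ofReal ((Real.sqrt (2 * Real.pi))⁻¹ ^ n * (2 / rq u) ^ n)) (Real.sqrt (kap P c) • y) := by
    intro y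
    have hq := rq_pos (Real.sqrt (kap P c) • y)
    simp only
    rw [← ENNReal.ofReal_mul (stdGPDF_pos y).le, ← ENNReal.ofReal_mul (by positivity)]
    congr 1
    have h2 : (∑ i, (Real.sqrt (kap P c) • y) i ^ 2) / (2 * kap P c) = (∑ i, y i ^ 2) / 2 := by
      simp_rw [Pi.smul_apply, smul_eq_mul, mul_pow, Real.sq_sqrt hk.le]
      rw [← Finset.mul_sum]; field_simp
    rw [h2, stdGPDF, Fintype.card_fin]
    have h3 : Real.exp (-(∑ i, y i ^ 2) / 2) * Real.exp ((∑ i, y i ^ 2) / 2) = 1 := by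
      rw [← Real.exp_add, show -(∑ i, y i ^ 2) / 2 + (∑ i, y i ^ 2) / 2 = 0 by ring, Real.exp_zero]
    rw [show 2 * Real.sqrt ((n : ℝ) + 1) / rq (Real.sqrt (kap P c) • y) =
      Real.sqrt ((n : ℝ) + 1) * (2 / rq (Real.sqrt (kap P c) • y)) by ring, mul_pow]
    linear_combination ((Real.sqrt (2 * Real.pi))⁻¹ ^ n * Real.sqrt ((n : ℝ) + 1) ^ n *
      (2 / rq (Real.sqrt (kap P c) • y)) ^ n) * h3
  have hm : Measurable fun u : Fin n → ℝ => ENNReal.ofReal ((Real.sqrt (2 * Real.pi))⁻¹ ^ n * (2 / rq u) ^ n) := by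
    refine Measurable.ennreal_ofReal ?_
    have := continuous_rq (n := n)
    refine Measurable.const_mul ?_ _
    exact ((measurable_const.div this.measurable).pow_const _)
  have hm2 := hm.const_mul (ENNReal.ofReal (Real.sqrt ((n : ℝ) + 1) ^ n))
  rw [lintegral_congr h1, ← lintegral_map hm2 (measurable_const_smul (Real.sqrt (kap P c))),
    Measure.map_addHaar_smul _ hsk.ne', lintegral_smul_measure, lintegral_const_mul _ hm, smul_eq_mul]
  rw [Module.finrank_fin_fun, ← mul_assoc, aN]
  congr 1
  rw [← ENNReal.ofReal_mul (by positivity)]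
  congr 1
  rw [abs_of_pos (by positivity), Real.sqrt_div (by positivity), div_pow]
  field_simp

end KacRice

section KacRice
variable {n P : ℕ} {c : ℕ → ℝ}

/-- Variance of the normalized radial derivative. -/
def vv (P : ℕ) (c : ℕ → ℝ) : ℝ := (kap P c + nuu P c) / nuu P c

/-- Regression coefficient of the energy on the radial derivative. -/
def bb (P : ℕ) (c : ℕ → ℝ) : ℝ := kap P c * Real.sqrt (nuu P c) / (kap P c + nuu P c)

/-- Residual standard deviation of the energy. -/
def tau (P : ℕ) (c : ℕ → ℝ) : ℝ := Real.sqrt (xi1 P c - kap P c ^ 2 / (kap P c + nuu P c))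

theorem stdGPDF_krMap (hk : 0 < kap P c) (g : GIdx (n + 1) P → ℝ) :
    stdGPDF _ (krMap n P c g) = stdGPDF _ g *
      Real.exp ((∑ i, Lm n P c g i ^ 2) / (2 * kap P c)) := by
  unfold stdGPDF krMap
  rw [sum_rho_sq _ (by rw [hrefl_transpose, hrefl_mul_self]), sum_prj_sq hk.ne', mul_assoc,
    ← Real.exp_add]
  congr 2
  field_simp
  ring

theorem ae_not_isCrit_pole (hn : 0 < n) (hk : 0 < kap P c) :
    ∀ᵐ g ∂(stdG (GIdx (n + 1) P)), ¬ IsCrit (n + 1) P c g (pole n) := by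
  refine (stdG_absolutelyContinuous _).ae_le ?_
  let i : Fin n := ⟨0, hn⟩
  let L : (GIdx (n + 1) P → ℝ) →ₗ[ℝ] ℝ := LinearMap.proj i ∘ₗ (Lm n P c).toLinearMap
  have hL : LinearMap.ker L ≠ ⊤ := by
    rw [Ne, LinearMap.ker_eq_top]
    intro h
    have := LinearMap.congr_fun h (lvec n P c i)
    simp only [L, LinearMap.comp_apply, LinearMap.proj_apply, LinearMap.zero_apply,
      ContinuousLinearMap.coe_coe] at this
    rw [Lm_apply, sum_lvec_mul_lvec, if_pos rfl] at this
    exact hk.ne' this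
  have h0 := Measure.addHaar_submodule (volume : Measure (GIdx (n + 1) P → ℝ)) _ hL
  rw [mem_ae_iff]
  refine measure_mono_null (fun g hg => ?_) h0
  have hg : IsCrit (n + 1) P c g (pole n) := not_not.1 hg
  show L g = 0
  simp only [L, LinearMap.comp_apply, LinearMap.proj_apply, ContinuousLinearMap.coe_coe]
  rw [Lm_apply]
  exact hg.2 _ (dotp_pole_tb i)

theorem kacRice_aux (hk : 0 < kap P c) {T : (GIdx (n + 1) P → ℝ) → Prop}
    (hT : MeasurableSet {h | T h}) (hTp : ∀ g, T (prj n P c g) ↔ T g)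
    {Q : (GIdx (n + 1) P → ℝ) → (Fin (n + 1) → ℝ) → Prop}
    (hQ : ∀ u h, Q (rho (hrefl u) h) ((hrefl u).mulVec (pole n)) ↔ T h) (hn : 0 < n) :
    AEMeasurable (fun g => ecount {σ | IsCrit (n + 1) P c g σ ∧ Q g σ}) (stdG (GIdx (n + 1) P)) ∧
    ∫⁻ g, ecount {σ | IsCrit (n + 1) P c g σ ∧ Q g σ} ∂(stdG (GIdx (n + 1) P)) =
      ENNReal.ofReal (Real.sqrt (((n : ℝ) + 1) / kap P c) ^ n) * aN n *
      ∫⁻ g, {h | T h}.indicator (fun g => ENNReal.ofReal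
        |(hessP n P c g - radP n P c g • 1).det|) g ∂(stdG (GIdx (n + 1) P)) := by
  have hae : (fun g => ecount {σ | IsCrit (n + 1) P c g σ ∧ Q g σ}) =ᵐ[stdG (GIdx (n + 1) P)]
      fun g' => ecount ({g | T (prj n P c g)} ∩ krMap n P c ⁻¹' {g'}) := by
    filter_upwards [ae_not_isCrit_pole hn hk] with g hg
    rw [ecount_krMap_fiber hk.ne' hQ]
    congr 1
    ext σ
    refine and_congr_right fun h => ⟨fun h' => ⟨fun e => hg (e ▸ h), h'⟩, fun h' => h'.2⟩
  have hd : ∀ g, HasFDerivAt (krMap n P c) (fderiv ℝ (krMap n P c) g) g := fun g =>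
    ((contDiff_krMap (n := n) (P := P) (c := c)).differentiable (by simp) g).hasFDerivAt
  have hdet : Measurable fun g => (fderiv ℝ (krMap n P c) g).det :=
    (ContinuousLinearMap.continuous_det.comp
      ((contDiff_krMap (n := n) (P := P) (c := c)).continuous_fderiv (by simp))).measurable
  have hs : MeasurableSet {g | T (prj n P c g)} := hT.preimage (prj n P c).continuous.measurable
  obtain ⟨h1, h2⟩ := area_formula (volume : Measure (GIdx (n + 1) P → ℝ)) hd hdet hs
  refine ⟨(h1.mono_ac (stdG_absolutelyContinuous _)).congr hae.symm, ?_⟩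
  have hmD : Measurable fun g => |(hessP n P c g - radP n P c g • 1).det| := by
    refine (measurable_det fun i j => ?_).abs
    simp only [Matrix.sub_apply, Matrix.smul_apply]
    have e1 : Measurable fun g => hessP n P c g i j :=
      (measurable_pi_apply j).comp ((measurable_pi_apply i).comp (measurable_hessP (c := c)))
    have e2 := measurable_radP (n := n) (P := P) (c := c)
    exact e1.sub (e2.smul_const _)
  set F : (GIdx (n + 1) P → ℝ) → ℝ≥0∞ := {h | T h}.indicator (fun g => ENNReal.ofReal
        |(hessP n P c g - radP n P c g • 1).det|) with hF
  have hFm : Measurable F := hmD.ennreal_ofReal.indicator hT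
  have hFp : ∀ g, F (prj n P c g) = F g := by
    intro g
    by_cases h : T g
    · rw [hF, Set.indicator_of_mem (by exact (hTp g).2 h), Set.indicator_of_mem (by exact h),
        hessP_prj, radP_prj]
    · rw [hF, Set.indicator_of_notMem (by exact fun h' => h ((hTp g).1 h')),
        Set.indicator_of_notMem (by exact h)]
  set K : (Fin n → ℝ) → ℝ≥0∞ := fun u => ENNReal.ofReal ((2 * Real.sqrt ((n : ℝ) + 1) / rq u) ^ n *
      Real.exp ((∑ i, u i ^ 2) / (2 * kap P c))) with hK
  have hKm : Measurable K := by
    have := (continuous_rq (n := n)).measurable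
    refine Measurable.ennreal_ofReal (Measurable.mul ?_ (by fun_prop))
    exact (measurable_const.div this).pow_const _
  rw [lintegral_congr_ae hae, lintegral_stdG]
  simp_rw [mul_comm (ENNReal.ofReal (stdGPDF _ _))]
  rw [h2 _ continuous_stdGPDF.measurable.ennreal_ofReal]
  have h3 : ∫⁻ g in {g | T (prj n P c g)}, ENNReal.ofReal |(fderiv ℝ (krMap n P c) g).det| *
      ENNReal.ofReal (stdGPDF _ (krMap n P c g)) =
      ∫⁻ g, F (prj n P c g) * K (Lm n P c g) ∂(stdG (GIdx (n + 1) P)) := by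
    rw [← lintegral_indicator hs, lintegral_stdG]
    refine lintegral_congr fun g => ?_
    by_cases h : T (prj n P c g)
    · rw [Set.indicator_of_mem (by exact h), hF, Set.indicator_of_mem (by exact h), hK,
        abs_det_krMap hk.ne', stdGPDF_krMap hk]
      have hq := rq_pos (Lm n P c g)
      have hp := (stdGPDF_pos g).le
      simp only
      rw [← ENNReal.ofReal_mul (by positivity), ← ENNReal.ofReal_mul (by positivity),
        ← ENNReal.ofReal_mul hp]
      congr 1; ring
    · rw [Set.indicator_of_notMem (by exact h), hF, Set.indicator_of_notMem (by exact h)]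
      simp
  rw [h3, lintegral_prj_Lm hk hFm hKm, hK, lintegral_weight hk, mul_comm]
  simp_rw [hFp]

theorem lintegral_stdG_unit {f : ℝ → ℝ≥0∞} (hf : Measurable f) :
    ∫⁻ y, f (y ()) ∂(stdG Unit) = ∫⁻ z, f z ∂(gaussianReal 0 1) := by
  have h := measurePreserving_funUnique (gaussianReal 0 1) Unit
  rw [← h.lintegral_comp hf]
  rfl

theorem bb_vv (hn : 0 < nuu P c) (hk : 0 < kap P c) :
    bb P c ^ 2 * vv P c = kap P c ^ 2 / (kap P c + nuu P c) := by
  unfold bb vv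
  rw [div_pow, mul_pow, Real.sq_sqrt hn.le]
  field_simp

theorem tau_sq (hn : 0 < nuu P c) (hk : 0 < kap P c) :
    tau P c ^ 2 = xi1 P c - kap P c ^ 2 / (kap P c + nuu P c) := by
  unfold tau
  rw [Real.sq_sqrt]
  rw [sub_nonneg, div_le_iff₀ (by positivity)]
  have h := Finset.sum_mul_sq_le_sq_mul_sq (Finset.Icc 2 P) c (fun k => (k : ℝ) * c k)
  have e1 : ∑ k ∈ Finset.Icc 2 P, c k * ((k : ℝ) * c k) = kap P c :=
    Finset.sum_congr rfl fun k _ => by ring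
  have e2 : ∑ k ∈ Finset.Icc 2 P, ((k : ℝ) * c k) ^ 2 = kap P c + nuu P c := by
    unfold kap nuu
    rw [← Finset.sum_add_distrib]
    exact Finset.sum_congr rfl fun k _ => by ring
  rw [e1, e2] at h
  exact h

theorem lintegral_pole_law (hν : 0 < nuu P c) (hk : 0 < kap P c)
    {f : (Fin n → Fin n → ℝ) × ℝ × ℝ → ℝ≥0∞} (hf : Measurable f) :
    ∫⁻ g, f (hessP n P c g, radP n P c g, hamP n P c g) ∂(stdG (GIdx (n + 1) P)) =
      ∫⁻ x, ∫⁻ z, ∫⁻ w, f (fun i j => Real.sqrt (nuu P c / ((n : ℝ) + 1)) * goe n x i j,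
        Real.sqrt (nuu P c / ((n : ℝ) + 1)) * (Real.sqrt (vv P c) * z),
        Real.sqrt ((n : ℝ) + 1) * (bb P c * (Real.sqrt (vv P c) * z) + tau P c * w))
        ∂(gaussianReal 0 1) ∂(gaussianReal 0 1) ∂(stdG (Fin n × Fin n)) := by
  classical
  set s := Real.sqrt (nuu P c / ((n : ℝ) + 1)) with hs
  set r := Real.sqrt ((n : ℝ) + 1) with hr
  set v := Real.sqrt (vv P c) with hv
  have hN : (0 : ℝ) < (n : ℝ) + 1 := by positivity
  have hvv : 0 < vv P c := by unfold vv; positivity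
  have hs2 : s * s = nuu P c / ((n : ℝ) + 1) := Real.mul_self_sqrt (by positivity)
  have hr2 : r * r = (n : ℝ) + 1 := Real.mul_self_sqrt hN.le
  have hv2 : v * v = vv P c := Real.mul_self_sqrt hvv.le
  have hsr : s * r = Real.sqrt (nuu P c) := by
    rw [hs, hr, ← Real.sqrt_mul (by positivity), div_mul_cancel₀ _ hN.ne']
  let m : (Fin n × Fin n) ⊕ (Unit ⊕ Unit) → GIdx (n + 1) P → ℝ :=
    Sum.elim (fun p => feat2 (n + 1) P c (pole n) (tb p.2) (tb p.1))
      (Sum.elim (fun _ J => feat1 (n + 1) P c (pole n) (pole n) J / ((n + 1 : ℕ) : ℝ))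
        fun _ => feat (n + 1) P c (pole n))
  let m' : (Fin n × Fin n) ⊕ (Unit ⊕ Unit) → (Fin n × Fin n) ⊕ (Unit ⊕ Unit) → ℝ :=
    Sum.elim (fun p => Sum.elim (fun q => s / Real.sqrt 2 *
        ((if q = p then 1 else 0) + if q = (p.2, p.1) then 1 else 0)) (Sum.elim 0 0))
      (Sum.elim (fun _ => Sum.elim 0 (Sum.elim (fun _ => s * v) 0))
        (fun _ => Sum.elim 0 (Sum.elim (fun _ => r * (bb P c * v)) fun _ => r * tau P c)))
  have hdp : dotp (pole n) (pole n) = ((n + 1 : ℕ) : ℝ) := dotp_pole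
  have hN1 : 0 < n + 1 := Nat.succ_pos n
  have hG : ∀ i j, ∑ a, m i a * m j a = ∑ a, m' i a * m' j a := by
    have c12 : ∀ p : Fin n × Fin n, ∑ J, feat1 (n + 1) P c (pole n) (pole n) J / ((n + 1 : ℕ) : ℝ) *
        feat2 (n + 1) P c (pole n) (tb p.2) (tb p.1) J = 0 := by
      intro p
      have := sum_feat1_mul_feat2 (P := P) (c := c) (pole n) (pole n) (pole n) _ _
        (dotp_pole_tb p.2) (dotp_pole_tb p.1)
      simp_rw [div_mul_eq_mul_div, ← Finset.sum_div, this, zero_div]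
    have c02 : ∀ p : Fin n × Fin n, ∑ J, feat (n + 1) P c (pole n) J *
        feat2 (n + 1) P c (pole n) (tb p.2) (tb p.1) J = 0 := by
      intro p
      rw [sum_feat_mul_feat2, dotp_pole_tb, mul_zero, zero_mul]
    have c01 : ∑ J, feat (n + 1) P c (pole n) J *
        (feat1 (n + 1) P c (pole n) (pole n) J / ((n + 1 : ℕ) : ℝ)) = kap P c := by
      simp_rw [mul_div_assoc', ← Finset.sum_div]
      rw [sum_feat_mul_feat1, hdp, kern_one_pole _ hN1]
      field_simp
    have c11 : ∑ J, feat1 (n + 1) P c (pole n) (pole n) J / ((n + 1 : ℕ) : ℝ) *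
        (feat1 (n + 1) P c (pole n) (pole n) J / ((n + 1 : ℕ) : ℝ)) =
          (kap P c + nuu P c) / ((n : ℝ) + 1) := by
      simp_rw [div_mul_div_comm, ← Finset.sum_div]
      rw [sum_feat1_mul_feat1, hdp, kern_one_pole _ hN1, kern_two_pole _ hN1]
      push_cast
      field_simp
      ring
    have k01 : kap P c = r * (bb P c * v) * (s * v) := by
      rw [show r * (bb P c * v) * (s * v) = (s * r) * bb P c * (v * v) by ring, hsr, hv2]
      unfold bb vv
      rw [show Real.sqrt (nuu P c) * (kap P c * Real.sqrt (nuu P c) / (kap P c + nuu P c)) *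
        ((kap P c + nuu P c) / nuu P c) = (Real.sqrt (nuu P c) * Real.sqrt (nuu P c)) * kap P c *
        ((kap P c + nuu P c) / (kap P c + nuu P c)) / nuu P c by ring,
        Real.mul_self_sqrt hν.le, div_self (by positivity)]
      field_simp
    have key : ∀ p q : Fin n × Fin n, ∑ J, feat2 (n + 1) P c (pole n) (tb p.2) (tb p.1) J *
        feat2 (n + 1) P c (pole n) (tb q.2) (tb q.1) J = ∑ a : Fin n × Fin n,
        (s / Real.sqrt 2 * ((if a = p then 1 else 0) + if a = (p.2, p.1) then 1 else 0)) *
        (s / Real.sqrt 2 * ((if a = q then 1 else 0) + if a = (q.2, q.1) then 1 else 0)) := by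
      intro p q
      rw [sum_feat2_mul_feat2 _ _ _ _ _ (dotp_tb_pole _) (dotp_tb_pole _) (dotp_pole_tb _)
        (dotp_pole_tb _), hdp, kern_two_pole _ hN1]
      simp only [dotp_tb_tb]
      have : ∀ a : Fin n × Fin n,
        (s / Real.sqrt 2 * ((if a = p then 1 else 0) + if a = (p.2, p.1) then 1 else 0)) *
        (s / Real.sqrt 2 * ((if a = q then 1 else 0) + if a = (q.2, q.1) then 1 else 0)) =
        (s * s / 2) * ((if a = p then ((if a = q then 1 else 0) + if a = (q.2, q.1) then 1 else 0) else 0)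
          + if a = (p.2, p.1) then ((if a = q then 1 else 0) + if a = (q.2, q.1) then 1 else 0) else 0) := by
        intro a
        rw [show ∀ X Y : ℝ, s / Real.sqrt 2 * X * (s / Real.sqrt 2 * Y) =
          (s * s / (Real.sqrt 2 * Real.sqrt 2)) * (X * Y) by intros; ring,
          Real.mul_self_sqrt (by norm_num : (0 : ℝ) ≤ 2), add_mul, ite_mul, ite_mul]
        simp only [one_mul, zero_mul]
      simp_rw [this]
      rw [← Finset.mul_sum, Finset.sum_add_distrib, Finset.sum_ite_eq', Finset.sum_ite_eq', hs2]
      simp only [Finset.mem_univ, if_true]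
      obtain ⟨p1, p2⟩ := p
      obtain ⟨q1, q2⟩ := q
      push_cast
      simp only [Prod.mk.injEq]
      have e : ∀ i j k l : Fin n, (if i = j ∧ k = l then (1 : ℝ) else 0) =
          (if i = j then 1 else 0) * if k = l then 1 else 0 := by
        intro i j k l
        rw [ite_and]; split_ifs <;> simp
      simp only [e]
      ring
    rintro (p | p | p) (q | q | q)
    · simp only [m, m', Sum.elim_inl, Fintype.sum_sum_type, Sum.elim_inr, Pi.zero_apply, mul_zero,
        Finset.sum_const_zero, add_zero]
      exact key p q
    · simp only [m, m', Sum.elim_inl, Fintype.sum_sum_type, Sum.elim_inr, Pi.zero_apply, mul_zero,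
        zero_mul, Finset.sum_const_zero, add_zero]
      rw [← c12 p]; exact Finset.sum_congr rfl fun J _ => mul_comm _ _
    · simp only [m, m', Sum.elim_inl, Fintype.sum_sum_type, Sum.elim_inr, Pi.zero_apply, mul_zero,
        zero_mul, Finset.sum_const_zero, add_zero]
      rw [← c02 p]; exact Finset.sum_congr rfl fun J _ => mul_comm _ _
    · simp only [m, m', Sum.elim_inl, Fintype.sum_sum_type, Sum.elim_inr, Pi.zero_apply, mul_zero,
        zero_mul, Finset.sum_const_zero, add_zero]
      exact c12 q
    · simp only [m, m', Sum.elim_inl, Fintype.sum_sum_type, Sum.elim_inr, Pi.zero_apply, mul_zero,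
        Finset.sum_const_zero, add_zero, zero_add, Finset.univ_unique, Finset.sum_singleton]
      rw [c11, show s * v * (s * v) = (s * s) * (v * v) by ring, hs2, hv2]
      unfold vv; field_simp
    · simp only [m, m', Sum.elim_inl, Fintype.sum_sum_type, Sum.elim_inr, Pi.zero_apply, mul_zero,
        zero_mul, Finset.sum_const_zero, add_zero, zero_add, Finset.univ_unique, Finset.sum_singleton]
      simp_rw [mul_comm _ (feat _ _ _ _ _)]
      rw [c01, mul_comm (s * v)]; exact k01
    · simp only [m, m', Sum.elim_inl, Fintype.sum_sum_type, Sum.elim_inr, Pi.zero_apply, mul_zero,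
        zero_mul, Finset.sum_const_zero, add_zero]
      exact c02 q
    · simp only [m, m', Sum.elim_inl, Fintype.sum_sum_type, Sum.elim_inr, Pi.zero_apply, mul_zero,
        Finset.sum_const_zero, add_zero, zero_add, Finset.univ_unique, Finset.sum_singleton]
      rw [c01]; exact k01
    · simp only [m, m', Sum.elim_inl, Fintype.sum_sum_type, Sum.elim_inr, Pi.zero_apply, mul_zero,
        Finset.sum_const_zero, zero_add, Finset.univ_unique, Finset.sum_singleton]
      rw [sum_feat_mul_feat, hdp, kern_zero_pole _ hN1,
        show r * (bb P c * v) * (r * (bb P c * v)) + r * tau P c * (r * tau P c) =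
          (r * r) * (bb P c ^ 2 * (v * v) + tau P c ^ 2) by ring, hr2, hv2, bb_vv hν hk, tau_sq hν hk]
      push_cast; ring
  let f0 : ((Fin n × Fin n) ⊕ (Unit ⊕ Unit) → ℝ) → ℝ≥0∞ := fun y =>
    f (fun i j => y (Sum.inl (i, j)), y (Sum.inr (Sum.inl ())), y (Sum.inr (Sum.inr ())))
  have hf0 : Measurable f0 := hf.comp (by fun_prop)
  have h1 := lintegral_dotMap_eq m m' hG hf0
  have e1 : ∀ g, f0 (dotMap m g) = f (hessP n P c g, radP n P c g, hamP n P c g) := by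
    intro g
    simp only [f0, dotMap_apply, m, Sum.elim_inl, Sum.elim_inr, radP, mul_div_assoc', ← Finset.sum_div]
    rfl
  have e2 : ∀ x y, f0 (dotMap m' (Sum.elim x y)) = f (fun i j => s * goe n x i j,
        s * (v * y (Sum.inl ())), r * (bb P c * (v * y (Sum.inl ())) + tau P c * y (Sum.inr ()))) := by
    intro x y
    simp only [f0, dotMap_apply, m', Sum.elim_inl, Sum.elim_inr, Fintype.sum_sum_type, Pi.zero_apply,
      mul_zero, Finset.sum_const_zero, add_zero, zero_add, Finset.univ_unique, Finset.sum_singleton]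
    congr 3
    · ext i j
      simp only [mul_add, mul_ite, mul_one, mul_zero, Finset.sum_add_distrib, Finset.sum_ite_eq',
        Finset.mem_univ, if_true, goe]
      ring
    · show y (Sum.inl ()) * (s * v) = _
      ring
    · show y (Sum.inl ()) * (r * (bb P c * v)) + y (Sum.inr ()) * (r * tau P c) = _
      ring
  simp_rw [e1] at h1
  have hf1 : Measurable fun x => f0 (dotMap m' x) := hf0.comp (dotMap m').continuous.measurable
  rw [h1, lintegral_stdG_sum hf1]
  refine lintegral_congr fun x => ?_
  simp_rw [e2]
  have hf2 : Measurable fun q : ℝ × ℝ => f (fun i j => s * goe n x i j,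
        s * (v * q.1), r * (bb P c * (v * q.1) + tau P c * q.2)) := hf.comp (by fun_prop)
  have hf3 : Measurable fun y : Unit ⊕ Unit → ℝ => f (fun i j => s * goe n x i j,
        s * (v * y (Sum.inl ())), r * (bb P c * (v * y (Sum.inl ())) + tau P c * y (Sum.inr ()))) :=
    hf.comp (by fun_prop)
  rw [lintegral_stdG_sum hf3]
  simp only [Sum.elim_inl, Sum.elim_inr]
  have h4 : ∀ z : Unit → ℝ, ∫⁻ w : Unit → ℝ, f (fun i j => s * goe n x i j,
        s * (v * z ()), r * (bb P c * (v * z ()) + tau P c * w ())) ∂(stdG Unit) =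
      ∫⁻ w, f (fun i j => s * goe n x i j,
        s * (v * z ()), r * (bb P c * (v * z ()) + tau P c * w)) ∂(gaussianReal 0 1) := fun z =>
    lintegral_stdG_unit (f := fun w => f (fun i j => s * goe n x i j,
        s * (v * z ()), r * (bb P c * (v * z ()) + tau P c * w))) (hf.comp (by fun_prop))
  simp_rw [h4]
  exact lintegral_stdG_unit (f := fun z => ∫⁻ w, f (fun i j => s * goe n x i j,
        s * (v * z), r * (bb P c * (v * z) + tau P c * w)) ∂(gaussianReal 0 1))
    (hf2.lintegral_prod_right (f := fun z w => f (fun i j => s * goe n x i j,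
        s * (v * z), r * (bb P c * (v * z) + tau P c * w))))

end KacRice

section spectral
variable {n : ℕ}

/-- Symmetric part of a matrix. -/
def sy (A : Matrix (Fin n) (Fin n) ℝ) : Matrix (Fin n) (Fin n) ℝ := (1 / 2 : ℝ) • (A + A.transpose)

theorem sy_isHermitian (A : Matrix (Fin n) (Fin n) ℝ) : (sy A).IsHermitian := by
  ext i j; simp [sy]; ring

theorem sy_eq_self {A : Matrix (Fin n) (Fin n) ℝ} (h : A.IsSymm) : sy A = A := by
  ext i j
  have : A j i = A i j := h.apply i j
  simp only [sy, Matrix.smul_apply, Matrix.add_apply, Matrix.transpose_apply, this, smul_eq_mul]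
  ring

/-- Eigenvalues of the symmetric part, in decreasing order. -/
def evs (A : Matrix (Fin n) (Fin n) ℝ) (i : Fin n) : ℝ :=
  (sy_isHermitian A).eigenvalues₀ (Fin.cast (Fintype.card_fin n).symm i)

theorem evs_antitone (A : Matrix (Fin n) (Fin n) ℝ) : Antitone (evs A) := fun i j h =>
  (sy_isHermitian A).eigenvalues₀_antitone (show Fin.cast _ i ≤ Fin.cast _ j from h)

/-- The reindexing between sorted and unsorted eigenvalues. -/
def evEquiv (n : ℕ) : Fin n ≃ Fin n :=
  (finCongr (Fintype.card_fin n).symm).trans (Fintype.equivOfCardEq (Fintype.card_fin _))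

theorem evs_eq (A : Matrix (Fin n) (Fin n) ℝ) (i : Fin n) :
    evs A i = (sy_isHermitian A).eigenvalues (evEquiv n i) := by
  unfold evs Matrix.IsHermitian.eigenvalues evEquiv
  simp

/-- Orthogonal matrix whose rows are eigenvectors. -/
def evm (A : Matrix (Fin n) (Fin n) ℝ) : Matrix (Fin n) (Fin n) ℝ := fun i j =>
  (sy_isHermitian A).eigenvectorBasis (evEquiv n i) j

theorem evm_mul_transpose (A : Matrix (Fin n) (Fin n) ℝ) : evm A * (evm A).transpose = 1 := by
  ext i j
  have h := orthonormal_iff_ite.1 (sy_isHermitian A).eigenvectorBasis.orthonormal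
    (evEquiv n i) (evEquiv n j)
  rw [PiLp.inner_apply] at h
  simp only [RCLike.inner_apply, conj_trivial, EmbeddingLike.apply_eq_iff_eq] at h
  rw [Matrix.mul_apply, Matrix.one_apply, ← h]
  exact Finset.sum_congr rfl fun k _ => mul_comm _ _

theorem transpose_mul_evm (A : Matrix (Fin n) (Fin n) ℝ) : (evm A).transpose * evm A = 1 :=
  mul_eq_one_comm.1 (evm_mul_transpose A)

theorem evm_mul_sy (A : Matrix (Fin n) (Fin n) ℝ) :
    evm A * sy A = Matrix.diagonal (evs A) * evm A := by
  ext i j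
  have h := congrFun ((sy_isHermitian A).mulVec_eigenvectorBasis (evEquiv n i)) j
  rw [← evs_eq] at h
  rw [Matrix.diagonal_mul, Matrix.mul_apply]
  refine Eq.trans ?_ h
  rw [Matrix.mulVec, dotProduct]
  refine Finset.sum_congr rfl fun k _ => ?_
  have : sy A k j = sy A j k := by simpa using (sy_isHermitian A).apply j k
  rw [mul_comm, this]; rfl

theorem sy_eq_diag (A : Matrix (Fin n) (Fin n) ℝ) :
    sy A = (evm A).transpose * Matrix.diagonal (evs A) * evm A := by
  rw [Matrix.mul_assoc, ← evm_mul_sy, ← Matrix.mul_assoc, transpose_mul_evm, Matrix.one_mul]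

theorem sy_sub_smul_eq (A : Matrix (Fin n) (Fin n) ℝ) (t : ℝ) :
    sy A - t • 1 = (evm A).transpose * Matrix.diagonal (fun i => evs A i - t) * evm A := by
  have : Matrix.diagonal (fun i => evs A i - t) = Matrix.diagonal (evs A) - t • 1 := by
    ext i j; by_cases h : i = j <;> simp [h]
  rw [this, Matrix.mul_sub, Matrix.sub_mul, ← sy_eq_diag]
  simp [transpose_mul_evm]

theorem det_sub_smul {A : Matrix (Fin n) (Fin n) ℝ} (h : A.IsSymm) (t : ℝ) :
    (A - t • 1).det = ∏ i, (evs A i - t) := by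
  have h1 := sy_sub_smul_eq A t
  rw [sy_eq_self h] at h1
  have h2 : (evm A).transpose.det * (evm A).det = 1 := by
    rw [← Matrix.det_mul, transpose_mul_evm, Matrix.det_one]
  rw [h1, Matrix.det_mul, Matrix.det_mul, Matrix.det_diagonal]
  linear_combination (∏ i, (evs A i - t)) * h2

theorem trace_pow_eq {A : Matrix (Fin n) (Fin n) ℝ} (h : A.IsSymm) (k : ℕ) :
    (A ^ k).trace = ∑ i, evs A i ^ k := by
  have h1 := sy_eq_diag A
  rw [sy_eq_self h] at h1
  have h2 : A ^ k = (evm A).transpose * Matrix.diagonal (evs A) ^ k * evm A := by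
    induction k with
    | zero => simp [transpose_mul_evm]
    | succ k ih =>
      rw [pow_succ, ih]; nth_rewrite 4 [h1]
      rw [show (evm A).transpose * Matrix.diagonal (evs A) ^ k * evm A *
        ((evm A).transpose * Matrix.diagonal (evs A) * evm A) =
        (evm A).transpose * Matrix.diagonal (evs A) ^ k * (evm A * (evm A).transpose) *
          Matrix.diagonal (evs A) * evm A by simp only [Matrix.mul_assoc], evm_mul_transpose,
        pow_succ, Matrix.mul_one]
      simp only [Matrix.mul_assoc]
  rw [h2, Matrix.trace_mul_comm, ← Matrix.mul_assoc, evm_mul_transpose, Matrix.one_mul,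
    Matrix.diagonal_pow, Matrix.trace_diagonal]
  rfl

/-- Quadratic form in eigen-coordinates. -/
theorem quad_eq (A : Matrix (Fin n) (Fin n) ℝ) (t : ℝ) (v : Fin n → ℝ) :
    dotp v ((A - t • (1 : Matrix (Fin n) (Fin n) ℝ)).mulVec v) =
      ∑ i, (evs A i - t) * ((evm A).mulVec v i) ^ 2 := by
  have h1 : dotp v ((A - t • (1 : Matrix (Fin n) (Fin n) ℝ)).mulVec v) =
      dotp v ((sy A - t • (1 : Matrix (Fin n) (Fin n) ℝ)).mulVec v) := by
    simp only [dotp_eq, Matrix.sub_mulVec, dotProduct_sub]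
    congr 1
    rw [sy, Matrix.smul_mulVec, Matrix.add_mulVec, dotProduct_smul, dotProduct_add,
      Matrix.mulVec_transpose, dotProduct_comm v (Matrix.vecMul v A), ← Matrix.dotProduct_mulVec,
      smul_eq_mul]
    ring
  rw [h1, sy_sub_smul_eq, dotp_eq, Matrix.mul_assoc, ← Matrix.mulVec_mulVec,
    Matrix.dotProduct_mulVec, Matrix.vecMul_transpose, ← Matrix.mulVec_mulVec, dotProduct]
  refine Finset.sum_congr rfl fun i _ => ?_
  rw [Matrix.mulVec_diagonal]; ring

/-- Number of eigenvalues below a level. -/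
def nlt (A : Matrix (Fin n) (Fin n) ℝ) (t : ℝ) : ℕ := (Finset.univ.filter fun i => evs A i < t).card

/-- Number of eigenvalues at or above a level. -/
def nge (A : Matrix (Fin n) (Fin n) ℝ) (t : ℝ) : ℕ := (Finset.univ.filter fun i => t ≤ evs A i).card

theorem nge_add_nlt (A : Matrix (Fin n) (Fin n) ℝ) (t : ℝ) : nge A t + nlt A t = n := by
  have := Finset.card_filter_add_card_filter_not (s := (Finset.univ : Finset (Fin n))) (fun i => t ≤ evs A i)
  simp only [not_le, Finset.card_univ, Fintype.card_fin] at this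
  exact this

/-- Maximal dimension of a negative definite subspace. -/
def negIdx (B : Matrix (Fin n) (Fin n) ℝ) : ℕ :=
  sSup {d : ℕ | ∃ W : Submodule ℝ (Fin n → ℝ), Module.finrank ℝ W = d ∧
    ∀ v ∈ W, v ≠ 0 → dotp v (B.mulVec v) < 0}

theorem negIdx_sub_smul (A : Matrix (Fin n) (Fin n) ℝ) (t : ℝ) :
    negIdx (A - t • (1 : Matrix (Fin n) (Fin n) ℝ)) = nlt A t := by
  set ι := {i : Fin n // evs A i < t}
  have hcard : Fintype.card ι = nlt A t := Fintype.card_subtype _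
  refine IsGreatest.csSup_eq ⟨?_, ?_⟩
  · let f : (ι → ℝ) →ₗ[ℝ] (Fin n → ℝ) := (evm A).transpose.mulVecLin ∘ₗ
      Function.ExtendByZero.linearMap ℝ (Subtype.val : ι → Fin n)
    have hE : ∀ y, (evm A).mulVec (f y) = Function.extend Subtype.val y 0 := by
      intro y
      simp only [f, LinearMap.comp_apply, Matrix.mulVecLin_apply, Matrix.mulVec_mulVec,
        evm_mul_transpose, Matrix.one_mulVec]
      rfl
    have hinj : Function.Injective f := by
      rw [injective_iff_map_eq_zero]
      intro y hy
      have := hE y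
      rw [hy, Matrix.mulVec_zero] at this
      ext i
      have h2 := congrFun this i.1
      rw [Subtype.val_injective.extend_apply] at h2
      exact h2.symm
    refine ⟨LinearMap.range f, ?_, ?_⟩
    · rw [LinearMap.finrank_range_of_inj hinj, Module.finrank_fintype_fun_eq_card, hcard]
    · rintro _ ⟨y, rfl⟩ hy
      rw [quad_eq, hE]
      have hle : ∀ i, (evs A i - t) * (Function.extend Subtype.val y 0 i : ℝ) ^ 2 ≤ 0 := by
        intro i
        by_cases hi : evs A i < t
        · exact mul_nonpos_of_nonpos_of_nonneg (by linarith) (sq_nonneg _)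
        · rw [Function.extend_apply' _ _ _ (by rintro ⟨a, rfl⟩; exact hi a.2)]; simp
      have hy0 : y ≠ 0 := fun h => hy (by rw [h, map_zero])
      obtain ⟨i, hi⟩ := Function.ne_iff.1 hy0
      refine Finset.sum_neg' (fun i _ => hle i) ⟨i.1, Finset.mem_univ _, ?_⟩
      rw [Subtype.val_injective.extend_apply]
      have : y i ≠ 0 := hi
      have h2 : 0 < y i ^ 2 := by positivity
      have h3 := i.2
      nlinarith
  · rintro d ⟨W, rfl, hW⟩
    let g : W →ₗ[ℝ] (ι → ℝ) := (LinearMap.funLeft ℝ ℝ (Subtype.val : ι → Fin n)) ∘ₗ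
      (evm A).mulVecLin ∘ₗ W.subtype
    have hg : Function.Injective g := by
      rw [injective_iff_map_eq_zero]
      rintro ⟨v, hv⟩ h
      by_contra hne
      have hv0 : v ≠ 0 := fun h => hne (by ext1; exact h)
      have := hW v hv hv0
      rw [quad_eq] at this
      refine this.not_ge (Finset.sum_nonneg fun i _ => ?_)
      by_cases hi : evs A i < t
      · have h2 : (evm A).mulVec v i = 0 := congrFun h ⟨i, hi⟩
        rw [h2]; simp
      · exact mul_nonneg (by linarith [not_lt.1 hi]) (sq_nonneg _)
    have := LinearMap.finrank_le_finrank_of_injective hg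
    rwa [Module.finrank_fintype_fun_eq_card, hcard] at this

theorem sum_sq_eq_trace (C : Matrix (Fin n) (Fin n) ℝ) :
    ∑ i, ∑ j, C i j ^ 2 = (C * C.transpose).trace := by
  simp only [Matrix.trace, Matrix.diag_apply, Matrix.mul_apply, Matrix.transpose_apply, sq]

theorem abs_sum_evs_sub_le {h : ℝ → ℝ} {L : ℝ} (hL : 0 ≤ L) (hh : ∀ a b, |h a - h b| ≤ L * |a - b|)
    (A B : Matrix (Fin n) (Fin n) ℝ) :
    |∑ i, h (evs A i) - ∑ i, h (evs B i)| ≤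
      L * (Real.sqrt n * Real.sqrt (∑ i, ∑ j, (sy A i j - sy B i j) ^ 2)) := by
  set M := evm A * (evm B).transpose with hM
  have hM1 : M * M.transpose = 1 := by
    rw [hM, Matrix.transpose_mul, Matrix.transpose_transpose,
      show evm A * (evm B).transpose * (evm B * (evm A).transpose) =
        evm A * ((evm B).transpose * evm B) * (evm A).transpose by simp only [Matrix.mul_assoc],
      transpose_mul_evm, Matrix.mul_one, evm_mul_transpose]
  have hM2 : M.transpose * M = 1 := mul_eq_one_comm.1 hM1
  have hr : ∀ i, ∑ j, M i j ^ 2 = 1 := by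
    intro i
    have := congrFun (congrFun hM1 i) i
    simpa [Matrix.mul_apply, sq] using this
  have hc : ∀ j, ∑ i, M i j ^ 2 = 1 := by
    intro j
    have := congrFun (congrFun hM2 j) j
    simpa [Matrix.mul_apply, sq] using this
  have hD : ∀ i j, (evm A * (sy A - sy B) * (evm B).transpose) i j = (evs A i - evs B j) * M i j := by
    intro i j
    have e1 : evm A * (sy A - sy B) * (evm B).transpose =
        Matrix.diagonal (evs A) * M - M * Matrix.diagonal (evs B) := by
      have e2 : sy B * (evm B).transpose = (evm B).transpose * Matrix.diagonal (evs B) := by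
        nth_rewrite 1 [sy_eq_diag B]
        rw [Matrix.mul_assoc, evm_mul_transpose, Matrix.mul_one]
      rw [Matrix.mul_sub, Matrix.sub_mul, evm_mul_sy, Matrix.mul_assoc, Matrix.mul_assoc, e2, hM,
        Matrix.mul_assoc]
    rw [e1, Matrix.sub_apply, Matrix.diagonal_mul, Matrix.mul_diagonal]; ring
  have hF : ∑ i, ∑ j, (sy A i j - sy B i j) ^ 2 = ∑ i, ∑ j, M i j ^ 2 * (evs A i - evs B j) ^ 2 := by
    have e1 : ∑ i, ∑ j, M i j ^ 2 * (evs A i - evs B j) ^ 2 =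
        ∑ i, ∑ j, ((evm A * (sy A - sy B) * (evm B).transpose) i j) ^ 2 :=
      Finset.sum_congr rfl fun i _ => Finset.sum_congr rfl fun j _ => by rw [hD]; ring
    have e2 : ∑ i, ∑ j, (sy A i j - sy B i j) ^ 2 = ∑ i, ∑ j, ((sy A - sy B) i j) ^ 2 := rfl
    rw [e1, e2, sum_sq_eq_trace, sum_sq_eq_trace, Matrix.transpose_mul, Matrix.transpose_mul,
      Matrix.transpose_transpose,
      show evm A * (sy A - sy B) * (evm B).transpose *
        (evm B * ((sy A - sy B).transpose * (evm A).transpose)) = evm A * (sy A - sy B) *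
        ((evm B).transpose * evm B) * ((sy A - sy B).transpose * (evm A).transpose) by
          simp only [Matrix.mul_assoc], transpose_mul_evm, Matrix.mul_one, ← Matrix.mul_assoc,
      Matrix.trace_mul_comm _ (evm A).transpose, ← Matrix.mul_assoc, ← Matrix.mul_assoc,
      transpose_mul_evm, Matrix.one_mul]
  have h1 : ∑ i, h (evs A i) - ∑ i, h (evs B i) =
      ∑ i, ∑ j, M i j ^ 2 * (h (evs A i) - h (evs B j)) := by
    simp only [mul_sub, Finset.sum_sub_distrib]
    congr 1
    · refine Finset.sum_congr rfl fun i _ => ?_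
      rw [← Finset.sum_mul, hr, one_mul]
    · rw [Finset.sum_comm]
      refine Finset.sum_congr rfl fun i _ => ?_
      rw [← Finset.sum_mul, hc, one_mul]
  have h2 : ∑ i, ∑ j, M i j ^ 2 * |evs A i - evs B j| ≤
      Real.sqrt n * Real.sqrt (∑ i, ∑ j, (sy A i j - sy B i j) ^ 2) := by
    rw [hF]
    have cs := Finset.sum_mul_sq_le_sq_mul_sq (Finset.univ : Finset (Fin n × Fin n))
      (fun p => |M p.1 p.2|) (fun p => |M p.1 p.2| * |evs A p.1 - evs B p.2|)
    simp only [Fintype.sum_prod_type, mul_pow, sq_abs] at cs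
    simp only [hr, Finset.sum_const, Finset.card_univ, Fintype.card_fin, nsmul_eq_mul, mul_one] at cs
    rw [← Real.sqrt_mul (by positivity)]
    refine Real.le_sqrt_of_sq_le (le_trans (le_of_eq ?_) cs)
    congr 1
    refine Finset.sum_congr rfl fun i _ => Finset.sum_congr rfl fun j _ => ?_
    rw [← mul_assoc, ← sq, sq_abs]
  rw [h1]
  calc |∑ i, ∑ j, M i j ^ 2 * (h (evs A i) - h (evs B j))|
      ≤ ∑ i, ∑ j, |M i j ^ 2 * (h (evs A i) - h (evs B j))| :=
        (Finset.abs_sum_le_sum_abs _ _).trans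
          (Finset.sum_le_sum fun i _ => Finset.abs_sum_le_sum_abs _ _)
    _ ≤ ∑ i, ∑ j, L * (M i j ^ 2 * |evs A i - evs B j|) := by
        refine Finset.sum_le_sum fun i _ => Finset.sum_le_sum fun j _ => ?_
        rw [abs_mul, abs_of_nonneg (sq_nonneg _)]
        have := hh (evs A i) (evs B j)
        nlinarith [sq_nonneg (M i j)]
    _ = L * ∑ i, ∑ j, M i j ^ 2 * |evs A i - evs B j| := by simp only [Finset.mul_sum]
    _ ≤ _ := mul_le_mul_of_nonneg_left h2 hL

end spectral

section measurability
variable {n : ℕ}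

theorem continuous_sum_evs {h : ℝ → ℝ} {L : ℝ} (hL : 0 ≤ L) (hh : ∀ a b, |h a - h b| ≤ L * |a - b|) :
    Continuous fun A : Fin n → Fin n → ℝ => ∑ i, h (evs A i) := by
  rw [continuous_iff_continuousAt]
  intro A
  rw [ContinuousAt, tendsto_iff_dist_tendsto_zero]
  have hc : Tendsto (fun B : Fin n → Fin n → ℝ =>
      L * (Real.sqrt n * Real.sqrt (∑ i, ∑ j, (sy B i j - sy A i j) ^ 2))) (nhds A) (nhds 0) := by
    have : Continuous (fun B : Fin n → Fin n → ℝ =>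
      L * (Real.sqrt n * Real.sqrt (∑ i, ∑ j, (sy B i j - sy A i j) ^ 2))) := by
      simp only [sy, Matrix.smul_apply]
      fun_prop
    have h2 := this.tendsto A
    simpa using h2
  refine squeeze_zero (fun _ => dist_nonneg) (fun B => ?_) hc
  rw [Real.dist_eq]
  exact abs_sum_evs_sub_le hL hh _ _

theorem nlt_eq_nlt_zero (A : Matrix (Fin n) (Fin n) ℝ) (t : ℝ) :
    nlt A t = nlt (A - t • (1 : Matrix (Fin n) (Fin n) ℝ)) 0 := by
  rw [← negIdx_sub_smul, ← negIdx_sub_smul, zero_smul, sub_zero]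

theorem nlt_cast (A : Matrix (Fin n) (Fin n) ℝ) (t : ℝ) :
    (nlt A t : ℝ) = ∑ i, if evs A i < t then (1 : ℝ) else 0 := by
  unfold nlt; rw [Finset.sum_boole]

theorem measurable_nlt_zero : Measurable fun A : Fin n → Fin n → ℝ => nlt A 0 := by
  have hlip : ∀ m : ℕ, ∀ a b : ℝ, |max 0 (min 1 (-(m * a))) - max 0 (min 1 (-(m * b)))| ≤
      (m : ℝ) * |a - b| := by
    intro m a b
    refine (abs_max_sub_max_le_max _ _ _ _).trans (max_le (by simp; positivity) ?_)
    refine (abs_min_sub_min_le_max _ _ _ _).trans (max_le (by simp; positivity) ?_)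
    rw [show -((m : ℝ) * a) - -(m * b) = m * (b - a) by ring, abs_mul, Nat.abs_cast, abs_sub_comm]
  have hlim : ∀ A : Fin n → Fin n → ℝ, Tendsto (fun m : ℕ =>
      ∑ i, max 0 (min 1 (-((m : ℝ) * evs A i)))) atTop (nhds (nlt A 0 : ℝ)) := by
    intro A
    have e : (nlt A 0 : ℝ) = ∑ i, if evs A i < 0 then (1 : ℝ) else 0 := by
      exact nlt_cast A 0
    rw [e]
    refine tendsto_finsetSum _ fun i _ => ?_
    by_cases hi : evs A i < 0
    · rw [if_pos hi]
      refine tendsto_const_nhds.congr' ?_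
      obtain ⟨m0, hm0⟩ := exists_nat_ge (1 / (-evs A i))
      filter_upwards [eventually_ge_atTop m0] with m hm
      have h1 : 1 / (-evs A i) ≤ m := hm0.trans (by exact_mod_cast hm)
      rw [div_le_iff₀ (by linarith)] at h1
      rw [min_eq_left (by linarith), max_eq_right zero_le_one]
    · rw [if_neg hi]
      refine tendsto_const_nhds.congr fun m => ?_
      have : 0 ≤ (m : ℝ) * evs A i := mul_nonneg (by positivity) (not_lt.1 hi)
      rw [min_eq_right (by linarith), max_eq_left (by linarith)]
  have hm : Measurable fun A : Fin n → Fin n → ℝ => (nlt A 0 : ℝ) :=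
    measurable_of_tendsto_metrizable
      (fun m => (continuous_sum_evs (Nat.cast_nonneg m) (hlip m)).measurable)
      (tendsto_pi_nhds.2 hlim)
  refine measurable_to_countable' fun k => ?_
  have : (fun A : Fin n → Fin n → ℝ => nlt A 0) ⁻¹' {k} =
      (fun A : Fin n → Fin n → ℝ => (nlt A 0 : ℝ)) ⁻¹' {(k : ℝ)} := by
    ext A; simp
  rw [this]
  exact hm (measurableSet_singleton _)

theorem measurable_nlt : Measurable fun p : (Fin n → Fin n → ℝ) × ℝ => nlt p.1 p.2 := by
  have : (fun p : (Fin n → Fin n → ℝ) × ℝ => nlt p.1 p.2) = (fun A : Fin n → Fin n → ℝ => nlt A 0) ∘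
      fun p : (Fin n → Fin n → ℝ) × ℝ => fun i j => p.1 i j - p.2 * (1 : Matrix (Fin n) (Fin n) ℝ) i j := by
    ext p; exact nlt_eq_nlt_zero _ _
  rw [this]
  exact measurable_nlt_zero.comp (by fun_prop)

theorem nge_eq (A : Matrix (Fin n) (Fin n) ℝ) (t : ℝ) : nge A t = n - nlt A t := by
  have := nge_add_nlt A t; omega

theorem measurable_nge : Measurable fun p : (Fin n → Fin n → ℝ) × ℝ => nge p.1 p.2 := by
  have : (fun p : (Fin n → Fin n → ℝ) × ℝ => nge p.1 p.2) = fun p => n - nlt p.1 p.2 :=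
    funext fun p => nge_eq _ _
  rw [this]
  exact (measurable_of_countable fun m : ℕ => n - m).comp measurable_nlt

theorem le_evs_iff (A : Matrix (Fin n) (Fin n) ℝ) (t : ℝ) (i : Fin n) :
    t ≤ evs A i ↔ (i : ℕ) < nge A t := by
  constructor
  · intro h
    have : Finset.Iic i ⊆ Finset.univ.filter fun j => t ≤ evs A j := by
      intro j hj
      simp only [Finset.mem_filter, Finset.mem_univ, true_and]
      exact h.trans (evs_antitone A (Finset.mem_Iic.1 hj))
    have := Finset.card_le_card this
    rw [Fin.card_Iic] at this
    exact this
  · intro h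
    by_contra hn
    have : (Finset.univ.filter fun j => t ≤ evs A j) ⊆ Finset.Iio i := by
      intro j hj
      simp only [Finset.mem_filter, Finset.mem_univ, true_and] at hj
      rw [Finset.mem_Iio]
      by_contra hij
      exact hn (hj.trans (evs_antitone A (not_lt.1 hij)))
    have := Finset.card_le_card this
    rw [Fin.card_Iio] at this
    exact absurd h (not_lt.2 this)

theorem measurable_evs (i : Fin n) : Measurable fun A : Fin n → Fin n → ℝ => evs A i := by
  refine measurable_of_Ici fun t => ?_
  have : (fun A : Fin n → Fin n → ℝ => evs A i) ⁻¹' Set.Ici t = {A | (i : ℕ) < nge A t} := by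
    ext A; exact le_evs_iff A t i
  rw [this]
  exact measurableSet_lt measurable_const (measurable_nge.comp (measurable_id.prodMk measurable_const))

theorem nge_antitone (A : Matrix (Fin n) (Fin n) ℝ) : Antitone (nge A) := fun s t h =>
  Finset.card_le_card fun i hi => by
    simp only [Finset.mem_filter, Finset.mem_univ, true_and] at hi ⊢
    exact h.trans hi

theorem nlt_smul (A : Matrix (Fin n) (Fin n) ℝ) (t : ℝ) {s : ℝ} (hs : 0 < s) :
    nlt (s • A) (s * t) = nlt A t := by
  rw [← negIdx_sub_smul, ← negIdx_sub_smul, mul_smul, ← smul_sub, negIdx, negIdx]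
  congr 1; ext d
  refine exists_congr fun W => and_congr_right fun _ => forall₂_congr fun v _ => imp_congr_right fun _ => ?_
  rw [Matrix.smul_mulVec, dotp_eq, dotp_eq, dotProduct_smul, smul_eq_mul]
  constructor
  · intro h; by_contra h2; exact absurd h (not_lt.2 (mul_nonneg hs.le (not_lt.1 h2)))
  · intro h; exact mul_neg_of_pos_of_neg hs h

end measurability

section index
variable {n P : ℕ} {c : ℕ → ℝ}

/-- Negative index of a function on the orthogonal complement of a vector. -/
def qidx {N : ℕ} (σ : Fin N → ℝ) (q : (Fin N → ℝ) → ℝ) : ℕ :=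
  sSup {d : ℕ | ∃ W : Submodule ℝ (Fin N → ℝ), Module.finrank ℝ W = d ∧
    (∀ v ∈ W, dotp v σ = 0) ∧ ∀ v ∈ W, v ≠ 0 → q v < 0}

/-- The tangential Hessian quadratic form, in flattened couplings. -/
def qform (N P : ℕ) (c : ℕ → ℝ) (g : GIdx N P → ℝ) (σ v : Fin N → ℝ) : ℝ :=
  ∑ J, g J * feat2 N P c σ v v J - (∑ J, g J * feat1 N P c σ σ J) / N * dotp v v

theorem critIndex_eq (N : ℕ) (g : (k : ℕ) → (Fin k → Fin N) → ℝ) (σ : Fin N → ℝ) :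
    critIndex N P c g σ = qidx σ (qform N P c (flatten N P g) σ) := by
  unfold critIndex qidx qform
  simp only [hessH_eq, dotp_gradH]
  simp only [dotp, sq]

/-- Embedding of the tangent space at the pole, followed by a reflection. -/
def tanL (u : Fin n → ℝ) : (Fin n → ℝ) →ₗ[ℝ] (Fin (n + 1) → ℝ) :=
  (hrefl u).mulVecLin ∘ₗ
    { toFun := fun y => Fin.cons 0 y
      map_add' := fun x y => by ext i; refine Fin.cases ?_ (fun j => ?_) i <;> simp
      map_smul' := fun a y => by ext i; refine Fin.cases ?_ (fun j => ?_) i <;> simp }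

theorem tanL_apply (u y : Fin n → ℝ) : tanL u y = (hrefl u).mulVec (Fin.cons 0 y) := rfl

theorem hrefl_hrefl (u : Fin n → ℝ) (x : Fin (n + 1) → ℝ) :
    (hrefl u).mulVec ((hrefl u).mulVec x) = x := by
  rw [Matrix.mulVec_mulVec, hrefl_mul_self, Matrix.one_mulVec]

theorem tanL_injective (u : Fin n → ℝ) : Function.Injective (tanL u) := by
  intro x y h
  have := congrArg (hrefl u).mulVec h
  rw [tanL_apply, tanL_apply, hrefl_hrefl, hrefl_hrefl] at this
  exact (Fin.cons_injective2 this).2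

theorem finrank_map_tanL (u : Fin n → ℝ) (W : Submodule ℝ (Fin n → ℝ)) :
    Module.finrank ℝ (W.map (tanL u)) = Module.finrank ℝ W :=
  (Submodule.equivMapOfInjective (tanL u) (tanL_injective u) W).finrank_eq.symm

theorem dotp_cons_pole (y : Fin n → ℝ) : dotp (Fin.cons 0 y) (pole n) = 0 := by
  simp [dotp, pole, Fin.sum_univ_succ]

theorem mem_range_tanL {u : Fin n → ℝ} {v : Fin (n + 1) → ℝ}
    (h : dotp v ((hrefl u).mulVec (pole n)) = 0) : v ∈ LinearMap.range (tanL u) := by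
  refine ⟨fun i => (hrefl u).mulVec v i.succ, ?_⟩
  rw [← hrefl_hrefl u v, tanL_apply, hrefl_hrefl]
  congr 1
  rw [← hrefl_hrefl u v, dotp_hrefl] at h
  ext i
  refine Fin.cases ?_ (fun j => ?_) i
  · simp [dotp, pole_eq, Fin.sum_univ_succ] at h
    rcases h with h | h
    · simpa using h.symm
    · rw [Real.sqrt_eq_zero (by positivity)] at h
      have : (0 : ℝ) < n + 1 := by positivity
      linarith
  · simp

theorem qidx_eq_negIdx (u : Fin n → ℝ) {q : (Fin (n + 1) → ℝ) → ℝ} {B : Matrix (Fin n) (Fin n) ℝ}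
    (h : ∀ y, q (tanL u y) = dotp y (B.mulVec y)) :
    qidx ((hrefl u).mulVec (pole n)) q = negIdx B := by
  unfold qidx negIdx
  congr 1
  ext d
  constructor
  · rintro ⟨W, hd, h1, h2⟩
    have hW : (W.comap (tanL u)).map (tanL u) = W := by
      rw [Submodule.map_comap_eq, inf_eq_right]
      exact fun v hv => mem_range_tanL (h1 v hv)
    refine ⟨W.comap (tanL u), ?_, fun y hy hy0 => ?_⟩
    · rw [← hd, ← hW, finrank_map_tanL, hW]
    · rw [← h]
      exact h2 _ hy fun h0 => hy0 (tanL_injective u (by rw [h0, map_zero]))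
  · rintro ⟨W, hd, h2⟩
    refine ⟨W.map (tanL u), ?_, ?_, ?_⟩
    · rw [← hd, finrank_map_tanL]
    · rintro _ ⟨y, hy, rfl⟩
      rw [tanL_apply, dotp_hrefl, dotp_cons_pole]
    · rintro _ ⟨y, hy, rfl⟩ h0
      rw [h]
      exact h2 y hy fun h => h0 (by rw [h, map_zero])

theorem feat2_linear_right {N : ℕ} (σ v : Fin N → ℝ) (J : GIdx N P) (w : Fin N → ℝ) :
    feat2 N P c σ v w J = ∑ i, w i * feat2 N P c σ v (Pi.single i 1) J := by
  refine (hasFDerivAt_feat1_line (c := c) J σ v w).unique ?_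
  simp_rw [feat1_linear _ _ w]
  exact HasDerivAt.fun_sum fun i _ => (hasFDerivAt_feat1_line J σ v _).const_mul _

theorem qform_tanL (u : Fin n → ℝ) (h : GIdx (n + 1) P → ℝ) (y : Fin n → ℝ) :
    qform (n + 1) P c (rho (hrefl u) h) ((hrefl u).mulVec (pole n)) (tanL u y) =
      dotp y ((hessP n P c h - radP n P c h • (1 : Matrix (Fin n) (Fin n) ℝ)).mulVec y) := by
  have e1 : ∀ J, rho (hrefl u) (feat2 (n + 1) P c ((hrefl u).mulVec (pole n)) (tanL u y) (tanL u y)) J =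
      feat2 (n + 1) P c (pole n) (Fin.cons 0 y) (Fin.cons 0 y) J := by
    intro J; rw [rho_feat2, tanL_apply, hrefl_hrefl, hrefl_hrefl]
  have e2 : ∀ J, rho (hrefl u) (feat1 (n + 1) P c ((hrefl u).mulVec (pole n))
      ((hrefl u).mulVec (pole n))) J = feat1 (n + 1) P c (pole n) (pole n) J := by
    intro J; rw [rho_feat1, hrefl_hrefl]
  have e3 : ∀ J, feat2 (n + 1) P c (pole n) (Fin.cons 0 y) (Fin.cons 0 y) J =
      ∑ i, ∑ j, y i * y j * feat2 (n + 1) P c (pole n) (tb j) (tb i) J := by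
    intro J
    rw [feat2_linear_right, Fin.sum_univ_succ]
    simp only [Fin.cons_zero, zero_mul, zero_add, Fin.cons_succ]
    refine Finset.sum_congr rfl fun i _ => ?_
    rw [feat2_linear, Fin.sum_univ_succ]
    simp only [Fin.cons_zero, zero_mul, zero_add, Fin.cons_succ, Finset.mul_sum]
    exact Finset.sum_congr rfl fun j _ => by rw [mul_assoc]; rfl
  have e4 : dotp (tanL u y) (tanL u y) = dotp y y := by
    rw [tanL_apply, dotp_hrefl]; simp [dotp, Fin.sum_univ_succ]
  unfold qform
  rw [sum_rho_mul, sum_rho_mul, hrefl_transpose, e4]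
  simp only [e1, e2, e3]
  rw [Matrix.sub_mulVec, Matrix.smul_mulVec, Matrix.one_mulVec, dotp_eq, dotp_eq, dotProduct_sub,
    dotProduct_smul, smul_eq_mul]
  congr 1
  simp only [Finset.mul_sum, dotProduct, Matrix.mulVec, hessP, Finset.sum_mul]
  rw [Finset.sum_comm]
  refine Finset.sum_congr rfl fun i _ => ?_
  rw [Finset.sum_comm]
  refine Finset.sum_congr rfl fun j _ => Finset.sum_congr rfl fun J _ => by ring

theorem qidx_rho (u : Fin n → ℝ) (h : GIdx (n + 1) P → ℝ) :
    qidx ((hrefl u).mulVec (pole n))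
      (qform (n + 1) P c (rho (hrefl u) h) ((hrefl u).mulVec (pole n))) =
      nlt (hessP n P c h) (radP n P c h) := by
  rw [qidx_eq_negIdx u (qform_tanL u h), negIdx_sub_smul]

open Classical in
/-- Kac–Rice formula for critical points with prescribed radial derivative, energy and index. -/
theorem kacRice_index (hν : 0 < nuu P c) (hk : 0 < kap P c) (hn : 0 < n) {S : Set (ℝ × ℝ)}
    (hS : MeasurableSet S) (m : ℕ) :
    AEMeasurable (fun g => ecount {σ | IsCrit (n + 1) P c g σ ∧
      (((∑ J, g J * feat1 (n + 1) P c σ σ J) / ((n + 1 : ℕ) : ℝ), ∑ J, g J * feat (n + 1) P c σ J) ∈ S ∧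
      qidx σ (qform (n + 1) P c g σ) = m)}) (stdG (GIdx (n + 1) P)) ∧
    ∫⁻ g, ecount {σ | IsCrit (n + 1) P c g σ ∧
      (((∑ J, g J * feat1 (n + 1) P c σ σ J) / ((n + 1 : ℕ) : ℝ), ∑ J, g J * feat (n + 1) P c σ J) ∈ S ∧
      qidx σ (qform (n + 1) P c g σ) = m)} ∂(stdG (GIdx (n + 1) P)) =
      ENNReal.ofReal (Real.sqrt (nuu P c / kap P c) ^ n) * aN n *
      ∫⁻ x, ∫⁻ z, ∫⁻ w, (if (Real.sqrt (nuu P c / ((n : ℝ) + 1)) * (Real.sqrt (vv P c) * z),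
        Real.sqrt ((n : ℝ) + 1) * (bb P c * (Real.sqrt (vv P c) * z) + tau P c * w)) ∈ S ∧
        nlt (goe n x) (Real.sqrt (vv P c) * z) = m then
          ENNReal.ofReal |(goe n x - (Real.sqrt (vv P c) * z) • (1 : Matrix _ _ ℝ)).det| else 0)
        ∂(gaussianReal 0 1) ∂(gaussianReal 0 1) ∂(stdG (Fin n × Fin n)) := by
  set T : (GIdx (n + 1) P → ℝ) → Prop := fun h => (radP n P c h, hamP n P c h) ∈ S ∧
    nlt (hessP n P c h) (radP n P c h) = m with hTdef
  have hTm : MeasurableSet {h | T h} := by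
    refine MeasurableSet.inter ?_ ?_
    · exact (measurable_radP.prodMk measurable_hamP) hS
    · exact (measurable_nlt.comp (Measurable.prodMk
        measurable_hessP
        measurable_radP)) (measurableSet_singleton m)
  have key := kacRice_aux (n := n) hk hTm
    (fun g => by simp only [hTdef, hessP_prj, radP_prj, hamP_prj])
    (Q := fun g σ => ((∑ J, g J * feat1 (n + 1) P c σ σ J) / ((n + 1 : ℕ) : ℝ),
      ∑ J, g J * feat (n + 1) P c σ J) ∈ S ∧ qidx σ (qform (n + 1) P c g σ) = m)
    (fun u h => by
      simp only [hTdef, qidx_rho]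
      rw [sum_rho_mul, sum_rho_mul, hrefl_transpose, rho_feat, rho_feat1, hrefl_hrefl]
      rfl) hn
  refine ⟨key.1, key.2.trans ?_⟩
  set f : (Fin n → Fin n → ℝ) × ℝ × ℝ → ℝ≥0∞ := fun p =>
    if p.2 ∈ S ∧ nlt p.1 p.2.1 = m then
      ENNReal.ofReal |(Matrix.of p.1 - p.2.1 • (1 : Matrix (Fin n) (Fin n) ℝ)).det| else 0 with hfdef
  have hf : Measurable f := by
    refine Measurable.ite ?_ ?_ measurable_const
    · refine MeasurableSet.inter (measurable_snd hS) ?_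
      exact (measurable_nlt.comp (measurable_fst.prodMk (measurable_fst.comp measurable_snd)))
        (measurableSet_singleton m)
    · refine ENNReal.measurable_ofReal.comp (measurable_norm.comp (measurable_det fun i j => ?_))
      simp only [Matrix.sub_apply, Matrix.smul_apply, Matrix.of_apply]
      fun_prop
  have h1 := lintegral_pole_law (n := n) hν hk hf
  have h2 : ∀ g : GIdx (n + 1) P → ℝ, {h | T h}.indicator (fun g => ENNReal.ofReal
        |(hessP n P c g - radP n P c g • 1).det|) g = f (hessP n P c g, radP n P c g, hamP n P c g) := by
    intro g
    by_cases hg : T g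
    · rw [Set.indicator_of_mem (by exact hg)]
      exact (if_pos hg).symm
    · rw [Set.indicator_of_notMem (by exact hg)]
      exact (if_neg hg).symm
  simp_rw [h2]
  rw [h1]
  set s := Real.sqrt (nuu P c / ((n : ℝ) + 1)) with hs
  have hs0 : 0 < s := Real.sqrt_pos.2 (by positivity)
  have h3 : ∀ (x : Fin n × Fin n → ℝ) (t b : ℝ), f (fun i j => s * goe n x i j, s * t, b) =
      ENNReal.ofReal (s ^ n) * (if (s * t, b) ∈ S ∧ nlt (goe n x) t = m then
        ENNReal.ofReal |(goe n x - t • (1 : Matrix _ _ ℝ)).det| else 0) := by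
    intro x t b
    have e1 : (Matrix.of fun i j => s * goe n x i j) = s • goe n x := by ext i j; simp
    have e0 : nlt (fun i j => s * goe n x i j) (s * t) = nlt (goe n x) t := nlt_smul _ _ hs0
    simp only [hfdef, e1, e0]
    split_ifs with h
    · rw [mul_smul, ← smul_sub, Matrix.det_smul, Fintype.card_fin, abs_mul, abs_of_pos (pow_pos hs0 n),
        ENNReal.ofReal_mul (pow_pos hs0 n).le]
    · simp
  simp_rw [h3]
  have h4 : ENNReal.ofReal (Real.sqrt (nuu P c / kap P c) ^ n) =
      ENNReal.ofReal (Real.sqrt (((n : ℝ) + 1) / kap P c) ^ n) * ENNReal.ofReal (s ^ n) := by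
    rw [← ENNReal.ofReal_mul (by positivity), ← mul_pow, hs, ← Real.sqrt_mul (by positivity)]
    congr 3
    field_simp
  rw [h4]
  have hmk : Measurable fun p : ((Fin n × Fin n → ℝ) × ℝ) × ℝ =>
      (if (s * (Real.sqrt (vv P c) * p.1.2),
        Real.sqrt ((n : ℝ) + 1) * (bb P c * (Real.sqrt (vv P c) * p.1.2) + tau P c * p.2)) ∈ S ∧
        nlt (goe n p.1.1) (Real.sqrt (vv P c) * p.1.2) = m then
          ENNReal.ofReal |(goe n p.1.1 - (Real.sqrt (vv P c) * p.1.2) • (1 : Matrix _ _ ℝ)).det| else 0) := by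
    refine Measurable.ite ?_ ?_ measurable_const
    · refine MeasurableSet.inter ?_ ?_
      · exact (show Measurable fun p : ((Fin n × Fin n → ℝ) × ℝ) × ℝ =>
          (s * (Real.sqrt (vv P c) * p.1.2),
          Real.sqrt ((n : ℝ) + 1) * (bb P c * (Real.sqrt (vv P c) * p.1.2) + tau P c * p.2)) by fun_prop) hS
      · refine (measurable_nlt.comp (g := fun p : (Fin n → Fin n → ℝ) × ℝ => nlt p.1 p.2)
          (f := fun p : ((Fin n × Fin n → ℝ) × ℝ) × ℝ =>
          ((goe n p.1.1 : Fin n → Fin n → ℝ), Real.sqrt (vv P c) * p.1.2)) ?_) (measurableSet_singleton m)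
        refine Measurable.prodMk ?_ (by fun_prop)
        refine measurable_pi_lambda _ fun i => measurable_pi_lambda _ fun j => ?_
        unfold goe; fun_prop
    · refine ENNReal.measurable_ofReal.comp (measurable_norm.comp (measurable_det fun i j => ?_))
      simp only [Matrix.sub_apply, Matrix.smul_apply, goe]
      fun_prop
  have hA : ∀ x, Measurable fun z => ∫⁻ w, (if (s * (Real.sqrt (vv P c) * z),
        Real.sqrt ((n : ℝ) + 1) * (bb P c * (Real.sqrt (vv P c) * z) + tau P c * w)) ∈ S ∧
        nlt (goe n x) (Real.sqrt (vv P c) * z) = m then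
          ENNReal.ofReal |(goe n x - (Real.sqrt (vv P c) * z) • (1 : Matrix _ _ ℝ)).det| else 0)
        ∂(gaussianReal 0 1) := fun x =>
    (hmk.comp (g := fun p : ((Fin n × Fin n → ℝ) × ℝ) × ℝ => _)
      (f := fun p : ℝ × ℝ => ((x, p.1), p.2)) (by fun_prop)).lintegral_prod_right'
  have hB : Measurable fun x => ∫⁻ z, ∫⁻ w, (if (s * (Real.sqrt (vv P c) * z),
        Real.sqrt ((n : ℝ) + 1) * (bb P c * (Real.sqrt (vv P c) * z) + tau P c * w)) ∈ S ∧
        nlt (goe n x) (Real.sqrt (vv P c) * z) = m then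
          ENNReal.ofReal |(goe n x - (Real.sqrt (vv P c) * z) • (1 : Matrix _ _ ℝ)).det| else 0)
        ∂(gaussianReal 0 1) ∂(gaussianReal 0 1) := by
    have h5 := hmk.lintegral_prod_right' (ν := gaussianReal 0 1)
    exact h5.lintegral_prod_right' (ν := gaussianReal 0 1)
  rw [show ∀ a b d e : ℝ≥0∞, a * b * d * e = a * d * (b * e) by intros; ring,
    ← lintegral_const_mul _ hB]
  congr 1
  refine lintegral_congr fun x => ?_
  rw [← lintegral_const_mul _ (hA x)]
  refine lintegral_congr fun z => ?_
  rw [lintegral_const_mul' _ _ ENNReal.ofReal_ne_top]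

end index

section integrability
variable {ι : Type*} [Fintype ι]

theorem integrable_exp_abs_gaussian (a : ℝ) :
    Integrable (fun x => Real.exp (a * |x|)) (gaussianReal 0 1) := by
  refine ((integrable_exp_mul_gaussianReal (μ := 0) (v := 1) a).add
    (integrable_exp_mul_gaussianReal (μ := 0) (v := 1) (-a))).mono'
    (by fun_prop) (ae_of_all _ fun x => ?_)
  rw [Real.norm_of_nonneg (Real.exp_pos _).le, Pi.add_apply]
  rcases abs_choice x with h | h <;> rw [h]
  · linarith [Real.exp_pos (-a * x)]
  · rw [show a * -x = -a * x by ring]; linarith [Real.exp_pos (a * x)]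

theorem integrable_exp_sum_abs (a : ℝ) :
    Integrable (fun x : ι → ℝ => Real.exp (a * ∑ i, |x i|)) (stdG ι) := by
  have : (fun x : ι → ℝ => Real.exp (a * ∑ i, |x i|)) = fun x => ∏ i, Real.exp (a * |x i|) := by
    ext x; rw [Finset.mul_sum, Real.exp_sum]
  rw [this]
  exact Integrable.fintype_prod (f := fun (_ : ι) y => Real.exp (a * |y|))
    fun _ => integrable_exp_abs_gaussian a

theorem integrable_of_exp_bound {f : (ι → ℝ) → ℝ} (hf : AEStronglyMeasurable f (stdG ι)) (C a : ℝ)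
    (h : ∀ x, |f x| ≤ C * Real.exp (a * ∑ i, |x i|)) : Integrable f (stdG ι) :=
  ((integrable_exp_sum_abs a).const_mul C).mono' hf (ae_of_all _ h)

theorem pow_le_factorial_mul_exp {s : ℝ} (hs : 0 ≤ s) (m : ℕ) : s ^ m ≤ m.factorial * Real.exp s := by
  have h := Real.pow_div_factorial_le_exp s hs m
  rw [div_le_iff₀ (by positivity)] at h
  linarith

theorem integrable_of_poly_bound {f : (ι → ℝ) → ℝ} (hf : AEStronglyMeasurable f (stdG ι)) (C : ℝ)
    (m : ℕ) (hC : 0 ≤ C) (h : ∀ x, |f x| ≤ C * (1 + ∑ i, |x i|) ^ m) : Integrable f (stdG ι) := by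
  refine integrable_of_exp_bound hf (C * (m.factorial * Real.exp 1)) 1 fun x => (h x).trans ?_
  rw [mul_assoc, mul_assoc]
  refine mul_le_mul_of_nonneg_left ?_ hC
  have h0 : 0 ≤ ∑ i, |x i| := Finset.sum_nonneg fun i _ => abs_nonneg _
  refine (pow_le_factorial_mul_exp (by linarith) m).trans (le_of_eq ?_)
  rw [Real.exp_add, one_mul]

theorem abs_goe_le {n : ℕ} (x : Fin n × Fin n → ℝ) (i j : Fin n) :
    |goe n x i j| ≤ 2 * ∑ p, |x p| := by
  have h : ∀ p, |x p| ≤ ∑ p, |x p| := fun p =>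
    Finset.single_le_sum (f := fun p => |x p|) (fun p _ => abs_nonneg _) (Finset.mem_univ p)
  have h2 : (1 : ℝ) ≤ Real.sqrt 2 := by rw [Real.one_le_sqrt]; norm_num
  rw [goe, abs_div, abs_of_pos (by positivity : 0 < Real.sqrt 2)]
  refine (div_le_self (abs_nonneg _) h2).trans ((abs_add_le _ _).trans ?_)
  linarith [h (i, j), h (j, i)]

theorem abs_det_goe_le {n : ℕ} (x : Fin n × Fin n → ℝ) (z : ℝ) :
    |(goe n x - (Real.sqrt 2 * z) • (1 : Matrix (Fin n) (Fin n) ℝ)).det| ≤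
      n.factorial * n.factorial * (Real.exp (2 * ∑ p, |x p|) * Real.exp (2 * |z|)) := by
  have h2 : Real.sqrt 2 ≤ 2 := by rw [Real.sqrt_le_left] <;> norm_num
  have hb := Matrix.det_le (A := goe n x - (Real.sqrt 2 * z) • (1 : Matrix (Fin n) (Fin n) ℝ))
    (abv := AbsoluteValue.abs) (x := 2 * ∑ p, |x p| + 2 * |z|) (fun i j => by
      rw [AbsoluteValue.abs_apply, Matrix.sub_apply]
      refine (abs_sub _ _).trans (add_le_add (abs_goe_le x i j) ?_)
      rw [Matrix.smul_apply, smul_eq_mul, abs_mul, abs_mul, abs_of_nonneg (Real.sqrt_nonneg 2)]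
      have : |(1 : Matrix (Fin n) (Fin n) ℝ) i j| ≤ 1 := by
        rw [Matrix.one_apply]; split_ifs <;> simp
      calc Real.sqrt 2 * |z| * |(1 : Matrix (Fin n) (Fin n) ℝ) i j| ≤ Real.sqrt 2 * |z| * 1 := by gcongr
        _ ≤ 2 * |z| := by rw [mul_one]; gcongr)
  rw [AbsoluteValue.abs_apply, Fintype.card_fin, nsmul_eq_mul] at hb
  refine hb.trans ?_
  rw [mul_assoc, ← Real.exp_add]
  have h0 : 0 ≤ ∑ i, |x i| := Finset.sum_nonneg fun i _ => abs_nonneg _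
  exact mul_le_mul_of_nonneg_left (pow_le_factorial_mul_exp (by positivity) n) (by positivity)

theorem lintegral_det_goe_lt_top (n : ℕ) :
    ∫⁻ x, ∫⁻ z, ENNReal.ofReal |(goe n x - (Real.sqrt 2 * z) • (1 : Matrix (Fin n) (Fin n) ℝ)).det|
      ∂(gaussianReal 0 1) ∂(stdG (Fin n × Fin n)) < ⊤ := by
  have h1 := (integrable_exp_sum_abs (ι := Fin n × Fin n) 2).lintegral_lt_top
  have h2 := (integrable_exp_abs_gaussian 2).lintegral_lt_top
  calc _ ≤ ∫⁻ x : Fin n × Fin n → ℝ, ∫⁻ z, ENNReal.ofReal (n.factorial * n.factorial) *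
        ENNReal.ofReal (Real.exp (2 * ∑ p, |x p|)) * ENNReal.ofReal (Real.exp (2 * |z|))
          ∂(gaussianReal 0 1) ∂(stdG (Fin n × Fin n)) := by
        refine lintegral_mono fun x => lintegral_mono fun z => ?_
        rw [← ENNReal.ofReal_mul (by positivity), ← ENNReal.ofReal_mul (by positivity), mul_assoc]
        exact ENNReal.ofReal_le_ofReal (abs_det_goe_le x z)
    _ = ENNReal.ofReal (n.factorial * n.factorial) *
        (∫⁻ x : Fin n × Fin n → ℝ, ENNReal.ofReal (Real.exp (2 * ∑ p, |x p|)) ∂(stdG (Fin n × Fin n))) *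
        ∫⁻ z, ENNReal.ofReal (Real.exp (2 * |z|)) ∂(gaussianReal 0 1) := by
        rw [← lintegral_const_mul' _ _ ENNReal.ofReal_ne_top, ← lintegral_mul_const' _ _ h2.ne]
        refine lintegral_congr fun x => ?_
        rw [lintegral_const_mul' _ _ (ENNReal.mul_ne_top ENNReal.ofReal_ne_top ENNReal.ofReal_ne_top)]
    _ < ⊤ := ENNReal.mul_lt_top (ENNReal.mul_lt_top ENNReal.ofReal_lt_top h1) h2

end integrability

theorem lintegral_gamma {a r : ℝ} (ha : 0 < a) (hr : 0 < r) :
    ∫⁻ t in Set.Ioi (0 : ℝ), ENNReal.ofReal (t ^ (a - 1) * Real.exp (-(r * t))) =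
      ENNReal.ofReal ((1 / r) ^ a * Real.Gamma a) := by
  have h := Real.integral_rpow_mul_exp_neg_mul_Ioi ha hr
  have hpos : 0 < (1 / r) ^ a * Real.Gamma a := mul_pos (by positivity) (Real.Gamma_pos_of_pos ha)
  rw [← h, ofReal_integral_eq_lintegral_ofReal]
  · exact Integrable.of_integral_ne_zero (by rw [h]; exact hpos.ne')
  · refine (ae_restrict_iff' measurableSet_Ioi).2 (ae_of_all _ fun t ht => ?_)
    have : 0 < t := ht
    positivity

theorem lintegral_exp_neg_sq (n : ℕ) {t : ℝ} (ht : 0 < t) :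
    ∫⁻ u : Fin n → ℝ, ENNReal.ofReal (Real.exp (-(t * ∑ i, u i ^ 2))) =
      ENNReal.ofReal (Real.sqrt (Real.pi / t) ^ n) := by
  have e : ∀ u : Fin n → ℝ, Real.exp (-(t * ∑ i, u i ^ 2)) = ∏ i, Real.exp (-t * u i ^ 2) := by
    intro u; rw [← Real.exp_sum, ← Finset.mul_sum, neg_mul]
  have h : ∫ u : Fin n → ℝ, ∏ i, Real.exp (-t * u i ^ 2) = Real.sqrt (Real.pi / t) ^ n := by
    rw [integral_fintype_prod_volume_eq_prod (f := fun (_ : Fin n) (y : ℝ) => Real.exp (-t * y ^ 2))]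
    simp only [integral_gaussian, Finset.prod_const, Finset.card_univ, Fintype.card_fin]
  simp_rw [e]
  rw [← h, ofReal_integral_eq_lintegral_ofReal]
  · exact Integrable.fintype_prod (f := fun (_ : Fin n) (y : ℝ) => Real.exp (-t * y ^ 2))
      fun _ => integrable_exp_neg_mul_sq ht
  · exact ae_of_all _ fun u => Finset.prod_nonneg fun i _ => (Real.exp_pos _).le

theorem aN_eq {n : ℕ} (hn : 0 < n) : aN n =
    ENNReal.ofReal (Real.sqrt 2 ^ n * Real.Gamma (n / 2) / Real.Gamma n) := by
  have hnr : (0 : ℝ) < n := by exact_mod_cast hn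
  have hG := Real.Gamma_pos_of_pos hnr
  have h2pi : 0 < Real.sqrt (2 * Real.pi) := by positivity
  have h1 : ∀ u : Fin n → ℝ, ENNReal.ofReal ((Real.sqrt (2 * Real.pi))⁻¹ ^ n * (2 / rq u) ^ n) =
      ENNReal.ofReal ((2 / Real.sqrt (2 * Real.pi)) ^ n / Real.Gamma n) *
        ∫⁻ t in Set.Ioi (0 : ℝ), ENNReal.ofReal (t ^ ((n : ℝ) - 1) * Real.exp (-(rq u * t))) := by
    intro u
    have := rq_pos u
    rw [lintegral_gamma hnr this, ← ENNReal.ofReal_mul (by positivity), Real.rpow_natCast]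
    congr 1
    rw [div_mul_eq_mul_div, ← mul_assoc, mul_div_assoc, div_self hG.ne', mul_one, ← mul_pow, ← mul_pow]
    congr 1
    field_simp
  unfold aN
  simp_rw [h1]
  have hm : Measurable fun p : (Fin n → ℝ) × ℝ =>
      ENNReal.ofReal (p.2 ^ ((n : ℝ) - 1) * Real.exp (-(rq p.1 * p.2))) := by
    unfold rq; fun_prop
  rw [lintegral_const_mul _ hm.lintegral_prod_right', lintegral_lintegral_swap hm.aemeasurable]
  have h2 : ∀ t ∈ Set.Ioi (0 : ℝ), ∫⁻ u : Fin n → ℝ,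
      ENNReal.ofReal (t ^ ((n : ℝ) - 1) * Real.exp (-(rq u * t))) =
      ENNReal.ofReal (Real.sqrt Real.pi ^ n) *
        ENNReal.ofReal (t ^ ((n : ℝ) / 2 - 1) * Real.exp (-(1 * t))) := by
    intro t ht
    have ht : 0 < t := ht
    have e : ∀ u : Fin n → ℝ, ENNReal.ofReal (t ^ ((n : ℝ) - 1) * Real.exp (-(rq u * t))) =
        ENNReal.ofReal (t ^ ((n : ℝ) - 1) * Real.exp (-t)) *
          ENNReal.ofReal (Real.exp (-(t * ∑ i, u i ^ 2))) := by
      intro u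
      rw [← ENNReal.ofReal_mul (by positivity), mul_assoc, ← Real.exp_add, rq]
      congr 3; ring
    simp_rw [e]
    rw [lintegral_const_mul' _ _ ENNReal.ofReal_ne_top, lintegral_exp_neg_sq n ht,
      ← ENNReal.ofReal_mul (by positivity), ← ENNReal.ofReal_mul (by positivity)]
    congr 1
    rw [Real.sqrt_div Real.pi_pos.le, div_pow,
      show (n : ℝ) / 2 - 1 = ((n : ℝ) - 1) - n / 2 by ring, Real.rpow_sub ht ((n : ℝ) - 1), one_mul,
      show t ^ ((n : ℝ) / 2) = Real.sqrt t ^ n by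
        rw [Real.sqrt_eq_rpow, ← Real.rpow_natCast, ← Real.rpow_mul ht.le]; congr 1; ring]
    field_simp
  rw [setLIntegral_congr_fun measurableSet_Ioi h2, lintegral_const_mul' _ _ ENNReal.ofReal_ne_top,
    lintegral_gamma (by positivity) one_pos, ← ENNReal.ofReal_mul (by positivity),
    ← ENNReal.ofReal_mul (by positivity)]
  congr 1
  have hs : (2 / Real.sqrt (2 * Real.pi)) ^ n * Real.sqrt Real.pi ^ n = Real.sqrt 2 ^ n := by
    rw [← mul_pow]
    congr 1
    rw [Real.sqrt_mul (by norm_num)]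
    have : Real.sqrt 2 * Real.sqrt 2 = 2 := Real.mul_self_sqrt (by norm_num)
    field_simp
    linarith
  rw [div_one, Real.one_rpow, one_mul, ← hs]
  ring

theorem aN_ne_top {n : ℕ} (hn : 0 < n) : aN n ≠ ⊤ := by
  rw [aN_eq hn]; exact ENNReal.ofReal_ne_top

section eigen
variable {N : ℕ} {W : Matrix (Fin N) (Fin N) ℝ} {σ : Fin N → ℝ}

/-- Critical points of the quadratic form of `W` on the sphere. -/
def eigSet (W : Matrix (Fin N) (Fin N) ℝ) : Set (Fin N → ℝ) :=
  {σ | dotp σ σ = N ∧ ∀ v, dotp σ v = 0 → dotp v (W.mulVec σ) = 0}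

/-- Rayleigh quotient on the sphere of radius `√N`. -/
def rayl (W : Matrix (Fin N) (Fin N) ℝ) (σ : Fin N → ℝ) : ℝ := dotp σ (W.mulVec σ) / N

theorem mulVec_of_mem_eigSet (hN : 0 < N) (h : σ ∈ eigSet W) : W.mulVec σ = rayl W σ • σ := by
  have hN' : (N : ℝ) ≠ 0 := by exact_mod_cast hN.ne'
  set x := W.mulVec σ - rayl W σ • σ with hx
  have h1 : dotp σ x = 0 := by
    rw [hx, dotp_eq, dotProduct_sub, dotProduct_smul, ← dotp_eq, ← dotp_eq, h.1, rayl, smul_eq_mul]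
    field_simp; ring
  have h2 : dotp x x = 0 := by
    have e : dotp x x = dotp x (W.mulVec σ) - rayl W σ * dotp x σ := by
      nth_rewrite 2 [hx]
      rw [dotp_eq, dotProduct_sub, dotProduct_smul, smul_eq_mul]; rfl
    rw [e, h.2 x h1, dotp_comm, h1]; ring
  exact sub_eq_zero.1 (dotp_self_eq_zero h2)

theorem mem_eigSet_of_mulVec {l : ℝ} (h : dotp σ σ = N) (hl : W.mulVec σ = l • σ) : σ ∈ eigSet W := by
  refine ⟨h, fun v hv => ?_⟩
  rw [hl, dotp_eq, dotProduct_smul, ← dotp_eq, dotp_comm, hv, smul_zero]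

theorem rayl_eq {l : ℝ} (hN : 0 < N) (h : dotp σ σ = N) (hl : W.mulVec σ = l • σ) : rayl W σ = l := by
  have hN' : (N : ℝ) ≠ 0 := by exact_mod_cast hN.ne'
  rw [rayl, hl, dotp_eq, dotProduct_smul, ← dotp_eq, h, smul_eq_mul]
  field_simp

theorem qidx_eigen {l s : ℝ} (hN : 0 < N) (hW : W.IsSymm) (hs : 0 < s) (h : dotp σ σ = N)
    (hl : W.mulVec σ = l • σ) :
    qidx σ (fun v => s * (dotp v (W.mulVec v) - l * dotp v v)) = nlt W l := by
  have hN' : (N : ℝ) ≠ 0 := by exact_mod_cast hN.ne'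
  rw [← negIdx_sub_smul]
  have hq : ∀ v, dotp v ((W - l • (1 : Matrix (Fin N) (Fin N) ℝ)).mulVec v) =
      dotp v (W.mulVec v) - l * dotp v v := by
    intro v
    rw [Matrix.sub_mulVec, Matrix.smul_mulVec, Matrix.one_mulVec, dotp_eq, dotProduct_sub,
      dotProduct_smul]; rfl
  have hs' : ∀ a : ℝ, s * a < 0 ↔ a < 0 := fun a => by
    constructor
    · intro h; by_contra h2; exact absurd h (not_lt.2 (mul_nonneg hs.le (not_lt.1 h2)))
    · intro h; exact mul_neg_of_pos_of_neg hs h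
  have hσ : ∀ v, dotp σ (W.mulVec v) = l * dotp σ v := by
    intro v
    rw [dotp_eq, Matrix.dotProduct_mulVec, ← Matrix.mulVec_transpose, hW.eq, hl, smul_dotProduct]; rfl
  unfold qidx negIdx
  congr 1
  ext d
  simp only [hq, hs']
  constructor
  · rintro ⟨V, h1, _, h3⟩
    exact ⟨V, h1, h3⟩
  · rintro ⟨V, h1, h3⟩
    let pr : (Fin N → ℝ) →ₗ[ℝ] (Fin N → ℝ) :=
      { toFun := fun v => v - (dotp v σ / N) • σ
        map_add' := fun x y => by
          rw [dotp_eq, dotp_eq, dotp_eq, add_dotProduct]; ext i; simp; ring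
        map_smul' := fun a x => by
          rw [dotp_eq, dotp_eq, smul_dotProduct]; ext i; simp; ring }
    have hpr : ∀ v : Fin N → ℝ, pr v = v - (dotp v σ / N) • σ := fun v => rfl
    have hinv : ∀ (v : Fin N → ℝ) (a : ℝ), dotp (v - a • σ) (W.mulVec (v - a • σ)) - l * dotp (v - a • σ) (v - a • σ) =
        dotp v (W.mulVec v) - l * dotp v v := by
      intro v a
      have e1 := hσ v
      have e2 : dotp v (W.mulVec σ) = l * dotp v σ := by rw [hl, dotp_eq, dotProduct_smul]; rfl
      have e3 : dotp σ (W.mulVec σ) = l * dotp σ σ := by rw [hl, dotp_eq, dotProduct_smul]; rfl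
      have e4 := dotp_comm σ v
      simp only [dotp_eq] at e1 e2 e3 e4 ⊢
      simp only [Matrix.mulVec_sub, Matrix.mulVec_smul, sub_dotProduct, dotProduct_sub,
        smul_dotProduct, dotProduct_smul, smul_eq_mul, e1, e2, e3, e4]
      ring
    have hinj : Function.Injective (pr.domRestrict V) := by
      rw [injective_iff_map_eq_zero]
      rintro ⟨v, hv⟩ hv0
      by_contra hne
      have hv1 : v ≠ 0 := fun h => hne (by ext1; exact h)
      have h4 := h3 v hv hv1
      have h5 : pr v = 0 := hv0
      rw [← hinv v (dotp v σ / N), ← hpr, h5] at h4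
      simp [dotp] at h4
    refine ⟨LinearMap.range (pr.domRestrict V), ?_, ?_, ?_⟩
    · rw [LinearMap.finrank_range_of_inj hinj, h1]
    · rintro _ ⟨v, rfl⟩
      rw [LinearMap.domRestrict_apply, hpr, dotp_eq, sub_dotProduct, smul_dotProduct, ← dotp_eq,
        ← dotp_eq, h, smul_eq_mul]
      field_simp; ring
    · rintro _ ⟨v, rfl⟩ hv0
      rw [LinearMap.domRestrict_apply, hpr, hinv]
      refine h3 v v.2 fun h => hv0 ?_
      rw [LinearMap.domRestrict_apply, h, map_zero]

/-- A vector given by its eigen-coordinates. -/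
def eigVec (W : Matrix (Fin N) (Fin N) ℝ) (y : Fin N → ℝ) : Fin N → ℝ := (evm W).transpose.mulVec y

theorem dotp_eigVec (y y' : Fin N → ℝ) : dotp (eigVec W y) (eigVec W y') = dotp y y' :=
  dotp_mulVec _ (by rw [Matrix.transpose_transpose, evm_mul_transpose]) _ _

theorem eigVec_evm (v : Fin N → ℝ) : eigVec W ((evm W).mulVec v) = v := by
  rw [eigVec, Matrix.mulVec_mulVec, transpose_mul_evm, Matrix.one_mulVec]

theorem evm_eigVec (v : Fin N → ℝ) : (evm W).mulVec (eigVec W v) = v := by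
  rw [eigVec, Matrix.mulVec_mulVec, evm_mul_transpose, Matrix.one_mulVec]

theorem mulVec_eigVec (hW : W.IsSymm) (y : Fin N → ℝ) :
    W.mulVec (eigVec W y) = eigVec W fun i => evs W i * y i := by
  have h := sy_eq_diag W
  rw [sy_eq_self hW] at h
  have h2 : W * (evm W).transpose = (evm W).transpose * Matrix.diagonal (evs W) := by
    refine (congrArg (· * (evm W).transpose) h).trans ?_
    rw [Matrix.mul_assoc, Matrix.mul_assoc, evm_mul_transpose, Matrix.mul_one]
  rw [eigVec, Matrix.mulVec_mulVec, h2, ← Matrix.mulVec_mulVec, eigVec]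
  congr 1
  ext i
  rw [Matrix.mulVec_diagonal]

theorem evs_mul_of_mulVec (hW : W.IsSymm) {l : ℝ} (hl : W.mulVec σ = l • σ) (i : Fin N) :
    (evs W i - l) * (evm W).mulVec σ i = 0 := by
  have h := evm_mul_sy W
  rw [sy_eq_self hW] at h
  have h2 := congrArg (fun M => Matrix.mulVec M σ i) h
  simp only [← Matrix.mulVec_mulVec, hl, Matrix.mulVec_smul, Matrix.mulVec_diagonal, Pi.smul_apply,
    smul_eq_mul] at h2
  linarith

theorem nlt_evs (hinj : Function.Injective (evs W)) (i : Fin N) : nlt W (evs W i) + i + 1 = N := by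
  have hanti : StrictAnti (evs W) := (evs_antitone W).strictAnti_of_injective hinj
  have : nge W (evs W i) = i + 1 := by
    unfold nge
    rw [← Fin.card_Iic]
    congr 1
    ext j
    simp [hanti.le_iff_ge]
  have := nge_add_nlt W (evs W i)
  omega

theorem eigSet_index_eq (hN : 0 < N) (hW : W.IsSymm) (hinj : Function.Injective (evs W)) (k : Fin N)
    (B : Set ℝ) : {σ | σ ∈ eigSet W ∧ rayl W σ ∈ B ∧ nlt W (rayl W σ) + k + 1 = N} =
      {σ | evs W k ∈ B ∧ (σ = eigVec W (Pi.single k (Real.sqrt N)) ∨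
        σ = eigVec W (Pi.single k (-Real.sqrt N)))} := by
  ext σ
  have hN' : (0 : ℝ) < N := by exact_mod_cast hN
  constructor
  · rintro ⟨h1, h2, h3⟩
    have hl := mulVec_of_mem_eigSet hN h1
    set y := (evm W).mulVec σ with hy
    have hyy : dotp y y = N := by
      rw [← dotp_eigVec (W := W), hy, eigVec_evm, h1.1]
    have hne : ∃ i, y i ≠ 0 := by
      by_contra hcon
      push Not at hcon
      simp [dotp, hcon] at hyy
      linarith
    obtain ⟨i, hi⟩ := hne
    have hli : rayl W σ = evs W i := by
      rcases mul_eq_zero.1 (evs_mul_of_mulVec hW hl i) with h | h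
      · linarith
      · exact absurd h hi
    have hik : i = k := by
      have := nlt_evs hinj i
      rw [hli] at h3
      ext; omega
    subst hik
    have hyj : ∀ j, j ≠ i → y j = 0 := by
      intro j hj
      rcases mul_eq_zero.1 (evs_mul_of_mulVec hW hl j) with h | h
      · exact absurd (hinj (by linarith : evs W j = evs W i)) hj
      · exact h
    have hys : y = Pi.single i (y i) := by
      ext j
      by_cases hj : j = i
      · subst hj; simp
      · rw [hyj j hj, Pi.single_eq_of_ne hj]
    have hy2 : y i * y i = N := by
      rw [hys] at hyy
      simpa [dotp, Pi.single_apply] using hyy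
    refine ⟨hli ▸ h2, ?_⟩
    have hσ : σ = eigVec W y := (eigVec_evm σ).symm
    have : y i = Real.sqrt N ∨ y i = -Real.sqrt N := by
      rw [← sq_eq_sq_iff_eq_or_eq_neg, Real.sq_sqrt hN'.le, sq, hy2]
    rcases this with h | h
    · left; rw [hσ, hys, h]
    · right; rw [hσ, hys, h]
  · rintro ⟨hB, h⟩
    have key : ∀ a : ℝ, a * a = N → σ = eigVec W (Pi.single k a) →
        σ ∈ eigSet W ∧ rayl W σ ∈ B ∧ nlt W (rayl W σ) + k + 1 = N := by
      rintro a ha rfl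
      have e1 : dotp (eigVec W (Pi.single k a)) (eigVec W (Pi.single k a)) = N := by
        rw [dotp_eigVec]; simpa [dotp, Pi.single_apply] using ha
      have e2 : W.mulVec (eigVec W (Pi.single k a)) = evs W k • eigVec W (Pi.single k a) := by
        rw [mulVec_eigVec hW, eigVec, eigVec, ← Matrix.mulVec_smul]
        congr 1; ext j
        by_cases hj : j = k
        · subst hj; simp
        · simp [Pi.single_eq_of_ne hj]
      refine ⟨mem_eigSet_of_mulVec e1 e2, ?_, ?_⟩
      · rw [rayl_eq hN e1 e2]; exact hB
      · rw [rayl_eq hN e1 e2]; exact nlt_evs hinj k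
    rcases h with h | h
    · exact key _ (Real.mul_self_sqrt hN'.le) h
    · exact key _ (by rw [neg_mul_neg, Real.mul_self_sqrt hN'.le]) h

open Classical in
theorem ecount_eigSet_index (hN : 0 < N) (hW : W.IsSymm) (hinj : Function.Injective (evs W)) (k : Fin N)
    (B : Set ℝ) : ecount {σ | σ ∈ eigSet W ∧ rayl W σ ∈ B ∧ nlt W (rayl W σ) + k + 1 = N} =
      if evs W k ∈ B then 2 else 0 := by
  rw [eigSet_index_eq hN hW hinj]
  have hN' : (0 : ℝ) < N := by exact_mod_cast hN
  split_ifs with h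
  · have hne : eigVec W (Pi.single k (Real.sqrt N)) ≠ eigVec W (Pi.single k (-Real.sqrt N)) := by
      intro he
      have := congrArg (evm W).mulVec he
      rw [evm_eigVec, evm_eigVec] at this
      have h2 := congrFun this k
      simp only [Pi.single_eq_same] at h2
      have : 0 < Real.sqrt N := Real.sqrt_pos.2 hN'
      linarith
    have : {σ | evs W k ∈ B ∧ (σ = eigVec W (Pi.single k (Real.sqrt N)) ∨
        σ = eigVec W (Pi.single k (-Real.sqrt N)))} = {eigVec W (Pi.single k (Real.sqrt N)),
          eigVec W (Pi.single k (-Real.sqrt N))} := by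
      ext σ; simp [h]
    rw [this, ecount_eq_encard, Set.encard_pair hne]
    rfl
  · simp [h, ecount]

theorem infinite_eigSet_of_not_injective (hN : 0 < N) (hW : W.IsSymm) (h : ¬ Function.Injective (evs W)) :
    ∃ m < N, {σ | σ ∈ eigSet W ∧ nlt W (rayl W σ) = m}.Infinite := by
  have hN' : (0 : ℝ) < N := by exact_mod_cast hN
  unfold Function.Injective at h
  push Not at h
  obtain ⟨i, j, hij, hne⟩ := h
  refine ⟨nlt W (evs W i), ?_, ?_⟩
  · have h1 : 0 < nge W (evs W i) := Finset.card_pos.2 ⟨i, by simp⟩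
    have := nge_add_nlt W (evs W i)
    omega
  set r := Real.sqrt N
  have hr : r * r = N := Real.mul_self_sqrt hN'.le
  set f : ℝ → (Fin N → ℝ) := fun t =>
    eigVec W (Pi.single i (r * Real.cos t) + Pi.single j (r * Real.sin t)) with hf
  refine Set.infinite_of_injOn_mapsTo (f := f) (s := Set.Icc 0 Real.pi) ?_ ?_
    (Set.Icc_infinite Real.pi_pos)
  · intro s hs t ht hst
    have := congrFun (congrArg (evm W).mulVec hst) i
    rw [hf] at this
    simp only [evm_eigVec, Pi.add_apply, Pi.single_eq_same, Pi.single_eq_of_ne hne, add_zero] at this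
    exact Real.injOn_cos hs ht (mul_left_cancel₀ (Real.sqrt_pos.2 hN').ne' this)
  · intro t _
    have e1 : dotp (f t) (f t) = N := by
      rw [show dotp (f t) (f t) = _ from dotp_eigVec _ _]
      simp only [dotp_eq, add_dotProduct, dotProduct_add, single_dotProduct,
        Pi.single_eq_same, Pi.single_eq_of_ne hne, Pi.single_eq_of_ne hne.symm]
      linear_combination hr + r * r * Real.sin_sq_add_cos_sq t
    have e2 : W.mulVec (f t) = evs W i • f t := by
      rw [hf, mulVec_eigVec hW]
      simp only [eigVec, ← Matrix.mulVec_smul]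
      congr 1; ext l
      by_cases hl : l = i
      · subst hl; simp
      · by_cases hl2 : l = j
        · subst hl2; simp [hij]
        · simp [Pi.single_eq_of_ne hl, Pi.single_eq_of_ne hl2]
    exact ⟨mem_eigSet_of_mulVec e1 e2, by rw [rayl_eq hN e1 e2]⟩

end eigen

section twospin
variable {N : ℕ}

/-- Pairs of indices as couplings of the pure `2`-spin model. -/
def pairEquiv (N : ℕ) : Fin N × Fin N ≃ GIdx N 2 :=
  Equiv.ofBijective (fun p => ⟨⟨2, by simp⟩, ![p.1, p.2]⟩) (by
    constructor
    · rintro ⟨a, b⟩ ⟨a', b'⟩ h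
      simp only [Sigma.mk.injEq, heq_eq_eq, true_and] at h
      have h0 := congrFun h 0
      have h1 := congrFun h 1
      simp at h0 h1
      rw [h0, h1]
    · rintro ⟨⟨k, hk⟩, J⟩
      have hk2 : k = 2 := by have := Finset.mem_Icc.1 hk; omega
      subst hk2
      refine ⟨(J 0, J 1), ?_⟩
      refine congrArg (Sigma.mk _) (funext fun i => ?_)
      fin_cases i <;> rfl)

/-- The couplings of the `2`-spin model as an array. -/
def gmat (g : GIdx N 2 → ℝ) : Fin N × Fin N → ℝ := fun p => g (pairEquiv N p)

theorem goe_isSymm (x : Fin N × Fin N → ℝ) : (goe N x).IsSymm := by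
  ext i j
  simp [goe, add_comm]

theorem feat_pair (σ : Fin N → ℝ) (p : Fin N × Fin N) :
    feat N 2 (pureC 2) σ (pairEquiv N p) = (Real.sqrt N)⁻¹ * (σ p.1 * σ p.2) := by
  have : feat N 2 (pureC 2) σ (pairEquiv N p) = pureC 2 2 * (N : ℝ) ^ (-((((2 : ℕ) : ℝ) - 1) / 2)) *
    ∏ i : Fin 2, σ (![p.1, p.2] i) := rfl
  rw [this, Fin.prod_univ_two]
  simp only [pureC, if_true, one_mul, Matrix.cons_val_zero, Matrix.cons_val_one]
  congr 1
  rw [Real.rpow_neg (by positivity), Real.sqrt_eq_rpow]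
  norm_num

theorem sum_feat_two (g : GIdx N 2 → ℝ) (σ : Fin N → ℝ) :
    ∑ J, g J * feat N 2 (pureC 2) σ J =
      Real.sqrt (2 / N) / 2 * dotp σ ((goe N (gmat g)).mulVec σ) := by
  rw [← (pairEquiv N).sum_comp]
  have hs : Real.sqrt 2 * Real.sqrt 2 = 2 := Real.mul_self_sqrt (by norm_num)
  have e : dotp σ ((goe N (gmat g)).mulVec σ) =
      Real.sqrt 2 * ∑ p : Fin N × Fin N, gmat g p * (σ p.1 * σ p.2) := by
    have e1 : dotp σ ((goe N (gmat g)).mulVec σ) = ∑ i, ∑ j, (gmat g (i, j) * (σ i * σ j) / Real.sqrt 2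
        + gmat g (j, i) * (σ j * σ i) / Real.sqrt 2) := by
      unfold dotp
      refine Finset.sum_congr rfl fun i _ => ?_
      rw [Matrix.mulVec, dotProduct, Finset.mul_sum]
      refine Finset.sum_congr rfl fun j _ => ?_
      simp only [goe]; ring
    rw [e1]
    simp only [Finset.sum_add_distrib]
    rw [Finset.sum_comm (f := fun i j => gmat g (j, i) * (σ j * σ i) / Real.sqrt 2),
      Fintype.sum_prod_type]
    simp only [← Finset.sum_div]
    field_simp
    rw [sq, hs]; ring
  rw [e, Real.sqrt_div (by norm_num)]
  simp only [feat_pair]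
  rw [← mul_assoc, Finset.mul_sum]
  refine Finset.sum_congr rfl fun p _ => ?_
  have : Real.sqrt 2 / Real.sqrt N / 2 * Real.sqrt 2 = (Real.sqrt N)⁻¹ := by
    rw [div_div, div_mul_eq_mul_div, hs, mul_comm (Real.sqrt N), ← div_div, div_self (by norm_num), one_div]
  rw [this]; simp only [gmat]; ring

theorem dotp_mulVec_symm {W : Matrix (Fin N) (Fin N) ℝ} (hW : W.IsSymm) (v w : Fin N → ℝ) :
    dotp v (W.mulVec w) = dotp w (W.mulVec v) := by
  rw [dotp_eq, Matrix.dotProduct_mulVec, ← Matrix.mulVec_transpose, hW.eq, dotProduct_comm, ← dotp_eq]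

theorem sum_feat1_two (g : GIdx N 2 → ℝ) (σ v : Fin N → ℝ) :
    ∑ J, g J * feat1 N 2 (pureC 2) σ v J =
      Real.sqrt (2 / N) * dotp v ((goe N (gmat g)).mulVec σ) := by
  have h1 : HasDerivAt (fun s : ℝ => ∑ J, g J * feat N 2 (pureC 2) (σ + s • v) J)
      (∑ J, g J * feat1 N 2 (pureC 2) σ v J) 0 :=
    HasDerivAt.fun_sum fun J _ => (hasFDerivAt_feat_line J σ v).const_mul _
  refine h1.unique ?_
  have e : ∀ s : ℝ, ∑ J, g J * feat N 2 (pureC 2) (σ + s • v) J = Real.sqrt (2 / N) / 2 *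
      (dotp σ ((goe N (gmat g)).mulVec σ) + s * dotp v ((goe N (gmat g)).mulVec σ) +
        s * (dotp v ((goe N (gmat g)).mulVec σ) + s * dotp v ((goe N (gmat g)).mulVec v))) := by
    intro s
    rw [sum_feat_two, Matrix.mulVec_add, Matrix.mulVec_smul, dotp_line_right, dotp_line_left,
      dotp_line_left, dotp_mulVec_symm (goe_isSymm _) σ v]
  simp_rw [e]
  have h2 := (((hasDerivAt_affine (dotp σ ((goe N (gmat g)).mulVec σ)) (dotp v ((goe N (gmat g)).mulVec σ))).fun_add
    ((hasDerivAt_id (0 : ℝ)).fun_mul (hasDerivAt_affine (dotp v ((goe N (gmat g)).mulVec σ))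
      (dotp v ((goe N (gmat g)).mulVec v))))).const_mul (Real.sqrt (2 / N) / 2))
  refine h2.congr_deriv ?_
  simp; ring

theorem sum_feat2_two (g : GIdx N 2 → ℝ) (σ v w : Fin N → ℝ) :
    ∑ J, g J * feat2 N 2 (pureC 2) σ v w J =
      Real.sqrt (2 / N) * dotp w ((goe N (gmat g)).mulVec v) := by
  have h1 : HasDerivAt (fun s : ℝ => ∑ J, g J * feat1 N 2 (pureC 2) (σ + s • v) w J)
      (∑ J, g J * feat2 N 2 (pureC 2) σ v w J) 0 :=
    HasDerivAt.fun_sum fun J _ => (hasFDerivAt_feat1_line J σ v w).const_mul _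
  refine h1.unique ?_
  simp_rw [sum_feat1_two, Matrix.mulVec_add, Matrix.mulVec_smul, dotp_line_right]
  exact (hasDerivAt_affine _ _).const_mul _

theorem isCrit_two (hN : 0 < N) (g : GIdx N 2 → ℝ) (σ : Fin N → ℝ) :
    IsCrit N 2 (pureC 2) g σ ↔ σ ∈ eigSet (goe N (gmat g)) := by
  have hs : Real.sqrt (2 / N) ≠ 0 := by positivity
  unfold IsCrit eigSet
  simp only [sum_feat1_two, mul_eq_zero, hs, false_or]
  rfl

theorem rad_two (g : GIdx N 2 → ℝ) (σ : Fin N → ℝ) :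
    (∑ J, g J * feat1 N 2 (pureC 2) σ σ J) / N = Real.sqrt (2 / N) * rayl (goe N (gmat g)) σ := by
  rw [sum_feat1_two, rayl, mul_div_assoc]

theorem qidx_two (hN : 0 < N) (g : GIdx N 2 → ℝ) {σ : Fin N → ℝ} (h : σ ∈ eigSet (goe N (gmat g))) :
    qidx σ (qform N 2 (pureC 2) g σ) = nlt (goe N (gmat g)) (rayl (goe N (gmat g)) σ) := by
  have hs : 0 < Real.sqrt (2 / N) := by positivity
  rw [← qidx_eigen hN (goe_isSymm _) hs h.1 (mulVec_of_mem_eigSet hN h)]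
  congr 1
  ext v
  rw [qform, sum_feat2_two, rad_two]; ring

theorem kap_two : kap 2 (pureC 2) = 2 := by simp [kap, pureC]
theorem nuu_two : nuu 2 (pureC 2) = 2 := by simp [nuu, pureC]; norm_num
theorem vv_two : vv 2 (pureC 2) = 2 := by rw [vv, kap_two, nuu_two]; norm_num

theorem lintegral_gmat {f : (Fin N × Fin N → ℝ) → ℝ≥0∞} (hf : Measurable f) :
    ∫⁻ g, f (gmat g) ∂(stdG (GIdx N 2)) = ∫⁻ x, f x ∂(stdG (Fin N × Fin N)) := by
  classical
  have h := lintegral_dotMap_eq (ι := GIdx N 2) (ι' := Fin N × Fin N) (κ := Fin N × Fin N)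
    (fun p => Pi.single (pairEquiv N p) 1) (fun p => Pi.single p 1) (fun i j => by
      simp only [Pi.single_apply, mul_ite, mul_one, mul_zero, Finset.sum_ite_eq', Finset.mem_univ, if_true,
        EmbeddingLike.apply_eq_iff_eq]) hf
  have e1 : ∀ g : GIdx N 2 → ℝ, dotMap (fun p => Pi.single (pairEquiv N p) 1) g = gmat g := by
    intro g; ext p; rw [dotMap_apply]; simp [Pi.single_apply, gmat]
  have e2 : ∀ g : Fin N × Fin N → ℝ, dotMap (fun p => Pi.single p 1) g = g := by
    intro g; ext p; rw [dotMap_apply]; simp [Pi.single_apply]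
  simpa only [e1, e2] using h

open Classical in
/-- The determinant integral appearing in the Kac–Rice formula for eigenvalues. -/
def detInt (n k : ℕ) (B : Set ℝ) : ℝ≥0∞ :=
  ∫⁻ x, ∫⁻ z, (if Real.sqrt 2 * z ∈ B ∧ nge (goe n x) (Real.sqrt 2 * z) = k then
    ENNReal.ofReal |(goe n x - (Real.sqrt 2 * z) • (1 : Matrix (Fin n) (Fin n) ℝ)).det| else 0)
      ∂(gaussianReal 0 1) ∂(stdG (Fin n × Fin n))

theorem detInt_lt_top (n k : ℕ) (B : Set ℝ) : detInt n k B < ⊤ := by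
  refine lt_of_le_of_lt ?_ (lintegral_det_goe_lt_top n)
  refine lintegral_mono fun x => lintegral_mono fun z => ?_
  split_ifs <;> simp

open Classical in
theorem kacRice_two {n k : ℕ} (hn : 0 < n) (hk : k ≤ n) {B : Set ℝ} (hB : MeasurableSet B) :
    ∫⁻ g, ecount {σ | σ ∈ eigSet (goe (n + 1) (gmat g)) ∧ rayl (goe (n + 1) (gmat g)) σ ∈ B ∧
      nlt (goe (n + 1) (gmat g)) (rayl (goe (n + 1) (gmat g)) σ) + k + 1 = n + 1}
        ∂(stdG (GIdx (n + 1) 2)) = aN n * detInt n k B ∧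
    AEMeasurable (fun g => ecount {σ | σ ∈ eigSet (goe (n + 1) (gmat g)) ∧
      rayl (goe (n + 1) (gmat g)) σ ∈ B ∧
      nlt (goe (n + 1) (gmat g)) (rayl (goe (n + 1) (gmat g)) σ) + k + 1 = n + 1})
        (stdG (GIdx (n + 1) 2)) := by
  have hs : (0 : ℝ) < Real.sqrt (2 / ((n : ℝ) + 1)) := by positivity
  have hS : MeasurableSet {q : ℝ × ℝ | q.1 / Real.sqrt (2 / ((n : ℝ) + 1)) ∈ B} :=
    (measurable_fst.div_const _) hB
  have h := kacRice_index (P := 2) (c := pureC 2) (by rw [nuu_two]; norm_num) (by rw [kap_two]; norm_num) hn hS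
    (n - k)
  have hset : ∀ g : GIdx (n + 1) 2 → ℝ, {σ | IsCrit (n + 1) 2 (pureC 2) g σ ∧
      (((∑ J, g J * feat1 (n + 1) 2 (pureC 2) σ σ J) / ((n + 1 : ℕ) : ℝ),
        ∑ J, g J * feat (n + 1) 2 (pureC 2) σ J) ∈
        {q : ℝ × ℝ | q.1 / Real.sqrt (2 / ((n : ℝ) + 1)) ∈ B} ∧
      qidx σ (qform (n + 1) 2 (pureC 2) g σ) = n - k)} =
      {σ | σ ∈ eigSet (goe (n + 1) (gmat g)) ∧ rayl (goe (n + 1) (gmat g)) σ ∈ B ∧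
      nlt (goe (n + 1) (gmat g)) (rayl (goe (n + 1) (gmat g)) σ) + k + 1 = n + 1} := by
    intro g
    ext σ
    simp only [Set.mem_ofPred_eq]
    rw [isCrit_two (N := n + 1) (Nat.succ_pos n)]
    refine and_congr_right fun hσ => ?_
    rw [rad_two, qidx_two (N := n + 1) (Nat.succ_pos n) g hσ]
    have : Real.sqrt (2 / ((n + 1 : ℕ) : ℝ)) * rayl (goe (n + 1) (gmat g)) σ /
        Real.sqrt (2 / ((n : ℝ) + 1)) = rayl (goe (n + 1) (gmat g)) σ := by
      push_cast; field_simp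
    rw [this]
    refine and_congr_right fun _ => ?_
    omega
  simp only [hset] at h
  refine ⟨h.2.trans ?_, h.1⟩
  rw [nuu_two, kap_two, vv_two, div_self (by norm_num), Real.sqrt_one, one_pow, ENNReal.ofReal_one, one_mul]
  congr 1
  unfold detInt
  refine lintegral_congr fun x => lintegral_congr fun z => ?_
  have e : (Real.sqrt (2 / ((n : ℝ) + 1)) * (Real.sqrt 2 * z)) / Real.sqrt (2 / ((n : ℝ) + 1)) =
    Real.sqrt 2 * z := by field_simp
  simp only [Set.mem_ofPred_eq, e]
  rw [lintegral_const, measure_univ, mul_one]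
  have := nge_add_nlt (goe n x) (Real.sqrt 2 * z)
  congr 1
  refine propext (and_congr_right fun _ => ?_)
  omega

theorem measurable_goe (n : ℕ) : Measurable fun x : Fin n × Fin n → ℝ => (fun i j => goe n x i j) := by
  refine measurable_pi_lambda _ fun i => measurable_pi_lambda _ fun j => ?_
  unfold goe; fun_prop

theorem measurable_evs_goe {n : ℕ} (i : Fin n) : Measurable fun x => evs (goe n x) i :=
  (measurable_evs i).comp (measurable_goe n)

theorem ae_injective_evs {n : ℕ} (hn : 0 < n) :
    ∀ᵐ g ∂(stdG (GIdx (n + 1) 2)), Function.Injective (evs (goe (n + 1) (gmat g))) := by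
  have h : ∀ k : Fin (n + 1), ∀ᵐ g ∂(stdG (GIdx (n + 1) 2)),
      ecount {σ | σ ∈ eigSet (goe (n + 1) (gmat g)) ∧ rayl (goe (n + 1) (gmat g)) σ ∈ Set.univ ∧
      nlt (goe (n + 1) (gmat g)) (rayl (goe (n + 1) (gmat g)) σ) + k + 1 = n + 1} < ⊤ := by
    intro k
    have h2 := kacRice_two hn (Nat.lt_succ_iff.1 k.2) (B := Set.univ) MeasurableSet.univ
    refine ae_lt_top' h2.2 ?_
    rw [h2.1]
    exact ENNReal.mul_ne_top (aN_ne_top hn) (detInt_lt_top _ _ _).ne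
  rw [← ae_all_iff] at h
  filter_upwards [h] with g hg
  by_contra hcon
  obtain ⟨m, hlt, hm⟩ := infinite_eigSet_of_not_injective (Nat.succ_pos n) (goe_isSymm _) hcon
  have := hg ⟨n - m, by omega⟩
  have heq : {σ | σ ∈ eigSet (goe (n + 1) (gmat g)) ∧ rayl (goe (n + 1) (gmat g)) σ ∈ Set.univ ∧
      nlt (goe (n + 1) (gmat g)) (rayl (goe (n + 1) (gmat g)) σ) + (n - m) + 1 = n + 1} =
      {σ | σ ∈ eigSet (goe (n + 1) (gmat g)) ∧ nlt (goe (n + 1) (gmat g)) (rayl (goe (n + 1) (gmat g)) σ) = m} := by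
    ext σ
    simp only [Set.mem_ofPred_eq, Set.mem_univ, true_and]
    refine and_congr_right fun _ => ?_
    omega
  simp only [heq, ecount_eq_encard, hm.encard_eq] at this
  simp at this

/-- The law of the `k`-th largest eigenvalue of the GOE through determinants of smaller size. -/
theorem two_mul_prob_evs {n k : ℕ} (hn : 0 < n) (hk : k < n + 1) {B : Set ℝ} (hB : MeasurableSet B) :
    2 * stdG (Fin (n + 1) × Fin (n + 1)) {x | evs (goe (n + 1) x) ⟨k, hk⟩ ∈ B} = aN n * detInt n k B := by
  classical
  rw [← (kacRice_two hn (Nat.lt_succ_iff.1 hk) hB).1]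
  have hm : Measurable fun x => (if evs (goe (n + 1) x) ⟨k, hk⟩ ∈ B then (2 : ℝ≥0∞) else 0) :=
    Measurable.ite ((measurable_evs_goe _) hB) measurable_const measurable_const
  have e : ∫⁻ x, (if evs (goe (n + 1) x) ⟨k, hk⟩ ∈ B then (2 : ℝ≥0∞) else 0)
      ∂(stdG (Fin (n + 1) × Fin (n + 1))) =
      2 * stdG (Fin (n + 1) × Fin (n + 1)) {x | evs (goe (n + 1) x) ⟨k, hk⟩ ∈ B} := by
    have hB' : MeasurableSet {x | evs (goe (n + 1) x) ⟨k, hk⟩ ∈ B} := (measurable_evs_goe _) hB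
    rw [← lintegral_indicator_const hB']
    refine lintegral_congr fun x => ?_
    by_cases h : evs (goe (n + 1) x) ⟨k, hk⟩ ∈ B
    · rw [if_pos h, Set.indicator_of_mem (by exact h)]
    · rw [if_neg h, Set.indicator_of_notMem (by exact h)]
  rw [← e, ← lintegral_gmat hm]
  refine lintegral_congr_ae ?_
  filter_upwards [ae_injective_evs hn] with g hg
  rw [← ecount_eigSet_index (Nat.succ_pos n) (goe_isSymm _) hg ⟨k, hk⟩ B]

end twospin

section reduction

theorem measurable_goe_pair (n : ℕ) : Measurable fun p : (Fin n × Fin n → ℝ) × ℝ =>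
    ((fun i j => goe n p.1 i j : Fin n → Fin n → ℝ), Real.sqrt 2 * p.2) :=
  ((measurable_goe n).comp measurable_fst).prodMk (measurable_snd.const_mul _)

theorem measurable_det_goe (n : ℕ) : Measurable fun p : (Fin n × Fin n → ℝ) × ℝ =>
    (goe n p.1 - (Real.sqrt 2 * p.2) • (1 : Matrix (Fin n) (Fin n) ℝ)).det := by
  refine measurable_det fun i j => ?_
  simp only [Matrix.sub_apply, Matrix.smul_apply, goe]
  fun_prop

open Classical in
/-- The weight in the determinant integral. -/
def detWt (n k : ℕ) (p : (Fin n × Fin n → ℝ) × ℝ) : ℝ≥0∞ :=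
  if nge (goe n p.1) (Real.sqrt 2 * p.2) = k then
    ENNReal.ofReal |(goe n p.1 - (Real.sqrt 2 * p.2) • (1 : Matrix (Fin n) (Fin n) ℝ)).det| else 0

theorem measurable_detWt (n k : ℕ) : Measurable (detWt n k) := by
  unfold detWt
  refine Measurable.ite ?_ ?_ measurable_const
  · exact (measurable_nge.comp (measurable_goe_pair n)) (measurableSet_singleton k)
  · exact (measurable_det_goe n).abs.ennreal_ofReal

theorem detInt_eq (n k : ℕ) (B : Set ℝ) :
    detInt n k B = ∫⁻ x, ∫⁻ z, B.indicator 1 (Real.sqrt 2 * z) * detWt n k (x, z)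
      ∂(gaussianReal 0 1) ∂(stdG (Fin n × Fin n)) := by
  unfold detInt detWt
  refine lintegral_congr fun x => lintegral_congr fun z => ?_
  by_cases h : Real.sqrt 2 * z ∈ B
  · simp [h]
  · simp [h]

theorem two_mul_lintegral_evs {n k : ℕ} (hn : 0 < n) (hk : k < n + 1) {φ : ℝ → ℝ≥0∞} (hφ : Measurable φ) :
    2 * ∫⁻ x, φ (evs (goe (n + 1) x) ⟨k, hk⟩) ∂(stdG (Fin (n + 1) × Fin (n + 1))) =
      aN n * ∫⁻ x, ∫⁻ z, φ (Real.sqrt 2 * z) * detWt n k (x, z)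
        ∂(gaussianReal 0 1) ∂(stdG (Fin n × Fin n)) := by
  have hm : Measurable fun p : (Fin n × Fin n → ℝ) × ℝ => Real.sqrt 2 * p.2 := measurable_snd.const_mul _
  set m2 : Measure ℝ := (((stdG (Fin n × Fin n)).prod (gaussianReal 0 1)).withDensity (detWt n k)).map
    (fun p => Real.sqrt 2 * p.2) with hm2
  have key : ∀ ψ : ℝ → ℝ≥0∞, Measurable ψ → ∫⁻ y, ψ y ∂m2 = ∫⁻ x, ∫⁻ z, ψ (Real.sqrt 2 * z) * detWt n k (x, z)
        ∂(gaussianReal 0 1) ∂(stdG (Fin n × Fin n)) := by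
    intro ψ hψ
    have hψ2 : Measurable fun p : (Fin n × Fin n → ℝ) × ℝ => ψ (Real.sqrt 2 * p.2) := hψ.comp hm
    rw [hm2, lintegral_map hψ hm, lintegral_withDensity_eq_lintegral_mul _ (measurable_detWt n k) hψ2,
      lintegral_prod _ ((measurable_detWt n k).mul hψ2).aemeasurable]
    refine lintegral_congr fun x => lintegral_congr fun z => ?_
    rw [Pi.mul_apply, mul_comm]
  have hmeas : (2 : ℝ≥0∞) • (stdG (Fin (n + 1) × Fin (n + 1))).map (fun x => evs (goe (n + 1) x) ⟨k, hk⟩) =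
      aN n • m2 := by
    ext B hB
    rw [Measure.smul_apply, Measure.smul_apply, Measure.map_apply (measurable_evs_goe _) hB, smul_eq_mul,
      smul_eq_mul]
    refine (two_mul_prob_evs hn hk hB).trans ?_
    rw [detInt_eq n k _, ← key _ (measurable_one.indicator hB), lintegral_indicator_one hB]
  rw [← key φ hφ, ← lintegral_map hφ (measurable_evs_goe _), ← smul_eq_mul, ← smul_eq_mul,
    ← lintegral_smul_measure, ← lintegral_smul_measure, hmeas]

/-- Change of variance for Gaussian integrals. -/
theorem lintegral_gaussian_scale {v : ℝ} (hv : 0 < v) {F : ℝ → ℝ≥0∞} (hF : Measurable F) :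
    ∫⁻ z, F (Real.sqrt v * z) ∂(gaussianReal 0 1) = ∫⁻ z, ENNReal.ofReal (Real.sqrt (2 / v) *
      Real.exp (-(1 / (2 * v) - 1 / 4) * (Real.sqrt 2 * z) ^ 2)) * F (Real.sqrt 2 * z) ∂(gaussianReal 0 1) := by
  have hmap : ∀ w : ℝ, 0 < w → ∀ G : ℝ → ℝ≥0∞, Measurable G →
      ∫⁻ z, G (Real.sqrt w * z) ∂(gaussianReal 0 1) =
        ∫⁻ y, ENNReal.ofReal ((Real.sqrt (2 * Real.pi * w))⁻¹ * Real.exp (-y ^ 2 / (2 * w))) * G y := by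
    intro w hw G hG
    rw [← lintegral_map hG (measurable_const_mul _), gaussianReal_map_const_mul]
    have hne : (NNReal.mk (Real.sqrt w ^ 2) (sq_nonneg _) * 1 : ℝ≥0) ≠ 0 := by
      intro h
      have := congrArg NNReal.toReal h
      simp only [mul_one, NNReal.coe_mk, NNReal.coe_zero, Real.sq_sqrt hw.le] at this
      exact hw.ne' this
    rw [gaussianReal_of_var_ne_zero _ hne,
      lintegral_withDensity_eq_lintegral_mul _ (measurable_gaussianPDF _ _) hG]
    refine lintegral_congr fun y => ?_
    rw [Pi.mul_apply, gaussianPDF, gaussianPDFReal]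
    simp [Real.sq_sqrt hw.le]
  rw [hmap v hv F hF, hmap 2 (by norm_num) (fun y => ENNReal.ofReal (Real.sqrt (2 / v) *
      Real.exp (-(1 / (2 * v) - 1 / 4) * y ^ 2)) * F y) (by fun_prop)]
  refine lintegral_congr fun y => ?_
  rw [← mul_assoc, ← ENNReal.ofReal_mul (by positivity)]
  congr 2
  have e1 : (Real.sqrt (2 * Real.pi * v))⁻¹ = (Real.sqrt (2 * Real.pi * 2))⁻¹ * Real.sqrt (2 / v) := by
    rw [← Real.sqrt_inv, ← Real.sqrt_inv, ← Real.sqrt_mul (by positivity)]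
    congr 1; field_simp
  have e2 : Real.exp (-y ^ 2 / (2 * v)) = Real.exp (-y ^ 2 / (2 * 2)) *
      Real.exp (-(1 / (2 * v) - 1 / 4) * y ^ 2) := by
    rw [← Real.exp_add]; congr 1; field_simp; ring
  rw [e1, e2]; ring

variable {P : ℕ} {c : ℕ → ℝ}

/-- Conditional probability that the energy is large, given the radial derivative. -/
def pN (P : ℕ) (c : ℕ → ℝ) (η : ℝ) (N : ℕ) (y : ℝ) : ℝ≥0∞ :=
  gaussianReal 0 1 {w | Real.sqrt N * η ≤ bb P c * y + tau P c * w}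

/-- The weight of an eigenvalue in the expected number of critical points. -/
def wtN (P : ℕ) (c : ℕ → ℝ) (η : ℝ) (N : ℕ) (y : ℝ) : ℝ≥0∞ :=
  ENNReal.ofReal (Real.sqrt (2 / vv P c) * Real.exp (-(1 / (2 * vv P c) - 1 / 4) * y ^ 2)) * pN P c η N y

theorem measurable_pN (η : ℝ) (N : ℕ) : Measurable (pN P c η N) := by
  unfold pN
  have hS : MeasurableSet {p : ℝ × ℝ | Real.sqrt N * η ≤ bb P c * p.1 + tau P c * p.2} :=
    measurableSet_le measurable_const (by fun_prop)
  exact measurable_measure_prodMk_left hS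

theorem measurable_wtN (η : ℝ) (N : ℕ) : Measurable (wtN P c η N) := by
  unfold wtN
  exact Measurable.mul (by fun_prop) (measurable_pN η N)

/-- Flattened critical points above a level, of given index. -/
def critIdx (N P : ℕ) (c : ℕ → ℝ) (η : ℝ) (g : GIdx N P → ℝ) (m : ℕ) : Set (Fin N → ℝ) :=
  {σ | IsCrit N P c g σ ∧ (((∑ J, g J * feat1 N P c σ σ J) / (N : ℝ), ∑ J, g J * feat N P c σ J) ∈
    {q : ℝ × ℝ | (N : ℝ) * η ≤ q.2} ∧ qidx σ (qform N P c g σ) = m)}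

theorem aemeasurable_ecount_critIdx (hν : 0 < nuu P c) (hk : 0 < kap P c) {n : ℕ} (hn : 0 < n) (η : ℝ) (m : ℕ) :
    AEMeasurable (fun g => ecount (critIdx (n + 1) P c η g m)) (stdG (GIdx (n + 1) P)) :=
  (kacRice_index hν hk hn (measurableSet_le measurable_const measurable_snd) m).1

open Classical in
theorem lintegral_critIdx_aux (hν : 0 < nuu P c) (hk : 0 < kap P c) {n : ℕ} (hn : 0 < n) (η : ℝ) (m : ℕ) :
    ∫⁻ g, ecount (critIdx (n + 1) P c η g m) ∂(stdG (GIdx (n + 1) P)) =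
      ENNReal.ofReal (Real.sqrt (nuu P c / kap P c) ^ n) * aN n *
      ∫⁻ x, ∫⁻ z, wtN P c η (n + 1) (Real.sqrt 2 * z) * (if nlt (goe n x) (Real.sqrt 2 * z) = m then
        ENNReal.ofReal |(goe n x - (Real.sqrt 2 * z) • (1 : Matrix (Fin n) (Fin n) ℝ)).det| else 0)
        ∂(gaussianReal 0 1) ∂(stdG (Fin n × Fin n)) := by
  refine (kacRice_index hν hk hn (measurableSet_le measurable_const measurable_snd) m).2.trans ?_
  congr 1
  refine lintegral_congr fun x => ?_
  have hvv : 0 < vv P c := by unfold vv; positivity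
  set F : ℝ → ℝ≥0∞ := fun y => pN P c η (n + 1) y * (if nlt (goe n x) y = m then
        ENNReal.ofReal |(goe n x - y • (1 : Matrix (Fin n) (Fin n) ℝ)).det| else 0) with hFdef
  have hF : Measurable F := by
    refine (measurable_pN _ _).mul (Measurable.ite ?_ ?_ measurable_const)
    · have h1 : Measurable fun y : ℝ => ((fun i j => goe n x i j : Fin n → Fin n → ℝ), y) := by fun_prop
      exact (measurable_nlt.comp h1) (measurableSet_singleton m)
    · have hd : Measurable fun y : ℝ => (goe n x - y • (1 : Matrix (Fin n) (Fin n) ℝ)).det := by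
        refine Continuous.measurable ?_
        refine Continuous.matrix_det ?_
        fun_prop
      exact hd.abs.ennreal_ofReal
  have h2 := lintegral_gaussian_scale hvv hF
  refine Eq.trans ?_ (h2.trans ?_)
  · refine lintegral_congr fun z => ?_
    have hsq : (0 : ℝ) < Real.sqrt ((n : ℝ) + 1) := by positivity
    have hiff : ∀ w : ℝ, ((n + 1 : ℕ) : ℝ) * η ≤ Real.sqrt ((n : ℝ) + 1) *
        (bb P c * (Real.sqrt (vv P c) * z) + tau P c * w) ↔
        Real.sqrt ((n + 1 : ℕ) : ℝ) * η ≤ bb P c * (Real.sqrt (vv P c) * z) + tau P c * w := by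
      intro w
      push_cast
      rw [show ((n : ℝ) + 1) * η = Real.sqrt ((n : ℝ) + 1) * (Real.sqrt ((n : ℝ) + 1) * η) by
        rw [← mul_assoc, Real.mul_self_sqrt (by positivity)], mul_le_mul_iff_right₀ hsq]
    simp only [Set.mem_ofPred_eq, hiff, hFdef]
    split_ifs with hm
    · simp only [hm, and_true]
      have hms : MeasurableSet {w : ℝ | Real.sqrt ((n + 1 : ℕ) : ℝ) * η ≤
          bb P c * (Real.sqrt (vv P c) * z) + tau P c * w} :=
        measurableSet_le measurable_const (by fun_prop)
      rw [pN, mul_comm (gaussianReal 0 1 _), ← lintegral_indicator_const hms]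
      refine lintegral_congr fun w => ?_
      by_cases hw : Real.sqrt ((n + 1 : ℕ) : ℝ) * η ≤ bb P c * (Real.sqrt (vv P c) * z) + tau P c * w
      · rw [if_pos hw, Set.indicator_of_mem (by exact hw)]
      · rw [if_neg hw, Set.indicator_of_notMem (by exact hw)]
    · simp [hm]
  · refine lintegral_congr fun z => ?_
    simp only [hFdef, wtN]
    rw [mul_assoc]

theorem lintegral_critIdx (hν : 0 < nuu P c) (hk : 0 < kap P c) {n : ℕ} (hn : 0 < n) (η : ℝ) {k : ℕ}
    (hkn : k < n + 1) :
    ∫⁻ g, ecount (critIdx (n + 1) P c η g (n - k)) ∂(stdG (GIdx (n + 1) P)) =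
      ENNReal.ofReal (Real.sqrt (nuu P c / kap P c) ^ n) *
      (2 * ∫⁻ x, wtN P c η (n + 1) (evs (goe (n + 1) x) ⟨k, hkn⟩) ∂(stdG (Fin (n + 1) × Fin (n + 1)))) := by
  rw [lintegral_critIdx_aux hν hk hn, two_mul_lintegral_evs hn hkn (measurable_wtN η (n + 1)), mul_assoc]
  congr 2
  refine lintegral_congr fun x => lintegral_congr fun z => ?_
  unfold detWt
  congr 1
  have := nge_add_nlt (goe n x) (Real.sqrt 2 * z)
  congr 1
  refine propext ?_
  simp only
  omega

theorem lintegral_critIdx_eq_zero (hν : 0 < nuu P c) (hk : 0 < kap P c) {n : ℕ} (hn : 0 < n) (η : ℝ) {m : ℕ}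
    (hm : n < m) : ∫⁻ g, ecount (critIdx (n + 1) P c η g m) ∂(stdG (GIdx (n + 1) P)) = 0 := by
  rw [lintegral_critIdx_aux hν hk hn]
  have : ∀ x z, nlt (goe n x) (Real.sqrt 2 * z) ≠ m := fun x z => by
    have := nge_add_nlt (goe n x) (Real.sqrt 2 * z)
    omega
  simp [this]

theorem lintegral_crit_total (hν : 0 < nuu P c) (hk : 0 < kap P c) {n : ℕ} (hn : 0 < n) (η : ℝ) :
    AEMeasurable (fun g => ecount (⋃ m, critIdx (n + 1) P c η g m)) (stdG (GIdx (n + 1) P)) ∧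
    ∫⁻ g, ecount (⋃ m, critIdx (n + 1) P c η g m) ∂(stdG (GIdx (n + 1) P)) =
      ENNReal.ofReal (Real.sqrt (nuu P c / kap P c) ^ n) *
      (2 * ∫⁻ x, ∑ k, wtN P c η (n + 1) (evs (goe (n + 1) x) k) ∂(stdG (Fin (n + 1) × Fin (n + 1)))) := by
  have hdis : ∀ g, Pairwise (Function.onFun Disjoint (critIdx (n + 1) P c η g)) := by
    intro g i j hij
    refine Set.disjoint_left.2 fun σ h1 h2 => hij ?_
    exact h1.2.2.symm.trans h2.2.2
  have h1 : ∀ g, ecount (⋃ m, critIdx (n + 1) P c η g m) = ∑' m, ecount (critIdx (n + 1) P c η g m) :=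
    fun g => ecount_iUnion (hdis g)
  simp only [h1]
  refine ⟨AEMeasurable.tsum fun m => aemeasurable_ecount_critIdx hν hk hn η m, ?_⟩
  have hmk : ∀ k ∈ Finset.univ, Measurable fun x => wtN P c η (n + 1) (evs (goe (n + 1) x) k) :=
    fun k _ => (measurable_wtN η (n + 1)).comp (measurable_evs_goe k)
  rw [lintegral_tsum fun m => aemeasurable_ecount_critIdx hν hk hn η m,
    tsum_eq_sum (s := Finset.range (n + 1)) fun m hm => lintegral_critIdx_eq_zero hν hk hn η
      (by simpa using hm),
    lintegral_finsetSum _ hmk, ← Finset.sum_range_reflect, Finset.mul_sum, Finset.mul_sum, Finset.sum_range]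
  refine Finset.sum_congr rfl fun k _ => ?_
  exact lintegral_critIdx hν hk hn η k.2

end reduction

section

variable {ι : Type*} [Fintype ι]

/-- `F` is `L`-Lipschitz for the Euclidean distance on `ι → ℝ`. -/
def LipE (L : ℝ) (F : (ι → ℝ) → ℝ) : Prop :=
  ∀ x y, |F x - F y| ≤ L * Real.sqrt (∑ i, (x i - y i) ^ 2)

theorem lintegral_exp_linear_stdG (a : ι → ℝ) :
    ∫⁻ y, ENNReal.ofReal (Real.exp (∑ i, a i * y i)) ∂(stdG ι) =
      ENNReal.ofReal (Real.exp ((∑ i, a i ^ 2) / 2)) := by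
  have h1 : (fun y : ι → ℝ => Real.exp (∑ i, a i * y i)) = fun y => ∏ i, Real.exp (a i * y i) := by
    ext y; rw [Real.exp_sum]
  have hInt : Integrable (fun y : ι → ℝ => ∏ i, Real.exp (a i * y i)) (stdG ι) :=
    Integrable.fintype_prod (f := fun (i : ι) y => Real.exp (a i * y))
      (fun i => integrable_exp_mul_gaussianReal (μ := 0) (v := 1) (a i))
  rw [← ofReal_integral_eq_lintegral_ofReal (by rw [h1]; exact hInt)
    (ae_of_all _ fun y => (Real.exp_pos _).le), h1, stdG]
  congr 1
  rw [integral_fintype_prod_eq_prod (f := fun (i : ι) y => Real.exp (a i * y)), Finset.sum_div,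
    Real.exp_sum]
  refine Finset.prod_congr rfl fun i _ => ?_
  have h := mgf_gaussianReal (p := gaussianReal 0 1) (X := id) (μ := 0) (v := 1) (by simp) (a i)
  simp only [mgf, id] at h
  rw [h]
  simp

theorem abs_fderiv_le_of_lipE {F : (ι → ℝ) → ℝ} {L : ℝ} (hL : LipE L F) (hd : Differentiable ℝ F)
    (x v : ι → ℝ) : |fderiv ℝ F x v| ≤ L * Real.sqrt (∑ i, v i ^ 2) := by
  have h : HasDerivAt (fun t : ℝ => F (x + t • v)) (fderiv ℝ F x v) 0 := by
    have h0 : HasFDerivAt F (fderiv ℝ F x) (x + (0 : ℝ) • v) := by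
      simpa using (hd x).hasFDerivAt
    have h1 : HasDerivAt (fun t : ℝ => x + t • v) v 0 := by
      simpa using ((hasDerivAt_id (0 : ℝ)).smul_const v).const_add x
    exact h0.comp_hasDerivAt 0 h1
  have h2 : (0 : ℝ) ≤ L * Real.sqrt (∑ i, v i ^ 2) := by
    have := (abs_nonneg _).trans (hL v 0); simpa using this
  refine h.le_of_lip' h2 (Eventually.of_forall fun t => ?_)
  rw [Real.norm_eq_abs, Real.norm_eq_abs]
  refine (hL _ _).trans (le_of_eq ?_)
  have : ∑ i, ((x + t • v) i - (x + (0 : ℝ) • v) i) ^ 2 = t ^ 2 * ∑ i, v i ^ 2 := by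
    rw [Finset.mul_sum]; refine Finset.sum_congr rfl fun i _ => ?_
    simp; ring
  rw [this, Real.sqrt_mul (sq_nonneg _), Real.sqrt_sq_eq_abs, sub_zero]; ring

theorem fderiv_eq_sum [DecidableEq ι] (l : (ι → ℝ) →L[ℝ] ℝ) (v : ι → ℝ) :
    l v = ∑ i, l (Pi.single i 1) * v i := by
  conv_lhs => rw [← Finset.univ_sum_single v]
  rw [map_sum]
  refine Finset.sum_congr rfl fun i _ => ?_
  have : Pi.single i (v i) = v i • (Pi.single i 1 : ι → ℝ) := by
    rw [← Pi.single_smul]; simp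
  rw [this, map_smul, smul_eq_mul, mul_comm]

theorem sum_sq_fderiv_le [DecidableEq ι] {F : (ι → ℝ) → ℝ} {L : ℝ} (hL : LipE L F)
    (hd : Differentiable ℝ F) (x : ι → ℝ) :
    ∑ i, (fderiv ℝ F x (Pi.single i 1)) ^ 2 ≤ L ^ 2 := by
  set v : ι → ℝ := fun i => fderiv ℝ F x (Pi.single i 1) with hv
  have h := abs_fderiv_le_of_lipE hL hd x v
  rw [fderiv_eq_sum] at h
  have h1 : ∑ i, fderiv ℝ F x (Pi.single i 1) * v i = ∑ i, v i ^ 2 :=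
    Finset.sum_congr rfl fun i _ => by rw [hv]; ring
  have h2 : 0 ≤ ∑ i, v i ^ 2 := Finset.sum_nonneg fun i _ => sq_nonneg _
  rw [h1, abs_of_nonneg h2] at h
  change ∑ i, v i ^ 2 ≤ _
  set s := ∑ i, v i ^ 2
  have h3 := Real.sq_sqrt h2
  rcases (Real.sqrt_nonneg s).eq_or_lt with h4 | h4
  · rw [← h3, ← h4]; simpa using sq_nonneg L
  · have : Real.sqrt s ≤ L := by
      by_contra hlt; push Not at hlt; nlinarith
    rw [← h3]; gcongr

/-- The rotation of a pair of Gaussian vectors preserves the joint law. -/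
theorem lintegral_rotation (θ : ℝ) {f : (ι → ℝ) × (ι → ℝ) → ℝ≥0∞} (hf : Measurable f) :
    ∫⁻ x, ∫⁻ y, f (Real.cos θ • y + Real.sin θ • x, -Real.sin θ • y + Real.cos θ • x)
      ∂(stdG ι) ∂(stdG ι) = ∫⁻ x, ∫⁻ y, f (x, y) ∂(stdG ι) ∂(stdG ι) := by
  classical
  let m : ι ⊕ ι → ι ⊕ ι → ℝ := fun a b => match a, b with
    | .inl i, .inl j => if i = j then Real.sin θ else 0
    | .inl i, .inr j => if i = j then Real.cos θ else 0
    | .inr i, .inl j => if i = j then Real.cos θ else 0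
    | .inr i, .inr j => if i = j then -Real.sin θ else 0
  let m' : ι ⊕ ι → ι ⊕ ι → ℝ := fun a b => if a = b then 1 else 0
  have hgram : ∀ a b, ∑ p, m a p * m b p = ∑ p, m' a p * m' b p := by
    have hcs := Real.sin_sq_add_cos_sq θ
    rintro (i | i) (j | j) <;> simp [m, m', Fintype.sum_sum_type] <;> split_ifs <;> nlinarith
  have hmeas : Measurable fun z : ι ⊕ ι → ℝ => f (fun i => z (.inl i), fun i => z (.inr i)) :=
    hf.comp (by fun_prop)
  have h := lintegral_dotMap_eq m m' hgram hmeas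
  rw [lintegral_stdG_sum (f := fun x => f (fun i => dotMap m x (.inl i), fun i => dotMap m x (.inr i)))
      (hmeas.comp (dotMap m).continuous.measurable),
    lintegral_stdG_sum (f := fun x => f (fun i => dotMap m' x (.inl i), fun i => dotMap m' x (.inr i)))
      (hmeas.comp (dotMap m').continuous.measurable)] at h
  have e1 : ∀ x y : ι → ℝ, (Real.cos θ • y + Real.sin θ • x, -Real.sin θ • y + Real.cos θ • x) =
      ((fun i => dotMap m (Sum.elim x y) (.inl i)), fun i => dotMap m (Sum.elim x y) (.inr i)) := by
    intro x y
    refine Prod.ext (funext fun i => ?_) (funext fun i => ?_) <;>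
      simp [dotMap_apply, m, Fintype.sum_sum_type] <;> ring
  have e2 : ∀ x y : ι → ℝ, (x, y) =
      ((fun i => dotMap m' (Sum.elim x y) (.inl i)), fun i => dotMap m' (Sum.elim x y) (.inr i)) := by
    intro x y
    refine Prod.ext (funext fun i => ?_) (funext fun i => ?_) <;>
      simp [dotMap_apply, m']
  simp_rw [e1]
  exact h.trans (lintegral_congr fun x => lintegral_congr fun y => by rw [← e2 x y])

theorem exp_intervalIntegral_le {φ : ℝ → ℝ} (hφ : Continuous φ) :
    ENNReal.ofReal (Real.exp (∫ t in (0 : ℝ)..(Real.pi / 2), φ t)) ≤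
      ENNReal.ofReal (2 / Real.pi) * ∫⁻ t in Set.Ioc 0 (Real.pi / 2),
        ENNReal.ofReal (Real.exp (Real.pi / 2 * φ t)) := by
  have hpi := Real.pi_pos
  set I := ∫ t in (0 : ℝ)..(Real.pi / 2), φ t with hI
  have hInt : ∀ g : ℝ → ℝ, Continuous g → IntervalIntegrable g volume 0 (Real.pi / 2) :=
    fun g hg => hg.intervalIntegrable _ _
  have h1 : Real.exp I ≤ 2 / Real.pi * ∫ t in (0 : ℝ)..(Real.pi / 2), Real.exp (Real.pi / 2 * φ t) := by
    have h2 : ∫ t in (0 : ℝ)..(Real.pi / 2), Real.exp I * (1 + (Real.pi / 2 * φ t - I)) ≤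
        ∫ t in (0 : ℝ)..(Real.pi / 2), Real.exp (Real.pi / 2 * φ t) := by
      refine intervalIntegral.integral_mono (by positivity) (hInt _ (by fun_prop))
        (hInt _ (by fun_prop)) fun t => ?_
      have := Real.add_one_le_exp (Real.pi / 2 * φ t - I)
      calc Real.exp I * (1 + (Real.pi / 2 * φ t - I)) ≤ Real.exp I * Real.exp (Real.pi / 2 * φ t - I) := by
            gcongr; linarith
        _ = _ := by rw [← Real.exp_add]; ring_nf
    have h3 : ∫ t in (0 : ℝ)..(Real.pi / 2), Real.exp I * (1 + (Real.pi / 2 * φ t - I)) =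
        Real.exp I * (Real.pi / 2) := by
      rw [intervalIntegral.integral_const_mul, intervalIntegral.integral_add (by simp)
        (hInt _ (by fun_prop)), intervalIntegral.integral_sub (hInt _ (by fun_prop)) (by simp),
        intervalIntegral.integral_const_mul, ← hI]
      simp
    rw [h3] at h2
    calc Real.exp I = 2 / Real.pi * (Real.exp I * (Real.pi / 2)) := by field_simp
      _ ≤ _ := by gcongr
  rw [← ofReal_integral_eq_lintegral_ofReal, ← ENNReal.ofReal_mul (by positivity)]
  · refine ENNReal.ofReal_le_ofReal ?_
    rwa [intervalIntegral.integral_of_le (by positivity)] at h1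
  · exact (hInt _ (by fun_prop)).1
  · exact ae_of_all _ fun t => (Real.exp_pos _).le

/-- The Maurey–Pisier inequality for smooth functions. -/
theorem maurey_pisier_smooth {F : (ι → ℝ) → ℝ} {L : ℝ} (hL : LipE L F)
    (hd : ContDiff ℝ 1 F) :
    ∫⁻ x, ∫⁻ y, ENNReal.ofReal (Real.exp (F x - F y)) ∂(stdG ι) ∂(stdG ι) ≤
      ENNReal.ofReal (Real.exp (Real.pi ^ 2 * L ^ 2 / 8)) := by
  classical
  have hpi := Real.pi_pos
  have hdd : Differentiable ℝ F := hd.differentiable one_ne_zero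
  have hcf : Continuous (fderiv ℝ F) := hd.continuous_fderiv one_ne_zero
  set f : (ι → ℝ) × (ι → ℝ) → ℝ≥0∞ := fun p =>
    ENNReal.ofReal (Real.exp (Real.pi / 2 * fderiv ℝ F p.1 p.2)) with hf
  have hfc : Continuous fun p : (ι → ℝ) × (ι → ℝ) => Real.exp (Real.pi / 2 * fderiv ℝ F p.1 p.2) := by
    have : Continuous fun p : (ι → ℝ) × (ι → ℝ) => fderiv ℝ F p.1 p.2 :=
      (hcf.comp continuous_fst).clm_apply continuous_snd
    fun_prop
  have hfm : Measurable f := hfc.measurable.ennreal_ofReal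
  have hpt : ∀ x y, ENNReal.ofReal (Real.exp (F x - F y)) ≤ ENNReal.ofReal (2 / Real.pi) *
      ∫⁻ t in Set.Ioc 0 (Real.pi / 2), f (Real.cos t • y + Real.sin t • x,
        -Real.sin t • y + Real.cos t • x) := by
    intro x y
    have hder : ∀ t, HasDerivAt (fun t : ℝ => F (Real.cos t • y + Real.sin t • x))
        (fderiv ℝ F (Real.cos t • y + Real.sin t • x) (-Real.sin t • y + Real.cos t • x)) t := by
      intro t
      exact (hdd _).hasFDerivAt.comp_hasDerivAt t
        (((Real.hasDerivAt_cos t).smul_const y).add ((Real.hasDerivAt_sin t).smul_const x))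
    have hc : Continuous fun t : ℝ =>
        fderiv ℝ F (Real.cos t • y + Real.sin t • x) (-Real.sin t • y + Real.cos t • x) :=
      (hcf.comp (by fun_prop)).clm_apply (by fun_prop)
    have h := intervalIntegral.integral_eq_sub_of_hasDerivAt (a := 0) (b := Real.pi / 2)
      (fun t _ => hder t) (hc.intervalIntegrable _ _)
    simp only [Real.cos_pi_div_two, Real.sin_pi_div_two, Real.cos_zero, Real.sin_zero, zero_smul,
      one_smul, zero_add, add_zero] at h
    rw [← h]
    exact exp_intervalIntegral_le hc
  have hm3 : Measurable fun q : ((ι → ℝ) × (ι → ℝ)) × ℝ =>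
      f (Real.cos q.2 • q.1.2 + Real.sin q.2 • q.1.1, -Real.sin q.2 • q.1.2 + Real.cos q.2 • q.1.1) :=
    hfm.comp (by fun_prop)
  calc _ ≤ ∫⁻ x, ∫⁻ y, (ENNReal.ofReal (2 / Real.pi) *
      ∫⁻ t in Set.Ioc 0 (Real.pi / 2), f (Real.cos t • y + Real.sin t • x,
        -Real.sin t • y + Real.cos t • x)) ∂(stdG ι) ∂(stdG ι) :=
        lintegral_mono fun x => lintegral_mono fun y => hpt x y
    _ = ENNReal.ofReal (2 / Real.pi) * ∫⁻ t in Set.Ioc 0 (Real.pi / 2), ∫⁻ x, ∫⁻ y,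
        f (Real.cos t • y + Real.sin t • x, -Real.sin t • y + Real.cos t • x)
          ∂(stdG ι) ∂(stdG ι) := by
        simp_rw [lintegral_const_mul' _ _ ENNReal.ofReal_ne_top]
        congr 1
        symm
        rw [lintegral_lintegral_swap]
        · refine lintegral_congr fun x => (lintegral_lintegral_swap ?_).symm
          refine Measurable.aemeasurable ?_
          exact hm3.comp (f := fun p : (ι → ℝ) × ℝ => ((x, p.1), p.2)) (by fun_prop)
        · refine Measurable.aemeasurable ?_
          change Measurable fun p : ℝ × (ι → ℝ) => ∫⁻ y, f (Real.cos p.1 • y + Real.sin p.1 • p.2,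
            -Real.sin p.1 • y + Real.cos p.1 • p.2) ∂(stdG ι)
          refine Measurable.lintegral_prod_right' (f := fun r : (ℝ × (ι → ℝ)) × (ι → ℝ) =>
            f (Real.cos r.1.1 • r.2 + Real.sin r.1.1 • r.1.2,
            -Real.sin r.1.1 • r.2 + Real.cos r.1.1 • r.1.2)) ?_
          exact hm3.comp (f := fun r : (ℝ × (ι → ℝ)) × (ι → ℝ) => ((r.1.2, r.2), r.1.1)) (by fun_prop)
    _ = ENNReal.ofReal (2 / Real.pi) * ∫⁻ t in Set.Ioc 0 (Real.pi / 2), ∫⁻ x, ∫⁻ y,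
        f (x, y) ∂(stdG ι) ∂(stdG ι) := by
        simp_rw [lintegral_rotation _ hfm]
    _ ≤ ENNReal.ofReal (2 / Real.pi) * ∫⁻ t in Set.Ioc 0 (Real.pi / 2),
        ENNReal.ofReal (Real.exp (Real.pi ^ 2 * L ^ 2 / 8)) := by
        gcongr with t
        calc _ ≤ ∫⁻ x, ENNReal.ofReal (Real.exp (Real.pi ^ 2 * L ^ 2 / 8)) ∂(stdG ι) := by
              refine lintegral_mono fun x => ?_
              have : ∀ y, f (x, y) = ENNReal.ofReal (Real.exp (∑ i,
                  (Real.pi / 2 * fderiv ℝ F x (Pi.single i 1)) * y i)) := by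
                intro y; simp only [hf]; rw [fderiv_eq_sum, Finset.mul_sum]; simp only [mul_assoc]
              simp_rw [this]
              rw [lintegral_exp_linear_stdG]
              refine ENNReal.ofReal_le_ofReal (Real.exp_le_exp.2 ?_)
              simp_rw [mul_pow]
              rw [← Finset.mul_sum]
              have := sum_sq_fderiv_le hL hdd x
              have h2 : 0 ≤ Real.pi ^ 2 := by positivity
              nlinarith
          _ = _ := by simp
    _ = _ := by
        rw [lintegral_const, mul_left_comm, Measure.restrict_apply_univ, Real.volume_Ioc,
          ← ENNReal.ofReal_mul (by positivity)]
        have : 2 / Real.pi * (Real.pi / 2 - 0) = 1 := by rw [sub_zero]; field_simp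
        rw [this]; simp

end

section

variable {ι : Type*} [Fintype ι]

theorem sqrt_sum_sq_le_sum_abs (v : ι → ℝ) : Real.sqrt (∑ i, v i ^ 2) ≤ ∑ i, |v i| := by
  refine Real.sqrt_le_iff.2 ⟨Finset.sum_nonneg fun i _ => abs_nonneg _, ?_⟩
  simp_rw [← sq_abs (v _)]
  exact Finset.sum_sq_le_sq_sum_of_nonneg fun i _ => abs_nonneg _

theorem LipE.continuous {F : (ι → ℝ) → ℝ} {L : ℝ} (hL : LipE L F) : Continuous F := by
  rw [continuous_iff_continuousAt]
  intro x
  rw [ContinuousAt, tendsto_iff_dist_tendsto_zero]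
  have h : Continuous fun y : ι → ℝ => L * Real.sqrt (∑ i, (y i - x i) ^ 2) := by fun_prop
  have h0 := h.tendsto x
  simp only [sub_self, ne_eq, OfNat.ofNat_ne_zero, not_false_eq_true, zero_pow,
    Finset.sum_const_zero, Real.sqrt_zero, mul_zero] at h0
  exact squeeze_zero (fun _ => dist_nonneg) (fun y => by rw [Real.dist_eq]; exact hL y x) h0

theorem LipE.abs_le {F : (ι → ℝ) → ℝ} {L : ℝ} (hL0 : 0 ≤ L) (hL : LipE L F) (x : ι → ℝ) :
    |F x| ≤ |F 0| + L * ∑ i, |x i| := by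
  have h1 := hL x 0
  have h2 := sqrt_sum_sq_le_sum_abs x
  simp only [Pi.zero_apply, sub_zero] at h1
  have h3 : |F x| ≤ |F 0| + |F x - F 0| := by
    have := abs_add_le (F 0) (F x - F 0); rwa [add_sub_cancel] at this
  have : L * Real.sqrt (∑ i, x i ^ 2) ≤ L * ∑ i, |x i| := by gcongr
  linarith

theorem LipE.integrable_exp {F : (ι → ℝ) → ℝ} {L : ℝ} (hL0 : 0 ≤ L) (hL : LipE L F) :
    Integrable (fun x => Real.exp (F x)) (stdG ι) := by
  refine integrable_of_exp_bound (Real.continuous_exp.comp hL.continuous).aestronglyMeasurable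
    (Real.exp |F 0|) L fun x => ?_
  rw [abs_of_pos (Real.exp_pos _), ← Real.exp_add, Real.exp_le_exp]
  exact (le_abs_self _).trans (hL.abs_le hL0 x)

theorem LipE.integrable {F : (ι → ℝ) → ℝ} {L : ℝ} (hL0 : 0 ≤ L) (hL : LipE L F) :
    Integrable F (stdG ι) := by
  refine integrable_of_poly_bound hL.continuous.aestronglyMeasurable (|F 0| + L) 1 (by positivity)
    fun x => (hL.abs_le hL0 x).trans ?_
  have : 0 ≤ ∑ i, |x i| := Finset.sum_nonneg fun i _ => abs_nonneg _
  have := mul_nonneg (abs_nonneg (F 0)) this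
  nlinarith

theorem LipE.neg {F : (ι → ℝ) → ℝ} {L : ℝ} (hL : LipE L F) : LipE L fun x => -F x := fun x y => by
  rw [← abs_neg, show -(-F x - -F y) = F x - F y by ring]; exact hL x y

theorem LipE.const_mul {F : (ι → ℝ) → ℝ} {L : ℝ} (hL : LipE L F) (a : ℝ) :
    LipE (|a| * L) fun x => a * F x := fun x y => by
  rw [← mul_sub, abs_mul, mul_assoc]; gcongr; exact hL x y

theorem exists_smooth_approx {F : (ι → ℝ) → ℝ} {L : ℝ} (hL0 : 0 ≤ L) (hL : LipE L F) {ε : ℝ}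
    (hε : 0 < ε) : ∃ F' : (ι → ℝ) → ℝ, ContDiff ℝ 1 F' ∧ LipE L F' ∧ ∀ x, |F' x - F x| ≤ ε := by
  have hcont := hL.continuous
  obtain ⟨r, hr, hr2⟩ : ∃ r > 0, L * (Fintype.card ι * r) ≤ ε := by
    refine ⟨ε / (L * Fintype.card ι + 1), by positivity, ?_⟩
    rw [← mul_assoc, ← mul_div_assoc, div_le_iff₀ (by positivity)]
    nlinarith [mul_nonneg hL0 (Nat.cast_nonneg (α := ℝ) (Fintype.card ι))]
  let φ : ContDiffBump (0 : ι → ℝ) := ⟨r / 2, r, by positivity, by linarith⟩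
  have hInt : ∀ x, Integrable fun t => φ.normed volume t • F (x - t) := fun x =>
    Continuous.integrable_of_hasCompactSupport
      (φ.continuous_normed.smul (hcont.comp (by fun_prop)))
      (φ.hasCompactSupport_normed.smul_right)
  refine ⟨convolution (φ.normed volume) F (ContinuousLinearMap.lsmul ℝ ℝ) volume, ?_, ?_, ?_⟩
  · exact φ.hasCompactSupport_normed.contDiff_convolution_left _ (φ.contDiff_normed (n := 1))
      hcont.locallyIntegrable
  · intro x y
    rw [convolution_lsmul, convolution_lsmul, ← integral_sub (hInt x) (hInt y)]
    have h1 : ∀ t, ‖φ.normed volume t • F (x - t) - φ.normed volume t • F (y - t)‖ ≤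
        φ.normed volume t * (L * Real.sqrt (∑ i, (x i - y i) ^ 2)) := by
      intro t
      rw [← smul_sub, norm_smul, Real.norm_of_nonneg (φ.nonneg_normed t)]
      refine mul_le_mul_of_nonneg_left ?_ (φ.nonneg_normed t)
      have := hL (x - t) (y - t)
      simpa using this
    refine (norm_integral_le_of_norm_le ((φ.integrable_normed).mul_const _)
      (ae_of_all _ h1)).trans (le_of_eq ?_)
    rw [integral_mul_const, φ.integral_normed, one_mul]
  · intro x
    rw [← Real.dist_eq]
    refine φ.dist_normed_convolution_le hcont.aestronglyMeasurable fun y hy => ?_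
    rw [Real.dist_eq]
    refine (hL y x).trans (le_trans ?_ hr2)
    gcongr
    refine (sqrt_sum_sq_le_sum_abs fun i => y i - x i).trans ?_
    calc ∑ i, |y i - x i| ≤ ∑ _i : ι, r := by
          refine Finset.sum_le_sum fun i _ => ?_
          rw [← Real.dist_eq]
          exact (dist_le_pi_dist y x i).trans (le_of_lt hy)
      _ = _ := by simp

theorem maurey_pisier {F : (ι → ℝ) → ℝ} {L : ℝ} (hL0 : 0 ≤ L) (hL : LipE L F) :
    ∫⁻ x, ∫⁻ y, ENNReal.ofReal (Real.exp (F x - F y)) ∂(stdG ι) ∂(stdG ι) ≤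
      ENNReal.ofReal (Real.exp (Real.pi ^ 2 * L ^ 2 / 8)) := by
  have hlim : Tendsto (fun ε : ℝ => ENNReal.ofReal (Real.exp (2 * ε)) *
      ENNReal.ofReal (Real.exp (Real.pi ^ 2 * L ^ 2 / 8))) (nhdsWithin 0 (Set.Ioi 0))
      (nhds (ENNReal.ofReal (Real.exp (Real.pi ^ 2 * L ^ 2 / 8)))) := by
    simp_rw [← ENNReal.ofReal_mul (Real.exp_pos _).le]
    have hc : Continuous fun ε : ℝ =>
      ENNReal.ofReal (Real.exp (2 * ε) * Real.exp (Real.pi ^ 2 * L ^ 2 / 8)) :=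
      ENNReal.continuous_ofReal.comp (by fun_prop)
    have := (hc.tendsto 0).mono_left (nhdsWithin_le_nhds (s := Set.Ioi 0))
    simpa using this
  refine ge_of_tendsto hlim (eventually_nhdsWithin_of_forall fun ε hε => ?_)
  obtain ⟨F', h1, h2, h3⟩ := exists_smooth_approx hL0 hL hε
  refine le_trans ?_ (mul_le_mul_right (maurey_pisier_smooth h2 h1) _)
  simp_rw [← lintegral_const_mul' _ _ ENNReal.ofReal_ne_top, ← ENNReal.ofReal_mul (Real.exp_pos _).le,
    ← Real.exp_add]
  refine lintegral_mono fun x => lintegral_mono fun y => ?_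
  refine ENNReal.ofReal_le_ofReal (Real.exp_le_exp.2 ?_)
  have hx := abs_le.1 (h3 x)
  have hy := abs_le.1 (h3 y)
  linarith [hx.1, hx.2, hy.1, hy.2]

theorem exp_integral_le_lintegral {F : (ι → ℝ) → ℝ} (hF : Integrable F (stdG ι))
    (hexp : Integrable (fun x => Real.exp (F x)) (stdG ι)) :
    ENNReal.ofReal (Real.exp (∫ x, F x ∂(stdG ι))) ≤
      ∫⁻ x, ENNReal.ofReal (Real.exp (F x)) ∂(stdG ι) := by
  set m := ∫ x, F x ∂(stdG ι) with hm
  have hi : Integrable (fun x => Real.exp m * (1 + (F x - m))) (stdG ι) :=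
    ((integrable_const 1).add (hF.sub (integrable_const m))).const_mul _
  have h1 : ∫ x, Real.exp m * (1 + (F x - m)) ∂(stdG ι) = Real.exp m := by
    have h2 : ∫ x, (1 + (F x - m)) ∂(stdG ι) = 1 := by
      have := integral_add (μ := stdG ι) (integrable_const (1 : ℝ)) (hF.sub (integrable_const m))
      have h3 := integral_sub (μ := stdG ι) hF (integrable_const m)
      simp only [Pi.sub_apply] at this
      rw [this, h3, ← hm]
      simp
    rw [integral_const_mul, h2, mul_one]
  rw [← ofReal_integral_eq_lintegral_ofReal hexp (ae_of_all _ fun x => (Real.exp_pos _).le)]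
  refine ENNReal.ofReal_le_ofReal ?_
  rw [← h1]
  refine integral_mono hi hexp fun x => ?_
  have := Real.add_one_le_exp (F x - m)
  calc Real.exp m * (1 + (F x - m)) ≤ Real.exp m * Real.exp (F x - m) := by
        gcongr; linarith
    _ = _ := by rw [← Real.exp_add]; ring_nf

/-- Gaussian concentration: the exponential moment of a Lipschitz function. -/
theorem lintegral_exp_le_of_lipE {F : (ι → ℝ) → ℝ} {L : ℝ} (hL0 : 0 ≤ L) (hL : LipE L F) :
    ∫⁻ x, ENNReal.ofReal (Real.exp (F x)) ∂(stdG ι) ≤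
      ENNReal.ofReal (Real.exp (∫ x, F x ∂(stdG ι) + Real.pi ^ 2 * L ^ 2 / 8)) := by
  have h := maurey_pisier hL0 hL
  simp_rw [sub_eq_add_neg, Real.exp_add, ENNReal.ofReal_mul (Real.exp_pos _).le,
    lintegral_const_mul' _ _ ENNReal.ofReal_ne_top] at h
  have hm : Measurable fun x => ENNReal.ofReal (Real.exp (F x)) :=
    (Real.continuous_exp.comp hL.continuous).measurable.ennreal_ofReal
  rw [lintegral_mul_const _ hm] at h
  have hj := exp_integral_le_lintegral (hL.neg.integrable hL0) (hL.neg.integrable_exp hL0)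
  rw [integral_neg] at hj
  set I := ∫⁻ x, ENNReal.ofReal (Real.exp (F x)) ∂(stdG ι)
  set m := ∫ x, F x ∂(stdG ι)
  have h2 : I * ENNReal.ofReal (Real.exp (-m)) ≤ ENNReal.ofReal (Real.exp (Real.pi ^ 2 * L ^ 2 / 8)) :=
    (mul_le_mul_right hj _).trans h
  calc I = I * ENNReal.ofReal (Real.exp (-m)) * ENNReal.ofReal (Real.exp m) := by
        rw [mul_assoc, ← ENNReal.ofReal_mul (Real.exp_pos _).le, ← Real.exp_add]; simp
    _ ≤ _ := mul_le_mul_left h2 _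
    _ = _ := by rw [← ENNReal.ofReal_mul (Real.exp_pos _).le, ← Real.exp_add]; ring_nf

/-- Gaussian concentration: the lower tail. -/
theorem prob_le_sub_of_lipE {F : (ι → ℝ) → ℝ} {L : ℝ} (hL0 : 0 < L) (hL : LipE L F) {t : ℝ}
    (ht : 0 ≤ t) : stdG ι {x | F x ≤ ∫ y, F y ∂(stdG ι) - t} ≤
      ENNReal.ofReal (Real.exp (-(2 * t ^ 2 / (Real.pi ^ 2 * L ^ 2)))) := by
  have hpi := Real.pi_pos
  set m := ∫ x, F x ∂(stdG ι)
  set s := 4 * t / (Real.pi ^ 2 * L ^ 2) with hs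
  have hs0 : 0 ≤ s := by positivity
  have h := lintegral_exp_le_of_lipE (by positivity) (hL.const_mul (-s))
  rw [integral_const_mul] at h
  have hmk := mul_meas_ge_le_lintegral (μ := stdG ι)
    (f := fun x => ENNReal.ofReal (Real.exp (-s * F x)))
    (Real.continuous_exp.comp (continuous_const.mul hL.continuous)).measurable.ennreal_ofReal
    (ENNReal.ofReal (Real.exp (-s * (m - t))))
  have hsub : {x | F x ≤ m - t} ⊆ {x | ENNReal.ofReal (Real.exp (-s * (m - t))) ≤
      ENNReal.ofReal (Real.exp (-s * F x))} := by
    intro x hx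
    refine ENNReal.ofReal_le_ofReal (Real.exp_le_exp.2 ?_)
    have : F x ≤ m - t := hx
    nlinarith
  have h3 := (mul_le_mul_right (measure_mono hsub) _).trans (hmk.trans h)
  set p := stdG ι {x | F x ≤ m - t}
  calc p = ENNReal.ofReal (Real.exp (s * (m - t))) * (ENNReal.ofReal (Real.exp (-s * (m - t))) * p) := by
        rw [← mul_assoc, ← ENNReal.ofReal_mul (Real.exp_pos _).le, ← Real.exp_add]; simp
    _ ≤ _ := mul_le_mul_right h3 _
    _ = _ := by
        rw [← ENNReal.ofReal_mul (Real.exp_pos _).le, ← Real.exp_add]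
        congr 2
        rw [abs_neg, abs_of_nonneg hs0, hs]
        change _ + (_ * m + _) = _
        field_simp
        ring

theorem lipE_goe_trace {n : ℕ} {h : ℝ → ℝ} {l : ℝ} (hl : 0 ≤ l) (hh : ∀ x y, |h x - h y| ≤ l * |x - y|) :
    LipE (Real.sqrt (2 * n) * l) fun x : Fin n × Fin n → ℝ => ∑ i, h (evs (goe n x) i) := by
  intro x y
  refine (abs_sum_evs_sub_le hl hh _ _).trans ?_
  rw [mul_comm (Real.sqrt _) l, mul_assoc, Real.sqrt_mul (by norm_num), mul_comm (Real.sqrt 2),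
    mul_assoc]
  refine mul_le_mul_of_nonneg_left (mul_le_mul_of_nonneg_left ?_ (Real.sqrt_nonneg _)) hl
  rw [← Real.sqrt_mul (by norm_num)]
  refine Real.sqrt_le_sqrt ?_
  have h2 : Real.sqrt 2 ^ 2 = 2 := Real.sq_sqrt (by norm_num)
  have h0 : Real.sqrt 2 ≠ 0 := by positivity
  have hs : ∀ (z : Fin n × Fin n → ℝ) i j, sy (goe n z) i j = (z (i, j) + z (j, i)) / Real.sqrt 2 := by
    intro z i j
    simp only [sy, goe, Matrix.smul_apply, Matrix.add_apply, Matrix.transpose_apply, smul_eq_mul]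
    ring
  calc ∑ i, ∑ j, (sy (goe n x) i j - sy (goe n y) i j) ^ 2
      ≤ ∑ i, ∑ j, ((x (i, j) - y (i, j)) ^ 2 + (x (j, i) - y (j, i)) ^ 2) := by
        refine Finset.sum_le_sum fun i _ => Finset.sum_le_sum fun j _ => ?_
        rw [hs, hs, ← sub_div, div_pow, h2]
        nlinarith [sq_nonneg ((x (i, j) - y (i, j)) - (x (j, i) - y (j, i)))]
    _ = 2 * ∑ p, (x p - y p) ^ 2 := by
        simp_rw [Finset.sum_add_distrib]
        rw [Finset.sum_comm (f := fun i j => (x (j, i) - y (j, i)) ^ 2), ← two_mul,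
          Fintype.sum_prod_type]

end

section

theorem integrable_pow_gaussian (m : ℕ) : Integrable (fun x : ℝ => x ^ m) (gaussianReal 0 1) := by
  refine ((integrable_exp_abs_gaussian 1).const_mul (m.factorial : ℝ)).mono' (by fun_prop)
    (ae_of_all _ fun x => ?_)
  rw [norm_pow, Real.norm_eq_abs, one_mul]
  exact pow_le_factorial_mul_exp (abs_nonneg x) m

theorem gaussian_moment_succ (m : ℕ) :
    ∫ x, x ^ (m + 1) ∂(gaussianReal 0 1) = m * ∫ x, x ^ (m - 1) ∂(gaussianReal 0 1) := by
  have hk : ∀ k : ℕ, Integrable (fun x : ℝ => gaussianPDFReal 0 1 x * x ^ k) := by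
    intro k
    have h := integrable_pow_gaussian k
    rw [gaussianReal_of_var_ne_zero 0 one_ne_zero, integrable_withDensity_iff_integrable_smul₀'
      (by fun_prop) (by simp [gaussianPDF])] at h
    refine h.congr (ae_of_all _ fun x => ?_)
    simp [gaussianPDF, gaussianPDFReal_nonneg]
  have hd : ∀ x : ℝ, HasDerivAt (gaussianPDFReal 0 1) (-x * gaussianPDFReal 0 1 x) x := by
    intro x
    have h1 : HasDerivAt (fun x : ℝ => -(x - 0) ^ 2 / (2 * ((1 : ℝ≥0) : ℝ))) (-x) x := by
      have := ((((hasDerivAt_id x).sub_const 0).pow 2).neg).div_const (2 * ((1 : ℝ≥0) : ℝ))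
      refine this.congr_deriv ?_
      simp; ring
    exact ((h1.exp).const_mul _).congr_deriv (by rw [gaussianPDFReal]; ring)
  have key := integral_eq_zero_of_hasDerivAt_of_integrable
    (f := fun x : ℝ => gaussianPDFReal 0 1 x * x ^ m)
    (f' := fun x => -(gaussianPDFReal 0 1 x * x ^ (m + 1)) + m * (gaussianPDFReal 0 1 x * x ^ (m - 1)))
    (fun x => ((hd x).mul (hasDerivAt_pow m x)).congr_deriv (by ring))
    ((hk (m + 1)).neg.add ((hk (m - 1)).const_mul _)) (hk m)
  have h1 := integral_add (hk (m + 1)).neg ((hk (m - 1)).const_mul (m : ℝ))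
  simp only [Pi.neg_apply] at h1
  rw [h1, integral_neg, integral_const_mul] at key
  simp_rw [integral_gaussianReal_eq_integral_smul one_ne_zero, smul_eq_mul]
  linarith

open MvPolynomial

variable {ι : Type*} [Fintype ι]

theorem integrable_eval_stdG (p : MvPolynomial ι ℝ) : Integrable (fun x => eval x p) (stdG ι) := by
  induction p using MvPolynomial.induction_on' with
  | monomial s a =>
    simp only [eval_monomial]
    refine Integrable.const_mul ?_ a
    simp_rw [Finsupp.prod_fintype _ _ (fun i => pow_zero _)]
    exact Integrable.fintype_prod (f := fun (i : ι) y => y ^ s i)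
      (fun i => integrable_pow_gaussian (s i))
  | add p q hp hq =>
    simp only [map_add]
    exact hp.add hq

/-- The Gaussian expectation of a polynomial. -/
def gE : MvPolynomial ι ℝ →ₗ[ℝ] ℝ where
  toFun p := ∫ x, eval x p ∂(stdG ι)
  map_add' p q := by
    simp only [map_add]; exact integral_add (integrable_eval_stdG p) (integrable_eval_stdG q)
  map_smul' a p := by
    simp only [smul_eval, RingHom.id_apply, smul_eq_mul]; exact integral_const_mul _ _

theorem gE_monomial (s : ι →₀ ℕ) (a : ℝ) :
    gE (monomial s a) = a * ∏ i, ∫ y, y ^ s i ∂(gaussianReal 0 1) := by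
  change ∫ x, eval x (monomial s a) ∂(stdG ι) = _
  simp only [eval_monomial]
  rw [integral_const_mul]
  simp_rw [Finsupp.prod_fintype _ _ (fun i => pow_zero _)]
  rw [stdG, integral_fintype_prod_eq_prod (f := fun (i : ι) y => y ^ s i)]

/-- Gaussian integration by parts for polynomials. -/
theorem gE_X_mul (a : ι) (p : MvPolynomial ι ℝ) : gE (X a * p) = gE (pderiv a p) := by
  classical
  induction p using MvPolynomial.induction_on' with
  | monomial s r =>
    rw [pderiv_monomial, X, monomial_mul, gE_monomial, gE_monomial, one_mul, mul_assoc,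
      ← Finset.mul_prod_erase _ _ (Finset.mem_univ a), ← Finset.mul_prod_erase _ _ (Finset.mem_univ a),
      ← mul_assoc (s a : ℝ)]
    have h : ∀ i ∈ Finset.univ.erase a, ((Finsupp.single a 1 + s : ι →₀ ℕ)) i = s i ∧
        ((s - Finsupp.single a 1 : ι →₀ ℕ)) i = s i := fun i hi => by
      have := Finset.ne_of_mem_erase hi
      simp [this.symm]
    have h1 := Finset.prod_congr rfl fun i hi =>
      congrArg (fun m : ℕ => ∫ y, y ^ m ∂(gaussianReal 0 1)) (h i hi).1
    have h2 := Finset.prod_congr rfl fun i hi =>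
      congrArg (fun m : ℕ => ∫ y, y ^ m ∂(gaussianReal 0 1)) (h i hi).2
    rw [h1, h2]
    congr 2
    have e1 : ((Finsupp.single a 1 + s : ι →₀ ℕ)) a = s a + 1 := by simp [add_comm]
    have e2 : ((s - Finsupp.single a 1 : ι →₀ ℕ)) a = s a - 1 := by simp
    rw [e1, e2]
    exact gaussian_moment_succ (s a)
  | add p q hp hq => rw [mul_add, map_add, map_add, map_add, hp, hq]

variable {n : ℕ}

/-- The generic symmetric matrix with polynomial entries. -/
def pW (n : ℕ) : Matrix (Fin n) (Fin n) (MvPolynomial (Fin n × Fin n) ℝ) :=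
  fun i j => C (1 / Real.sqrt 2) * (X (i, j) + X (j, i))

/-- The derivation dual to the entry `(i, j)` of `pW`. -/
def pD (i j : Fin n) : Derivation ℝ (MvPolynomial (Fin n × Fin n) ℝ) (MvPolynomial (Fin n × Fin n) ℝ) :=
  (1 / Real.sqrt 2) • (pderiv (i, j) + pderiv (j, i))

theorem gE_pW_mul (i j : Fin n) (p : MvPolynomial (Fin n × Fin n) ℝ) :
    gE (pW n i j * p) = gE (pD i j p) := by
  have h1 : pW n i j * p = (1 / Real.sqrt 2) • (X (i, j) * p + X (j, i) * p) := by
    rw [pW, smul_eq_C_mul]; ring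
  rw [h1, map_smul, map_add, gE_X_mul, gE_X_mul, ← map_add, ← map_smul]
  rfl

theorem pD_pW (i j k l : Fin n) : pD i j (pW n k l) =
    (if i = k ∧ j = l then 1 else 0) + (if i = l ∧ j = k then 1 else 0) := by
  have h2 : (Real.sqrt 2)⁻¹ * (Real.sqrt 2)⁻¹ = 1 / 2 := by
    rw [← mul_inv, Real.mul_self_sqrt (by norm_num)]; norm_num
  have hX : ∀ a b c d : Fin n, pderiv (a, b) (X (c, d) : MvPolynomial (Fin n × Fin n) ℝ) =
      if a = c ∧ b = d then 1 else 0 := by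
    intro a b c d
    rw [pderiv_X, Pi.single_apply]
    simp [Prod.ext_iff, eq_comm]
  have e : pD i j (pW n k l) = (1 / 2 : ℝ) • (pderiv (i, j) (X (k, l) + X (l, k)) +
      pderiv (j, i) (X (k, l) + X (l, k)) : MvPolynomial (Fin n × Fin n) ℝ) := by
    rw [pW, ← smul_eq_C_mul, pD, Derivation.smul_apply, Derivation.map_smul, smul_smul]
    simp only [one_div, h2, Derivation.add_apply]
  rw [e]
  simp only [map_add, hX]
  have h3 : ∀ p q : MvPolynomial (Fin n × Fin n) ℝ,
      (1 / 2 : ℝ) • (p + q + (q + p)) = p + q := by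
    intro p q
    rw [add_comm q p, ← two_smul ℝ (p + q), smul_smul]; norm_num
  rw [show (if i = l ∧ j = k then (1 : MvPolynomial (Fin n × Fin n) ℝ) else 0) =
    if j = k ∧ i = l then 1 else 0 by simp only [and_comm],
    show (if j = l ∧ i = k then (1 : MvPolynomial (Fin n × Fin n) ℝ) else 0) =
    if i = k ∧ j = l then 1 else 0 by simp only [and_comm]]
  exact h3 _ _

theorem pD_pow (i j : Fin n) (k : ℕ) (a b : Fin n) :
    pD i j ((pW n ^ k) a b) = ∑ s ∈ Finset.range k,
      ((pW n ^ s) a i * (pW n ^ (k - 1 - s)) j b + (pW n ^ s) a j * (pW n ^ (k - 1 - s)) i b) := by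
  induction k generalizing b with
  | zero =>
    simp only [pow_zero, Matrix.one_apply, Finset.range_zero, Finset.sum_empty]
    split_ifs <;> simp
  | succ k ih =>
    rw [pow_succ, Matrix.mul_apply, map_sum]
    simp_rw [Derivation.leibniz, smul_eq_mul, pD_pW, ih]
    rw [Finset.sum_add_distrib, Finset.sum_range_succ, add_comm]
    congr 1
    · simp_rw [Finset.mul_sum]
      rw [Finset.sum_comm]
      refine Finset.sum_congr rfl fun s hs => ?_
      have hs' := Finset.mem_range.1 hs
      rw [show k + 1 - 1 - s = (k - 1 - s) + 1 by omega, pow_succ (pW n) (k - 1 - s),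
        Matrix.mul_apply, Matrix.mul_apply, Finset.mul_sum, Finset.mul_sum, ← Finset.sum_add_distrib]
      exact Finset.sum_congr rfl fun c _ => by ring
    · simp only [Nat.add_sub_cancel, Nat.sub_self, pow_zero, Matrix.one_apply, mul_add,
        Finset.sum_add_distrib, mul_ite, mul_one, mul_zero]
      congr 1
      · rw [Finset.sum_eq_single i] <;> simp +contextual [eq_comm]
      · rw [Finset.sum_eq_single j] <;> simp +contextual [eq_comm]

end

section

open MvPolynomial

variable {n : ℕ}

/-- The trace of the `k`-th power of the generic symmetric matrix. -/
def pT (n k : ℕ) : MvPolynomial (Fin n × Fin n) ℝ := (pW n ^ k).trace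

theorem pW_transpose (n : ℕ) : (pW n).transpose = pW n := by
  ext1 i j; simp only [Matrix.transpose_apply, pW, add_comm]

theorem pW_pow_symm (k : ℕ) (i j : Fin n) : (pW n ^ k) i j = (pW n ^ k) j i := by
  have : ((pW n) ^ k).transpose = pW n ^ k := by rw [Matrix.transpose_pow, pW_transpose]
  exact (congrFun (congrFun this j) i)

theorem sum_pW_pow_mul (a b : ℕ) : ∑ i, ∑ j, (pW n ^ a) j i * (pW n ^ b) i j = pT n (a + b) := by
  rw [pT, pow_add, Matrix.trace, Finset.sum_comm]
  exact Finset.sum_congr rfl fun i _ => by rw [Matrix.diag_apply, Matrix.mul_apply]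

/-- The carré-du-champ derivation paired with `pT n (k + 1)`. -/
def pG (n k : ℕ) (F : MvPolynomial (Fin n × Fin n) ℝ) : MvPolynomial (Fin n × Fin n) ℝ :=
  ∑ i, ∑ j, (pW n ^ k) j i * pD i j F

theorem pG_one (k : ℕ) : pG n k 1 = 0 := by simp [pG]

theorem pG_mul (k : ℕ) (F H : MvPolynomial (Fin n × Fin n) ℝ) :
    pG n k (F * H) = pG n k F * H + F * pG n k H := by
  simp only [pG, Finset.sum_mul, Finset.mul_sum, ← Finset.sum_add_distrib, Derivation.leibniz,
    smul_eq_mul]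
  exact Finset.sum_congr rfl fun i _ => Finset.sum_congr rfl fun j _ => by ring

theorem pD_pT (i j : Fin n) (l : ℕ) : pD i j (pT n (l + 1)) = (2 * (l + 1) : ℝ) • (pW n ^ l) i j := by
  rw [pT, Matrix.trace, map_sum]
  simp_rw [Matrix.diag_apply, pD_pow]
  rw [Finset.sum_comm]
  have : ∀ s ∈ Finset.range (l + 1), ∑ a, ((pW n ^ s) a i * (pW n ^ (l + 1 - 1 - s)) j a +
      (pW n ^ s) a j * (pW n ^ (l + 1 - 1 - s)) i a) = (2 : ℝ) • (pW n ^ l) i j := by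
    intro s hs
    have hs' := Finset.mem_range.1 hs
    have e : ∀ i j, ∑ a, (pW n ^ s) a i * (pW n ^ (l + 1 - 1 - s)) j a = (pW n ^ l) j i := by
      intro i j
      rw [show l = (l + 1 - 1 - s) + s by omega, pow_add, Matrix.mul_apply]
      exact Finset.sum_congr rfl fun a _ => by
        rw [mul_comm, show l + 1 - 1 - s + s + 1 - 1 - s = l + 1 - 1 - s by omega]
    rw [Finset.sum_add_distrib, e, e, pW_pow_symm l j i, two_smul]
  rw [Finset.sum_congr rfl this, Finset.sum_const, Finset.card_range, ← Nat.cast_smul_eq_nsmul ℝ,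
    smul_smul]
  congr 1; push_cast; ring

theorem pG_pT (k l : ℕ) : pG n k (pT n (l + 1)) = (2 * (l + 1) : ℝ) • pT n (k + l) := by
  simp only [pG, pD_pT, mul_smul_comm]
  simp_rw [← Finset.smul_sum]
  rw [sum_pW_pow_mul]

theorem pG_pT_zero (k : ℕ) : pG n k (pT n 0) = 0 := by
  have : pT n 0 = ((n : ℕ) : MvPolynomial (Fin n × Fin n) ℝ) := by simp [pT]
  rw [this]; simp [pG]

/-- The loop equation for traces of the Gaussian orthogonal ensemble. -/
theorem gE_pT_mul (k : ℕ) (F : MvPolynomial (Fin n × Fin n) ℝ) :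
    gE (pT n (k + 1) * F) = ∑ s ∈ Finset.range k, (gE (pT n (k - 1) * F) +
      gE (pT n s * (pT n (k - 1 - s) * F))) + gE (pG n k F) := by
  have h1 : pT n (k + 1) * F = ∑ i, ∑ j, pW n i j * ((pW n ^ k) j i * F) := by
    rw [pT, pow_succ', Matrix.trace, Finset.sum_mul]
    refine Finset.sum_congr rfl fun i _ => ?_
    rw [Matrix.diag_apply, Matrix.mul_apply, Finset.sum_mul]
    exact Finset.sum_congr rfl fun j _ => by ring
  have h2 : ∀ i j : Fin n, pD i j ((pW n ^ k) j i * F) = (pW n ^ k) j i * pD i j F +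
      ∑ s ∈ Finset.range k, ((pW n ^ s) j i * (pW n ^ (k - 1 - s)) i j * F +
        (pW n ^ s) j j * (pW n ^ (k - 1 - s)) i i * F) := by
    intro i j
    rw [Derivation.leibniz, smul_eq_mul, smul_eq_mul, pD_pow, Finset.mul_sum]
    congr 1
    refine Finset.sum_congr rfl fun s _ => ?_
    rw [pW_pow_symm (k - 1 - s) j i]; ring
  have h3 : ∑ i, ∑ j, pD i j ((pW n ^ k) j i * F) = ∑ s ∈ Finset.range k, (pT n (k - 1) * F +
      pT n s * (pT n (k - 1 - s) * F)) + pG n k F := by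
    have e1 : ∀ f : Fin n → Fin n → ℕ → MvPolynomial (Fin n × Fin n) ℝ,
        ∑ i, ∑ j, ∑ s ∈ Finset.range k, f i j s = ∑ s ∈ Finset.range k, ∑ i, ∑ j, f i j s := by
      intro f
      rw [Finset.sum_congr rfl fun i _ => Finset.sum_comm, Finset.sum_comm]
    have e2 : ∀ f g : Fin n → Fin n → MvPolynomial (Fin n × Fin n) ℝ,
        ∑ i, ∑ j, (f i j + g i j) = ∑ i, ∑ j, f i j + ∑ i, ∑ j, g i j := by
      intro f g; simp_rw [Finset.sum_add_distrib]
    simp_rw [h2]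
    rw [e2, ← pG, add_comm, e1]
    congr 1
    refine Finset.sum_congr rfl fun s hs => ?_
    have hs' := Finset.mem_range.1 hs
    rw [e2]
    congr 1
    · rw [show k - 1 = s + (k - 1 - s) by omega, ← sum_pW_pow_mul]
      simp_rw [Finset.sum_mul]
      rw [show s + (k - 1 - s) - s = k - 1 - s by omega]
    · simp only [pT, Matrix.trace, Matrix.diag_apply]
      rw [← mul_assoc, Finset.sum_mul_sum, Finset.sum_comm]
      simp_rw [Finset.sum_mul]
  rw [h1, map_sum]
  simp_rw [map_sum, gE_pW_mul, ← map_sum]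
  rw [h3, map_add, map_sum]
  simp_rw [map_add]

end

section

open MvPolynomial

/-- The moments of the semicircle law. -/
def scm (k : ℕ) : ℝ := if Even k then (catalan (k / 2) : ℝ) else 0

theorem sum_range_even {f : ℕ → ℝ} (hf : ∀ s, Odd s → f s = 0) (p : ℕ) :
    ∑ s ∈ Finset.range (2 * p + 1), f s = ∑ i ∈ Finset.range (p + 1), f (2 * i) := by
  induction p with
  | zero => simp
  | succ p ih =>
    rw [show 2 * (p + 1) + 1 = 2 * p + 1 + 1 + 1 by ring, Finset.sum_range_succ,
      Finset.sum_range_succ, ih, hf (2 * p + 1) ⟨p, rfl⟩, Finset.sum_range_succ _ (p + 1)]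
    ring_nf

theorem scm_succ (k : ℕ) : scm (k + 1) = ∑ s ∈ Finset.range k, scm s * scm (k - 1 - s) := by
  have hodd : ∀ s, Odd s → scm s = 0 := fun s hs => by
    rw [scm, if_neg (Nat.not_even_iff_odd.2 hs)]
  have heven : ∀ i, scm (2 * i) = catalan i := fun i => by simp [scm]
  rcases Nat.even_or_odd' k with ⟨p, rfl | rfl⟩
  · rw [hodd _ ⟨p, rfl⟩]
    symm
    refine Finset.sum_eq_zero fun s hs => ?_
    have hs' := Finset.mem_range.1 hs
    rcases Nat.even_or_odd' s with ⟨q, rfl | rfl⟩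
    · rw [hodd (2 * p - 1 - 2 * q) ⟨p - q - 1, by omega⟩, mul_zero]
    · rw [hodd _ ⟨q, rfl⟩, zero_mul]
  · rw [show 2 * p + 1 + 1 = 2 * (p + 1) by ring, heven, catalan_succ,
      sum_range_even (fun s hs => by rw [hodd s hs, zero_mul])]
    push_cast
    rw [← Fin.sum_univ_eq_sum_range (fun i => scm (2 * i) * scm (2 * p - 2 * i))]
    refine Finset.sum_congr rfl fun i _ => ?_
    rw [show 2 * p - 2 * (i : ℕ) = 2 * (p - i) by omega, heven, heven]

/-- A product of traces of powers. -/
def lT (n : ℕ) (ks : List ℕ) : MvPolynomial (Fin n × Fin n) ℝ := (ks.map (pT n)).prod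

theorem lT_cons (n k : ℕ) (ks : List ℕ) : lT n (k :: ks) = pT n k * lT n ks := by simp [lT]

theorem lT_append (n : ℕ) (ks ls : List ℕ) : lT n (ks ++ ls) = lT n ks * lT n ls := by simp [lT]

/-- A normalised Gaussian expectation. -/
def nE (a b n : ℕ) (F : MvPolynomial (Fin n × Fin n) ℝ) : ℝ := gE F / ((n : ℝ) ^ a * Real.sqrt n ^ b)

theorem nE_succ (a b : ℕ) {n : ℕ} (F : MvPolynomial (Fin n × Fin n) ℝ) :
    nE (a + 1) b n F = nE a b n F * (1 / n) := by
  rw [nE, nE, pow_succ, div_mul_div_comm, mul_one]; congr 1; ring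

theorem nE_add_two (a b : ℕ) {n : ℕ} (F : MvPolynomial (Fin n × Fin n) ℝ) :
    nE a (b + 2) n F = nE (a + 1) b n F := by
  rw [nE, nE, pow_add, Real.sq_sqrt (Nat.cast_nonneg n)]; congr 1; ring

theorem nE_add (a b : ℕ) {n : ℕ} (F H : MvPolynomial (Fin n × Fin n) ℝ) :
    nE a b n (F + H) = nE a b n F + nE a b n H := by
  rw [nE, map_add, add_div]; rfl

theorem nE_smul (a b : ℕ) {n : ℕ} (r : ℝ) (F : MvPolynomial (Fin n × Fin n) ℝ) :
    nE a b n (r • F) = r * nE a b n F := by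
  rw [nE, map_smul, smul_eq_mul, mul_div_assoc]; rfl

/-- The normalised mixed moments of `ks` converge. -/
def MomConv (ks : List ℕ) : Prop :=
  Tendsto (fun n => nE ks.length ks.sum n (lT n ks)) atTop (nhds (ks.map scm).prod)

theorem tendsto_nE_pG (k M : ℕ) (ih : ∀ ks : List ℕ, ks.sum + ks.length < M → MomConv ks)
    (ls : List ℕ) : ∀ ks : List ℕ, k + 2 + ks.sum + ks.length + ls.sum + ls.length ≤ M →
    Tendsto (fun n => nE (1 + ks.length + ls.length) (k + 1 + ks.sum + ls.sum) n
      (lT n ks * pG n k (lT n ls))) atTop (nhds 0) := by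
  induction ls with
  | nil =>
    intro ks _
    have : ∀ n, lT n ks * pG n k (lT n []) = 0 := fun n => by simp [lT, pG_one]
    simp [this, nE]
  | cons l ls hls =>
    intro ks hM
    simp only [List.sum_cons, List.length_cons] at hM
    have h2 := hls (l :: ks) (by simp only [List.sum_cons, List.length_cons]; omega)
    have e : ∀ n, lT n ks * pG n k (lT n (l :: ls)) = lT n ks * (pG n k (pT n l) * lT n ls) +
        lT n (l :: ks) * pG n k (lT n ls) := fun n => by
      rw [lT_cons, pG_mul, lT_cons]; ring
    simp_rw [e, nE_add]
    rw [← zero_add (0 : ℝ)]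
    refine Tendsto.add ?_ ?_
    · rcases l with _ | l
      · simp [pG_pT_zero, nE]
      · have h3 := ih ((k + l) :: (ks ++ ls)) (by
          simp only [List.sum_cons, List.length_cons, List.sum_append, List.length_append]; omega)
        have h4 : ∀ n, lT n ks * (pG n k (pT n (l + 1)) * lT n ls) =
            (2 * (l + 1) : ℝ) • lT n ((k + l) :: (ks ++ ls)) := fun n => by
          rw [pG_pT, lT_cons, lT_append, smul_mul_assoc, mul_smul_comm]; congr 1; ring
        have hl : 1 + ks.length + ((l + 1) :: ls).length =
          (((k + l) :: (ks ++ ls)).length) + 1 := by simp; ring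
        have hs : k + 1 + ks.sum + ((l + 1) :: ls).sum = ((k + l) :: (ks ++ ls)).sum + 2 := by
          simp; ring
        simp_rw [h4, nE_smul, hl, hs, nE_add_two, nE_succ]
        have h5 := ((h3.mul tendsto_one_div_atTop_nhds_zero_nat).mul
          tendsto_one_div_atTop_nhds_zero_nat).const_mul (2 * (l + 1) : ℝ)
        simpa using h5
    · convert h2 using 3 with n
      · simp; ring
      · simp; ring

theorem momConv (ks : List ℕ) : MomConv ks := by
  induction hM : ks.sum + ks.length using Nat.strong_induction_on generalizing ks with
  | _ M ihM =>
  have ih : ∀ ls : List ℕ, ls.sum + ls.length < M → MomConv ls := fun ls h => ihM _ h ls rfl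
  rcases ks with _ | ⟨k, ks⟩
  · have : ∀ n : ℕ, gE (1 : MvPolynomial (Fin n × Fin n) ℝ) = 1 := fun n => by
      change ∫ x, eval x (1 : MvPolynomial (Fin n × Fin n) ℝ) ∂(stdG _) = 1
      simp
    simp [MomConv, lT, nE, this]
  simp only [List.sum_cons, List.length_cons] at hM
  rcases k with _ | k
  · have h := ih ks (by omega)
    have e : ∀ᶠ n : ℕ in atTop, nE ks.length ks.sum n (lT n ks) =
        nE (0 :: ks).length (0 :: ks).sum n (lT n (0 :: ks)) := by
      filter_upwards [eventually_gt_atTop 0] with n hn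
      have h1 : lT n (0 :: ks) = (n : ℝ) • lT n ks := by
        rw [lT_cons, smul_eq_C_mul]; simp [pT]
      rw [h1, nE_smul, List.length_cons, nE_succ, List.sum_cons, zero_add]
      field_simp
    have h' := h.congr' e
    simpa [MomConv, scm] using h'
  · have hF : ∀ n, nE ((k + 1) :: ks).length ((k + 1) :: ks).sum n (lT n ((k + 1) :: ks)) =
        ∑ s ∈ Finset.range k, (nE ((k - 1) :: ks).length ((k - 1) :: ks).sum n
            (lT n ((k - 1) :: ks)) * (1 / n) +
          nE (s :: (k - 1 - s) :: ks).length (s :: (k - 1 - s) :: ks).sum n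
            (lT n (s :: (k - 1 - s) :: ks))) +
        nE (1 + ([] : List ℕ).length + ks.length) (k + 1 + ([] : List ℕ).sum + ks.sum) n
          (lT n [] * pG n k (lT n ks)) := by
      intro n
      rw [lT_cons, nE, gE_pT_mul, add_div, Finset.sum_div]
      congr 1
      · refine Finset.sum_congr rfl fun s hs => ?_
        have hs' := Finset.mem_range.1 hs
        rw [add_div, ← nE_succ, ← lT_cons, ← lT_cons, ← lT_cons]
        change nE _ _ n _ + nE _ _ n _ = _
        congr 1
        · rw [← nE_add_two]
          congr 1; simp; omega
        · have : ((k + 1) :: ks).sum = (s :: (k - 1 - s) :: ks).sum + 2 := by simp; omega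
          rw [this, nE_add_two]; rfl
      · simp only [lT, nE, List.map_nil, List.prod_nil, one_mul, List.length_nil, List.sum_nil,
          add_zero, List.length_cons, List.sum_cons]
        rw [add_comm 1]
    have hlim : Tendsto (fun n => nE ((k + 1) :: ks).length ((k + 1) :: ks).sum n
        (lT n ((k + 1) :: ks))) atTop (nhds (∑ s ∈ Finset.range k,
          ((((k - 1) :: ks).map scm).prod * 0 + ((s :: (k - 1 - s) :: ks).map scm).prod) + 0)) := by
      simp_rw [hF]
      refine Tendsto.add (tendsto_finsetSum _ fun s hs => ?_)
        (tendsto_nE_pG k M ih ks [] (by simp; omega))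
      have hs' := Finset.mem_range.1 hs
      refine Tendsto.add (Tendsto.mul (ih _ ?_) tendsto_one_div_atTop_nhds_zero_nat) (ih _ ?_)
      · simp only [List.sum_cons, List.length_cons]; omega
      · simp only [List.sum_cons, List.length_cons]; omega
    unfold MomConv
    convert hlim using 2
    simp only [List.map_cons, List.prod_cons, mul_zero, zero_add, add_zero, scm_succ, Finset.sum_mul,
      mul_assoc]

theorem eval_pT {n : ℕ} (k : ℕ) (x : Fin n × Fin n → ℝ) :
    eval x (pT n k) = ∑ i, evs (goe n x) i ^ k := by
  rw [← trace_pow_eq (goe_isSymm x)]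
  have h : (pW n).map (eval x) = goe n x := by
    ext i j
    simp [pW, goe]; ring
  have h2 : ((pW n) ^ k).map (eval x) = goe n x ^ k := by
    rw [Matrix.map_pow, h]
  rw [pT, ← h2, Matrix.trace, Matrix.trace, map_sum]
  rfl

/-- Convergence of the mean empirical moments of the Gaussian orthogonal ensemble. -/
theorem tendsto_goe_moment (k : ℕ) :
    Tendsto (fun n : ℕ => (∫ x, ∑ i, (evs (goe n x) i / Real.sqrt n) ^ k ∂(stdG (Fin n × Fin n))) / n)
      atTop (nhds (scm k)) := by
  have h := momConv [k]
  simp only [MomConv, List.length_cons, List.length_nil, List.sum_cons, List.sum_nil,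
    List.map_cons, List.map_nil, List.prod_cons, List.prod_nil, mul_one, add_zero, zero_add] at h
  convert h using 2 with n
  have : ∀ x : Fin n × Fin n → ℝ, ∑ i, (evs (goe n x) i / Real.sqrt n) ^ k =
      eval x (pT n k) * (Real.sqrt n ^ k)⁻¹ := by
    intro x; rw [eval_pT, Finset.sum_mul]; simp_rw [div_pow, div_eq_mul_inv]
  simp_rw [this]
  rw [integral_mul_const, nE, lT]
  simp only [List.map_cons, List.map_nil, List.prod_cons, List.prod_nil, mul_one, pow_one]
  change _ = (∫ x, eval x (pT n k) ∂(stdG _)) / _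
  field_simp

end

/-- Integration against the semicircle law on `[-2, 2]`. -/
def scI (h : ℝ → ℝ) : ℝ :=
  2 / Real.pi * ∫ θ in (0 : ℝ)..Real.pi, h (2 * Real.cos θ) * Real.sin θ ^ 2

theorem integral_cos_pow_even (p : ℕ) :
    ∫ θ in (0 : ℝ)..Real.pi, Real.cos θ ^ (2 * p) = Real.pi * (Nat.centralBinom p / 4 ^ p) := by
  induction p with
  | zero => simp
  | succ p ih =>
    rw [show 2 * (p + 1) = 2 * p + 2 by ring, integral_cos_pow, ih]
    have h := Nat.succ_mul_centralBinom_succ p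
    have h' : ((p : ℝ) + 1) * (Nat.centralBinom (p + 1) : ℝ) = 2 * (2 * p + 1) * Nat.centralBinom p := by
      exact_mod_cast h
    have h2 : (Nat.centralBinom (p + 1) : ℝ) = 2 * (2 * p + 1) * Nat.centralBinom p / (p + 1) := by
      field_simp; linarith
    rw [h2]
    simp
    field_simp
    ring

theorem integral_cos_pow_odd (p : ℕ) : ∫ θ in (0 : ℝ)..Real.pi, Real.cos θ ^ (2 * p + 1) = 0 := by
  induction p with
  | zero => simp
  | succ p ih =>
    rw [show 2 * (p + 1) + 1 = 2 * p + 1 + 2 by ring, integral_cos_pow, ih]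
    simp

theorem scI_pow (k : ℕ) : scI (fun x => x ^ k) = scm k := by
  have hpi := Real.pi_pos
  have hi : ∀ k, IntervalIntegrable (fun θ => Real.cos θ ^ k) volume 0 Real.pi := fun k =>
    Continuous.intervalIntegrable (by fun_prop) _ _
  have h : scI (fun x => x ^ k) = 2 / Real.pi * (2 ^ k *
      ((∫ θ in (0 : ℝ)..Real.pi, Real.cos θ ^ k) - ∫ θ in (0 : ℝ)..Real.pi, Real.cos θ ^ (k + 2))) := by
    rw [scI, ← intervalIntegral.integral_sub (hi _) (hi _)]
    have : (fun θ => (2 * Real.cos θ) ^ k * Real.sin θ ^ 2) =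
        fun θ => 2 ^ k * (Real.cos θ ^ k - Real.cos θ ^ (k + 2)) := by
      funext θ; rw [Real.sin_sq]; ring
    rw [this, intervalIntegral.integral_const_mul]
  rw [h]
  rcases Nat.even_or_odd' k with ⟨p, rfl | rfl⟩
  · have hc : ((p : ℝ) + 1) * (catalan p : ℝ) = Nat.centralBinom p := by
      exact_mod_cast succ_mul_catalan_eq_centralBinom p
    rw [integral_cos_pow, integral_cos_pow_even, scm, if_pos ⟨p, by ring⟩]
    simp only [Real.sin_pi, Real.sin_zero, mul_zero, sub_zero, zero_div, zero_add, pow_mul]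
    rw [← hc, show 2 * p / 2 = p by omega]
    push_cast
    norm_num
    field_simp
    ring
  · rw [integral_cos_pow, integral_cos_pow_odd, scm, if_neg (by simp)]
    simp

theorem scm_le (q : ℕ) : scm (2 * q) ≤ 4 ^ q := by
  have hc : ((q : ℝ) + 1) * (catalan q : ℝ) = Nat.centralBinom q := by
    exact_mod_cast succ_mul_catalan_eq_centralBinom q
  have h1 : (Nat.centralBinom q : ℝ) ≤ 4 ^ q := by
    have h2 : Nat.centralBinom q ≤ 2 ^ (2 * q) := by
      rw [Nat.centralBinom]; exact Nat.choose_le_two_pow _ _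
    rw [pow_mul] at h2
    exact_mod_cast h2
  rw [scm, if_pos ⟨q, by ring⟩, show 2 * q / 2 = q by omega]
  have : (0 : ℝ) ≤ q * catalan q := by positivity
  linarith

theorem scI_congr_abs_le {f g : ℝ → ℝ} {ε : ℝ} (hf : Continuous f) (hg : Continuous g)
    (h : ∀ x ∈ Set.Icc (-2 : ℝ) 2, |f x - g x| ≤ ε) : |scI f - scI g| ≤ ε := by
  have hpi := Real.pi_pos
  have h1 := scI_pow 0
  have hs0 : scm 0 = 1 := by simp [scm]
  simp only [scI, pow_zero, one_mul, hs0] at h1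
  have hi : ∀ f : ℝ → ℝ, Continuous f →
      IntervalIntegrable (fun θ => f (2 * Real.cos θ) * Real.sin θ ^ 2) volume 0 Real.pi :=
    fun f hf => Continuous.intervalIntegrable (by fun_prop) _ _
  rw [scI, scI, ← mul_sub, ← intervalIntegral.integral_sub (hi f hf) (hi g hg), abs_mul,
    abs_of_pos (by positivity)]
  have hie : IntervalIntegrable (fun θ => ε * Real.sin θ ^ 2) volume 0 Real.pi :=
    Continuous.intervalIntegrable (by fun_prop) _ _
  calc _ ≤ 2 / Real.pi * ∫ θ in (0 : ℝ)..Real.pi, ε * Real.sin θ ^ 2 := by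
        gcongr
        rw [← Real.norm_eq_abs]
        refine intervalIntegral.norm_integral_le_of_norm_le hpi.le (ae_of_all _ fun θ _ => ?_) hie
        rw [← sub_mul, norm_mul, Real.norm_eq_abs, Real.norm_of_nonneg (sq_nonneg _)]
        refine mul_le_mul_of_nonneg_right (h _ ⟨?_, ?_⟩) (sq_nonneg _)
        · linarith [Real.neg_one_le_cos θ]
        · linarith [Real.cos_le_one θ]
    _ = ε := by
        rw [intervalIntegral.integral_const_mul, mul_left_comm, h1, mul_one]

/-- The mean of the linear statistic `h` under the normalised spectral distribution. -/
def LN (n : ℕ) (h : ℝ → ℝ) : ℝ :=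
  (∫ x, ∑ i, h (evs (goe n x) i / Real.sqrt n) ∂(stdG (Fin n × Fin n))) / n

theorem integrable_evs_pow (n k : ℕ) :
    Integrable (fun x => ∑ i, (evs (goe n x) i / Real.sqrt n) ^ k) (stdG (Fin n × Fin n)) := by
  have : ∀ x : Fin n × Fin n → ℝ, ∑ i, (evs (goe n x) i / Real.sqrt n) ^ k =
      MvPolynomial.eval x (pT n k) * (Real.sqrt n ^ k)⁻¹ := by
    intro x; rw [eval_pT, Finset.sum_mul]; simp_rw [div_pow, div_eq_mul_inv]
  simp_rw [this]
  exact (integrable_eval_stdG _).mul_const _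

theorem integrable_LN {h : ℝ → ℝ} (hm : Measurable h) {C : ℝ} {k : ℕ}
    (hb : ∀ x, |h x| ≤ C * (1 + x ^ (2 * k))) (n : ℕ) :
    Integrable (fun x => ∑ i, h (evs (goe n x) i / Real.sqrt n)) (stdG (Fin n × Fin n)) := by
  have hi : Integrable (fun x => C * ((n : ℝ) + ∑ i, (evs (goe n x) i / Real.sqrt n) ^ (2 * k)))
    (stdG (Fin n × Fin n)) := ((integrable_const (n : ℝ)).add (integrable_evs_pow n (2 * k))).const_mul C
  refine hi.mono' ?_ (ae_of_all _ fun x => ?_)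
  · refine Measurable.aestronglyMeasurable (Finset.measurable_fun_sum _ fun i _ => ?_)
    exact hm.comp ((measurable_evs_goe i).div_const _)
  · calc _ ≤ ∑ i, |h (evs (goe n x) i / Real.sqrt n)| := Finset.abs_sum_le_sum_abs _ _
      _ ≤ ∑ i, C * (1 + (evs (goe n x) i / Real.sqrt n) ^ (2 * k)) := Finset.sum_le_sum fun i _ => hb _
      _ = _ := by rw [← Finset.mul_sum, Finset.sum_add_distrib]; simp

theorem abs_eval_le_pow (p : Polynomial ℝ) : ∃ C, 0 ≤ C ∧ ∀ d, p.natDegree < d → ∀ x : ℝ,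
    |p.eval x| ≤ C * (1 + x ^ (2 * d)) := by
  refine ⟨∑ i ∈ Finset.range (p.natDegree + 1), |p.coeff i|,
    Finset.sum_nonneg fun i _ => abs_nonneg _, fun d hd x => ?_⟩
  rw [Polynomial.eval_eq_sum_range, Finset.sum_mul]
  refine (Finset.abs_sum_le_sum_abs _ _).trans (Finset.sum_le_sum fun i hi => ?_)
  rw [abs_mul, abs_pow]
  gcongr
  have hx : x ^ (2 * d) = |x| ^ (2 * d) := by rw [pow_mul, pow_mul, sq_abs]
  rw [hx]
  have hi' := Finset.mem_range.1 hi
  rcases le_total |x| 1 with h | h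
  · have := pow_le_one₀ (n := i) (abs_nonneg x) h
    have : 0 ≤ |x| ^ (2 * d) := by positivity
    linarith
  · have := pow_le_pow_right₀ h (show i ≤ 2 * d by omega)
    linarith

theorem tendsto_LN_poly (p : Polynomial ℝ) :
    Tendsto (fun n => LN n fun x => p.eval x) atTop (nhds (scI fun x => p.eval x)) := by
  have h1 : ∀ n, LN n (fun x => p.eval x) = ∑ k ∈ Finset.range (p.natDegree + 1),
      p.coeff k * LN n (fun x => x ^ k) := by
    intro n
    simp only [LN, Polynomial.eval_eq_sum_range]
    have : ∀ x : Fin n × Fin n → ℝ, ∑ i, ∑ k ∈ Finset.range (p.natDegree + 1),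
        p.coeff k * (evs (goe n x) i / Real.sqrt n) ^ k = ∑ k ∈ Finset.range (p.natDegree + 1),
        p.coeff k * ∑ i, (evs (goe n x) i / Real.sqrt n) ^ k := by
      intro x; rw [Finset.sum_comm]; simp_rw [Finset.mul_sum]
    simp_rw [this]
    rw [integral_finsetSum _ fun k _ => (integrable_evs_pow n k).const_mul _, Finset.sum_div]
    simp_rw [integral_const_mul, mul_div_assoc]
  have h2 : scI (fun x => p.eval x) = ∑ k ∈ Finset.range (p.natDegree + 1), p.coeff k * scm k := by
    simp only [← scI_pow, scI, Polynomial.eval_eq_sum_range]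
    simp_rw [Finset.sum_mul]
    rw [intervalIntegral.integral_finsetSum fun k _ =>
      Continuous.intervalIntegrable (by fun_prop) _ _, Finset.mul_sum]
    refine Finset.sum_congr rfl fun k _ => ?_
    simp_rw [mul_assoc]
    rw [intervalIntegral.integral_const_mul]; ring
  simp_rw [h1]
  rw [h2]
  exact tendsto_finsetSum _ fun k _ => (tendsto_goe_moment k).const_mul _

/-- The semicircle law for the Gaussian orthogonal ensemble. -/
theorem tendsto_LN {h : ℝ → ℝ} (hc : Continuous h) {C : ℝ} (hC : 0 ≤ C)
    (hb : ∀ x, |h x| ≤ C * (1 + x ^ 2)) :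
    Tendsto (fun n => LN n h) atTop (nhds (scI h)) := by
  rw [Metric.tendsto_atTop']
  intro ε' hε'
  set ε := ε' / 6 with hεd
  have hε : 0 < ε := by positivity
  obtain ⟨p, hp⟩ := exists_polynomial_near_of_continuousOn (-3) 3 h hc.continuousOn ε hε
  obtain ⟨D, hD, hDp⟩ := abs_eval_le_pow p
  set d := p.natDegree + 1 with hd
  set K := 2 * C + 2 * D with hK
  obtain ⟨j, hj⟩ : ∃ j : ℕ, K * 4 ^ d * (4 / 9 : ℝ) ^ j < ε := by
    have h1 : Tendsto (fun j : ℕ => K * 4 ^ d * (4 / 9 : ℝ) ^ j) atTop (nhds (K * 4 ^ d * 0)) :=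
      (tendsto_pow_atTop_nhds_zero_of_lt_one (by norm_num) (by norm_num)).const_mul _
    rw [mul_zero] at h1
    exact (h1.eventually (gt_mem_nhds hε)).exists
  set r : Polynomial ℝ := Polynomial.C ε + Polynomial.C (K / 9 ^ j) * Polynomial.X ^ (2 * (d + j)) with hr
  have hre : ∀ x, r.eval x = ε + K / 9 ^ j * x ^ (2 * (d + j)) := fun x => by simp [hr]
  have hclose : ∀ x, |h x - p.eval x| ≤ r.eval x := by
    intro x
    rw [hre]
    have hK0 : 0 ≤ K := by positivity
    have hpow : (0 : ℝ) ≤ x ^ (2 * (d + j)) := by rw [pow_mul]; positivity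
    by_cases hx : |x| ≤ 3
    · have := hp x (abs_le.1 hx)
      rw [abs_sub_comm] at this
      have : 0 ≤ K / 9 ^ j * x ^ (2 * (d + j)) := by positivity
      linarith
    · push Not at hx
      have hx9 : 9 ≤ x ^ 2 := by rw [← sq_abs]; nlinarith
      have h1 : (1 : ℝ) ≤ x ^ (2 * d) := by rw [pow_mul]; exact one_le_pow₀ (by linarith)
      have h2 : x ^ 2 ≤ x ^ (2 * d) := by
        rw [pow_mul]; exact le_self_pow₀ (by linarith) (by omega)
      have h3 : |h x - p.eval x| ≤ K * x ^ (2 * d) := by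
        have e1 := hb x
        have e2 := hDp d (by omega) x
        have e3 := abs_sub (h x) (p.eval x)
        have e4 : C * (1 + x ^ 2) ≤ C * (2 * x ^ (2 * d)) := by gcongr; linarith
        have e5 : D * (1 + x ^ (2 * d)) ≤ D * (2 * x ^ (2 * d)) := by gcongr; linarith
        rw [hK]; linarith
      have h4 : K * x ^ (2 * d) ≤ K / 9 ^ j * x ^ (2 * (d + j)) := by
        have e1 : x ^ (2 * (d + j)) = x ^ (2 * d) * (x ^ 2) ^ j := by
          rw [← pow_mul, ← pow_add, Nat.mul_add]
        rw [e1, div_mul_eq_mul_div, le_div_iff₀ (by positivity)]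
        have : (9 : ℝ) ^ j ≤ (x ^ 2) ^ j := by gcongr
        have h5 : 0 ≤ K * x ^ (2 * d) := by positivity
        nlinarith
      linarith
  obtain ⟨R, hR, hRr⟩ := abs_eval_le_pow r
  have hpm : Measurable fun x => p.eval x := p.continuous.measurable
  have hrm : Measurable fun x => r.eval x := r.continuous.measurable
  have hbh : ∀ x, |h x| ≤ C * (1 + x ^ (2 * 1)) := by simpa using hb
  have hmain : ∀ n, |LN n h - LN n (fun x => p.eval x)| ≤ LN n fun x => r.eval x := by
    intro n
    have i1 := integrable_LN hc.measurable hbh n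
    have i2 := integrable_LN hpm (hDp d (by omega)) n
    have i3 := integrable_LN hrm (hRr (r.natDegree + 1) (by omega)) n
    rw [LN, LN, ← sub_div, ← integral_sub i1 i2, abs_div,
      abs_of_nonneg (Nat.cast_nonneg (α := ℝ) n)]
    refine div_le_div_of_nonneg_right ?_ (Nat.cast_nonneg n)
    rw [← Real.norm_eq_abs]
    refine norm_integral_le_of_norm_le i3 (ae_of_all _ fun x => ?_)
    rw [← Finset.sum_sub_distrib]
    exact (Finset.abs_sum_le_sum_abs _ _).trans (Finset.sum_le_sum fun i _ => hclose _)
  have hscr : (scI fun x => r.eval x) ≤ 2 * ε := by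
    have : (scI fun x => r.eval x) = ε + K / 9 ^ j * scm (2 * (d + j)) := by
      have h0 := scI_pow 0
      have hs0 : scm 0 = 1 := by simp [scm]
      rw [← scI_pow (2 * (d + j))]
      simp only [hs0, scI, pow_zero, one_mul] at h0
      have e : (fun θ => r.eval (2 * Real.cos θ) * Real.sin θ ^ 2) = fun θ => ε * Real.sin θ ^ 2 +
          K / 9 ^ j * ((2 * Real.cos θ) ^ (2 * (d + j)) * Real.sin θ ^ 2) := by
        funext θ; rw [hre]; ring
      simp only [scI]
      rw [e, intervalIntegral.integral_add (Continuous.intervalIntegrable (by fun_prop) _ _)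
        (Continuous.intervalIntegrable (by fun_prop) _ _), intervalIntegral.integral_const_mul,
        intervalIntegral.integral_const_mul]
      linear_combination ε * h0
    rw [this]
    have h1 := scm_le (d + j)
    have : K / 9 ^ j * scm (2 * (d + j)) ≤ K / 9 ^ j * 4 ^ (d + j) := by gcongr
    have h2 : K / 9 ^ j * 4 ^ (d + j) = K * 4 ^ d * (4 / 9 : ℝ) ^ j := by
      rw [pow_add, div_pow]; ring
    linarith
  have hscp : |scI h - scI fun x => p.eval x| ≤ ε := by
    refine scI_congr_abs_le hc p.continuous fun x hx => ?_
    rw [abs_sub_comm]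
    exact (hp x ⟨by linarith [hx.1], by linarith [hx.2]⟩).le
  obtain ⟨n1, hn1⟩ := Metric.tendsto_atTop'.1 (tendsto_LN_poly p) ε hε
  obtain ⟨n2, hn2⟩ := Metric.tendsto_atTop'.1 (tendsto_LN_poly r) ε hε
  refine ⟨max n1 n2, fun n hn => ?_⟩
  have a1 := abs_lt.1 (hn1 n (lt_of_le_of_lt (le_max_left _ _) hn))
  have a2 := abs_lt.1 (hn2 n (lt_of_le_of_lt (le_max_right _ _) hn))
  have a3 := abs_le.1 (hmain n)
  have a4 := abs_le.1 hscp
  rw [Real.dist_eq, abs_lt]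
  constructor <;> linarith [a1.1, a1.2, a2.1, a2.2, a3.1, a3.2, a4.1, a4.2]

theorem log_Gamma_mid {s : ℝ} (hs : 0 < s) :
    Real.log (Real.Gamma (s + 1 / 2)) ≤ Real.log (Real.Gamma s) + Real.log s / 2 := by
  have h := Real.convexOn_log_Gamma.2 (Set.mem_Ioi.2 hs) (Set.mem_Ioi.2 (show 0 < s + 1 by linarith))
    (show (0 : ℝ) ≤ 1 / 2 by norm_num) (show (0 : ℝ) ≤ 1 / 2 by norm_num) (by norm_num)
  simp only [smul_eq_mul, Function.comp] at h
  rw [Real.Gamma_add_one hs.ne', Real.log_mul hs.ne' (Real.Gamma_pos_of_pos hs).ne',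
    show 1 / 2 * s + 1 / 2 * (s + 1) = s + 1 / 2 by ring] at h
  linarith

/-- Exponential growth rate of the normalising constant. -/
theorem tendsto_log_aN : Tendsto (fun n : ℕ => (Real.log (aN n).toReal + n / 2 * Real.log n) / n)
    atTop (nhds (1 / 2)) := by
  set c0 := Real.log 2 / 2 + Real.log Real.pi / 4 with hc0
  set S : ℕ → ℝ := fun n => Real.log (Stirling.stirlingSeq n) with hS
  have hSt : Tendsto S atTop (nhds (Real.log (Real.sqrt Real.pi))) :=
    (Real.continuousAt_log (by positivity)).tendsto.comp Stirling.tendsto_stirlingSeq_sqrt_pi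
  have hlog : Tendsto (fun n : ℕ => Real.log n / n) atTop (nhds 0) := by
    have := (Real.isLittleO_log_id_atTop.tendsto_div_nhds_zero).comp tendsto_natCast_atTop_atTop
    exact this
  have hinv : Tendsto (fun n : ℕ => (1 : ℝ) / n) atTop (nhds 0) := tendsto_one_div_atTop_nhds_zero_nat
  have hSn : Tendsto (fun n => S n * (1 / (n : ℝ))) atTop (nhds 0) := by
    simpa using hSt.mul hinv
  have key : ∀ e : ℝ, Tendsto (fun n : ℕ => 1 / 2 + (-(1 / 2) * (S n * (1 / n)) +
      e * (Real.log n / n) + (c0 - Real.log 2 / 4) * (1 / n))) atTop (nhds (1 / 2)) := by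
    intro e
    have := (((hSn.const_mul (-(1 / 2))).add (hlog.const_mul e)).add
      (hinv.const_mul (c0 - Real.log 2 / 4))).const_add (1 / 2)
    simpa using this
  refine tendsto_of_tendsto_of_tendsto_of_le_of_le' (key 0) (key (1 / 4)) ?_ ?_
  all_goals
    filter_upwards [eventually_ge_atTop 3] with n hn
    have hn0 : (0 : ℝ) < n := by exact_mod_cast (by omega : 0 < n)
    have hn3 : (3 : ℝ) ≤ n := by exact_mod_cast hn
    have hG := Real.Gamma_pos_of_pos hn0
    have hG2 := Real.Gamma_pos_of_pos (show (0 : ℝ) < n / 2 by linarith)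
    have hG3 := Real.Gamma_pos_of_pos (show (0 : ℝ) < n / 2 + 1 / 2 by linarith)
    have hG4 := Real.Gamma_pos_of_pos (show (0 : ℝ) < (n - 1) / 2 by linarith)
    have e1 : Real.log (aN n).toReal = n / 2 * Real.log 2 + Real.log (Real.Gamma (n / 2)) -
        Real.log (Real.Gamma n) := by
      rw [aN_eq (by omega), ENNReal.toReal_ofReal (by positivity),
        Real.log_div (by positivity) hG.ne', Real.log_mul (by positivity) hG2.ne', Real.log_pow,
        Real.log_sqrt (by norm_num)]
      ring
    have e2 : Real.log (Real.Gamma (n / 2)) + Real.log (Real.Gamma (n / 2 + 1 / 2)) =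
        Real.log (Real.Gamma n) + (1 - n) * Real.log 2 + Real.log Real.pi / 2 := by
      have h := Real.Gamma_mul_Gamma_add_half (n / 2 : ℝ)
      rw [← Real.log_mul hG2.ne' hG3.ne', h, show 2 * ((n : ℝ) / 2) = n by ring,
        Real.log_mul (by positivity) (by positivity), Real.log_mul hG.ne' (by positivity),
        Real.log_rpow (by norm_num), Real.log_sqrt (by positivity)]
    have e3 := log_Gamma_mid (show (0 : ℝ) < n / 2 by linarith)
    have e4 := log_Gamma_mid (show (0 : ℝ) < (n - 1) / 2 by linarith)
    have e5 : Real.log (Real.Gamma (n / 2 + 1 / 2)) =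
        Real.log ((n - 1) / 2) + Real.log (Real.Gamma ((n - 1) / 2)) := by
      rw [← Real.log_mul (by linarith) hG4.ne', ← Real.Gamma_add_one (by linarith)]
      congr 2; ring
    rw [show ((n : ℝ) - 1) / 2 + 1 / 2 = n / 2 by ring] at e4
    have e6 : 0 ≤ Real.log ((n - 1 : ℝ) / 2) := Real.log_nonneg (by linarith)
    have e7 : Real.log ((n : ℝ) / 2) ≤ Real.log n := Real.log_le_log (by linarith) (by linarith)
    have e8 : Real.log (Real.Gamma n) = Real.log (n.factorial : ℝ) - Real.log n := by
      have h := Real.Gamma_nat_eq_factorial n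
      rw [Real.Gamma_add_one hn0.ne'] at h
      rw [← h, Real.log_mul hn0.ne' hG.ne']; ring
    have e9 := Stirling.log_stirlingSeq_formula n
    rw [Real.log_mul (by norm_num) hn0.ne', Real.log_div hn0.ne' (Real.exp_pos 1).ne', Real.log_exp] at e9
    have e10 : S n = Real.log (Stirling.stirlingSeq n) := rfl
  · rw [le_div_iff₀ hn0, e1]
    have : (1 / 2 + (-(1 / 2) * (S n * (1 / n)) +
      0 * (Real.log n / n) + (c0 - Real.log 2 / 4) * (1 / n))) * n = n / 2 - S n / 2 + c0 - Real.log 2 / 4 := by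
      field_simp; ring
    rw [this]
    linarith
  · rw [div_le_iff₀ hn0, e1]
    have : (1 / 2 + (-(1 / 2) * (S n * (1 / n)) +
      1 / 4 * (Real.log n / n) + (c0 - Real.log 2 / 4) * (1 / n))) * n =
        n / 2 - S n / 2 + Real.log n / 4 + c0 - Real.log 2 / 4 := by
      field_simp; ring
    rw [this]
    linarith

/-- The rate function of the largest eigenvalue. -/
def rateK (x : ℝ) : ℝ :=
  (Real.sinh (2 * Real.arcosh (max x 2 / 2)) - 2 * Real.arcosh (max x 2 / 2)) / 2

theorem rateK_of_le {x : ℝ} (hx : x ≤ 2) : rateK x = 0 := by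
  simp [rateK, max_eq_right hx]

theorem rateK_strictMonoOn : StrictMonoOn rateK (Set.Ici 2) := by
  intro x hx y hy hxy
  have hx' : 2 ≤ x := hx
  have h1 : Real.arcosh (x / 2) < Real.arcosh (y / 2) :=
    (Real.arcosh_lt_arcosh (by linarith) (by linarith)).2 (by linarith)
  have := Real.sinh_sub_id_strictMono (show 2 * Real.arcosh (x / 2) < 2 * Real.arcosh (y / 2) by linarith)
  simp only [rateK, max_eq_left hx', max_eq_left (hx'.trans hxy.le)]
  simp only at this
  linarith

theorem rateK_mono : Monotone rateK := by
  intro x y hxy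
  have h1 : Real.arcosh (max x 2 / 2) ≤ Real.arcosh (max y 2 / 2) :=
    (Real.arcosh_le_arcosh (by positivity) (by positivity)).2 (by gcongr)
  have := Real.sinh_sub_id_strictMono.monotone
    (show 2 * Real.arcosh (max x 2 / 2) ≤ 2 * Real.arcosh (max y 2 / 2) by linarith)
  simp only [rateK]
  linarith

theorem rateK_nonneg (x : ℝ) : 0 ≤ rateK x := by
  rcases le_total x 2 with h | h
  · rw [rateK_of_le h]
  · have := rateK_mono h
    rwa [rateK_of_le le_rfl] at this

theorem rateK_pos {x : ℝ} (hx : 2 < x) : 0 < rateK x := by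
  have := rateK_strictMonoOn (Set.mem_Ici.2 le_rfl) (Set.mem_Ici.2 hx.le) hx
  rwa [rateK_of_le le_rfl] at this

theorem continuous_rateK : Continuous rateK := by
  have h : Continuous fun x : ℝ => Real.arcosh (max x 2 / 2) :=
    Real.continuousOn_arcosh.comp_continuous (by fun_prop)
      fun x => Set.mem_Ici.2 (by have := le_max_right x 2; linarith)
  unfold rateK
  exact ((Real.continuous_sinh.comp (h.const_mul 2)).sub (h.const_mul 2)).div_const 2

theorem hasSum_log_cos {r : ℝ} (hr0 : 0 ≤ r) (hr : r < 1) (θ : ℝ) :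
    HasSum (fun m : ℕ => r ^ m * Real.cos (m * θ) / m)
      (-(Real.log (1 - 2 * r * Real.cos θ + r ^ 2) / 2)) := by
  have hz : ‖(r : ℂ) * Complex.exp (θ * Complex.I)‖ < 1 := by
    rw [norm_mul, Complex.norm_exp_ofReal_mul_I, mul_one, Complex.norm_real, Real.norm_of_nonneg hr0]
    exact hr
  have h := Complex.hasSum_re (Complex.hasSum_taylorSeries_neg_log hz)
  have e1 : ∀ m : ℕ, (((r : ℂ) * Complex.exp (θ * Complex.I)) ^ m / m).re =
      r ^ m * Real.cos (m * θ) / m := by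
    intro m
    rw [mul_pow, ← Complex.exp_nat_mul, ← mul_assoc, Complex.div_natCast_re, ← Complex.ofReal_pow,
      Complex.re_ofReal_mul, ← Complex.ofReal_natCast, ← Complex.ofReal_mul,
      Complex.exp_ofReal_mul_I_re]
  simp_rw [e1] at h
  convert h using 1
  rw [Complex.neg_re, Complex.log_re]
  have e2 : ‖1 - (r : ℂ) * Complex.exp (θ * Complex.I)‖ ^ 2 = 1 - 2 * r * Real.cos θ + r ^ 2 := by
    rw [← Complex.normSq_eq_norm_sq, Complex.normSq_apply]
    simp only [Complex.sub_re, Complex.sub_im, Complex.one_re, Complex.one_im, Complex.re_ofReal_mul,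
      Complex.im_ofReal_mul, Complex.exp_ofReal_mul_I_re, Complex.exp_ofReal_mul_I_im]
    nlinarith [Real.sin_sq_add_cos_sq θ]
  rw [← e2, Real.log_pow]; push_cast; ring

theorem integral_cos_int_mul (k : ℤ) :
    ∫ θ in (0 : ℝ)..Real.pi, Real.cos (k * θ) = if k = 0 then Real.pi else 0 := by
  split_ifs with h
  · simp [h]
  · rw [intervalIntegral.integral_comp_mul_left (fun x => Real.cos x) (by exact_mod_cast h), integral_cos]
    simp [Real.sin_int_mul_pi]

theorem integral_cos_mul_sin_sq (m : ℕ) (hm : m ≠ 0) :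
    ∫ θ in (0 : ℝ)..Real.pi, Real.cos (m * θ) * Real.sin θ ^ 2 = if m = 2 then -(Real.pi / 4) else 0 := by
  have e : (fun θ => Real.cos (m * θ) * Real.sin θ ^ 2) = fun θ =>
      1 / 2 * Real.cos (((m : ℤ) : ℝ) * θ) - (1 / 4 * Real.cos (((m + 2 : ℤ) : ℝ) * θ) +
        1 / 4 * Real.cos (((m - 2 : ℤ) : ℝ) * θ)) := by
    funext θ
    have h1 : Real.sin θ ^ 2 = 1 / 2 - Real.cos (2 * θ) / 2 := Real.sin_sq_eq_half_sub θ
    push_cast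
    rw [add_mul, sub_mul, Real.cos_add, Real.cos_sub, h1]
    ring
  have hi : ∀ k : ℤ, ∀ a : ℝ, IntervalIntegrable (fun θ => a * Real.cos (k * θ)) volume 0 Real.pi :=
    fun k a => Continuous.intervalIntegrable (by fun_prop) _ _
  rw [e, intervalIntegral.integral_sub (hi _ _) ((hi _ _).add (hi _ _)),
    intervalIntegral.integral_add (hi _ _) (hi _ _)]
  simp only [intervalIntegral.integral_const_mul, integral_cos_int_mul]
  rw [if_neg (by exact_mod_cast hm), if_neg (by omega)]
  by_cases h2 : m = 2
  · simp [h2]; ring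
  · rw [if_neg (by omega), if_neg h2]; ring

/-- The logarithmic potential of the semicircle law outside its support. -/
theorem scI_log {x : ℝ} (hx : 2 < x) :
    scI (fun y => Real.log (x - y)) = x ^ 2 / 4 - 1 / 2 - rateK x := by
  have hpi := Real.pi_pos
  set u := Real.arcosh (x / 2) with hu
  have hu0 : 0 < u := Real.arcosh_pos (by linarith)
  have hxu : x = 2 * Real.cosh u := by rw [hu, Real.cosh_arcosh (by linarith)]; ring
  set r := Real.exp (-u) with hr
  have hr0 : 0 < r := Real.exp_pos _
  have hr1 : r < 1 := by rw [hr, Real.exp_lt_one_iff]; linarith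
  have hru : Real.exp u * r = 1 := by rw [hr, ← Real.exp_add]; simp
  have hx2 : x = Real.exp u + r := by rw [hxu, Real.cosh_eq]; ring
  have hK : rateK x = (Real.sinh (2 * u) - 2 * u) / 2 := by
    rw [rateK, max_eq_left hx.le]
  have hpos : ∀ θ, 0 < 1 - 2 * r * Real.cos θ + r ^ 2 := by
    intro θ
    have h1 := Real.cos_le_one θ
    nlinarith [sq_nonneg (1 - r), mul_nonneg hr0.le (sub_nonneg.2 h1), sq_pos_of_pos (sub_pos.2 hr1)]
  have hlog : ∀ θ, Real.log (x - 2 * Real.cos θ) = u + Real.log (1 - 2 * r * Real.cos θ + r ^ 2) := by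
    intro θ
    rw [← Real.log_exp u, ← Real.log_mul (Real.exp_pos u).ne' (hpos θ).ne']
    congr 1
    rw [hx2]
    linear_combination (2 * Real.cos θ - r) * hru
  have hsum : HasSum (fun m : ℕ => ∫ θ in (0 : ℝ)..Real.pi, r ^ m * Real.cos (m * θ) / m * Real.sin θ ^ 2)
      (∫ θ in (0 : ℝ)..Real.pi, -(Real.log (1 - 2 * r * Real.cos θ + r ^ 2) / 2) * Real.sin θ ^ 2) := by
    refine intervalIntegral.hasSum_integral_of_dominated_convergence (fun m _ => r ^ m)
      (fun m => Continuous.aestronglyMeasurable (by fun_prop)) (fun m => ae_of_all _ fun θ _ => ?_)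
      (ae_of_all _ fun θ _ => summable_geometric_of_lt_one hr0.le hr1)
      intervalIntegrable_const (ae_of_all _ fun θ _ => (hasSum_log_cos hr0.le hr1 θ).mul_right _)
    rw [norm_mul, norm_div, norm_mul, Real.norm_of_nonneg (pow_nonneg hr0.le _), Real.norm_eq_abs,
      Real.norm_eq_abs, Real.norm_eq_abs, abs_of_nonneg (sq_nonneg (Real.sin θ)), Nat.abs_cast]
    have h1 := Real.abs_cos_le_one (m * θ)
    have h2 := Real.sin_sq_le_one θ
    have h3 : 0 ≤ r ^ m := pow_nonneg hr0.le _
    rcases Nat.eq_zero_or_pos m with rfl | hm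
    · simp
    · have hm1 : (1 : ℝ) ≤ m := by exact_mod_cast hm
      have h4 : r ^ m * |Real.cos (m * θ)| / m ≤ r ^ m := by
        rw [div_le_iff₀ (by linarith)]
        nlinarith [mul_le_mul_of_nonneg_left h1 h3]
      calc _ ≤ r ^ m * 1 := mul_le_mul h4 h2 (sq_nonneg _) h3
        _ = _ := mul_one _
  have hval : ∫ θ in (0 : ℝ)..Real.pi, -(Real.log (1 - 2 * r * Real.cos θ + r ^ 2) / 2) * Real.sin θ ^ 2
      = -(Real.pi / 8) * r ^ 2 := by
    refine hsum.unique ?_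
    refine (hasSum_ite_eq (2 : ℕ) (-(Real.pi / 8) * r ^ 2)).congr_fun fun m => ?_
    have e : (fun θ => r ^ m * Real.cos (m * θ) / m * Real.sin θ ^ 2) =
        fun θ => r ^ m / m * (Real.cos (m * θ) * Real.sin θ ^ 2) := by funext θ; ring
    rw [e, intervalIntegral.integral_const_mul]
    rcases Nat.eq_zero_or_pos m with rfl | hm
    · simp
    · rw [integral_cos_mul_sin_sq m hm.ne']
      by_cases h2 : m = 2
      · simp only [h2, if_true]; push_cast; ring
      · simp [h2]
  have h0 := scI_pow 0
  have hs0 : scm 0 = 1 := by simp [scm]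
  simp only [hs0, scI, pow_zero, one_mul] at h0
  have e : (fun θ => Real.log (x - 2 * Real.cos θ) * Real.sin θ ^ 2) = fun θ => u * Real.sin θ ^ 2 +
      (-2) * (-(Real.log (1 - 2 * r * Real.cos θ + r ^ 2) / 2) * Real.sin θ ^ 2) := by
    funext θ; rw [hlog]; ring
  have hcl : Continuous fun θ => Real.log (1 - 2 * r * Real.cos θ + r ^ 2) :=
    Continuous.log (by fun_prop) fun θ => (hpos θ).ne'
  rw [scI, e, intervalIntegral.integral_add (Continuous.intervalIntegrable (by fun_prop) _ _)
    (Continuous.intervalIntegrable (by fun_prop) _ _), intervalIntegral.integral_const_mul,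
    intervalIntegral.integral_const_mul, hval, hK]
  have e3 : 2 / Real.pi * (-2 * (-(Real.pi / 8) * r ^ 2)) = r ^ 2 / 2 := by field_simp; ring
  have e4 : Real.sinh (2 * u) = (Real.exp u ^ 2 - r ^ 2) / 2 := by
    rw [Real.sinh_eq, hr, ← Real.exp_nat_mul, ← Real.exp_nat_mul]; push_cast; ring_nf
  rw [e4, mul_add, e3, hx2]
  linear_combination u * h0 - (1 / 2) * hru

/-- The exponential with values in `ℝ≥0∞`. -/
def oe (t : ℝ) : ℝ≥0∞ := ENNReal.ofReal (Real.exp t)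

theorem oe_mul (a b : ℝ) : oe a * oe b = oe (a + b) := by
  rw [oe, oe, oe, ← ENNReal.ofReal_mul (Real.exp_pos _).le, Real.exp_add]

theorem oe_le {a b : ℝ} (h : a ≤ b) : oe a ≤ oe b := ENNReal.ofReal_le_ofReal (Real.exp_le_exp.2 h)

theorem oe_rpow (a p : ℝ) : oe a ^ p = oe (a * p) := by
  rw [oe, oe, ENNReal.ofReal_rpow_of_pos (Real.exp_pos _), ← Real.exp_mul]

theorem oe_zero : oe 0 = 1 := by simp [oe]

theorem oe_ne_top (a : ℝ) : oe a ≠ ⊤ := ENNReal.ofReal_ne_top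

theorem oe_log {a : ℝ≥0∞} (h0 : a ≠ 0) (h1 : a ≠ ⊤) : oe (Real.log a.toReal) = a := by
  rw [oe, Real.exp_log (ENNReal.toReal_pos h0 h1), ENNReal.ofReal_toReal h1]

theorem oe_log_ofReal {a : ℝ} (h : 0 < a) : oe (Real.log a) = ENNReal.ofReal a := by
  rw [oe, Real.exp_log h]

theorem aN_pos {n : ℕ} (hn : 0 < n) : aN n ≠ 0 := by
  rw [aN_eq hn]
  have h1 := Real.Gamma_pos_of_pos (show (0 : ℝ) < n by exact_mod_cast hn)
  have h2 := Real.Gamma_pos_of_pos (show (0 : ℝ) < n / 2 by positivity)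
  exact (ENNReal.ofReal_pos.2 (by positivity)).ne'

theorem lintegral_oe_gaussian (M s : ℝ) :
    ∫⁻ z, oe (M * (z - s)) ∂(gaussianReal 0 1) = oe (M ^ 2 / 2 - M * s) := by
  have h := congrFun (mgf_fun_id_gaussianReal (μ := 0) (v := 1)) M
  simp only [mgf] at h
  have e : ∀ z, oe (M * (z - s)) = oe (-(M * s)) * ENNReal.ofReal (Real.exp (M * z)) := by
    intro z; rw [← oe, oe_mul]; congr 1; ring
  simp_rw [e]
  rw [lintegral_const_mul' _ _ (oe_ne_top _), ← ofReal_integral_eq_lintegral_ofReal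
    (integrable_exp_mul_gaussianReal M) (ae_of_all _ fun x => (Real.exp_pos _).le), h, ← oe, oe_mul]
  congr 1; simp; ring

/-- The logarithmic potential truncated at distance `δ`. -/
def lgm (δ y t : ℝ) : ℝ := Real.log (max |t - y| δ)

theorem log_sub_log_le {a b δ : ℝ} (hδ : 0 < δ) (ha : δ ≤ a) (hb : δ ≤ b) :
    Real.log a - Real.log b ≤ |a - b| / δ := by
  have hb0 : 0 < b := by linarith
  have ha0 : 0 < a := by linarith
  rw [← Real.log_div ha0.ne' hb0.ne']
  calc _ ≤ a / b - 1 := Real.log_le_sub_one_of_pos (by positivity)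
    _ = (a - b) / b := by field_simp
    _ ≤ |a - b| / b := by gcongr; exact le_abs_self _
    _ ≤ _ := by gcongr

theorem abs_max_sub_le (a b δ : ℝ) : |max a δ - max b δ| ≤ |a - b| := by
  have := abs_max_sub_max_le_max a δ b δ
  simpa using this

theorem lgm_sub_le {δ : ℝ} (hδ : 0 < δ) (y y' t t' : ℝ) :
    |lgm δ y t - lgm δ y' t'| ≤ |(t - y) - (t' - y')| / δ := by
  have h : ∀ y y' t t' : ℝ, lgm δ y t - lgm δ y' t' ≤ |(t - y) - (t' - y')| / δ := by
    intro y y' t t'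
    refine (log_sub_log_le hδ (le_max_right _ _) (le_max_right _ _)).trans ?_
    exact div_le_div_of_nonneg_right
      ((abs_max_sub_le _ _ _).trans (abs_abs_sub_abs_le_abs_sub _ _)) hδ.le
  rw [abs_le]
  refine ⟨?_, h y y' t t'⟩
  have := h y' y t' t
  rw [abs_sub_comm] at this
  linarith

theorem continuous_lgm {δ : ℝ} (hδ : 0 < δ) (y : ℝ) : Continuous (lgm δ y) := by
  unfold lgm
  refine Continuous.log (by fun_prop) fun t => ?_
  have := le_max_right |t - y| δ
  linarith

theorem lgm_bound {δ : ℝ} (hδ : 0 < δ) (y t : ℝ) :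
    |lgm δ y t| ≤ (|lgm δ y 0| + δ⁻¹) * (1 + t ^ 2) := by
  have h := lgm_sub_le hδ y y t 0
  rw [show t - y - (0 - y) = t by ring] at h
  have h1 := abs_sub_abs_le_abs_sub (lgm δ y t) (lgm δ y 0)
  have h2 : |t| ≤ 1 + t ^ 2 := by nlinarith [sq_abs t, sq_nonneg (|t| - 1), abs_nonneg t]
  have h3 : |t| / δ ≤ δ⁻¹ * (1 + t ^ 2) := by rw [div_eq_inv_mul]; gcongr
  have h4 : 0 ≤ |lgm δ y 0| * t ^ 2 := by positivity
  linarith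

theorem lgm_bound' {δ : ℝ} (hδ : 0 < δ) (y t : ℝ) :
    |lgm δ y t| ≤ (|lgm δ y 0| + δ⁻¹) * (1 + t ^ (2 * 1)) := lgm_bound hδ y t

theorem tendsto_LN_lgm {δ : ℝ} (hδ : 0 < δ) (y : ℝ) :
    Tendsto (fun n => LN n (lgm δ y)) atTop (nhds (scI (lgm δ y))) :=
  tendsto_LN (continuous_lgm hδ y) (by positivity) (lgm_bound hδ y)

/-- The truncated log-determinant. -/
def TG (n : ℕ) (δ y : ℝ) (x : Fin n × Fin n → ℝ) : ℝ := ∑ i, lgm δ y (evs (goe n x) i / Real.sqrt n)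

theorem lipE_scaled {n : ℕ} (hn : 0 < n) {h : ℝ → ℝ} {l : ℝ} (hl : 0 ≤ l)
    (hh : ∀ s t, |h s - h t| ≤ l * |s - t|) :
    LipE (Real.sqrt 2 * l) fun x => ∑ i, h (evs (goe n x) i / Real.sqrt n) := by
  have hs : 0 < Real.sqrt n := Real.sqrt_pos.2 (by exact_mod_cast hn)
  have := lipE_goe_trace (n := n) (h := fun t => h (t / Real.sqrt n)) (l := l / Real.sqrt n)
    (by positivity) fun s t => by
      refine (hh _ _).trans (le_of_eq ?_)
      rw [← sub_div, abs_div, abs_of_pos hs]; ring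
  convert this using 1
  rw [Real.sqrt_mul (by norm_num)]
  field_simp

theorem lipE_TG {n : ℕ} (hn : 0 < n) {δ : ℝ} (hδ : 0 < δ) (y : ℝ) : LipE (Real.sqrt 2 * δ⁻¹) (TG n δ y) := by
  refine lipE_scaled hn (by positivity) fun s t => (lgm_sub_le hδ y y s t).trans (le_of_eq ?_)
  rw [show s - y - (t - y) = s - t by ring]; ring

theorem integral_TG {n : ℕ} (hn : 0 < n) (δ y : ℝ) :
    ∫ x, TG n δ y x ∂(stdG (Fin n × Fin n)) = n * LN n (lgm δ y) := by
  have : (n : ℝ) ≠ 0 := by exact_mod_cast hn.ne'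
  rw [LN]; unfold TG; field_simp

theorem abs_det_le_TG {n : ℕ} (hn : 0 < n) {δ : ℝ} (hδ : 0 < δ) (y : ℝ) (x : Fin n × Fin n → ℝ) :
    |(goe n x - (y * Real.sqrt n) • (1 : Matrix (Fin n) (Fin n) ℝ)).det| ≤
      Real.exp (n / 2 * Real.log n + TG n δ y x) := by
  have hs : 0 < Real.sqrt n := Real.sqrt_pos.2 (by exact_mod_cast hn)
  have hn0 : (0 : ℝ) < n := by exact_mod_cast hn
  rw [det_sub_smul (goe_isSymm x), Finset.abs_prod, TG, Real.exp_add, Real.exp_sum]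
  have e : Real.exp (n / 2 * Real.log n) = ∏ _i : Fin n, Real.sqrt n := by
    rw [Finset.prod_const, Finset.card_univ, Fintype.card_fin, ← Real.exp_log hs, ← Real.exp_nat_mul,
      Real.log_sqrt hn0.le]; ring_nf
  rw [e, ← Finset.prod_mul_distrib]
  refine Finset.prod_le_prod (fun i _ => abs_nonneg _) fun i _ => ?_
  rw [lgm, Real.exp_log (lt_of_lt_of_le hδ (le_max_right _ _))]
  calc |evs (goe n x) i - y * Real.sqrt n| = Real.sqrt n * |evs (goe n x) i / Real.sqrt n - y| := by
        rw [← abs_of_pos hs, ← abs_mul, abs_of_pos hs]; congr 1; field_simp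
    _ ≤ _ := by gcongr; exact le_max_left _ _

theorem abs_det_eq_TG {n : ℕ} (hn : 0 < n) {δ : ℝ} (hδ : 0 < δ) (y : ℝ) (x : Fin n × Fin n → ℝ)
    (h : ∀ i, δ ≤ |evs (goe n x) i / Real.sqrt n - y|) :
    |(goe n x - (y * Real.sqrt n) • (1 : Matrix (Fin n) (Fin n) ℝ)).det| =
      Real.exp (n / 2 * Real.log n + TG n δ y x) := by
  have hs : 0 < Real.sqrt n := Real.sqrt_pos.2 (by exact_mod_cast hn)
  have hn0 : (0 : ℝ) < n := by exact_mod_cast hn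
  rw [det_sub_smul (goe_isSymm x), Finset.abs_prod, TG, Real.exp_add, Real.exp_sum]
  have e : Real.exp (n / 2 * Real.log n) = ∏ _i : Fin n, Real.sqrt n := by
    rw [Finset.prod_const, Finset.card_univ, Fintype.card_fin, ← Real.exp_log hs, ← Real.exp_nat_mul,
      Real.log_sqrt hn0.le]; ring_nf
  rw [e, ← Finset.prod_mul_distrib]
  refine Finset.prod_congr rfl fun i _ => ?_
  rw [lgm, Real.exp_log (lt_of_lt_of_le hδ (le_max_right _ _)), max_eq_left (h i)]
  rw [← abs_of_pos hs, ← abs_mul, abs_of_pos hs]; congr 1; field_simp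

theorem lintegral_TG_le {n : ℕ} (hn : 0 < n) {δ : ℝ} (hδ : 0 < δ) (y : ℝ) {p q : ℝ}
    (hpq : p.HolderConjugate q) {A : Set (Fin n × Fin n → ℝ)} (hA : MeasurableSet A) :
    ∫⁻ x, A.indicator 1 x * oe (TG n δ y x) ∂(stdG (Fin n × Fin n)) ≤
      stdG (Fin n × Fin n) A ^ (1 / p) * oe (n * LN n (lgm δ y) + q * Real.pi ^ 2 / (4 * δ ^ 2)) := by
  have hL := lipE_TG hn hδ y
  have hq := hpq.symm.pos
  have hp := hpq.pos
  have hm : Measurable fun x => oe (TG n δ y x) :=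
    (Real.continuous_exp.measurable.comp hL.continuous.measurable).ennreal_ofReal
  refine (ENNReal.lintegral_mul_le_Lp_mul_Lq _ hpq (measurable_one.indicator hA).aemeasurable
    hm.aemeasurable).trans ?_
  refine mul_le_mul' (le_of_eq ?_) ?_
  · congr 1
    rw [← lintegral_indicator_one hA]
    refine lintegral_congr fun x => ?_
    by_cases hx : x ∈ A
    · simp [hx]
    · simp [hx, hp]
  · simp_rw [oe_rpow]
    have h := lintegral_exp_le_of_lipE (by positivity) (hL.const_mul q)
    have e : ∀ x, oe (TG n δ y x * q) = ENNReal.ofReal (Real.exp (q * TG n δ y x)) := fun x => by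
      rw [mul_comm, oe]
    simp_rw [e]
    refine (ENNReal.rpow_le_rpow h (by positivity)).trans ?_
    rw [← oe, oe_rpow, integral_const_mul, integral_TG hn, abs_of_pos hq, mul_pow, mul_pow,
      Real.sq_sqrt (by norm_num)]
    refine oe_le (le_of_eq ?_)
    field_simp; ring

theorem measurableSet_le_nge (n j : ℕ) (t : ℝ) :
    MeasurableSet {x : Fin n × Fin n → ℝ | j ≤ nge (goe n x) t} := by
  have h : Measurable fun x : Fin n × Fin n → ℝ => nge (goe n x) t :=
    measurable_nge.comp ((measurable_goe n).prodMk measurable_const)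
  exact h measurableSet_Ici

/-- The reciprocal distance truncated at distance `δ`. -/
def rcm (δ y t : ℝ) : ℝ := (max |t - y| δ)⁻¹

theorem continuous_rcm {δ : ℝ} (hδ : 0 < δ) (y : ℝ) : Continuous (rcm δ y) := by
  unfold rcm
  refine Continuous.inv₀ (by fun_prop) fun t => ?_
  have := le_max_right |t - y| δ
  linarith

theorem rcm_bound {δ : ℝ} (hδ : 0 < δ) (y t : ℝ) : |rcm δ y t| ≤ δ⁻¹ * (1 + t ^ 2) := by
  have h : δ ≤ max |t - y| δ := le_max_right _ _
  have h1 : (max |t - y| δ)⁻¹ ≤ δ⁻¹ := by gcongr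
  rw [rcm, abs_of_nonneg (inv_nonneg.2 (hδ.le.trans h))]
  have : 0 ≤ δ⁻¹ * t ^ 2 := by positivity
  linarith

theorem LN_lgm_le {n : ℕ} {δ : ℝ} (hδ : 0 < δ) {y y' : ℝ} (hy : y ≤ y') :
    LN n (lgm δ y') ≤ LN n (lgm δ y) + (y' - y) * LN n (rcm δ y) := by
  have i1 := integrable_LN (continuous_lgm hδ y').measurable (lgm_bound' hδ y') n
  have i2 := integrable_LN (continuous_lgm hδ y).measurable (lgm_bound' hδ y) n
  have i3 := integrable_LN (continuous_rcm hδ y).measurable (k := 1) (rcm_bound hδ y) n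
  unfold LN
  rw [← mul_div_assoc, ← add_div, ← integral_const_mul, ← integral_add i2 (i3.const_mul _)]
  refine div_le_div_of_nonneg_right (integral_mono i1 (i2.add (i3.const_mul _)) fun x => ?_)
    (Nat.cast_nonneg n)
  simp only
  rw [Finset.mul_sum, ← Finset.sum_add_distrib]
  refine Finset.sum_le_sum fun i _ => ?_
  set t := evs (goe n x) i / Real.sqrt n
  have hb : 0 < max |t - y| δ := lt_of_lt_of_le hδ (le_max_right _ _)
  have ha : 0 < max |t - y'| δ := lt_of_lt_of_le hδ (le_max_right _ _)
  have h1 : max |t - y'| δ ≤ max |t - y| δ + (y' - y) := by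
    have h2 := abs_max_sub_le |t - y'| |t - y| δ
    have h3 := abs_abs_sub_abs_le_abs_sub (t - y') (t - y)
    rw [show t - y' - (t - y) = -(y' - y) by ring, abs_neg, abs_of_nonneg (sub_nonneg.2 hy)] at h3
    have := le_abs_self (max |t - y'| δ - max |t - y| δ)
    linarith
  have h2 : Real.log (max |t - y'| δ) - Real.log (max |t - y| δ) ≤ (y' - y) * (max |t - y| δ)⁻¹ := by
    rw [← Real.log_div ha.ne' hb.ne']
    refine (Real.log_le_sub_one_of_pos (by positivity)).trans ?_
    rw [div_sub_one hb.ne', div_eq_mul_inv]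
    exact mul_le_mul_of_nonneg_right (by linarith) (inv_nonneg.2 hb.le)
  simp only [lgm, rcm]
  linarith

theorem scI_congr {f g : ℝ → ℝ} (h : ∀ x ∈ Set.Icc (-2 : ℝ) 2, f x = g x) : scI f = scI g := by
  unfold scI
  have : (fun θ => f (2 * Real.cos θ) * Real.sin θ ^ 2) = fun θ => g (2 * Real.cos θ) * Real.sin θ ^ 2 := by
    funext θ
    rw [h _ ⟨?_, ?_⟩]
    · linarith [Real.neg_one_le_cos θ]
    · linarith [Real.cos_le_one θ]
  rw [this]

theorem scI_lgm {δ y : ℝ} (hy : 2 < y) (hδ : δ ≤ y - 2) :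
    scI (lgm δ y) = y ^ 2 / 4 - 1 / 2 - rateK y := by
  rw [← scI_log hy]
  refine scI_congr fun t ht => ?_
  have h1 : |t - y| = y - t := by rw [abs_sub_comm, abs_of_nonneg]; linarith [ht.2]
  rw [lgm, h1, max_eq_left]
  linarith [ht.2]

theorem scI_rcm_le {δ y : ℝ} (hδ0 : 0 < δ) (hy : 2 < y) : scI (rcm δ y) ≤ 1 := by
  have hpi := Real.pi_pos
  have h : ∫ θ in (0 : ℝ)..Real.pi, rcm δ y (2 * Real.cos θ) * Real.sin θ ^ 2 ≤
      ∫ θ in (0 : ℝ)..Real.pi, (1 / 2 + Real.cos θ / 2) := by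
    have hc := continuous_rcm hδ0 y
    refine intervalIntegral.integral_mono_on hpi.le (Continuous.intervalIntegrable (by fun_prop) _ _)
      (Continuous.intervalIntegrable (by fun_prop) _ _) fun θ _ => ?_
    have h1 := Real.cos_le_one θ
    have h0 := Real.neg_one_le_cos θ
    rw [Real.sin_sq, rcm]
    have h2 : y - 2 * Real.cos θ ≤ max |2 * Real.cos θ - y| δ := by
      refine le_trans ?_ (le_max_left _ _)
      rw [abs_sub_comm]; exact le_abs_self _
    rw [inv_mul_le_iff₀ (by linarith)]
    nlinarith
  have e : ∫ θ in (0 : ℝ)..Real.pi, (1 / 2 + Real.cos θ / 2) = Real.pi / 2 := by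
    rw [intervalIntegral.integral_add (by simp) (Continuous.intervalIntegrable (by fun_prop) _ _),
      intervalIntegral.integral_div]
    simp
  rw [scI]
  calc _ ≤ 2 / Real.pi * (Real.pi / 2) := by rw [← e]; gcongr
    _ = 1 := by field_simp

theorem detInt_le {n k : ℕ} (hn : 0 < n) {δ : ℝ} (hδ : 0 < δ) (y : ℝ) {p q : ℝ}
    (hpq : p.HolderConjugate q) :
    detInt n k (Set.Ici (y * Real.sqrt n)) ≤
      stdG (Fin n × Fin n) {x | k ≤ nge (goe n x) (y * Real.sqrt n)} ^ (1 / p) *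
      oe (n / 2 * Real.log n + n * LN n (lgm δ y) + q * Real.pi ^ 2 / (4 * δ ^ 2) +
        n * ((max (LN n (rcm δ y) - y / 2) 0) ^ 2 - y ^ 2 / 4)) := by
  have hs : 0 < Real.sqrt n := Real.sqrt_pos.2 (by exact_mod_cast hn)
  have hn0 : (0 : ℝ) < n := by exact_mod_cast hn
  set A := {x : Fin n × Fin n → ℝ | k ≤ nge (goe n x) (y * Real.sqrt n)} with hA
  have hAm : MeasurableSet A := measurableSet_le_nge n k _
  set g := LN n (rcm δ y) with hg
  set r2 := Real.sqrt 2 with hr2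
  have hr2p : 0 < r2 := by positivity
  have hr2s : r2 ^ 2 = 2 := Real.sq_sqrt (by norm_num)
  have hsn : Real.sqrt n ^ 2 = n := Real.sq_sqrt hn0.le
  set s := y * Real.sqrt n / r2 with hsd
  set M := max (r2 * Real.sqrt n * g) s with hM
  rw [detInt_eq n k _, ← hr2, lintegral_lintegral_swap]
  swap
  · refine Measurable.aemeasurable ?_
    refine Measurable.mul ?_ (measurable_detWt n k)
    exact (measurable_one.indicator measurableSet_Ici).comp (measurable_snd.const_mul _)
  set Q := stdG (Fin n × Fin n) A ^ (1 / p) with hQ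
  set E := n / 2 * Real.log n + n * LN n (lgm δ y) + q * Real.pi ^ 2 / (4 * δ ^ 2) with hE
  calc _ ≤ ∫⁻ z, Q * oe E * oe (M * (z - s)) ∂(gaussianReal 0 1) := by
        refine lintegral_mono fun z => ?_
        by_cases hz : y * Real.sqrt n ≤ r2 * z
        swap
        · have : ∀ x : Fin n × Fin n → ℝ, (Set.Ici (y * Real.sqrt n)).indicator (1 : ℝ → ℝ≥0∞) (r2 * z) *
              detWt n k (x, z) = 0 := by
            intro x; rw [Set.indicator_of_notMem (by exact hz), zero_mul]
          simp [this]
        set y' := r2 * z / Real.sqrt n with hy'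
        have hy'e : r2 * z = y' * Real.sqrt n := by rw [hy']; field_simp
        have hyy : y ≤ y' := by rw [hy', le_div_iff₀ hs]; exact hz
        have hzs : s ≤ z := by rw [hsd, div_le_iff₀ hr2p]; linarith
        have h1 : ∀ x : Fin n × Fin n → ℝ, (Set.Ici (y * Real.sqrt n)).indicator (1 : ℝ → ℝ≥0∞) (r2 * z) *
              detWt n k (x, z) ≤ oe (n / 2 * Real.log n) * (A.indicator 1 x * oe (TG n δ y' x)) := by
          intro x
          rw [Set.indicator_of_mem (by exact hz), Pi.one_apply, one_mul, detWt]
          simp only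
          split_ifs with h
          · have hx : x ∈ A := by
              rw [hA]
              show k ≤ nge (goe n x) (y * Real.sqrt n)
              rw [← h]; exact nge_antitone _ hz
            rw [Set.indicator_of_mem hx, Pi.one_apply, one_mul, oe_mul, hy'e]
            exact ENNReal.ofReal_le_ofReal (abs_det_le_TG hn hδ y' x)
          · exact zero_le
        refine (lintegral_mono h1).trans ?_
        rw [lintegral_const_mul' _ _ (oe_ne_top _)]
        refine (mul_le_mul' le_rfl (lintegral_TG_le hn hδ y' hpq hAm)).trans ?_
        rw [← hQ, mul_left_comm, mul_assoc Q, oe_mul, oe_mul]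
        refine mul_le_mul' le_rfl (oe_le ?_)
        have h2 := LN_lgm_le (n := n) hδ hyy
        have h3 : n * ((y' - y) * g) = r2 * Real.sqrt n * g * (z - s) := by
          rw [hy', hsd]
          field_simp
          rw [hsn]
        have h4 : r2 * Real.sqrt n * g * (z - s) ≤ M * (z - s) :=
          mul_le_mul_of_nonneg_right (le_max_left _ _) (by linarith)
        have h5 := mul_le_mul_of_nonneg_left h2 hn0.le
        rw [mul_add] at h5
        rw [hE]
        linarith
    _ = Q * oe E * oe (M ^ 2 / 2 - M * s) := by
        rw [lintegral_const_mul _ (by unfold oe; fun_prop), lintegral_oe_gaussian]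
    _ ≤ _ := by
        rw [mul_assoc, oe_mul]
        refine mul_le_mul' le_rfl (oe_le ?_)
        have h1 : M = s + r2 * Real.sqrt n * max (g - y / 2) 0 := by
          rw [mul_max_of_nonneg _ _ (by positivity), ← max_add_add_left, hM]
          congr 1
          · rw [hsd]; field_simp; rw [hr2s]; ring
          · ring
        have h2 : s ^ 2 = y ^ 2 * n / 2 := by rw [hsd, div_pow, mul_pow, hr2s, hsn]
        have h3 : M ^ 2 / 2 - M * s = n * ((max (g - y / 2) 0) ^ 2 - y ^ 2 / 4) := by
          rw [h1]
          linear_combination (-1 / 2) * h2 + (1 / 2) * Real.sqrt n ^ 2 * (max (g - y / 2) 0) ^ 2 * hr2s +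
            (max (g - y / 2) 0) ^ 2 * hsn
        rw [h3]

/-- Probability that at least `j` eigenvalues exceed `y √n`. -/
def pge (n j : ℕ) (y : ℝ) : ℝ≥0∞ :=
  stdG (Fin n × Fin n) {x | j ≤ nge (goe n x) (y * Real.sqrt n)}

theorem eventually_of_succ {p : ℕ → Prop} (h : ∀ᶠ n in atTop, p (n + 1)) : ∀ᶠ n in atTop, p n := by
  rw [← map_add_atTop_eq_nat 1]; exact h

theorem pge_le_one (n j : ℕ) (y : ℝ) : pge n j y ≤ 1 := prob_le_one

theorem pge_succ_eq {n k : ℕ} (hk : k < n) (y : ℝ) :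
    pge n (k + 1) y = stdG (Fin n × Fin n) {x | y * Real.sqrt n ≤ evs (goe n x) ⟨k, hk⟩} := by
  unfold pge
  congr 1
  ext x
  exact (le_evs_iff (goe n x) (y * Real.sqrt n) ⟨k, hk⟩).symm

theorem tendsto_inv_mul (c : ℝ) : Tendsto (fun n : ℕ => c * (1 / (n : ℝ))) atTop (nhds 0) := by
  simpa using tendsto_one_div_atTop_nhds_zero_nat.const_mul c

/-- Large deviation upper bound for the largest eigenvalues. -/
theorem pge_upper (j : ℕ) : ∀ {x : ℝ}, 2 < x → ∀ {ε : ℝ}, 0 < ε →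
    ∀ᶠ n : ℕ in atTop, pge n j x ≤ oe (-(n * (j * rateK x - ε))) := by
  induction j with
  | zero =>
    intro x hx ε hε
    refine Eventually.of_forall fun n => (pge_le_one _ _ _).trans ?_
    rw [← oe_zero]
    refine oe_le ?_
    have : (0 : ℝ) ≤ n * ε := by positivity
    push_cast; linarith
  | succ k ih =>
    intro x hx ε hε
    set ε1 := ε / 4 with hε1
    have hεpos1 : 0 < ε1 := by positivity
    set K := rateK x with hK
    have hKp : 0 < K := rateK_pos hx
    set δ := x - 2 with hδ
    have hδp : 0 < δ := by rw [hδ]; linarith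
    obtain ⟨q, hq1, hq⟩ : ∃ q : ℝ, 1 < q ∧ k * K / q ≤ ε1 := by
      refine ⟨2 + k * K / ε1, ?_, ?_⟩
      · have : 0 ≤ k * K / ε1 := by positivity
        linarith
      · rw [div_le_iff₀ (by positivity)]
        have : ε1 * (k * K / ε1) = k * K := by field_simp
        rw [mul_add, this]; linarith
    have hpq := (Real.HolderConjugate.conjExponent hq1).symm
    set p := q.conjExponent with hp
    have hpi : 1 / p = 1 - 1 / q := by
      have := hpq.inv_add_inv_eq_one
      rw [one_div, one_div]; linarith
    have hpp := hpq.pos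
    have hgt : Tendsto (fun n => LN n (rcm δ x)) atTop (nhds (scI (rcm δ x))) :=
      tendsto_LN (continuous_rcm hδp x) (by positivity) (rcm_bound hδp x)
    have hmax : Tendsto (fun n => (max (LN n (rcm δ x) - x / 2) 0) ^ 2) atTop (nhds 0) := by
      have h1 := ((hgt.sub_const (x / 2)).max (tendsto_const_nhds (x := (0 : ℝ)))).pow 2
      rw [max_eq_right (by have := scI_rcm_le hδp hx; linarith)] at h1
      simpa using h1
    have hlim : Tendsto (fun n : ℕ => (Real.log (aN n).toReal + n / 2 * Real.log n) / n + LN n (lgm δ x) +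
        q * Real.pi ^ 2 / (4 * δ ^ 2) * (1 / (n : ℝ)) + ((max (LN n (rcm δ x) - x / 2) 0) ^ 2 - x ^ 2 / 4))
        atTop (nhds (-K)) := by
      have := ((tendsto_log_aN.add (tendsto_LN_lgm hδp x)).add
        (tendsto_inv_mul (q * Real.pi ^ 2 / (4 * δ ^ 2)))).add (hmax.sub_const (x ^ 2 / 4))
      rw [scI_lgm hx le_rfl] at this
      convert this using 2
      ring
    refine eventually_of_succ ?_
    filter_upwards [hlim.eventually (gt_mem_nhds (show -K < -K + ε1 by linarith)), ih hx hεpos1,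
      eventually_gt_atTop 0, eventually_gt_atTop k,
      (tendsto_natCast_atTop_atTop (R := ℝ)).eventually_ge_atTop (((k : ℝ) + 1) * K / ε1)]
      with n h1 h2 hn hkn hnbig
    have hn0 : (0 : ℝ) < n := by exact_mod_cast hn
    have hkn' : k < n + 1 := by omega
    have h3 := two_mul_prob_evs hn hkn' (measurableSet_Ici (a := x * Real.sqrt n))
    have h4 : pge (n + 1) (k + 1) x ≤ aN n * detInt n k (Set.Ici (x * Real.sqrt n)) := by
      rw [pge_succ_eq hkn', ← h3, two_mul]
      refine (measure_mono fun z hz => ?_).trans le_self_add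
      have hz' : x * Real.sqrt ((n + 1 : ℕ) : ℝ) ≤ evs (goe (n + 1) z) ⟨k, hkn'⟩ := hz
      refine le_trans (b := x * Real.sqrt ((n + 1 : ℕ) : ℝ)) ?_ hz'
      have : Real.sqrt n ≤ Real.sqrt ((n + 1 : ℕ) : ℝ) := Real.sqrt_le_sqrt (by push_cast; linarith)
      exact mul_le_mul_of_nonneg_left this (by linarith)
    refine h4.trans ((mul_le_mul' le_rfl (detInt_le hn hδp x hpq)).trans ?_)
    have h5 : pge n k x ^ (1 / p) ≤ oe (-(n * (k * K - ε1)) * (1 / p)) := by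
      rw [← oe_rpow]; exact ENNReal.rpow_le_rpow h2 (by positivity)
    refine (mul_le_mul' le_rfl (mul_le_mul' h5 le_rfl)).trans ?_
    conv_lhs => rw [← oe_log (aN_pos hn) (aN_ne_top hn)]
    rw [oe_mul, oe_mul]
    refine oe_le ?_
    have h6 := mul_le_mul_of_nonneg_left h1.le hn0.le
    have h7 : n * ((Real.log (aN n).toReal + n / 2 * Real.log n) / n + LN n (lgm δ x) +
        q * Real.pi ^ 2 / (4 * δ ^ 2) * (1 / (n : ℝ)) + ((max (LN n (rcm δ x) - x / 2) 0) ^ 2 - x ^ 2 / 4)) =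
        Real.log (aN n).toReal + (n / 2 * Real.log n + n * LN n (lgm δ x) + q * Real.pi ^ 2 / (4 * δ ^ 2) +
        n * ((max (LN n (rcm δ x) - x / 2) 0) ^ 2 - x ^ 2 / 4)) := by
      field_simp
      ring
    rw [h7] at h6
    have h8 : -(n * (k * K - ε1)) * (1 / p) ≤ n * (2 * ε1 - k * K) := by
      rw [hpi, neg_mul, mul_assoc, ← mul_neg]
      refine mul_le_mul_of_nonneg_left ?_ hn0.le
      have : ε1 * (1 / q) ≥ 0 := by positivity
      have : k * K * (1 / q) = k * K / q := by ring
      nlinarith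
    have h9 : ((k : ℝ) + 1) * K ≤ n * ε1 := by rwa [div_le_iff₀ hεpos1] at hnbig
    have h10 : ε = 4 * ε1 := by rw [hε1]; ring
    push_cast
    rw [h10]
    nlinarith

theorem gaussian_Icc_ge {a b : ℝ} (ha : 0 ≤ a) (hab : a ≤ b) :
    ENNReal.ofReal ((b - a) / Real.sqrt (2 * Real.pi)) * oe (-(b ^ 2 / 2)) ≤
      gaussianReal 0 1 (Set.Icc a b) := by
  rw [gaussianReal_of_var_ne_zero _ one_ne_zero, withDensity_apply _ measurableSet_Icc]
  calc _ = ∫⁻ _ in Set.Icc a b, ENNReal.ofReal ((Real.sqrt (2 * Real.pi))⁻¹ * Real.exp (-(b ^ 2 / 2))) := by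
        rw [setLIntegral_const, Real.volume_Icc, oe, ← ENNReal.ofReal_mul (by
          exact div_nonneg (by linarith) (Real.sqrt_nonneg _)), ← ENNReal.ofReal_mul (by positivity)]
        congr 1; ring
    _ ≤ _ := by
        refine setLIntegral_mono' measurableSet_Icc fun z hz => ?_
        rw [gaussianPDF, gaussianPDFReal]
        refine ENNReal.ofReal_le_ofReal ?_
        simp only [NNReal.coe_one, mul_one, sub_zero]
        gcongr
        have : z ^ 2 ≤ b ^ 2 := pow_le_pow_left₀ (ha.trans hz.1) hz.2 2
        linarith

theorem TG_sub_le {n : ℕ} {δ σ y y0 : ℝ} (hδ : 0 < δ) (h1 : y0 ≤ y) (h2 : y ≤ y0 + σ)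
    (x : Fin n × Fin n → ℝ) : TG n δ y0 x - n * (σ / δ) ≤ TG n δ y x := by
  have h : TG n δ y0 x - TG n δ y x ≤ ∑ _i : Fin n, σ / δ := by
    unfold TG
    rw [← Finset.sum_sub_distrib]
    refine Finset.sum_le_sum fun i _ => (le_abs_self _).trans ((lgm_sub_le hδ _ _ _ _).trans ?_)
    refine div_le_div_of_nonneg_right ?_ hδ.le
    rw [abs_le]; constructor <;> linarith
  simp only [Finset.sum_const, Finset.card_univ, Fintype.card_fin, nsmul_eq_mul] at h
  linarith

/-- Lower bound for the determinant integral on the event that exactly `k` eigenvalues lie above the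
window and none is close to it. -/
theorem le_detInt {n : ℕ} (hn : 0 < n) (k : ℕ) {δ σ a b y0 : ℝ} (hδ : 0 < δ) (ha : a + δ ≤ y0)
    (hb : y0 + σ + δ ≤ b) (c : ℝ) :
    stdG (Fin n × Fin n) {x | k ≤ nge (goe n x) (b * Real.sqrt n) ∧
      ¬ (k + 1 ≤ nge (goe n x) (a * Real.sqrt n)) ∧ c < TG n δ y0 x} *
      (oe (n / 2 * Real.log n + (c - n * (σ / δ))) *
      gaussianReal 0 1 (Set.Icc (y0 * Real.sqrt n / Real.sqrt 2) ((y0 + σ) * Real.sqrt n / Real.sqrt 2))) ≤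
    detInt n k (Set.Icc (y0 * Real.sqrt n) ((y0 + σ) * Real.sqrt n)) := by
  have hs : 0 < Real.sqrt n := Real.sqrt_pos.2 (by exact_mod_cast hn)
  have h2 : 0 < Real.sqrt 2 := by positivity
  rw [detInt_eq n k _]
  set D := {x | k ≤ nge (goe n x) (b * Real.sqrt n) ∧
      ¬ (k + 1 ≤ nge (goe n x) (a * Real.sqrt n)) ∧ c < TG n δ y0 x} with hD
  set I := Set.Icc (y0 * Real.sqrt n / Real.sqrt 2) ((y0 + σ) * Real.sqrt n / Real.sqrt 2) with hI
  have hDm : MeasurableSet D := (measurableSet_le_nge n k _).inter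
    ((measurableSet_le_nge n (k + 1) _).compl.inter
      (measurableSet_lt measurable_const (lipE_TG hn hδ y0).continuous.measurable))
  calc _ = ∫⁻ _ in D, ∫⁻ _ in I, oe (n / 2 * Real.log n + (c - n * (σ / δ))) ∂(gaussianReal 0 1)
        ∂(stdG (Fin n × Fin n)) := by
        rw [setLIntegral_const, setLIntegral_const, mul_comm]
    _ ≤ ∫⁻ x in D, ∫⁻ z, (Set.Icc (y0 * Real.sqrt n) ((y0 + σ) * Real.sqrt n)).indicator 1 (Real.sqrt 2 * z) *
          detWt n k (x, z) ∂(gaussianReal 0 1) ∂(stdG (Fin n × Fin n)) := by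
        refine setLIntegral_mono' hDm fun x hx => ?_
        refine le_trans (setLIntegral_mono' measurableSet_Icc fun z hz => ?_) (setLIntegral_le_lintegral I _)
        obtain ⟨hx1, hx2, hx3⟩ : k ≤ nge (goe n x) (b * Real.sqrt n) ∧
          ¬ (k + 1 ≤ nge (goe n x) (a * Real.sqrt n)) ∧ c < TG n δ y0 x := hx
        set y := Real.sqrt 2 * z / Real.sqrt n with hy
        have hyz : Real.sqrt 2 * z = y * Real.sqrt n := by rw [hy]; field_simp
        have hz1 : y0 * Real.sqrt n ≤ Real.sqrt 2 * z := by
          have := hz.1; rw [div_le_iff₀ h2] at this; linarith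
        have hz2 : Real.sqrt 2 * z ≤ (y0 + σ) * Real.sqrt n := by
          have := hz.2; rw [le_div_iff₀ h2] at this; linarith
        have hy1 : y0 ≤ y := by rw [hy, le_div_iff₀ hs]; exact hz1
        have hy2 : y ≤ y0 + σ := by rw [hy, div_le_iff₀ hs]; exact hz2
        have hk1 : nge (goe n x) (b * Real.sqrt n) ≤ nge (goe n x) (y * Real.sqrt n) :=
          nge_antitone _ (mul_le_mul_of_nonneg_right (by linarith) hs.le)
        have hk2 : nge (goe n x) (y * Real.sqrt n) ≤ nge (goe n x) (a * Real.sqrt n) :=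
          nge_antitone _ (mul_le_mul_of_nonneg_right (by linarith) hs.le)
        have hge : ∀ i, δ ≤ |evs (goe n x) i / Real.sqrt n - y| := by
          intro i
          by_cases hi : (i : ℕ) < k
          · have h := (le_evs_iff (goe n x) (b * Real.sqrt n) i).2 (by omega)
            rw [← le_div_iff₀ hs] at h
            exact le_trans (by linarith) (le_abs_self _)
          · have h := (not_congr (le_evs_iff (goe n x) (a * Real.sqrt n) i)).2 (by omega)
            rw [not_le, ← div_lt_iff₀ hs] at h
            exact le_trans (by linarith) (neg_le_abs _)
        rw [Set.indicator_of_mem (by exact ⟨hz1, hz2⟩), Pi.one_apply, one_mul, detWt]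
        dsimp only
        rw [if_pos (by rw [hyz]; omega), hyz, abs_det_eq_TG hn hδ y x hge]
        refine oe_le ?_
        have := TG_sub_le hδ hy1 hy2 x
        linarith
    _ ≤ _ := setLIntegral_le_lintegral D _

theorem two_mul_oe_le {s t : ℝ} (h : s + 1 ≤ t) : 2 * oe s ≤ oe t := by
  refine le_trans ?_ (oe_le h)
  rw [add_comm, ← oe_mul]
  refine mul_le_mul' ?_ le_rfl
  rw [oe, ← ENNReal.ofReal_ofNat]
  exact ENNReal.ofReal_le_ofReal (by linarith [Real.add_one_le_exp (1 : ℝ)])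

theorem three_mul_oe_le {s t : ℝ} (h : s + 2 ≤ t) : 3 * oe s ≤ oe t := by
  refine le_trans ?_ (oe_le h)
  rw [add_comm, ← oe_mul]
  refine mul_le_mul' ?_ le_rfl
  rw [oe, ← ENNReal.ofReal_ofNat]
  exact ENNReal.ofReal_le_ofReal (by linarith [Real.add_one_le_exp (2 : ℝ)])

theorem exists_pos_le {f : ℝ → ℝ} (hf : Continuous f) {u : ℝ} (h : f 0 < u) :
    ∃ d : ℝ, 0 < d ∧ ∀ t, 0 ≤ t → t ≤ d → f t ≤ u := by
  obtain ⟨d, hd, H⟩ := Metric.eventually_nhds_iff.1 ((hf.tendsto 0).eventually (gt_mem_nhds h))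
  refine ⟨d / 2, by positivity, fun t h0 h1 => (H ?_).le⟩
  rw [Real.dist_eq, sub_zero, abs_of_nonneg h0]; linarith

theorem eventually_le_nat_mul {c : ℝ} (hc : 0 < c) (u : ℝ) : ∀ᶠ n : ℕ in atTop, u ≤ n * c := by
  filter_upwards [(tendsto_natCast_atTop_atTop (R := ℝ)).eventually_ge_atTop (u / c)] with n h
  rwa [div_le_iff₀ hc] at h

/-- The probability of the event used in the lower bound. -/
theorem le_prob_window (k : ℕ) {δ ε a b y0 : ℝ} (hδ : 0 < δ) (hε : 0 < ε) (ha : 2 < a)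
    (hab : k * rateK b + 3 * ε ≤ (k + 1) * rateK a)
    (hlow : ∀ᶠ n : ℕ in atTop, oe (-(n * (k * rateK b + ε))) ≤ pge n k b) :
    ∀ᶠ n : ℕ in atTop, oe (-(n * (k * rateK b + 2 * ε))) ≤
      stdG (Fin n × Fin n) {x | k ≤ nge (goe n x) (b * Real.sqrt n) ∧
      ¬ (k + 1 ≤ nge (goe n x) (a * Real.sqrt n)) ∧ n * LN n (lgm δ y0) - n * ε < TG n δ y0 x} := by
  have hpi := Real.pi_pos
  filter_upwards [hlow, pge_upper (k + 1) ha hε, eventually_gt_atTop 0, eventually_le_nat_mul hε 2,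
    eventually_le_nat_mul (show 0 < δ ^ 2 * ε ^ 2 / Real.pi ^ 2 by positivity) (k * rateK b + 2 * ε)]
    with n h1 h2 hn h3 h4
  have hn0 : (0 : ℝ) < n := by exact_mod_cast hn
  set Q := k * rateK b + 2 * ε with hQ
  set D := {x | k ≤ nge (goe n x) (b * Real.sqrt n) ∧
      ¬ (k + 1 ≤ nge (goe n x) (a * Real.sqrt n)) ∧ n * LN n (lgm δ y0) - n * ε < TG n δ y0 x}
  have h5 := prob_le_sub_of_lipE (by positivity) (lipE_TG hn hδ y0) (show 0 ≤ n * ε by positivity)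
  rw [integral_TG hn] at h5
  have h6 : pge n k b ≤ stdG (Fin n × Fin n) D + (pge n (k + 1) a +
      stdG (Fin n × Fin n) {x | TG n δ y0 x ≤ n * LN n (lgm δ y0) - n * ε}) := by
    refine le_trans (measure_mono fun x hx => ?_) ((measure_union_le _ _).trans
      (add_le_add le_rfl (measure_union_le _ _)))
    by_cases hx1 : k + 1 ≤ nge (goe n x) (a * Real.sqrt n)
    · exact Or.inr (Or.inl hx1)
    by_cases hx2 : TG n δ y0 x ≤ n * LN n (lgm δ y0) - n * ε
    · exact Or.inr (Or.inr hx2)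
    · exact Or.inl ⟨hx, hx1, not_le.1 hx2⟩
  have h7 : pge n (k + 1) a ≤ oe (-(n * Q)) := by
    refine h2.trans (oe_le (neg_le_neg (mul_le_mul_of_nonneg_left ?_ hn0.le)))
    push_cast; rw [hQ]; linarith
  have h8 : stdG (Fin n × Fin n) {x | TG n δ y0 x ≤ n * LN n (lgm δ y0) - n * ε} ≤ oe (-(n * Q)) := by
    refine h5.trans (oe_le (neg_le_neg ?_))
    have : 2 * (n * ε) ^ 2 / (Real.pi ^ 2 * (Real.sqrt 2 * δ⁻¹) ^ 2) = n * (n * (δ ^ 2 * ε ^ 2 / Real.pi ^ 2)) := by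
      rw [mul_pow (Real.sqrt 2), Real.sq_sqrt (by norm_num)]; field_simp
    rw [this]
    exact mul_le_mul_of_nonneg_left h4 hn0.le
  have h9 : 3 * oe (-(n * Q)) ≤ stdG (Fin n × Fin n) D + 2 * oe (-(n * Q)) := by
    refine (three_mul_oe_le ?_).trans (h1.trans (h6.trans ?_))
    · rw [hQ]; nlinarith
    · rw [two_mul]; exact add_le_add le_rfl (add_le_add h7 h8)
  rw [show (3 : ℝ≥0∞) = 1 + 2 by norm_num, add_mul, one_mul] at h9
  exact (ENNReal.add_le_add_iff_right (ENNReal.mul_ne_top (by norm_num) (oe_ne_top _))).1 h9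

/-- Large deviation lower bound for the largest eigenvalues. -/
theorem pge_lower (j : ℕ) : ∀ {x : ℝ}, 2 < x → ∀ {ε : ℝ}, 0 < ε →
    ∀ᶠ n : ℕ in atTop, oe (-(n * (j * rateK x + ε))) ≤ pge n j x := by
  induction j with
  | zero =>
    intro x hx ε hε
    refine Eventually.of_forall fun n => ?_
    have : pge n 0 x = 1 := by simp [pge]
    rw [this, ← oe_zero]
    refine oe_le ?_
    have : (0 : ℝ) ≤ n * ε := by positivity
    push_cast; linarith
  | succ k ih =>
    intro x hx ε hε
    set K := rateK x with hK
    have hKp : 0 < K := rateK_pos hx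
    obtain ⟨ε1, he, he1, he2⟩ : ∃ ε1 : ℝ, 0 < ε1 ∧ 10 * ε1 ≤ ε ∧ 5 * ε1 ≤ K :=
      ⟨min (ε / 10) (K / 5), by positivity, by linarith [min_le_left (ε / 10) (K / 5)],
        by linarith [min_le_right (ε / 10) (K / 5)]⟩
    obtain ⟨d1, hd1, H1⟩ := exists_pos_le (f := fun t => rateK (x + 2 * t)) (u := K + ε1)
      (continuous_rateK.comp (by fun_prop)) (by simp [← hK, he])
    obtain ⟨δ, hδ, H2⟩ := exists_pos_le (f := fun t => k * rateK (x + 4 * t)) (u := k * K + ε1)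
      (continuous_const.mul (continuous_rateK.comp (by fun_prop))) (by simp [← hK, he])
    obtain ⟨δ, hδ, H1, H2⟩ : ∃ δ : ℝ, 0 < δ ∧ rateK (x + 2 * δ) ≤ K + ε1 ∧ k * rateK (x + 4 * δ) ≤ k * K + ε1 :=
      ⟨min d1 δ, by positivity, H1 _ (by positivity) (min_le_left _ _), H2 _ (by positivity) (min_le_right _ _)⟩
    set y0 := x + 2 * δ with hy0
    set b := x + 4 * δ with hb
    obtain ⟨d, hd, H3⟩ := exists_pos_le (f := fun t => (y0 + t) ^ 2 / 4) (u := y0 ^ 2 / 4 + ε1)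
      (by fun_prop) (by simp [he])
    obtain ⟨σ, hσ, hσ1, hσ2, H3⟩ : ∃ σ : ℝ, 0 < σ ∧ σ ≤ δ ∧ σ / δ ≤ ε1 ∧ (y0 + σ) ^ 2 / 4 ≤ y0 ^ 2 / 4 + ε1 := by
      refine ⟨min d (min δ (δ * ε1)), by positivity, (min_le_right _ _).trans (min_le_left _ _), ?_,
        H3 _ (by positivity) (min_le_left _ _)⟩
      rw [div_le_iff₀ hδ, mul_comm]
      exact (min_le_right _ _).trans (min_le_right _ _)
    have hwin := le_prob_window k (y0 := y0) hδ he (a := x + δ) (b := b) (by linarith) (by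
      have : K ≤ rateK (x + δ) := rateK_mono (by linarith)
      have : (k + 1) * K ≤ (k + 1) * rateK (x + δ) := by gcongr
      nlinarith) (ih (by linarith) he)
    have hLN := tendsto_LN_lgm hδ y0
    rw [scI_lgm (by linarith) (by linarith)] at hLN
    refine eventually_of_succ ?_
    filter_upwards [hwin, hLN.eventually (lt_mem_nhds (sub_lt_self _ he)),
      tendsto_log_aN.eventually (lt_mem_nhds (sub_lt_self _ he)), eventually_gt_atTop 0, eventually_gt_atTop k,
      eventually_le_nat_mul he 1, eventually_le_nat_mul (show 0 < σ ^ 2 by positivity) (4 * Real.pi),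
      eventually_le_nat_mul (show 0 < y0 ^ 2 - x ^ 2 by nlinarith) (x ^ 2)]
      with n h1 h2 h3 hn hkn h4 h5 h6
    have hn0 : (0 : ℝ) < n := by exact_mod_cast hn
    have hs : 0 < Real.sqrt n := Real.sqrt_pos.2 hn0
    have hkn' : k < n + 1 := by omega
    have h7 := two_mul_prob_evs hn hkn' (measurableSet_Icc (a := y0 * Real.sqrt n) (b := (y0 + σ) * Real.sqrt n))
    have h8 : stdG (Fin (n + 1) × Fin (n + 1)) {z | evs (goe (n + 1) z) ⟨k, hkn'⟩ ∈
        Set.Icc (y0 * Real.sqrt n) ((y0 + σ) * Real.sqrt n)} ≤ pge (n + 1) (k + 1) x := by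
      rw [pge_succ_eq hkn']
      refine measure_mono fun z hz => ?_
      have hz' : y0 * Real.sqrt n ≤ evs (goe (n + 1) z) ⟨k, hkn'⟩ := hz.1
      refine le_trans (b := y0 * Real.sqrt n) ?_ hz'
      rw [← Real.sqrt_sq (show 0 ≤ x by linarith), ← Real.sqrt_sq (show 0 ≤ y0 by linarith),
        ← Real.sqrt_mul (by positivity), ← Real.sqrt_mul (by positivity)]
      refine Real.sqrt_le_sqrt ?_
      push_cast; linarith
    have h9 := le_detInt hn k (a := x + δ) (b := b) (y0 := y0) (σ := σ) hδ (by linarith) (by linarith)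
      (n * LN n (lgm δ y0) - n * ε1)
    have h10 : oe (-(n * ((y0 + σ) ^ 2 / 4))) ≤ gaussianReal 0 1
        (Set.Icc (y0 * Real.sqrt n / Real.sqrt 2) ((y0 + σ) * Real.sqrt n / Real.sqrt 2)) := by
      refine le_trans ?_ (gaussian_Icc_ge (by have : 0 ≤ y0 := by linarith
                                              positivity) (by gcongr; linarith))
      have e1 : ((y0 + σ) * Real.sqrt n / Real.sqrt 2) ^ 2 / 2 = n * ((y0 + σ) ^ 2 / 4) := by
        rw [div_pow, mul_pow, Real.sq_sqrt hn0.le, Real.sq_sqrt (by norm_num)]; ring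
      rw [e1]
      refine le_mul_of_one_le_left (zero_le) ?_
      rw [← ENNReal.ofReal_one]
      refine ENNReal.ofReal_le_ofReal ?_
      rw [one_le_div (by positivity), ← sub_div, le_div_iff₀ (by positivity), ← Real.sqrt_mul (by positivity)]
      rw [show (y0 + σ) * Real.sqrt n - y0 * Real.sqrt n = Real.sqrt (σ ^ 2 * n) by
        rw [Real.sqrt_mul (by positivity), Real.sqrt_sq hσ.le]; ring]
      exact Real.sqrt_le_sqrt (by linarith)
    have h11 : oe (-(n * ((k + 1) * K + 9 * ε1))) ≤ 2 * pge (n + 1) (k + 1) x := by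
      refine le_trans ?_ (mul_le_mul' le_rfl h8)
      rw [h7]
      refine le_trans ?_ (mul_le_mul' le_rfl ((mul_le_mul' h1 (mul_le_mul' le_rfl h10)).trans h9))
      conv_rhs => rw [← oe_log (aN_pos hn) (aN_ne_top hn)]
      rw [oe_mul, oe_mul, oe_mul]
      refine oe_le ?_
      rw [lt_div_iff₀ hn0] at h3
      have f1 := mul_le_mul_of_nonneg_left h2.le hn0.le
      have f2 := mul_le_mul_of_nonneg_left H1 hn0.le
      have f3 := mul_le_mul_of_nonneg_left H2 hn0.le
      have f4 := mul_le_mul_of_nonneg_left hσ2 hn0.le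
      have f5 := mul_le_mul_of_nonneg_left H3 hn0.le
      linarith
    have h12 : 2 * oe (-(n * ((k + 1) * K + 10 * ε1))) ≤ 2 * pge (n + 1) (k + 1) x :=
      (two_mul_oe_le (by linarith)).trans h11
    rw [ENNReal.mul_le_mul_iff_right (by norm_num) (by norm_num)] at h12
    refine le_trans (oe_le (neg_le_neg ?_)) h12
    push_cast
    have : (0 : ℝ) ≤ (k + 1) * K := by positivity
    nlinarith

theorem eventually_const_mul_oe_le (C : ℕ) {s t : ℝ} (h : s < t) :
    ∀ᶠ n : ℕ in atTop, (C : ℝ≥0∞) * oe (n * s) ≤ oe (n * t) := by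
  filter_upwards [eventually_le_nat_mul (sub_pos.2 h) C] with n hn
  rw [show (n : ℝ) * t = n * (t - s) + n * s by ring, ← oe_mul]
  refine mul_le_mul' ?_ le_rfl
  rw [oe, ← ENNReal.ofReal_natCast]
  exact ENNReal.ofReal_le_ofReal (hn.trans (by linarith [Real.add_one_le_exp (n * (t - s))]))

/-- Growth at exponential rate `S`. -/
def HasRate (I : ℕ → ℝ≥0∞) (S : ℝ) : Prop :=
  ∀ ε : ℝ, 0 < ε → ∀ᶠ n : ℕ in atTop, oe (n * (S - ε)) ≤ I n ∧ I n ≤ oe (n * (S + ε))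

theorem HasRate.tendsto {I : ℕ → ℝ≥0∞} {S : ℝ} (h : HasRate I S) :
    Tendsto (fun n : ℕ => Real.log (I n).toReal / n) atTop (nhds S) := by
  rw [Metric.tendsto_nhds]
  intro ε hε
  filter_upwards [h (ε / 2) (by positivity), eventually_gt_atTop 0] with n hn hn0
  have hn0' : (0 : ℝ) < n := by exact_mod_cast hn0
  have htop : I n ≠ ⊤ := ne_top_of_le_ne_top (oe_ne_top _) hn.2
  have h1 : Real.exp (n * (S - ε / 2)) ≤ (I n).toReal := by
    have := ENNReal.toReal_mono htop hn.1
    rwa [oe, ENNReal.toReal_ofReal (Real.exp_pos _).le] at this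
  have h2 : (I n).toReal ≤ Real.exp (n * (S + ε / 2)) := by
    have := ENNReal.toReal_mono (oe_ne_top _) hn.2
    rwa [oe, ENNReal.toReal_ofReal (Real.exp_pos _).le] at this
  have h3 : n * (S - ε / 2) ≤ Real.log (I n).toReal := by
    rw [Real.le_log_iff_exp_le (lt_of_lt_of_le (Real.exp_pos _) h1)]; exact h1
  have h4 : Real.log (I n).toReal ≤ n * (S + ε / 2) := by
    rw [Real.log_le_iff_le_exp (lt_of_lt_of_le (Real.exp_pos _) h1)]; exact h2
  rw [Real.dist_eq, abs_lt]
  constructor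
  · have : S - ε / 2 ≤ Real.log (I n).toReal / n := by rw [le_div_iff₀ hn0']; linarith
    linarith
  · have : Real.log (I n).toReal / n ≤ S + ε / 2 := by rw [div_le_iff₀ hn0']; linarith
    linarith

section Laplace
variable {m : ℕ → Measure ℝ} {f : ℕ → ℝ → ℝ≥0∞} {R F : ℝ → ℝ} {l x0 : ℝ}

theorem setLIntegral_le_oe {s : Set ℝ} (hs : MeasurableSet s) {n : ℕ} {a b : ℝ} (h1 : ∀ x ∈ s, f n x ≤ oe (n * a))
    (h2 : m n s ≤ oe (n * b)) : ∫⁻ x in s, f n x ∂(m n) ≤ oe (n * (a + b)) := by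
  refine (setLIntegral_mono' hs h1).trans ?_
  rw [setLIntegral_const, mul_add, ← oe_mul]
  exact mul_le_mul' le_rfl h2

theorem laplace_upper (hx0 : l ≤ x0) (hR : Continuous R) (hF : Continuous F) (hF0 : ∀ x, F x ≤ 0) (hRl : R l = 0)
    (hRtop : ∀ M, ∃ x, l < x ∧ M ≤ R x)
    (hmass : ∀ ε, 0 < ε → ∀ᶠ n : ℕ in atTop, m n Set.univ ≤ oe (n * ε))
    (hU : ∀ x, l < x → ∀ ε, 0 < ε → ∀ᶠ n : ℕ in atTop, m n (Set.Ici x) ≤ oe (-(n * (R x - ε))))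
    (hfU : ∀ ε, 0 < ε → ∀ᶠ n : ℕ in atTop, ∀ x, f n x ≤ oe (n * (F x + ε)))
    (hzero : l < x0 → ∀ n, 0 < n → ∀ x < x0, f n x = 0)
    (hleft : ∀ x, x < l → ∀ ε, 0 < ε → ∀ᶠ n : ℕ in atTop,
      ∫⁻ y in Set.Iio x, f n y ∂(m n) ≤ oe (n * (F l + ε)))
    {S : ℝ} (hS : ∀ x, x0 ≤ x → F x - R x ≤ S) {ε : ℝ} (hε : 0 < ε) :
    ∀ᶠ n : ℕ in atTop, ∫⁻ x, f n x ∂(m n) ≤ oe (n * (S + ε)) := by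
  set e := ε / 5 with he
  have hep : 0 < e := by positivity
  set Pr : Set ℝ → Prop := fun s => ∃ C : ℕ, ∀ᶠ n : ℕ in atTop, ∫⁻ x in s, f n x ∂(m n) ≤ C * oe (n * (S + 4 * e))
    with hPr
  have hmono : ∀ ⦃s t⦄, s ⊆ t → Pr t → Pr s := by
    rintro s t hst ⟨C, hC⟩
    exact ⟨C, hC.mono fun n hn => (lintegral_mono_set hst).trans hn⟩
  have hunion : ∀ ⦃s t⦄, Pr s → Pr t → Pr (s ∪ t) := by
    rintro s t ⟨C, hC⟩ ⟨C', hC'⟩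
    refine ⟨C + C', ?_⟩
    filter_upwards [hC, hC'] with n h1 h2
    refine (lintegral_union_le _ _ _).trans ?_
    push_cast; rw [add_mul]; exact add_le_add h1 h2
  have hone : ∀ {s : Set ℝ} {a : ℝ}, a ≤ S + 4 * e →
      (∀ᶠ n : ℕ in atTop, ∫⁻ x in s, f n x ∂(m n) ≤ oe (n * a)) → Pr s := by
    intro s a ha h
    refine ⟨1, h.mono fun n hn => hn.trans ?_⟩
    rw [Nat.cast_one, one_mul]
    exact oe_le (mul_le_mul_of_nonneg_left ha n.cast_nonneg)
  have hlow : ∀ x, x < x0 → (l < x0 ∨ x < l) → Pr (Set.Iio x) := by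
    intro x hx h
    rcases lt_or_eq_of_le hx0 with h0 | h0
    · refine ⟨0, (eventually_gt_atTop 0).mono fun n hn => le_of_eq ?_⟩
      rw [setLIntegral_congr_fun (g := fun _ => 0) measurableSet_Iio fun y hy =>
        hzero h0 n hn y (lt_trans (Set.mem_Iio.1 hy) hx)]
      simp
    · have hxl : x < l := by rw [h0]; exact hx
      refine hone (a := F l + e) ?_ (hleft x hxl e hep)
      have := hS l (by rw [h0]); rw [hRl] at this; linarith
  have hloc : ∀ x, ∃ t ∈ nhds x, Pr t := by
    intro x
    rcases lt_or_ge x x0 with hx | hx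
    · exact ⟨Set.Iio ((x + x0) / 2), Iio_mem_nhds (by linarith), hlow _ (by linarith) (by
        rcases lt_or_eq_of_le hx0 with h0 | h0
        · exact Or.inl h0
        · right; linarith)⟩
    have hFx : ∀ᶠ y in nhds x, F y < F x + e := (hF.tendsto x).eventually (gt_mem_nhds (by linarith))
    rcases lt_or_eq_of_le (hx0.trans hx) with hlx | hlx
    · have hRx : ∀ᶠ y in nhds x, R x - e < R y := (hR.tendsto x).eventually (lt_mem_nhds (by linarith))
      obtain ⟨r, hr, H⟩ := Metric.eventually_nhds_iff.1 (hFx.and (hRx.and (lt_mem_nhds hlx)))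
      have hmem : dist (x - r / 2) x < r := by
        rw [Real.dist_eq, show x - r / 2 - x = -(r / 2) by ring, abs_neg, abs_of_pos (by positivity)]; linarith
      obtain ⟨-, h2, h3⟩ := H hmem
      refine ⟨Set.Ioo (x - r / 2) (x + r / 2), Ioo_mem_nhds (by linarith) (by linarith), ?_⟩
      refine hone (a := (F x + 2 * e) + (-(R x - e) + e)) (by have := hS x hx; linarith) ?_
      filter_upwards [hfU e hep, hU _ h3 e hep] with n k1 k2
      refine setLIntegral_le_oe measurableSet_Ioo (fun y hy => (k1 y).trans (oe_le ?_)) ?_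
      · have : F y < F x + e := (H (by rw [Real.dist_eq, abs_lt]; constructor <;> linarith [hy.1, hy.2])).1
        exact mul_le_mul_of_nonneg_left (by linarith) n.cast_nonneg
      · refine (measure_mono fun y hy => hy.1.le).trans (k2.trans (oe_le ?_))
        rw [← mul_neg]
        exact mul_le_mul_of_nonneg_left (by linarith) n.cast_nonneg
    · obtain ⟨r, hr, H⟩ := Metric.eventually_nhds_iff.1 hFx
      refine ⟨Set.Ioo (x - r) (x + r), Ioo_mem_nhds (by linarith) (by linarith), ?_⟩
      have hR0 : R x = 0 := by rw [← hlx]; exact hRl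
      refine hone (a := (F x + 2 * e) + e) (by have := hS x hx; linarith) ?_
      filter_upwards [hfU e hep, hmass e hep] with n k1 k2
      refine setLIntegral_le_oe measurableSet_Ioo (fun y hy => (k1 y).trans (oe_le ?_)) ?_
      · have : F y < F x + e := H (by rw [Real.dist_eq, abs_lt]; constructor <;> linarith [hy.1, hy.2])
        exact mul_le_mul_of_nonneg_left (by linarith) n.cast_nonneg
      · exact (measure_mono (Set.subset_univ _)).trans k2
  obtain ⟨M, hM, hM2⟩ := hRtop (-S)
  have hcpt : Pr (Set.Icc (l - 2) M) := by
    refine isCompact_Icc.induction_on (p := Pr) ?_ hmono hunion ?_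
    · exact ⟨0, Eventually.of_forall fun n => by simp⟩
    · intro x _
      obtain ⟨t, ht, h⟩ := hloc x
      exact ⟨t, mem_nhdsWithin_of_mem_nhds ht, h⟩
  have hhigh : Pr (Set.Ici M) := by
    refine hone (a := (0 + e) + (-(R M) + e)) (by linarith) ?_
    filter_upwards [hfU e hep, hU M hM e hep] with n k1 k2
    refine setLIntegral_le_oe measurableSet_Ici (fun y hy => (k1 y).trans (oe_le ?_)) (k2.trans (oe_le ?_))
    · exact mul_le_mul_of_nonneg_left (by linarith [hF0 y]) n.cast_nonneg
    · rw [← mul_neg]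
      exact mul_le_mul_of_nonneg_left (by linarith) n.cast_nonneg
  have hall : Pr Set.univ := by
    refine hmono (fun y _ => ?_) (hunion (hlow (l - 1) (by linarith) (Or.inr (by linarith))) (hunion hcpt hhigh))
    rcases lt_or_ge y (l - 1) with h | h
    · exact Or.inl h
    rcases le_or_gt y M with h' | h'
    · exact Or.inr (Or.inl ⟨by linarith, h'⟩)
    · exact Or.inr (Or.inr h'.le)
  obtain ⟨C, hC⟩ := hall
  filter_upwards [hC, eventually_const_mul_oe_le C (show S + 4 * e < S + ε by rw [he]; linarith)] with n h1 h2
  rw [Measure.restrict_univ] at h1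
  exact h1.trans h2

theorem laplace_lower (hx0 : l ≤ x0) (hR : Continuous R) (hF : Continuous F)
    (hL : ∀ x y, l < x → x < y → ∀ ε, 0 < ε → ∀ᶠ n : ℕ in atTop, oe (-(n * (R x + ε))) ≤ m n (Set.Icc x y))
    (hfL : ∀ x, x0 < x → ∀ ε, 0 < ε → ∃ y, x < y ∧ ∀ᶠ n : ℕ in atTop, ∀ z ∈ Set.Icc x y, oe (n * (F x - ε)) ≤ f n z)
    {x : ℝ} (hx : x0 ≤ x) {ε : ℝ} (hε : 0 < ε) :
    ∀ᶠ n : ℕ in atTop, oe (n * (F x - R x - ε)) ≤ ∫⁻ x, f n x ∂(m n) := by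
  obtain ⟨d, hd, H⟩ := exists_pos_le (f := fun t => R (x + t) - F (x + t)) (u := R x - F x + ε / 3)
    (by fun_prop) (by simp; positivity)
  have H := H d hd.le le_rfl
  obtain ⟨y, hxy, hy⟩ := hfL (x + d) (by linarith) (ε / 3) (by positivity)
  filter_upwards [hy, hL (x + d) y (by linarith) hxy (ε / 3) (by positivity)] with n h1 h2
  calc oe (n * (F x - R x - ε)) ≤ oe (n * (F (x + d) - ε / 3)) * oe (-(n * (R (x + d) + ε / 3))) := by
        rw [oe_mul, ← mul_neg, ← mul_add]
        exact oe_le (mul_le_mul_of_nonneg_left (by linarith) n.cast_nonneg)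
    _ ≤ oe (n * (F (x + d) - ε / 3)) * m n (Set.Icc (x + d) y) := mul_le_mul' le_rfl h2
    _ = ∫⁻ _ in Set.Icc (x + d) y, oe (n * (F (x + d) - ε / 3)) ∂(m n) := by rw [setLIntegral_const]
    _ ≤ ∫⁻ z in Set.Icc (x + d) y, f n z ∂(m n) := setLIntegral_mono' measurableSet_Icc h1
    _ ≤ _ := setLIntegral_le_lintegral _ _

/-- A Laplace principle. -/
theorem exists_hasRate (hx0 : l ≤ x0) (hR : Continuous R) (hF : Continuous F) (hF0 : ∀ x, F x ≤ 0)
    (hR0 : ∀ x, 0 ≤ R x) (hRl : R l = 0) (hRtop : ∀ M, ∃ x, l < x ∧ M ≤ R x)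
    (hmass : ∀ ε, 0 < ε → ∀ᶠ n : ℕ in atTop, m n Set.univ ≤ oe (n * ε))
    (hU : ∀ x, l < x → ∀ ε, 0 < ε → ∀ᶠ n : ℕ in atTop, m n (Set.Ici x) ≤ oe (-(n * (R x - ε))))
    (hL : ∀ x y, l < x → x < y → ∀ ε, 0 < ε → ∀ᶠ n : ℕ in atTop, oe (-(n * (R x + ε))) ≤ m n (Set.Icc x y))
    (hfU : ∀ ε, 0 < ε → ∀ᶠ n : ℕ in atTop, ∀ x, f n x ≤ oe (n * (F x + ε)))
    (hfL : ∀ x, x0 < x → ∀ ε, 0 < ε → ∃ y, x < y ∧ ∀ᶠ n : ℕ in atTop, ∀ z ∈ Set.Icc x y, oe (n * (F x - ε)) ≤ f n z)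
    (hzero : l < x0 → ∀ n, 0 < n → ∀ x < x0, f n x = 0)
    (hleft : ∀ x, x < l → ∀ ε, 0 < ε → ∀ᶠ n : ℕ in atTop,
      ∫⁻ y in Set.Iio x, f n y ∂(m n) ≤ oe (n * (F l + ε))) :
    ∃ S, HasRate (fun n => ∫⁻ x, f n x ∂(m n)) S := by
  set T := (fun x => F x - R x) '' Set.Ici x0
  have hne : T.Nonempty := ⟨_, Set.mem_image_of_mem _ Set.self_mem_Ici⟩
  have hbdd : BddAbove T := ⟨0, by rintro _ ⟨x, -, rfl⟩; dsimp only; linarith [hF0 x, hR0 x]⟩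
  refine ⟨sSup T, fun ε hε => ?_⟩
  obtain ⟨_, ⟨x, hx, rfl⟩, hx2⟩ := exists_lt_of_lt_csSup hne (show sSup T - ε / 2 < sSup T by linarith)
  filter_upwards [laplace_upper hx0 hR hF hF0 hRl hRtop hmass hU hfU hzero hleft
    (fun x hx => le_csSup hbdd ⟨x, hx, rfl⟩) hε, laplace_lower hx0 hR hF hL hfL hx (half_pos hε)] with n h1 h2
  refine ⟨le_trans (oe_le ?_) h2, h1⟩
  exact mul_le_mul_of_nonneg_left (by dsimp only at hx2; linarith) n.cast_nonneg

end Laplace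

section

variable {P : ℕ} {c : ℕ → ℝ}

/-- Exponential rate of the weight of an eigenvalue. -/
def wtRate (P : ℕ) (c : ℕ → ℝ) (η u : ℝ) : ℝ :=
  -((1 / (2 * vv P c) - 1 / 4) * u ^ 2) - (max (η - bb P c * u) 0) ^ 2 / (2 * tau P c ^ 2)

theorem continuous_wtRate (η : ℝ) : Continuous (wtRate P c η) := by
  unfold wtRate
  exact Continuous.sub (by fun_prop) ((((continuous_const.sub (continuous_const.mul continuous_id)).max
    continuous_const).pow 2).div_const _)

theorem gaussian_Ici_le {s : ℝ} (hs : 0 ≤ s) : gaussianReal 0 1 (Set.Ici s) ≤ oe (-(s ^ 2 / 2)) := by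
  have h := lintegral_oe_gaussian s s
  rw [show s ^ 2 / 2 - s * s = -(s ^ 2 / 2) by ring] at h
  rw [← h, ← lintegral_indicator_one measurableSet_Ici]
  refine lintegral_mono fun z => ?_
  by_cases hz : z ∈ Set.Ici s
  · rw [Set.indicator_of_mem hz, Pi.one_apply, ← oe_zero]
    exact oe_le (mul_nonneg hs (sub_nonneg.2 hz))
  · rw [Set.indicator_of_notMem hz]; exact zero_le

theorem tau_nonneg : 0 ≤ tau P c := Real.sqrt_nonneg _

theorem pN_le (η : ℝ) (n : ℕ) (u : ℝ) :
    pN P c η n (Real.sqrt n * u) ≤ oe (-(n * ((max (η - bb P c * u) 0) ^ 2 / (2 * tau P c ^ 2)))) := by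
  rcases eq_or_lt_of_le (tau_nonneg (P := P) (c := c)) with h | h
  · rw [← h]
    simp only [ne_eq, OfNat.ofNat_ne_zero, not_false_eq_true, zero_pow, mul_zero, div_zero, neg_zero, oe_zero]
    exact prob_le_one
  · have hs := Real.sqrt_nonneg (n : ℝ)
    set s := Real.sqrt n * (max (η - bb P c * u) 0 / tau P c) with hsd
    have hs0 : 0 ≤ s := by positivity
    have e : n * ((max (η - bb P c * u) 0) ^ 2 / (2 * tau P c ^ 2)) = s ^ 2 / 2 := by
      rw [hsd, mul_pow, Real.sq_sqrt n.cast_nonneg]; field_simp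
    rw [e]
    rcases le_total (η - bb P c * u) 0 with h0 | h0
    · have : s = 0 := by rw [hsd, max_eq_right h0]; simp
      rw [this]; simp only [ne_eq, OfNat.ofNat_ne_zero, not_false_eq_true, zero_pow, zero_div, neg_zero, oe_zero]
      exact prob_le_one
    · refine (measure_mono fun w hw => ?_).trans (gaussian_Ici_le hs0)
      have hw' : Real.sqrt n * η ≤ bb P c * (Real.sqrt n * u) + tau P c * w := hw
      show s ≤ w
      rw [hsd, max_eq_left h0, mul_div_assoc', div_le_iff₀ h]
      linarith

theorem le_pN (hb : 0 < bb P c) {η x : ℝ} (hx : 0 < tau P c ∨ η ≤ bb P c * x) {ε : ℝ} (hε : 0 < ε) :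
    ∀ᶠ n : ℕ in atTop, ∀ z, x ≤ z →
      oe (-(n * ((max (η - bb P c * x) 0) ^ 2 / (2 * tau P c ^ 2) + ε))) ≤ pN P c η n (Real.sqrt n * z) := by
  by_cases h0 : η ≤ bb P c * x ∧ tau P c = 0
  · refine Eventually.of_forall fun n z hz => ?_
    have : pN P c η n (Real.sqrt n * z) = 1 := by
      unfold pN
      have hu : {w | Real.sqrt n * η ≤ bb P c * (Real.sqrt n * z) + tau P c * w} = Set.univ := by
        refine Set.eq_univ_of_forall fun w => ?_
        show Real.sqrt n * η ≤ bb P c * (Real.sqrt n * z) + tau P c * w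
        rw [h0.2, zero_mul, add_zero]
        have : η ≤ bb P c * z := h0.1.trans (mul_le_mul_of_nonneg_left hz hb.le)
        calc _ ≤ Real.sqrt n * (bb P c * z) := mul_le_mul_of_nonneg_left this (Real.sqrt_nonneg _)
          _ = _ := by ring
      rw [hu, measure_univ]
    rw [this, ← oe_zero]
    refine oe_le ?_
    rw [neg_nonpos]; positivity
  have ht : 0 < tau P c := by
    rcases hx with h | h
    · exact h
    · exact lt_of_le_of_ne tau_nonneg fun h' => h0 ⟨h, h'.symm⟩
  set q := max (η - bb P c * x) 0 / tau P c with hq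
  have hq0 : 0 ≤ q := by positivity
  have hlim : Tendsto (fun n : ℕ => Real.sqrt n * (ε / 2)) atTop atTop :=
    (Real.tendsto_sqrt_atTop.comp tendsto_natCast_atTop_atTop).atTop_mul_const (by positivity)
  filter_upwards [hlim.eventually_ge_atTop q, eventually_le_nat_mul (half_pos hε)
    (1 / 2 + Real.log (Real.sqrt (2 * Real.pi)))] with n h1 h2 z hz
  have hs := Real.sqrt_nonneg (n : ℝ)
  have hpi := Real.pi_pos
  calc _ ≤ ENNReal.ofReal ((Real.sqrt n * q + 1 - Real.sqrt n * q) / Real.sqrt (2 * Real.pi)) *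
        oe (-((Real.sqrt n * q + 1) ^ 2 / 2)) := by
        rw [add_sub_cancel_left, ← oe_log_ofReal (by positivity), oe_mul]
        refine oe_le ?_
        rw [Real.log_div one_ne_zero (by positivity), Real.log_one, zero_sub, ← neg_add, neg_le_neg_iff]
        have e : (max (η - bb P c * x) 0) ^ 2 / (2 * tau P c ^ 2) = q ^ 2 / 2 := by
          rw [hq]; field_simp
        rw [e]
        have := mul_le_mul_of_nonneg_left h1 hs
        have h3 := Real.sq_sqrt (n.cast_nonneg (α := ℝ))
        nlinarith
    _ ≤ gaussianReal 0 1 (Set.Icc (Real.sqrt n * q) (Real.sqrt n * q + 1)) :=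
        gaussian_Icc_ge (by positivity) (by linarith)
    _ ≤ _ := by
        refine measure_mono fun w hw => ?_
        show Real.sqrt n * η ≤ bb P c * (Real.sqrt n * z) + tau P c * w
        have h3 := mul_le_mul_of_nonneg_left hw.1 ht.le
        have h4 : tau P c * (Real.sqrt n * q) = Real.sqrt n * max (η - bb P c * x) 0 := by
          rw [hq]; field_simp
        have h5 := mul_le_mul_of_nonneg_left (le_max_left (η - bb P c * x) 0) hs
        have h6 := mul_le_mul_of_nonneg_left (mul_le_mul_of_nonneg_left hz hb.le) hs
        linarith

theorem wtN_eq (hv : 0 < vv P c) (η : ℝ) (n : ℕ) (u : ℝ) : wtN P c η n (Real.sqrt n * u) =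
    oe (Real.log (Real.sqrt (2 / vv P c)) + -(n * ((1 / (2 * vv P c) - 1 / 4) * u ^ 2))) *
      pN P c η n (Real.sqrt n * u) := by
  rw [wtN, ← oe_mul, oe_log_ofReal (by positivity), ENNReal.ofReal_mul (by positivity), oe, mul_pow,
    Real.sq_sqrt n.cast_nonneg]
  congr 4
  ring

theorem wtN_le (hv : 0 < vv P c) (η : ℝ) {ε : ℝ} (hε : 0 < ε) :
    ∀ᶠ n : ℕ in atTop, ∀ u, wtN P c η n (Real.sqrt n * u) ≤ oe (n * (wtRate P c η u + ε)) := by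
  filter_upwards [eventually_le_nat_mul hε (Real.log (Real.sqrt (2 / vv P c)))] with n hn u
  rw [wtN_eq hv]
  refine (mul_le_mul' le_rfl (pN_le η n u)).trans ?_
  rw [oe_mul, wtRate]
  refine oe_le ?_
  linarith

theorem le_wtN (hv : 0 < vv P c) (hb : 0 < bb P c) {η x : ℝ} (hx : 0 < tau P c ∨ η ≤ bb P c * x)
    {ε : ℝ} (hε : 0 < ε) : ∃ y, x < y ∧ ∀ᶠ n : ℕ in atTop, ∀ z ∈ Set.Icc x y,
      oe (n * (wtRate P c η x - ε)) ≤ wtN P c η n (Real.sqrt n * z) := by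
  obtain ⟨d, hd, H⟩ := exists_pos_le (f := fun t => (1 / (2 * vv P c) - 1 / 4) * (x + t) ^ 2)
    (u := (1 / (2 * vv P c) - 1 / 4) * x ^ 2 + ε / 3) (by fun_prop) (by simp; positivity)
  refine ⟨x + d, by linarith, ?_⟩
  filter_upwards [eventually_le_nat_mul (show 0 < ε / 3 by positivity) (-Real.log (Real.sqrt (2 / vv P c))),
    le_pN hb hx (show 0 < ε / 3 by positivity)] with n h1 h2 z hz
  rw [wtN_eq hv]
  refine le_trans ?_ (mul_le_mul' le_rfl (h2 z hz.1))
  rw [oe_mul, wtRate]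
  refine oe_le ?_
  have h3 := H (z - x) (by linarith [hz.1]) (by linarith [hz.2])
  simp only [add_sub_cancel] at h3
  have h4 := mul_le_mul_of_nonneg_left h3 (n.cast_nonneg (α := ℝ))
  linarith

theorem wtN_eq_zero (ht : tau P c = 0) {η u : ℝ} (hu : bb P c * u < η) {n : ℕ} (hn : 0 < n) :
    wtN P c η n (Real.sqrt n * u) = 0 := by
  have hs : 0 < Real.sqrt n := Real.sqrt_pos.2 (by exact_mod_cast hn)
  have : {w | Real.sqrt n * η ≤ bb P c * (Real.sqrt n * u) + tau P c * w} = ∅ := by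
    refine Set.eq_empty_of_forall_notMem fun w hw => ?_
    have hw' : Real.sqrt n * η ≤ bb P c * (Real.sqrt n * u) + tau P c * w := hw
    rw [ht, zero_mul, add_zero] at hw'
    have := mul_lt_mul_of_pos_left hu hs
    linarith
  rw [wtN, pN, this, measure_empty, mul_zero]

theorem wtRate_nonpos (hA : 0 ≤ 1 / (2 * vv P c) - 1 / 4) (η u : ℝ) : wtRate P c η u ≤ 0 := by
  unfold wtRate
  have h1 : 0 ≤ (1 / (2 * vv P c) - 1 / 4) * u ^ 2 := by positivity
  have h2 : 0 ≤ (max (η - bb P c * u) 0) ^ 2 / (2 * tau P c ^ 2) := by positivity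
  linarith

theorem wtRate_mono_of_nonpos (hA : 0 ≤ 1 / (2 * vv P c) - 1 / 4) (hb : 0 < bb P c) (η : ℝ) {u w : ℝ} (h : u ≤ w)
    (hw : w ≤ 0) : wtRate P c η u ≤ wtRate P c η w := by
  unfold wtRate
  have h1 : w ^ 2 ≤ u ^ 2 := by nlinarith
  have h2 := mul_le_mul_of_nonneg_left h1 hA
  have h3 : max (η - bb P c * w) 0 ≤ max (η - bb P c * u) 0 :=
    max_le_max (by have := mul_le_mul_of_nonneg_left h hb.le; linarith) le_rfl
  have h4 : (max (η - bb P c * w) 0) ^ 2 / (2 * tau P c ^ 2) ≤ (max (η - bb P c * u) 0) ^ 2 / (2 * tau P c ^ 2) :=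
    div_le_div_of_nonneg_right (pow_le_pow_left₀ (le_max_right _ _) h3 2) (by positivity)
  linarith

/-- The Laplace principle for the eigenvalue weights. -/
theorem exists_hasRate_wtN (hv : 0 < vv P c) (hb : 0 < bb P c) (hA : 0 ≤ 1 / (2 * vv P c) - 1 / 4) (η : ℝ)
    {m : ℕ → Measure ℝ} {R : ℝ → ℝ} {l : ℝ} (hR : Continuous R)
    (hR0 : ∀ x, 0 ≤ R x) (hRl : R l = 0) (hRtop : ∀ M, ∃ x, l < x ∧ M ≤ R x)
    (hmass : ∀ ε, 0 < ε → ∀ᶠ n : ℕ in atTop, m n Set.univ ≤ oe (n * ε))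
    (hU : ∀ x, l < x → ∀ ε, 0 < ε → ∀ᶠ n : ℕ in atTop, m n (Set.Ici x) ≤ oe (-(n * (R x - ε))))
    (hL : ∀ x y, l < x → x < y → ∀ ε, 0 < ε → ∀ᶠ n : ℕ in atTop, oe (-(n * (R x + ε))) ≤ m n (Set.Icc x y))
    (hleft : ∀ x, x < l → ∀ ε, 0 < ε → ∀ᶠ n : ℕ in atTop,
      ∫⁻ y in Set.Iio x, wtN P c η n (Real.sqrt n * y) ∂(m n) ≤ oe (n * (wtRate P c η l + ε))) :
    ∃ S, HasRate (fun n => ∫⁻ x, wtN P c η n (Real.sqrt n * x) ∂(m n)) S := by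
  rcases eq_or_lt_of_le (tau_nonneg (P := P) (c := c)) with h | h
  · refine exists_hasRate (x0 := max l (η / bb P c)) (le_max_left _ _) hR (continuous_wtRate η) (wtRate_nonpos hA η)
      hR0 hRl hRtop hmass hU hL (fun ε hε => wtN_le hv η hε) (fun x hx ε hε => le_wtN hv hb (Or.inr ?_) hε)
      (fun hl n hn x hx => wtN_eq_zero h.symm ?_ hn) hleft
    · have := (le_max_right l (η / bb P c)).trans_lt hx
      rw [div_lt_iff₀ hb] at this; linarith
    · rcases lt_max_iff.1 hl with h1 | h1
      · exact absurd h1 (lt_irrefl _)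
      · rw [max_eq_right h1.le, lt_div_iff₀ hb] at hx; linarith
  · exact exists_hasRate (x0 := l) le_rfl hR (continuous_wtRate η) (wtRate_nonpos hA η)
      hR0 hRl hRtop hmass hU hL (fun ε hε => wtN_le hv η hε) (fun x hx ε hε => le_wtN hv hb (Or.inl h) hε)
      (fun hl => absurd hl (lt_irrefl _)) hleft

end

section

variable {P : ℕ} {c : ℕ → ℝ}

theorem exists_le_rateK (M : ℝ) : ∃ x, 2 < x ∧ M ≤ rateK x := by
  set u := 2 * |M| + 2 with hu
  have hM := abs_nonneg M
  have hM' := le_abs_self M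
  refine ⟨2 * Real.cosh u, by have := Real.one_lt_cosh.2 (show u ≠ 0 by positivity); linarith, ?_⟩
  have h1 : rateK (2 * Real.cosh u) = (Real.sinh (2 * u) - 2 * u) / 2 := by
    unfold rateK
    rw [max_eq_left (by linarith [Real.one_le_cosh u]), mul_div_cancel_left₀ _ (by norm_num),
      Real.arcosh_cosh (by positivity)]
  rw [h1, Real.sinh_eq]
  have h2 := Real.quadratic_le_exp_of_nonneg (show 0 ≤ 2 * u by positivity)
  have h3 : Real.exp (-(2 * u)) ≤ 1 := Real.exp_le_one_iff.2 (by have : 0 ≤ u := by positivity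
                                                                 linarith)
  nlinarith

theorem scI_pos {h : ℝ → ℝ} (hc : Continuous h) (h0 : ∀ t, 0 ≤ h t) {t : ℝ} (ht : 0 < h t) (h1 : -2 < t) (h2 : t < 2) :
    0 < scI h := by
  have hpi := Real.pi_pos
  unfold scI
  refine mul_pos (by positivity) (intervalIntegral.integral_pos hpi (Continuous.continuousOn (by fun_prop))
    (fun θ _ => by have := h0 (2 * Real.cos θ)
                   positivity) ⟨Real.arccos (t / 2), ⟨Real.arccos_nonneg _, Real.arccos_le_pi _⟩, ?_⟩)
  rw [Real.cos_arccos (by linarith) (by linarith), Real.sin_arccos, mul_div_cancel₀ _ (by norm_num),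
    Real.sq_sqrt (by nlinarith)]
  exact mul_pos ht (by nlinarith)

/-- A Lipschitz bump supported on `[x, y]`. -/
def bump (x y t : ℝ) : ℝ := max 0 (min 1 (min (t - x) (y - t)))

theorem bump_nonneg (x y t : ℝ) : 0 ≤ bump x y t := le_max_left _ _

theorem bump_le_one (x y t : ℝ) : bump x y t ≤ 1 := max_le zero_le_one (min_le_left _ _)

theorem bump_eq_zero {x y t : ℝ} (h : t ∉ Set.Icc x y) : bump x y t = 0 := by
  refine max_eq_left ((min_le_right _ _).trans ?_)
  by_cases h1 : x ≤ t
  · exact (min_le_right _ _).trans (by have : ¬ t ≤ y := fun h2 => h ⟨h1, h2⟩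
                                       linarith)
  · exact (min_le_left _ _).trans (by linarith)

theorem bump_sub_le (x y s t : ℝ) : |bump x y s - bump x y t| ≤ 1 * |s - t| := by
  have h : ∀ s t, bump x y s ≤ bump x y t + |s - t| := by
    intro s t
    have h1 := le_abs_self (s - t)
    have h2 := neg_abs_le (s - t)
    have h3 := abs_nonneg (s - t)
    refine max_le (add_nonneg (bump_nonneg _ _ _) h3) ?_
    rw [← sub_le_iff_le_add]
    refine le_trans ?_ (le_max_right _ _)
    refine le_min ?_ (le_min ?_ ?_)
    · linarith [min_le_left 1 (min (s - x) (y - s))]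
    · linarith [(min_le_right 1 (min (s - x) (y - s))).trans (min_le_left _ _)]
    · linarith [(min_le_right 1 (min (s - x) (y - s))).trans (min_le_right _ _)]
  rw [one_mul, abs_le]
  constructor
  · have := h t s; rw [abs_sub_comm] at this; linarith
  · linarith [h s t]

theorem continuous_bump (x y : ℝ) : Continuous (bump x y) := by unfold bump; fun_prop

theorem bump_bound (x y t : ℝ) : |bump x y t| ≤ 1 * (1 + t ^ 2) := by
  rw [abs_of_nonneg (bump_nonneg _ _ _)]
  nlinarith [bump_le_one x y t, sq_nonneg t]

theorem scI_bump_pos {x y : ℝ} (hxy : x < y) (hx : x < 2) (hy : -2 < y) : 0 < scI (bump x y) := by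
  have h1 : max x (-2) < min y 2 := max_lt (lt_min hxy hx) (lt_min hy (by norm_num))
  have a1 := le_max_left x (-2)
  have a2 := le_max_right x (-2)
  have a3 := min_le_left y 2
  have a4 := min_le_right y 2
  refine scI_pos (continuous_bump x y) (bump_nonneg x y) (t := (max x (-2) + min y 2) / 2) ?_ (by linarith) (by linarith)
  refine lt_max_of_lt_right (lt_min zero_lt_one (lt_min ?_ ?_)) <;> linarith

theorem sum_bump_le_nge {n : ℕ} (hn : 0 < n) (x y : ℝ) (g : Fin n × Fin n → ℝ) :
    ∑ i, bump x y (evs (goe n g) i / Real.sqrt n) ≤ nge (goe n g) (x * Real.sqrt n) := by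
  have hs : 0 < Real.sqrt n := Real.sqrt_pos.2 (by exact_mod_cast hn)
  unfold nge
  rw [Finset.natCast_card_filter]
  refine Finset.sum_le_sum fun i _ => ?_
  split_ifs with h
  · exact bump_le_one _ _ _
  · refine (bump_eq_zero fun h' => h ?_).le
    rw [← le_div_iff₀ hs]; exact h'.1

/-- It is superexponentially unlikely that few eigenvalues exceed a point below the edge. -/
theorem prob_nge_le {x : ℝ} (hx : x < 2) (k : ℕ) (M : ℝ) :
    ∀ᶠ n : ℕ in atTop, stdG (Fin n × Fin n) {g | nge (goe n g) (x * Real.sqrt n) ≤ k} ≤ oe (n * M) := by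
  have hpi := Real.pi_pos
  have hs0 := scI_bump_pos (y := 3) (by linarith) hx (by norm_num)
  set s := scI (bump x 3) / 3 with hs
  have hsp : 0 < s := by positivity
  have hlim := tendsto_LN (continuous_bump x 3) zero_le_one (bump_bound x 3)
  filter_upwards [hlim.eventually (lt_mem_nhds (show 2 * s < scI (bump x 3) by rw [hs]; linarith)),
    eventually_gt_atTop 0, eventually_le_nat_mul hsp k,
    eventually_le_nat_mul (show 0 < s ^ 2 / Real.pi ^ 2 by positivity) (-M)] with n h1 hn h2 h3
  have hn0 : (0 : ℝ) < n := by exact_mod_cast hn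
  have h4 := prob_le_sub_of_lipE (by positivity) (lipE_scaled hn zero_le_one (bump_sub_le x 3))
    (show 0 ≤ n * s by positivity)
  have h5 : ∫ g, ∑ i, bump x 3 (evs (goe n g) i / Real.sqrt n) ∂(stdG (Fin n × Fin n)) = n * LN n (bump x 3) := by
    rw [LN]; field_simp
  rw [h5] at h4
  refine (measure_mono fun g hg => ?_).trans (h4.trans (oe_le ?_))
  · have hg' : nge (goe n g) (x * Real.sqrt n) ≤ k := hg
    show ∑ i, bump x 3 (evs (goe n g) i / Real.sqrt n) ≤ n * LN n (bump x 3) - n * s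
    have h6 := sum_bump_le_nge hn x 3 g
    have h7 : (nge (goe n g) (x * Real.sqrt n) : ℝ) ≤ k := by exact_mod_cast hg'
    have h8 := mul_le_mul_of_nonneg_left h1.le hn0.le
    linarith
  · have h9 := mul_le_mul_of_nonneg_left h3 hn0.le
    have : 2 * (n * s) ^ 2 / (Real.pi ^ 2 * (Real.sqrt 2 * 1) ^ 2) = n * (n * (s ^ 2 / Real.pi ^ 2)) := by
      rw [mul_one, Real.sq_sqrt (by norm_num)]; field_simp
    rw [this]; linarith

/-- Law of the rescaled `k`-th largest eigenvalue. -/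
def evLaw (k n : ℕ) : Measure ℝ :=
  if h : k < n then (stdG (Fin n × Fin n)).map fun g => evs (goe n g) ⟨k, h⟩ / Real.sqrt n else 0

theorem measurable_evs_div {n : ℕ} (i : Fin n) : Measurable fun g => evs (goe n g) i / Real.sqrt n :=
  (measurable_evs_goe i).div_const _

theorem lintegral_evLaw {k n : ℕ} (h : k < n) {φ : ℝ → ℝ≥0∞} (hφ : Measurable φ) :
    ∫⁻ y, φ (Real.sqrt n * y) ∂(evLaw k n) = ∫⁻ g, φ (evs (goe n g) ⟨k, h⟩) ∂(stdG (Fin n × Fin n)) := by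
  have hs : 0 < Real.sqrt n := Real.sqrt_pos.2 (by exact_mod_cast (by omega : 0 < n))
  have hm : Measurable fun y => φ (Real.sqrt n * y) := hφ.comp (measurable_const.mul measurable_id)
  rw [evLaw, dif_pos h, lintegral_map hm (measurable_evs_div _)]
  refine lintegral_congr fun g => ?_
  rw [mul_div_cancel₀ _ hs.ne']

theorem evLaw_apply {k n : ℕ} (h : k < n) {s : Set ℝ} (hs : MeasurableSet s) :
    evLaw k n s = stdG (Fin n × Fin n) {g | evs (goe n g) ⟨k, h⟩ / Real.sqrt n ∈ s} := by
  rw [evLaw, dif_pos h, Measure.map_apply (measurable_evs_div _) hs]; rfl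

theorem evLaw_Ici {k n : ℕ} (h : k < n) (x : ℝ) : evLaw k n (Set.Ici x) = pge n (k + 1) x := by
  have hs : 0 < Real.sqrt n := Real.sqrt_pos.2 (by exact_mod_cast (by omega : 0 < n))
  rw [evLaw_apply h measurableSet_Ici, pge_succ_eq h]
  congr 1
  ext g
  show x ≤ evs (goe n g) ⟨k, h⟩ / Real.sqrt n ↔ x * Real.sqrt n ≤ evs (goe n g) ⟨k, h⟩
  rw [le_div_iff₀ hs]

theorem evLaw_le_one (k n : ℕ) (s : Set ℝ) : evLaw k n s ≤ 1 := by
  refine (measure_mono (Set.subset_univ s)).trans ?_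
  unfold evLaw
  split_ifs with h
  · rw [Measure.map_apply (measurable_evs_div _) MeasurableSet.univ]; exact prob_le_one
  · simp

theorem one_le_oe {t : ℝ} (h : 0 ≤ t) : 1 ≤ oe t := by rw [← oe_zero]; exact oe_le h

theorem evLaw_upper (k : ℕ) {x : ℝ} (hx : 2 < x) {ε : ℝ} (hε : 0 < ε) :
    ∀ᶠ n : ℕ in atTop, evLaw k n (Set.Ici x) ≤ oe (-(n * ((k + 1) * rateK x - ε))) := by
  filter_upwards [pge_upper (k + 1) hx hε, eventually_gt_atTop k] with n h1 h2
  rw [evLaw_Ici h2]; exact_mod_cast h1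

theorem evLaw_lower (k : ℕ) {x y : ℝ} (hx : 2 < x) (hxy : x < y) {ε : ℝ} (hε : 0 < ε) :
    ∀ᶠ n : ℕ in atTop, oe (-(n * ((k + 1) * rateK x + ε))) ≤ evLaw k n (Set.Icc x y) := by
  have hK : rateK x < rateK y := rateK_strictMonoOn hx.le (hx.trans hxy).le hxy
  have hR : (k + 1) * rateK x < (k + 1) * rateK y := mul_lt_mul_of_pos_left hK (by positivity)
  set Rx := (k + 1) * rateK x
  set Ry := (k + 1) * rateK y
  obtain ⟨e, he, he1, he2⟩ : ∃ e : ℝ, 0 < e ∧ 2 * e ≤ ε ∧ 3 * e ≤ Ry - Rx :=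
    ⟨min (ε / 2) ((Ry - Rx) / 3), lt_min (by positivity) (by linarith),
      by linarith [min_le_left (ε / 2) ((Ry - Rx) / 3)], by linarith [min_le_right (ε / 2) ((Ry - Rx) / 3)]⟩
  filter_upwards [pge_lower (k + 1) hx he, evLaw_upper k (hx.trans hxy) he, eventually_gt_atTop k,
    eventually_le_nat_mul he 1] with n h1 h2 h3 h4
  rw [← evLaw_Ici h3] at h1
  push_cast at h1
  have hn0 := n.cast_nonneg (α := ℝ)
  have h5 : evLaw k n (Set.Ici x) ≤ evLaw k n (Set.Icc x y) + evLaw k n (Set.Ici y) := by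
    refine (measure_mono fun z hz => ?_).trans (measure_union_le _ _)
    rcases le_total z y with h | h
    · exact Or.inl ⟨hz, h⟩
    · exact Or.inr h
  have h6 : 2 * oe (-(n * (Rx + 2 * e))) ≤ evLaw k n (Set.Icc x y) + oe (-(n * (Rx + 2 * e))) := by
    refine (two_mul_oe_le (t := -(n * (Rx + e))) (by linarith)).trans (h1.trans (h5.trans (add_le_add le_rfl
      (h2.trans (oe_le (neg_le_neg (mul_le_mul_of_nonneg_left (by linarith) hn0)))))))
  rw [two_mul] at h6
  refine le_trans (oe_le (neg_le_neg (mul_le_mul_of_nonneg_left (by linarith) hn0)))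
    ((ENNReal.add_le_add_iff_right (oe_ne_top _)).1 h6)

theorem evLaw_Iio_le {x : ℝ} (hx : x < 2) (k : ℕ) (M : ℝ) :
    ∀ᶠ n : ℕ in atTop, evLaw k n (Set.Iio x) ≤ oe (n * M) := by
  filter_upwards [prob_nge_le hx k M, eventually_gt_atTop k] with n h1 h2
  have hs : 0 < Real.sqrt n := Real.sqrt_pos.2 (by exact_mod_cast (by omega : 0 < n))
  rw [evLaw_apply h2 measurableSet_Iio]
  refine (measure_mono fun g hg => ?_).trans h1
  have hg' : evs (goe n g) ⟨k, h2⟩ / Real.sqrt n < x := hg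
  rw [div_lt_iff₀ hs, ← not_le, le_evs_iff] at hg'
  exact not_lt.1 hg'

theorem exists_hasRate_index (hv : 0 < vv P c) (hb : 0 < bb P c) (hA : 0 ≤ 1 / (2 * vv P c) - 1 / 4) (η : ℝ) (k : ℕ) :
    ∃ S, HasRate (fun n => ∫⁻ x, wtN P c η n (Real.sqrt n * x) ∂(evLaw k n)) S := by
  refine exists_hasRate_wtN hv hb hA η (R := fun x => (k + 1) * rateK x) (l := 2)
    (continuous_const.mul continuous_rateK) (fun x => mul_nonneg (by positivity) (rateK_nonneg x))
    (by rw [rateK_of_le le_rfl, mul_zero]) (fun M => ?_)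
    (fun ε hε => Eventually.of_forall fun n => (evLaw_le_one _ _ _).trans (one_le_oe (by positivity)))
    (fun x hx ε hε => evLaw_upper k hx hε) (fun x y hx hxy ε hε => evLaw_lower k hx hxy hε)
    (fun x hx ε hε => ?_)
  · obtain ⟨x, h1, h2⟩ := exists_le_rateK M
    exact ⟨x, h1, h2.trans (le_mul_of_one_le_left (rateK_nonneg x) (by linarith [k.cast_nonneg (α := ℝ)]))⟩
  · filter_upwards [wtN_le hv η hε, evLaw_Iio_le hx k (wtRate P c η 2)] with n h1 h2
    rw [add_comm]
    refine setLIntegral_le_oe (f := fun n y => wtN P c η n (Real.sqrt n * y)) measurableSet_Iio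
      (fun y _ => (h1 y).trans (oe_le ?_)) h2
    exact mul_le_mul_of_nonneg_left (by linarith [wtRate_nonpos hA η y]) n.cast_nonneg

end

section

variable {P : ℕ} {c : ℕ → ℝ}

/-- The expected (unnormalized) empirical measure of the rescaled eigenvalues. -/
def evSum (n : ℕ) : Measure ℝ := ∑ k ∈ Finset.range n, evLaw k n

theorem evSum_apply (n : ℕ) (s : Set ℝ) : evSum n s = ∑ k ∈ Finset.range n, evLaw k n s := by
  simp [evSum]

theorem lintegral_evSum (n : ℕ) {φ : ℝ → ℝ≥0∞} (hφ : Measurable φ) :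
    ∫⁻ y, φ (Real.sqrt n * y) ∂(evSum n) = ∫⁻ g, ∑ i, φ (evs (goe n g) i) ∂(stdG (Fin n × Fin n)) := by
  have hm : ∀ i ∈ (Finset.univ : Finset (Fin n)), Measurable fun g : Fin n × Fin n → ℝ => φ (evs (goe n g) i) :=
    fun i _ => hφ.comp (measurable_evs_goe i)
  rw [evSum, lintegral_finsetSum_measure, lintegral_finsetSum _ hm,
    ← Fin.sum_univ_eq_sum_range (fun k => ∫⁻ y, φ (Real.sqrt n * y) ∂(evLaw k n))]
  exact Finset.sum_congr rfl fun i _ => lintegral_evLaw i.2 hφ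

theorem eventually_natCast_le_oe {ε : ℝ} (hε : 0 < ε) : ∀ᶠ n : ℕ in atTop, (n : ℝ≥0∞) ≤ oe (n * ε) := by
  filter_upwards [eventually_le_nat_mul (show 0 < ε ^ 2 by positivity) 2] with n hn
  rw [oe, ← ENNReal.ofReal_natCast]
  refine ENNReal.ofReal_le_ofReal (le_trans ?_ (Real.quadratic_le_exp_of_nonneg (by positivity)))
  have := mul_le_mul_of_nonneg_left hn (n.cast_nonneg (α := ℝ))
  have h2 : 0 ≤ n * ε := by positivity
  nlinarith

theorem evSum_le_nat (n : ℕ) (s : Set ℝ) : evSum n s ≤ n := by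
  rw [evSum_apply]
  refine (Finset.sum_le_card_nsmul _ _ 1 fun k _ => evLaw_le_one k n s).trans ?_
  simp

theorem evSum_mass {ε : ℝ} (hε : 0 < ε) (s : Set ℝ) : ∀ᶠ n : ℕ in atTop, evSum n s ≤ oe (n * ε) := by
  filter_upwards [eventually_natCast_le_oe hε] with n hn
  exact (evSum_le_nat n s).trans hn

theorem evLaw_Ici_anti {k n : ℕ} (h : k < n) (x : ℝ) : evLaw k n (Set.Ici x) ≤ evLaw 0 n (Set.Ici x) := by
  rw [evLaw_Ici h, evLaw_Ici (by omega)]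
  refine measure_mono fun g hg => ?_
  have hg' : k + 1 ≤ nge (goe n g) (x * Real.sqrt n) := hg
  show 0 + 1 ≤ nge (goe n g) (x * Real.sqrt n)
  omega

theorem evSum_upper (x : ℝ) {ε : ℝ} (hε : 0 < ε) :
    ∀ᶠ n : ℕ in atTop, evSum n (Set.Ici x) ≤ oe (-(n * (rateK x - ε))) := by
  rcases le_or_gt x 2 with hx | hx
  · filter_upwards [evSum_mass hε (Set.Ici x)] with n hn
    rwa [rateK_of_le hx, zero_sub, mul_neg, neg_neg]
  · filter_upwards [eventually_natCast_le_oe (half_pos hε), evLaw_upper 0 hx (half_pos hε)] with n h1 h2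
    have h3 : evSum n (Set.Ici x) ≤ n * evLaw 0 n (Set.Ici x) := by
      rw [evSum_apply]
      refine (Finset.sum_le_card_nsmul _ _ _ fun k hk => evLaw_Ici_anti (Finset.mem_range.1 hk) x).trans ?_
      simp
    refine h3.trans ((mul_le_mul' h1 h2).trans ?_)
    rw [oe_mul]
    refine oe_le ?_
    push_cast; linarith

theorem evSum_lower_bulk {x y : ℝ} (hxy : x < y) (hx : x < 2) (hy : -2 < y) :
    ∀ᶠ n : ℕ in atTop, 1 ≤ evSum n (Set.Icc x y) := by
  have hs0 := scI_bump_pos hxy hx hy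
  have hlim := tendsto_LN (continuous_bump x y) zero_le_one (bump_bound x y)
  filter_upwards [hlim.eventually (lt_mem_nhds (half_lt_self hs0)), eventually_gt_atTop 0,
    eventually_le_nat_mul (half_pos hs0) 1] with n h1 hn h2
  have hn0 : (0 : ℝ) < n := by exact_mod_cast hn
  have hs : 0 < Real.sqrt n := Real.sqrt_pos.2 hn0
  have hInt := integrable_LN (k := 1) (continuous_bump x y).measurable (C := 1)
    (fun t => by rw [mul_one 2]; exact bump_bound x y t) n
  have h5 : ∫ g, ∑ i, bump x y (evs (goe n g) i / Real.sqrt n) ∂(stdG (Fin n × Fin n)) = n * LN n (bump x y) := by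
    rw [LN]; field_simp
  have h6 : 1 ≤ n * LN n (bump x y) := h2.trans (mul_le_mul_of_nonneg_left h1.le hn0.le)
  have hm : Measurable fun t => (Set.Icc x y).indicator (1 : ℝ → ℝ≥0∞) (t / Real.sqrt n) :=
    (measurable_one.indicator measurableSet_Icc).comp (measurable_id.div_const _)
  have h7 := lintegral_evSum n hm
  simp only [mul_div_cancel_left₀ _ hs.ne'] at h7
  rw [lintegral_indicator_one measurableSet_Icc] at h7
  rw [h7]
  calc (1 : ℝ≥0∞) ≤ ENNReal.ofReal (∫ g, ∑ i, bump x y (evs (goe n g) i / Real.sqrt n) ∂(stdG (Fin n × Fin n))) := by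
        rw [h5, ← ENNReal.ofReal_one]; exact ENNReal.ofReal_le_ofReal h6
    _ = ∫⁻ g, ENNReal.ofReal (∑ i, bump x y (evs (goe n g) i / Real.sqrt n)) ∂(stdG (Fin n × Fin n)) :=
        ofReal_integral_eq_lintegral_ofReal hInt
          (ae_of_all _ fun g => Finset.sum_nonneg fun i _ => bump_nonneg _ _ _)
    _ ≤ _ := by
        refine lintegral_mono fun g => ?_
        rw [ENNReal.ofReal_sum_of_nonneg fun i _ => bump_nonneg _ _ _]
        refine Finset.sum_le_sum fun i _ => ?_
        by_cases h : evs (goe n g) i / Real.sqrt n ∈ Set.Icc x y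
        · rw [Set.indicator_of_mem h, Pi.one_apply, ← ENNReal.ofReal_one]
          exact ENNReal.ofReal_le_ofReal (bump_le_one _ _ _)
        · rw [bump_eq_zero h, ENNReal.ofReal_zero]; exact zero_le

theorem evSum_lower {x y : ℝ} (hx : -2 < x) (hxy : x < y) {ε : ℝ} (hε : 0 < ε) :
    ∀ᶠ n : ℕ in atTop, oe (-(n * (rateK x + ε))) ≤ evSum n (Set.Icc x y) := by
  rcases lt_or_ge x 2 with h | h
  · filter_upwards [evSum_lower_bulk hxy h (hx.trans hxy)] with n hn
    refine le_trans ?_ hn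
    rw [← oe_zero]
    refine oe_le (neg_nonpos.2 (mul_nonneg n.cast_nonneg (by linarith [rateK_nonneg x])))
  · obtain ⟨d, hd, H⟩ := exists_pos_le (f := fun t => rateK (x + t)) (u := rateK x + ε / 2)
      (continuous_rateK.comp (by fun_prop)) (by simp [hε])
    set r := min d ((y - x) / 2) with hr
    have hr0 : 0 < r := lt_min hd (by linarith)
    have hr1 : r ≤ (y - x) / 2 := min_le_right _ _
    have H := H r hr0.le (min_le_left _ _)
    filter_upwards [evLaw_lower 0 (x := x + r) (y := y) (by linarith) (by linarith) (half_pos hε),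
      eventually_gt_atTop 0] with n h1 hn
    calc _ ≤ _ := oe_le (neg_le_neg (mul_le_mul_of_nonneg_left (by push_cast; linarith) n.cast_nonneg))
      _ ≤ evLaw 0 n (Set.Icc (x + r) y) := h1
      _ ≤ evLaw 0 n (Set.Icc x y) := measure_mono (Set.Icc_subset_Icc_left (by linarith))
      _ ≤ _ := by
        rw [evSum_apply]
        exact Finset.single_le_sum (f := fun k => evLaw k n (Set.Icc x y)) (fun _ _ => zero_le)
          (Finset.mem_range.2 hn)

theorem exists_hasRate_total (hv : 0 < vv P c) (hb : 0 < bb P c) (hA : 0 ≤ 1 / (2 * vv P c) - 1 / 4) (η : ℝ) :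
    ∃ S, HasRate (fun n => ∫⁻ x, wtN P c η n (Real.sqrt n * x) ∂(evSum n)) S := by
  refine exists_hasRate_wtN hv hb hA η (R := rateK) (l := -2) continuous_rateK rateK_nonneg
    (rateK_of_le (by norm_num)) (fun M => ?_) (fun ε hε => evSum_mass hε _)
    (fun x hx ε hε => evSum_upper x hε) (fun x y hx hxy ε hε => evSum_lower hx hxy hε) (fun x hx ε hε => ?_)
  · obtain ⟨x, h1, h2⟩ := exists_le_rateK M
    exact ⟨x, by linarith, h2⟩
  · filter_upwards [wtN_le hv η (half_pos hε), evSum_mass (half_pos hε) (Set.Iio x)] with n h1 h2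
    rw [show wtRate P c η (-2) + ε = (wtRate P c η (-2) + ε / 2) + ε / 2 by ring]
    refine setLIntegral_le_oe (f := fun n y => wtN P c η n (Real.sqrt n * y)) measurableSet_Iio
      (fun y hy => (h1 y).trans (oe_le ?_)) h2
    have hy' : y < x := hy
    have := wtRate_mono_of_nonpos hA hb η (show y ≤ -2 by linarith) (by norm_num)
    exact mul_le_mul_of_nonneg_left (by linarith) n.cast_nonneg

end

section

variable {P : ℕ} {c : ℕ → ℝ}

theorem kap_pos (hc : ∃ k ∈ Finset.Icc 2 P, c k ≠ 0) : 0 < kap P c := by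
  obtain ⟨k, hk, hck⟩ := hc
  have hk2 : (2 : ℝ) ≤ k := by exact_mod_cast (Finset.mem_Icc.1 hk).1
  refine Finset.sum_pos' (fun j _ => by positivity) ⟨k, hk, ?_⟩
  positivity

theorem kap_le_nuu : kap P c ≤ nuu P c := by
  refine Finset.sum_le_sum fun j hj => ?_
  have hj2 : (2 : ℝ) ≤ j := by exact_mod_cast (Finset.mem_Icc.1 hj).1
  refine mul_le_mul_of_nonneg_right ?_ (sq_nonneg _)
  nlinarith

theorem vv_pos (hk : 0 < kap P c) : 0 < vv P c := by
  have hν := hk.trans_le kap_le_nuu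
  unfold vv; positivity

theorem bb_pos (hk : 0 < kap P c) : 0 < bb P c := by
  have hν := hk.trans_le kap_le_nuu
  unfold bb; positivity

theorem quad_coeff_nonneg (hk : 0 < kap P c) : 0 ≤ 1 / (2 * vv P c) - 1 / 4 := by
  have hν := hk.trans_le kap_le_nuu
  have hv : vv P c ≤ 2 := by
    unfold vv; rw [div_le_iff₀ hν]; linarith [kap_le_nuu (P := P) (c := c)]
  rw [sub_nonneg]
  exact one_div_le_one_div_of_le (by have := vv_pos hk
                                     positivity) (by linarith)

theorem HasRate.shift {I : ℕ → ℝ≥0∞} {S : ℝ} (h : HasRate I S) {q : ℝ} (hq : 0 < q) {J : ℕ → ℝ≥0∞}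
    (hJ : ∀ᶠ n in atTop, J (n + 1) = ENNReal.ofReal (q ^ n) * (2 * I (n + 1))) : HasRate J (Real.log q + S) := by
  intro ε hε
  refine eventually_of_succ ?_
  filter_upwards [hJ, (tendsto_add_atTop_nat 1).eventually (h (ε / 2) (by positivity)),
    eventually_le_nat_mul (half_pos hε) (|Real.log q| + 1)] with n h1 h2 h3
  have e : ENNReal.ofReal (q ^ n) = oe (n * Real.log q) := by
    rw [← oe_log_ofReal (by positivity), Real.log_pow]
  have ha := neg_abs_le (Real.log q)
  have hb := le_abs_self (Real.log q)
  rw [h1, e]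
  constructor
  · refine le_trans ?_ (mul_le_mul' le_rfl ((le_mul_of_one_le_left zero_le (by norm_num)).trans (mul_le_mul' le_rfl h2.1)))
    rw [oe_mul]
    refine oe_le ?_
    push_cast; linarith
  · refine (mul_le_mul' le_rfl ((mul_le_mul' le_rfl h2.2).trans (two_mul_oe_le le_rfl))).trans ?_
    rw [oe_mul]
    refine oe_le ?_
    push_cast; linarith

theorem mem_crtSet_iff {N : ℕ} (hN : 0 < N) (g : (k : ℕ) → (Fin k → Fin N) → ℝ) (η : ℝ) (m : ℕ) (σ : Fin N → ℝ) :
    σ ∈ crtSet N P c g η ∧ critIndex N P c g σ = m ↔ σ ∈ critIdx N P c η (flatten N P g) m := by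
  have h1 : σ ∈ crtSet N P c g η ↔ IsCritPt N P c g σ ∧ (N : ℝ) * η ≤ hamiltonian N P c g σ := Iff.rfl
  rw [h1, isCritPt_iff hN, hamiltonian_eq, critIndex_eq, and_assoc]
  rfl

theorem crtSetIdx_eq {N : ℕ} (hN : 0 < N) (g : (k : ℕ) → (Fin k → Fin N) → ℝ) (η : ℝ) (k : ℕ) :
    crtSetIdx N P c g η k = critIdx N P c η (flatten N P g) (N - 1 - k) :=
  Set.ext fun σ => mem_crtSet_iff hN g η _ σ

theorem crtSet_eq {N : ℕ} (hN : 0 < N) (g : (k : ℕ) → (Fin k → Fin N) → ℝ) (η : ℝ) :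
    crtSet N P c g η = ⋃ m, critIdx N P c η (flatten N P g) m := by
  ext σ
  rw [Set.mem_iUnion]
  refine ⟨fun h => ⟨_, (mem_crtSet_iff hN g η _ σ).1 ⟨h, rfl⟩⟩, fun ⟨m, hm⟩ => ((mem_crtSet_iff hN g η m σ).2 hm).1⟩

theorem lintegral_flatten {Ω : Type*} [MeasureSpace Ω] {N : ℕ} {G : Ω → (k : ℕ) → (Fin k → Fin N) → ℝ}
    (hG : StdGaussianCouplings N P G) {φ : (GIdx N P → ℝ) → ℝ≥0∞} (hφ : AEMeasurable φ (stdG (GIdx N P))) :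
    ∫⁻ ω, φ (flatten N P (G ω)) ∂(ℙ : Measure Ω) = ∫⁻ g, φ g ∂(stdG (GIdx N P)) := by
  have hG' : Measure.map (fun ω => flatten N P (G ω)) ℙ = stdG (GIdx N P) := hG
  have hm : AEMeasurable (fun ω => flatten N P (G ω)) (ℙ : Measure Ω) := by
    refine AEMeasurable.of_map_ne_zero ?_
    rw [hG']; exact IsProbabilityMeasure.ne_zero _
  rw [← hG'] at hφ ⊢
  exact (lintegral_map' hφ hm).symm

end

/-- existence of the annealed complexity functions `Σ_k(η)` and `Σ(η)` as
exponential growth rates of the expected number of critical points. -/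
theorem statement_4 {Ω : Type*} [MeasureSpace Ω] [IsProbabilityMeasure (ℙ : Measure Ω)]
    (P : ℕ) (hP : 2 ≤ P) (c : ℕ → ℝ) (hc : ∃ k ∈ Finset.Icc 2 P, c k ≠ 0)
    (G : (N : ℕ) → Ω → (k : ℕ) → (Fin k → Fin N) → ℝ)
    (hG : ∀ N, 1 ≤ N → StdGaussianCouplings N P (G N))
    (η : ℝ) (k : ℕ) :
    (∃ Sk : ℝ, Tendsto (fun N : ℕ =>
        Real.log (∫⁻ ω, ecount (crtSetIdx N P c (G N ω) η k) ∂ℙ).toReal / N)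
      atTop (nhds Sk))
    ∧ (∃ Stot : ℝ, Tendsto (fun N : ℕ =>
        Real.log (∫⁻ ω, ecount (crtSet N P c (G N ω) η) ∂ℙ).toReal / N)
      atTop (nhds Stot)) := by
  have hk := kap_pos hc
  have hν : 0 < nuu P c := hk.trans_le kap_le_nuu
  have hq : 0 < Real.sqrt (nuu P c / kap P c) := Real.sqrt_pos.2 (by positivity)
  constructor
  · obtain ⟨S, hS⟩ := exists_hasRate_index (vv_pos hk) (bb_pos hk) (quad_coeff_nonneg hk) η k
    refine ⟨_, HasRate.tendsto (hS.shift hq ?_)⟩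
    filter_upwards [eventually_gt_atTop 0, eventually_gt_atTop k] with n hn hkn
    have hkn' : k < n + 1 := by omega
    simp only [crtSetIdx_eq (N := n + 1) (Nat.succ_pos n)]
    rw [lintegral_flatten (hG (n + 1) (by omega)) (aemeasurable_ecount_critIdx hν hk hn η _), Nat.add_sub_cancel,
      lintegral_critIdx hν hk hn η hkn', lintegral_evLaw hkn' (measurable_wtN η (n + 1))]
  · obtain ⟨S, hS⟩ := exists_hasRate_total (vv_pos hk) (bb_pos hk) (quad_coeff_nonneg hk) η
    refine ⟨_, HasRate.tendsto (hS.shift hq ?_)⟩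
    filter_upwards [eventually_gt_atTop 0] with n hn
    have h := lintegral_crit_total hν hk hn η
    simp only [crtSet_eq (N := n + 1) (Nat.succ_pos n)]
    rw [lintegral_flatten (hG (n + 1) (by omega)) h.1, h.2, lintegral_evSum _ (measurable_wtN η (n + 1))]
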